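/- Let A and B be C*-algebras. A closed ideal K of A ⊗̂ B is maximal modular if and only if K = A ⊗̂ N + M ⊗̂ B for some maximal modular ideals M of A and N of B. -/

import Mathlib

open scoped TensorProduct
open Pointwise

universe u

noncomputable section

/-- A C⋆-norm on a complex `*`-algebra.  On a matrix algebra over a C⋆-algebra such a
norm is unique, namely the canonical C⋆-norm. -/
structure IsCStarNorm {M : Type*} [NonUnitalRing M] [StarRing M] [Module ℂ M]
    (N : M → ℝ) : Prop where
  add_le : ∀ x y, N (x + y) ≤ N x + N y
  smul_eq : ∀ (c : ℂ) (x : M), N (c • x) = ‖c‖ * N x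
  eq_zero_of : ∀ x, N x = 0 → x = 0
  mul_le : ∀ x y, N (x * y) ≤ N x * N y
  star_mul_self : ∀ x, N (star x * x) = N x * N x

/-- The operator space projective tensor norm `‖·‖_∧` on the algebraic tensor product
`A ⊗ B`, relative to given families of matrix norms on `A` and `B`:
`‖u‖_∧ = inf { ‖α‖ ‖v‖ ‖w‖ ‖β‖ : u = α (v ⊗ w) β }` where `v ∈ M_p(A)`, `w ∈ M_q(B)`,
`α ∈ M_{1,pq}(ℂ)` and `β ∈ M_{pq,1}(ℂ)` (row and column vectors carrying the Euclidean
norm, which is their norm as scalar matrices). -/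
noncomputable def osProjNorm {A B : Type u}
    [AddCommGroup A] [Module ℂ A] [AddCommGroup B] [Module ℂ B]
    (NA : ∀ p : ℕ, Matrix (Fin p) (Fin p) A → ℝ)
    (NB : ∀ q : ℕ, Matrix (Fin q) (Fin q) B → ℝ) (u : A ⊗[ℂ] B) : ℝ :=
  sInf { r : ℝ | ∃ (p q : ℕ) (α : Fin p × Fin q → ℂ) (v : Matrix (Fin p) (Fin p) A)
      (w : Matrix (Fin q) (Fin q) B) (β : Fin p × Fin q → ℂ),
      u = ∑ ik : Fin p × Fin q, ∑ jl : Fin p × Fin q,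
            (α ik * β jl) • (v ik.1 jl.1 ⊗ₜ[ℂ] w ik.2 jl.2) ∧
      r = Real.sqrt (∑ ik, ‖α ik‖ ^ 2) * NA p v * NB q w *
            Real.sqrt (∑ jl, ‖β jl‖ ^ 2) }

/-- `X` is a completion of the algebraic tensor product `A ⊗ B` with respect to the
norm `ν`, via the (necessarily isometric) dense embedding `ι`, and the multiplication and
involution of `X` are the canonical ones induced from `A` and `B`.  Applied with
`ν = osProjNorm NA NB` (for the canonical matrix C⋆-norms `NA`, `NB`) this characterizes
the Banach `*`-algebra `A ⊗̂ B` (the operator space projective tensor product) up to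
isometric `*`-isomorphism; applied with `ν = bsProjNorm` it characterizes the Banach
space projective tensor product `A ⊗_γ B`. -/
structure IsTensorCompletion {A B : Type u} [NonUnitalRing A] [StarRing A] [Module ℂ A]
    [NonUnitalRing B] [StarRing B] [Module ℂ B] (ν : A ⊗[ℂ] B → ℝ)
    (X : Type u) [NonUnitalNormedRing X] [StarRing X] [NormedSpace ℂ X] [CompleteSpace X]
    (ι : A ⊗[ℂ] B →ₗ[ℂ] X) : Prop where
  norm_eq : ∀ u, ‖ι u‖ = ν u
  dense : DenseRange ι
  mul_tmul : ∀ (a c : A) (b d : B),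
    ι (a ⊗ₜ[ℂ] b) * ι (c ⊗ₜ[ℂ] d) = ι ((a * c) ⊗ₜ[ℂ] (b * d))
  star_tmul : ∀ (a : A) (b : B), star (ι (a ⊗ₜ[ℂ] b)) = ι (star a ⊗ₜ[ℂ] star b)

/-- The product ideal `S ⊗̂ T`: the closure in `X` (a completion of `A ⊗ B`) of the span of
elementary tensors `a ⊗ b` with `a ∈ S`, `b ∈ T`. -/
def tensorIdeal {A B : Type u} [NonUnitalRing A] [StarRing A] [Module ℂ A]
    [NonUnitalRing B] [StarRing B] [Module ℂ B]
    {X : Type u} [NonUnitalNormedRing X] [StarRing X] [NormedSpace ℂ X] [CompleteSpace X]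
    (ι : A ⊗[ℂ] B →ₗ[ℂ] X) (S : Set A) (T : Set B) : Set X :=
  closure (ι '' (Submodule.span ℂ (Set.image2 (fun a b => a ⊗ₜ[ℂ] b) S T)))

/-- A closed prime (two-sided) ideal of a Banach algebra: a proper closed two-sided ideal `K`
such that whenever the product of two closed two-sided ideals is contained in `K`, one of them
is contained in `K`. -/
def IsClosedPrimeIdeal {Y : Type u} [NonUnitalNormedRing Y] (K : TwoSidedIdeal Y) : Prop :=
  IsClosed (K : Set Y) ∧ (K : Set Y) ≠ Set.univ ∧
    ∀ I J : TwoSidedIdeal Y, IsClosed (I : Set Y) → IsClosed (J : Set Y) →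
      (∀ x ∈ I, ∀ y ∈ J, x * y ∈ K) → (I : Set Y) ⊆ (K : Set Y) ∨ (J : Set Y) ⊆ (K : Set Y)

/-- An irreducible continuous `*`-representation of a Banach `*`-algebra `Y` on a complex
Hilbert space. -/
structure IrreducibleRepOn (Y : Type u)
    [NonUnitalNormedRing Y] [StarRing Y] [NormedSpace ℂ Y] where
  H : Type u
  [normH : NormedAddCommGroup H]
  [ipsH : InnerProductSpace ℂ H]
  [csH : CompleteSpace H]
  π : Y →⋆ₙₐ[ℂ] (H →L[ℂ] H)
  continuous : Continuous π
  nonzero : ∃ y, π y ≠ 0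
  irreducible : ∀ S : Submodule ℂ H, IsClosed (S : Set H) →
    (∀ y : Y, ∀ v ∈ S, π y v ∈ S) → S = ⊥ ∨ S = ⊤

/-- A primitive ideal: the kernel of an irreducible `*`-representation. -/
def IsPrimitiveIdeal {Y : Type u} [NonUnitalNormedRing Y] [StarRing Y] [NormedSpace ℂ Y]
    (K : TwoSidedIdeal Y) : Prop :=
  ∃ ρ : IrreducibleRepOn Y, ∀ y, y ∈ K ↔ ρ.π y = 0

/-- A subset `K` of a ring is modular (as an ideal) if there is a relative unit `e`
with `x * e - x ∈ K` and `e * x - x ∈ K` for every `x`. -/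
def IsModularIdealSet {Y : Type u} [NonUnitalRing Y] (K : Set Y) : Prop :=
  ∃ e : Y, ∀ x : Y, x * e - x ∈ K ∧ e * x - x ∈ K

/-- A maximal modular (two-sided) ideal: a modular ideal which is proper and maximal among
proper two-sided ideals. -/
def IsMaximalModularIdeal {Y : Type u} [NonUnitalRing Y] (K : TwoSidedIdeal Y) : Prop :=
  IsModularIdealSet (K : Set Y) ∧ (K : Set Y) ≠ Set.univ ∧
    ∀ L : TwoSidedIdeal Y, (K : Set Y) ⊆ (L : Set Y) →
      (L : Set Y) = (K : Set Y) ∨ (L : Set Y) = Set.univ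

/-- The operator norm of a `p × p` matrix of bounded operators on a Hilbert space `H`,
viewed as an operator on the `ℓ²`-direct sum `H ⊕ ⋯ ⊕ H`. -/
noncomputable def opMatrixNorm {H : Type u} [NormedAddCommGroup H] [InnerProductSpace ℂ H]
    {p : ℕ} (T : Matrix (Fin p) (Fin p) (H →L[ℂ] H)) : ℝ :=
  sSup { r : ℝ | ∃ x : Fin p → H, (∑ i, ‖x i‖ ^ 2) ≤ 1 ∧
      r = Real.sqrt (∑ i, ‖∑ j, (T i j) (x j)‖ ^ 2) }

/-- An operator algebra structure on a Banach algebra `Y`: a bicontinuous algebra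
homomorphism of `Y` into the bounded operators on some Hilbert space. -/
structure OperatorAlgebraEmbedding (Y : Type u) [NonUnitalNormedRing Y] [NormedSpace ℂ Y] where
  H : Type u
  [normH : NormedAddCommGroup H]
  [ipsH : InnerProductSpace ℂ H]
  [csH : CompleteSpace H]
  ρ : Y →ₙₐ[ℂ] (H →L[ℂ] H)
  c : ℝ
  C : ℝ
  c_pos : 0 < c
  lower : ∀ y, c * ‖y‖ ≤ ‖ρ y‖
  upper : ∀ y, ‖ρ y‖ ≤ C * ‖y‖

/-- The matrix norms on `Y` induced by an operator algebra embedding, giving `Y` its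
operator space structure: the norm of `v ∈ M_p(Y)` is the operator norm of the matrix
of operators obtained by applying the embedding entrywise. -/
noncomputable def OperatorAlgebraEmbedding.matrixNorm {Y : Type u}
    [NonUnitalNormedRing Y] [NormedSpace ℂ Y] (e : OperatorAlgebraEmbedding Y)
    (p : ℕ) (v : Matrix (Fin p) (Fin p) Y) : ℝ :=
  letI := e.normH; letI := e.ipsH
  opMatrixNorm (v.map e.ρ)

/-- The Banach space projective tensor norm `‖·‖_γ` on the algebraic tensor product. -/
noncomputable def bsProjNorm {A B : Type u} [NonUnitalNormedRing A] [NormedSpace ℂ A]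
    [NonUnitalNormedRing B] [NormedSpace ℂ B] (u : A ⊗[ℂ] B) : ℝ :=
  sInf { r : ℝ | ∃ (n : ℕ) (a : Fin n → A) (b : Fin n → B),
      u = ∑ i, a i ⊗ₜ[ℂ] b i ∧ r = ∑ i, ‖a i‖ * ‖b i‖ }

/-- A C⋆-algebra `A` is subhomogeneous if there is `n : ℕ` bounding the (finite)
dimensions of all its irreducible `*`-representations. -/
def IsSubhomogeneous (A : Type u) [NonUnitalCStarAlgebra A] : Prop :=
  ∃ n : ℕ, ∀ ρ : IrreducibleRepOn A,
    letI := ρ.normH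
    letI := ρ.ipsH
    FiniteDimensional ℂ ρ.H ∧ Module.finrank ℂ ρ.H ≤ n


section
set_option linter.style.haveILetI false

lemma exists_unitary_avg {P : Type*} [CStarAlgebra P] {f : P} (hf : IsSelfAdjoint f)
    (hf1 : ‖f‖ ≤ 1) : ∃ u : unitary P, (u : P) + ((star u : unitary P) : P) = (2 : ℂ) • f := by
  letI := CStarAlgebra.spectralOrder P
  haveI := CStarAlgebra.spectralOrderedRing P
  refine ⟨⟨_, hf.self_add_I_smul_cfcSqrt_sub_sq_mem_unitary f hf1⟩, ?_⟩
  rw [Unitary.coe_star]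
  simp only [star_add, star_smul, hf.star_eq, (CFC.sqrt_nonneg (1 - f ^ 2)).isSelfAdjoint.star_eq]
  rw [two_smul]
  simp only [Complex.star_def, Complex.conj_I, neg_smul]
  abel

namespace IsCStarNorm
variable {E : Type*} [NonUnitalCStarAlgebra E] {N : E → ℝ}

lemma zero_eq (h : IsCStarNorm N) : N 0 = 0 := by
  have := h.smul_eq 0 0
  simpa using this

lemma nonneg (h : IsCStarNorm N) (x : E) : 0 ≤ N x := by
  have h1 := h.add_le x ((-1 : ℂ) • x)
  rw [h.smul_eq] at h1
  simp [h.zero_eq] at h1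
  linarith

lemma le_sa (h : IsCStarNorm N) {f : E} (hf : IsSelfAdjoint f) (hf1 : ‖f‖ ≤ 1) : N f ≤ 1 := by
  have hfs : IsSelfAdjoint (f : Unitization ℂ E) := hf.inr ℂ
  have hfn : ‖(f : Unitization ℂ E)‖ ≤ 1 := by rwa [Unitization.norm_inr]
  obtain ⟨u, hu⟩ := exists_unitary_avg hfs hfn
  -- multiplication by a unitary preserves `N`
  have key : ∀ (w : unitary (Unitization ℂ E)) (b c : E),
      (w : Unitization ℂ E) * (b : Unitization ℂ E) = (c : Unitization ℂ E) → N c = N b := by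
    intro w b c hc
    have h1 : star c * c = star b * b := by
      apply Unitization.inr_injective (R := ℂ)
      rw [Unitization.inr_mul, Unitization.inr_mul, Unitization.inr_star, Unitization.inr_star, ← hc,
        star_mul, mul_assoc, ← mul_assoc (star (w : Unitization ℂ E))]
      simp
    have h2 := h.star_mul_self c
    rw [h1, h.star_mul_self] at h2
    nlinarith [h.nonneg b, h.nonneg c]
  have ex : ∀ (x : Unitization ℂ E) (b : E), ∃ c : E, x * (b : Unitization ℂ E) = c := by
    intro x b
    refine ⟨x.fst • b + x.snd * b, ?_⟩
    ext <;> simp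
  obtain ⟨c1, hc1⟩ := ex u f
  obtain ⟨c2, hc2⟩ := ex (star u : unitary (Unitization ℂ E)) f
  have e1 := key u f c1 hc1
  have e2 := key (star u) f c2 hc2
  have e3 : c1 + c2 = (2 : ℂ) • (f * f) := by
    apply Unitization.inr_injective (R := ℂ)
    rw [Unitization.inr_add, ← hc1, ← hc2, ← add_mul, hu, Unitization.inr_smul, Unitization.inr_mul,
      smul_mul_assoc]
  have e4 := h.add_le c1 c2
  rw [e3, h.smul_eq, e1, e2] at e4
  have e5 := h.star_mul_self f
  rw [hf.star_eq] at e5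
  rw [e5] at e4
  simp at e4
  by_contra hcon
  push Not at hcon
  nlinarith

lemma le_norm (h : IsCStarNorm N) (x : E) : N x ≤ ‖x‖ := by
  by_cases hx : x = 0
  · simp [hx, h.zero_eq]
  have hp : 0 < ‖x‖ := norm_pos_iff.2 hx
  have h1 := h.le_sa (f := ((‖x‖ * ‖x‖)⁻¹ : ℝ) • (star x * x)) ?_ ?_
  · rw [← Complex.coe_smul, h.smul_eq, h.star_mul_self] at h1
    have : ‖(((‖x‖ * ‖x‖)⁻¹ : ℝ) : ℂ)‖ = (‖x‖ * ‖x‖)⁻¹ := by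
      rw [Complex.norm_real, Real.norm_of_nonneg (by positivity)]
    rw [this, inv_mul_le_iff₀ (by positivity)] at h1
    nlinarith [h.nonneg x]
  · exact IsSelfAdjoint.smul (by simp [IsSelfAdjoint]) (IsSelfAdjoint.star_mul_self x)
  · rw [norm_smul, CStarRing.norm_star_mul_self, Real.norm_of_nonneg (by positivity)]
    rw [inv_mul_cancel₀ (by positivity)]

lemma ge_pos (h : IsCStarNorm N) [PartialOrder E] [StarOrderedRing E] {a : E} (ha : 0 ≤ a) :
    ‖a‖ ≤ N a := by
  by_contra hcon
  push Not at hcon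
  obtain ⟨r, hr1, hr2⟩ := exists_between hcon
  have hr0 : 0 < r := lt_of_le_of_lt (h.nonneg a) hr1
  set g : ℝ → ℝ := fun t => max 0 (t - r) with hg
  set hh : ℝ → ℝ := fun t => t / (max t r) ^ 2 with hhh
  have hm : ∀ t, (max t r) ^ 2 ≠ 0 := fun t => by
    have : 0 < max t r := lt_max_of_lt_right hr0
    positivity
  have hgc : Continuous g := by fun_prop
  have hhc : Continuous hh := by
    apply Continuous.div (by fun_prop) (by fun_prop) hm
  have hg0 : g 0 = 0 := by simp [hg, hr0.le]
  have hh0 : hh 0 = 0 := by simp [hhh]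
  have hsa : IsSelfAdjoint a := ha.isSelfAdjoint
  set b := cfcₙ g a with hb
  have hspec : ∀ t ∈ quasispectrum ℝ a, 0 ≤ t := fun t ht => quasispectrum_nonneg_of_nonneg a ha t ht
  have hprod : a * (cfcₙ hh a * b) = b := by
    conv_lhs => rw [← cfcₙ_id' ℝ a]
    rw [hb]
    simp only [cfcₙ_id' ℝ a]
    rw [← cfcₙ_mul hh g a hhc.continuousOn hh0 hgc.continuousOn hg0]
    nth_rw 1 [← cfcₙ_id' ℝ a]
    rw [← cfcₙ_mul _ _ a (by fun_prop) rfl (by fun_prop) (by simp [hh0])]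
    apply cfcₙ_congr
    intro t ht
    by_cases htr : t ≤ r
    · simp [hg, htr]
    · push Not at htr
      have : t ≠ 0 := by linarith
      simp only [hhh, max_eq_left htr.le]
      field_simp
  have hne : b ≠ 0 := by
    intro hb0
    have hall : ∀ t ∈ quasispectrum ℝ a, g t = 0 := by
      intro t ht
      have := norm_apply_le_norm_cfcₙ g a ht hgc.continuousOn hg0
      rw [← hb, hb0] at this
      simpa using this
    -- norm in quasispectrum
    have : ‖a‖ ≤ r := by
      have : a = cfcₙ (fun t : ℝ => t) a := (cfcₙ_id' ℝ a).symm
      rw [this]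
      apply norm_cfcₙ_le
      intro t ht
      have h1 := hall t ht
      simp only [hg, max_eq_left_iff] at h1
      rw [Real.norm_of_nonneg (hspec t ht)]
      linarith
    linarith
  have hbn : 0 < N b := lt_of_le_of_ne (h.nonneg b) (fun hh => hne (h.eq_zero_of b hh.symm))
  have hhn : N (cfcₙ hh a) ≤ r⁻¹ := by
    refine (h.le_norm _).trans ?_
    apply norm_cfcₙ_le
    intro t ht
    have h0 := hspec t ht
    rw [Real.norm_of_nonneg (by simp only [hhh]; positivity)]
    simp only [hhh]
    have hmp : 0 < max t r := lt_max_of_lt_right hr0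
    rw [div_le_iff₀ (by positivity), ← div_eq_inv_mul, le_div_iff₀ hr0, sq]
    exact mul_le_mul (le_max_left _ _) (le_max_right _ _) hr0.le hmp.le
  have h1 : N b ≤ N a * (r⁻¹ * N b) := by
    calc N b = N (a * (cfcₙ hh a * b)) := by rw [hprod]
      _ ≤ N a * N (cfcₙ hh a * b) := h.mul_le _ _
      _ ≤ N a * (N (cfcₙ hh a) * N b) := by gcongr; exact h.nonneg a; exact h.mul_le _ _
      _ ≤ _ := by gcongr; exact h.nonneg a
  have h2 : N a * (r⁻¹ * N b) < r * (r⁻¹ * N b) := by gcongr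
  rw [← mul_assoc r, mul_inv_cancel₀ hr0.ne', one_mul] at h2
  linarith

/-- Uniqueness of the C*-norm. -/
theorem eq_norm (h : IsCStarNorm N) (x : E) : N x = ‖x‖ := by
  letI := CStarAlgebra.spectralOrder E
  haveI := CStarAlgebra.spectralOrderedRing E
  apply le_antisymm (h.le_norm x)
  have h1 := h.ge_pos (star_mul_self_nonneg x)
  rw [h.star_mul_self, CStarRing.norm_star_mul_self] at h1
  nlinarith [h.nonneg x, norm_nonneg x]

end IsCStarNorm

theorem matrix_norm_unique {A : Type*} [NonUnitalCStarAlgebra A] [PartialOrder A]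
    [StarOrderedRing A] {p : ℕ} {N : Matrix (Fin p) (Fin p) A → ℝ} (h : IsCStarNorm N)
    (v : CStarMatrix (Fin p) (Fin p) A) : N v = ‖v‖ := by
  have h' : IsCStarNorm (M := CStarMatrix (Fin p) (Fin p) A) N :=
    ⟨h.add_le, h.smul_eq, h.eq_zero_of, h.mul_le, h.star_mul_self⟩
  exact h'.eq_norm v
end

section
set_option linter.style.haveILetI false

/-! ### The Grothendieck inequality: near-maximal forms -/

def IsAvgUnitary {P : Type*} [CStarAlgebra P] (x : P) : Prop :=
  ∃ u w : unitary P, (u : P) + (w : P) = (2 : ℂ) • x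

lemma isAvgUnitary_of_sa {P : Type*} [CStarAlgebra P] {x : P} (hx : IsSelfAdjoint x)
    (h1 : ‖x‖ ≤ 1) : IsAvgUnitary x := by
  obtain ⟨u, hu⟩ := exists_unitary_avg hx h1
  exact ⟨u, star u, hu⟩

lemma isAvgUnitary_of_unitary {P : Type*} [CStarAlgebra P] (u : unitary P) :
    IsAvgUnitary (u : P) := ⟨u, u, by rw [two_smul]⟩

lemma spec_norm_le {P : Type*} [CStarAlgebra P] {a : P} {t : ℝ} (ht : t ∈ spectrum ℝ a) :
    |t| ≤ ‖a‖ := by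
  rcases subsingleton_or_nontrivial P with h | h
  · simp [spectrum.of_subsingleton] at ht
  · exact spectrum.norm_le_norm_of_mem ht

lemma spectrum_unit_interval {P : Type*} [CStarAlgebra P] [PartialOrder P] [StarOrderedRing P]
    {q : P} (h0 : 0 ≤ q) (h1 : ‖q‖ ≤ 1) {x : ℂ} (hx : x ∈ spectrum ℂ q) :
    ∃ t : ℝ, x = t ∧ 0 ≤ t ∧ t ≤ 1 := by
  have hsa : IsSelfAdjoint q := h0.isSelfAdjoint
  have hr := hsa.spectrumRestricts
  refine ⟨x.re, ?_, ?_, ?_⟩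
  · exact (hr.rightInvOn hx).symm
  · exact spectrum_nonneg_of_nonneg h0 (hr.apply_mem hx)
  · exact (le_abs_self _).trans ((spec_norm_le (hr.apply_mem hx)).trans h1)

lemma isAvgUnitary_rot {P : Type*} [CStarAlgebra P] [PartialOrder P] [StarOrderedRing P]
    {q : P} (h0 : 0 ≤ q) (h1 : ‖q‖ ≤ 1) {w : ℂ} (hw : w = Complex.I ∨ w = -Complex.I) :
    IsAvgUnitary (1 - (1 - w) • q) := by
  have hsa : IsSelfAdjoint q := h0.isSelfAdjoint
  have hn : IsStarNormal q := hsa.isStarNormal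
  set z : ℂ → ℂ := fun x => 1 - (1 - w) * x with hz
  have hzn : ∀ x ∈ spectrum ℂ q, 0 < ‖z x‖ ∧ ‖z x‖ ≤ 1 := by
    intro x hx
    obtain ⟨t, rfl, ht0, ht1⟩ := spectrum_unit_interval h0 h1 hx
    have hsq : ‖z t‖ ^ 2 = (1 - t) ^ 2 + t ^ 2 := by
      rw [Complex.sq_norm, Complex.normSq_apply]
      rcases hw with rfl | rfl <;> simp [hz] <;> ring
    constructor
    · have : 0 < ‖z t‖ ^ 2 := by rw [hsq]; nlinarith [sq_nonneg (2 * t - 1)]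
      by_contra hcon
      have : ‖z t‖ = 0 := le_antisymm (not_lt.1 hcon) (norm_nonneg _)
      simp [this] at *
    · have : ‖z t‖ ^ 2 ≤ 1 ^ 2 := by rw [hsq]; nlinarith
      exact (sq_le_sq₀ (norm_nonneg _) zero_le_one).1 this
  have hzc : Continuous z := by fun_prop
  set f : ℂ → ℂ → ℂ := fun σ x => z x * (1 + σ * (Complex.I * ((√(1 - ‖z x‖ ^ 2) / ‖z x‖ : ℝ) : ℂ)))
    with hf
  have hfc : ∀ σ, ContinuousOn (f σ) (spectrum ℂ q) := by
    intro σ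
    have : ContinuousOn (fun x => √(1 - ‖z x‖ ^ 2) / ‖z x‖) (spectrum ℂ q) := by
      apply ContinuousOn.div (by fun_prop) (by fun_prop)
      intro x hx
      exact (hzn x hx).1.ne'
    have h2 : ContinuousOn (fun x => ((√(1 - ‖z x‖ ^ 2) / ‖z x‖ : ℝ) : ℂ)) (spectrum ℂ q) :=
      Complex.continuous_ofReal.comp_continuousOn this
    fun_prop
  have hu : ∀ σ : ℝ, σ ^ 2 = 1 → cfc (f σ) q ∈ unitary P := by
    intro σ hσ
    rw [cfc_unitary_iff (f σ) q hn (hfc σ)]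
    intro x hx
    obtain ⟨hp, hl⟩ := hzn x hx
    rw [Complex.star_def, ← Complex.normSq_eq_conj_mul_self]
    norm_cast
    rw [Complex.normSq_mul, Complex.normSq_eq_norm_sq]
    have : Complex.normSq (1 + ((σ : ℝ) : ℂ) * (Complex.I * ((√(1 - ‖z x‖ ^ 2) / ‖z x‖ : ℝ) : ℂ)))
        = 1 + (√(1 - ‖z x‖ ^ 2) / ‖z x‖) ^ 2 := by
      rw [Complex.normSq_apply]
      simp only [Complex.add_re, Complex.one_re, Complex.mul_re, Complex.ofReal_re, Complex.I_re,
        Complex.I_im, Complex.ofReal_im, Complex.add_im, Complex.one_im, Complex.mul_im]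
      ring_nf
      rw [hσ]; ring
    rw [this, div_pow, Real.sq_sqrt (by nlinarith)]
    field_simp
    ring
  refine ⟨⟨_, hu 1 (by norm_num)⟩, ⟨_, hu (-1) (by norm_num)⟩, ?_⟩
  simp only
  rw [← cfc_add (a := q) (f _) (f _) (hfc _) (hfc _)]
  have : (1 - (1 - w) • q) = cfc z q := by
    rw [hz, cfc_sub (fun _ => (1:ℂ)) (fun x => (1 - w) * x) q, cfc_const_one ℂ q,
      cfc_const_mul (1 - w) (fun x => x) q, cfc_id' ℂ q]
  rw [this, ← cfc_smul (2 : ℂ) z q]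
  congr 1
  ext x
  simp only [hf, smul_eq_mul]
  push_cast
  ring

lemma exists_unitary_near_one {P : Type*} [CStarAlgebra P] {h : P} (hh : IsSelfAdjoint h)
    (h1 : ‖h‖ ≤ 1) {s : ℝ} (hs0 : 0 ≤ s) (hs1 : s ≤ 1) :
    ∃ d : P, IsSelfAdjoint d ∧ ‖d‖ ≤ s ^ 2 ∧ (1 - d + (Complex.I * s) • h) ∈ unitary P := by
  set a : P := s • h with ha
  have hsa : IsSelfAdjoint a := IsSelfAdjoint.smul (by simp [IsSelfAdjoint]) hh
  have han : ‖a‖ ≤ s := by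
    rw [ha, norm_smul, Real.norm_of_nonneg hs0]; nlinarith
  set r : P := cfc (fun t : ℝ => √(1 - t ^ 2)) a with hr
  have hsp : ∀ t ∈ spectrum ℝ a, |t| ≤ s := by
    intro t ht
    exact (spec_norm_le ht).trans han
  have hrsa : IsSelfAdjoint r := cfc_predicate _ _
  have hrr : r * r = 1 - a * a := by
    rw [hr, ← cfc_mul (fun t : ℝ => √(1 - t ^ 2)) (fun t : ℝ => √(1 - t ^ 2)) a]
    have : 1 - a * a = cfc (fun t : ℝ => 1 - t * t) a := by
      rw [cfc_sub (fun _ => (1:ℝ)) (fun t => t * t) a, cfc_const_one ℝ a,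
        cfc_mul (fun t => t) (fun t => t) a, cfc_id' ℝ a]
    rw [this]
    apply cfc_congr
    intro t ht
    have := abs_le.1 (hsp t ht)
    simp only
    rw [Real.mul_self_sqrt (by nlinarith)]
    ring
  have hra : Commute r a := by
    have := cfc_commute_cfc (fun t : ℝ => √(1 - t ^ 2)) (fun t => t) a
    rwa [cfc_id' ℝ a] at this
  refine ⟨1 - r, (IsSelfAdjoint.one P).sub hrsa, ?_, ?_⟩
  · have : 1 - r = cfc (fun t : ℝ => 1 - √(1 - t ^ 2)) a := by
      rw [cfc_sub (fun _ => (1:ℝ)) (fun t : ℝ => √(1 - t ^ 2)) a, cfc_const_one ℝ a]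
    rw [this]
    apply norm_cfc_le (by positivity)
    intro t ht
    have h3 := abs_le.1 (hsp t ht)
    have h4 : √(1 - t ^ 2) ≤ 1 := by
      apply Real.sqrt_le_one.2; nlinarith
    have h5 : 1 - t ^ 2 ≤ √(1 - t ^ 2) := by
      apply Real.le_sqrt_of_sq_le
      nlinarith [mul_nonneg (sq_nonneg t) (show 0 ≤ 1 - t ^ 2 by nlinarith)]
    rw [Real.norm_of_nonneg (by linarith)]
    nlinarith
  · have e : (1 - (1 - r) + (Complex.I * s) • h) = r + Complex.I • a := by
      rw [ha, mul_smul, Complex.coe_smul]; abel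
    rw [e]
    clear_value a r
    have hst : star (r + Complex.I • a) = r - Complex.I • a := by
      rw [star_add, star_smul, hrsa.star_eq, hsa.star_eq]
      simp [sub_eq_add_neg]
    have hI : ∀ y : P, Complex.I • Complex.I • y = - y := by
      intro y; rw [smul_smul, Complex.I_mul_I, neg_one_smul]
    rw [Unitary.mem_iff, hst]
    constructor
    · rw [sub_mul, mul_add, mul_add, hrr, mul_smul_comm, smul_mul_assoc, smul_mul_assoc,
        mul_smul_comm, hI, hra.eq]
      abel
    · rw [add_mul, mul_sub, mul_sub, hrr, mul_smul_comm, smul_mul_assoc, smul_mul_assoc,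
        mul_smul_comm, hI, hra.eq]
      abel
end

section
set_option linter.style.haveILetI false

structure NearMax {P Q : Type*} [CStarAlgebra P] [CStarAlgebra Q]
    (V : P →ₗ[ℂ] Q →ₗ[ℂ] ℂ) (ε : ℝ) : Prop where
  ub : ∀ (u : unitary P) (v : unitary Q), ‖V u v‖ ≤ 1
  near : 1 - ε ≤ (V 1 1).re

namespace NearMax
variable {P Q : Type*} [CStarAlgebra P] [CStarAlgebra Q]
  {V : P →ₗ[ℂ] Q →ₗ[ℂ] ℂ} {ε : ℝ}

lemma flip (h : NearMax V ε) : NearMax V.flip ε := ⟨fun u v => h.ub v u, h.near⟩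

lemma avg (h : NearMax V ε) {x : P} {y : Q} (hx : IsAvgUnitary x) (hy : IsAvgUnitary y) :
    ‖V x y‖ ≤ 1 := by
  obtain ⟨u, w, hx⟩ := hx
  obtain ⟨u', w', hy⟩ := hy
  have e : (4 : ℂ) * V x y = V u u' + V u w' + V w u' + V w w' := by
    have : V ((2 : ℂ) • x) ((2 : ℂ) • y) = V u u' + V u w' + V w u' + V w w' := by
      rw [← hx, ← hy]; simp only [map_add, LinearMap.add_apply]; ring
    rw [← this]; simp only [map_smul, LinearMap.smul_apply, smul_eq_mul]; ring
  have h4 : ‖(4 : ℂ) * V x y‖ ≤ 4 := by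
    rw [e]
    refine (norm_add_le _ _).trans ?_
    have h1 := norm_add_le (V u u' + V u w') (V w u')
    have h2 := norm_add_le (V u u') (V u w')
    linarith [h.ub u u', h.ub u w', h.ub w u', h.ub w w']
  rw [norm_mul] at h4
  have h5 : ‖(4:ℂ)‖ = 4 := by simp
  rw [h5] at h4
  linarith

lemma avg_sa (h : NearMax V ε) {x : P} {y : Q} (hx : IsAvgUnitary x) (hy : IsSelfAdjoint y) :
    ‖V x y‖ ≤ ‖y‖ := by
  by_cases h0 : y = 0
  · simp [h0]
  have hp : 0 < ‖y‖ := norm_pos_iff.2 h0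
  have h1 := h.avg hx (y := ((‖y‖⁻¹ : ℝ) : ℂ) • y) (isAvgUnitary_of_sa
    (by rw [Complex.coe_smul]; exact IsSelfAdjoint.smul (by simp [IsSelfAdjoint]) hy)
    (by rw [norm_smul]; simp [hp.ne']))
  rw [map_smul, norm_smul] at h1
  simp only [Complex.norm_real, norm_inv, norm_norm] at h1
  rw [inv_mul_le_iff₀ hp] at h1
  linarith

lemma one_avg : IsAvgUnitary (1 : P) := ⟨1, 1, by simp [two_smul]⟩

lemma sa_avg (h : NearMax V ε) {x : P} {y : Q} (hx : IsSelfAdjoint x) (hy : IsAvgUnitary y) :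
    ‖V x y‖ ≤ ‖x‖ := h.flip.avg_sa hy hx

lemma im_left (h : NearMax V ε) (hε : 0 < ε) (hε1 : ε ≤ 1) {x : P} (hx : IsSelfAdjoint x)
    (hx1 : ‖x‖ ≤ 1) : |(V x 1).im| ≤ 2 * √ε := by
  have key : ∀ x : P, IsSelfAdjoint x → ‖x‖ ≤ 1 → - (V x 1).im ≤ 2 * √ε := by
    intro x hx hx1
    have hs : 0 < √ε := Real.sqrt_pos.2 hε
    have hs1 : √ε ≤ 1 := Real.sqrt_le_one.2 hε1
    have hss : √ε ^ 2 = ε := Real.sq_sqrt hε.le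
    obtain ⟨d, hd, hdn, hu⟩ := exists_unitary_near_one hx hx1 hs.le hs1
    have h1 := h.avg (isAvgUnitary_of_unitary ⟨_, hu⟩) (one_avg (P := Q))
    have h2 := (Complex.re_le_norm _).trans h1
    have h3 := (Complex.abs_re_le_norm _).trans (h.sa_avg hd (one_avg (P := Q)))
    have h4 := (abs_le.1 h3).2
    simp only [map_add, map_sub, map_smul, LinearMap.add_apply, LinearMap.sub_apply,
      LinearMap.smul_apply, smul_eq_mul, Complex.add_re, Complex.sub_re, Complex.mul_re,
      Complex.mul_im, Complex.I_re, Complex.I_im, Complex.ofReal_re, Complex.ofReal_im] at h2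
    have h5 := h.near
    have : √ε * (- (V x 1).im) ≤ √ε * (2 * √ε) := by nlinarith
    exact le_of_mul_le_mul_left this hs
  rw [abs_le]
  have h1 := key x hx hx1
  have h2 := key (-x) hx.neg (by rwa [norm_neg])
  simp at h2
  constructor <;> linarith

variable [PartialOrder Q] [StarOrderedRing Q]

lemma psi_ge (h : NearMax V ε) {p : Q} (hp : 0 ≤ p) {r : ℝ} (hr0 : 0 < r) (hr : ‖p‖ ≤ r) :
    -(ε * r) ≤ (V 1 p).re := by
  have hsa : IsSelfAdjoint p := hp.isSelfAdjoint
  have h1 : ‖(1 : Q) - (r⁻¹ : ℝ) • p‖ ≤ 1 := by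
    have hq0 : 0 ≤ (r⁻¹ : ℝ) • p := smul_nonneg (by positivity) hp
    have hq1 : (r⁻¹ : ℝ) • p ≤ 1 := by
      rw [← CStarAlgebra.norm_le_one_iff_of_nonneg _ hq0, norm_smul, norm_inv,
        Real.norm_of_nonneg hr0.le, inv_mul_le_iff₀ hr0]
      linarith
    rw [CStarAlgebra.norm_le_one_iff_of_nonneg _ (sub_nonneg.2 hq1)]
    simpa using hq0
  have h2 := (Complex.re_le_norm _).trans (h.avg (one_avg (P := P)) (isAvgUnitary_of_sa
    ((IsSelfAdjoint.one Q).sub (IsSelfAdjoint.smul (by simp [IsSelfAdjoint]) hsa)) h1))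
  rw [← Complex.coe_smul] at h2
  simp only [map_sub, map_smul, smul_eq_mul, Complex.sub_re, Complex.re_ofReal_mul] at h2
  have h3 := h.near
  have h4 : -ε ≤ r⁻¹ * (V 1 p).re := by linarith
  have h5 := mul_le_mul_of_nonneg_right h4 hr0.le
  have h6 : r⁻¹ * (V 1 p).re * r = (V 1 p).re := by field_simp
  linarith

lemma g1 (h : NearMax V ε) (hε : 0 < ε) (hε1 : ε ≤ 1) {x : P} (hx : IsSelfAdjoint x)
    (hx1 : ‖x‖ ≤ 1) {q : Q} (hq0 : 0 ≤ q) (hq1 : ‖q‖ ≤ 1) {s : ℝ} (hs : 0 < s) (hs1 : s ≤ 1) :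
    ‖V x q‖ ≤ 3 * s + ((V 1 q).re + 5 * √ε) / s := by
  have hqs : IsSelfAdjoint q := hq0.isSelfAdjoint
  have him := h.flip.im_left hε hε1 hqs hq1
  simp only [LinearMap.flip_apply] at him
  have hεs : ε ≤ √ε := by
    apply Real.le_sqrt_of_sq_le; nlinarith
  have key : ∀ (σ : ℝ) (x : P), σ ^ 2 = 1 → IsSelfAdjoint x → ‖x‖ ≤ 1 →
      s * ((V x q).im + σ * (V x q).re) ≤ 3 * s ^ 2 + (V 1 q).re + 5 * √ε := by
    intro σ x hσ hx hx1
    obtain ⟨d, hd, hdn, hu⟩ := exists_unitary_near_one hx hx1 hs.le hs1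
    have hw : (-σ * Complex.I) = Complex.I ∨ (-σ * Complex.I) = -Complex.I := by
      have : (σ - 1) * (σ + 1) = 0 := by nlinarith
      rcases mul_eq_zero.1 this with h | h
      · right; have : σ = 1 := by linarith
        simp [this]
      · left; have : σ = -1 := by linarith
        simp [this]
    have hσ1 : |σ| = 1 := by
      have : |σ| ^ 2 = 1 := by rw [sq_abs, hσ]
      nlinarith [abs_nonneg σ]
    have h1 := h.avg (isAvgUnitary_of_unitary ⟨_, hu⟩) (isAvgUnitary_rot hq0 hq1 hw)
    have h2 := (Complex.re_le_norm _).trans h1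
    have h3 := (Complex.abs_re_le_norm _).trans (h.sa_avg hd (one_avg (P := Q)))
    have h4 := (abs_le.1 h3).2
    have h6 := h.sa_avg hd (isAvgUnitary_of_sa hqs hq1)
    have h7 := (abs_le.1 ((Complex.abs_re_le_norm _).trans h6)).1
    have h8 := ((Complex.abs_im_le_norm _).trans h6)
    have h8' : |σ * (V d q).im| ≤ ‖d‖ := by rw [abs_mul, hσ1, one_mul]; exact h8
    have h8'' := (abs_le.1 h8').2
    have h9 := h.im_left hε hε1 hx hx1
    have h9' := (abs_le.1 h9).2
    have h10 : |σ * (V 1 q).im| ≤ 2 * √ε := by rw [abs_mul, hσ1, one_mul]; exact him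
    have h10' := (abs_le.1 h10).1
    simp only [map_add, map_sub, map_smul, LinearMap.add_apply, LinearMap.sub_apply,
      LinearMap.smul_apply, smul_eq_mul, Complex.add_re, Complex.sub_re, Complex.mul_re,
      Complex.add_im, Complex.sub_im, Complex.one_re, Complex.one_im, Complex.neg_re, Complex.neg_im,
      Complex.mul_im, Complex.I_re, Complex.I_im, Complex.ofReal_re, Complex.ofReal_im] at h2
    have h5 := h.near
    have h11 : s * (V x 1).im ≤ 2 * √ε := by
      have := Real.sqrt_nonneg ε
      calc s * (V x 1).im ≤ s * (2 * √ε) := by gcongr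
        _ ≤ 1 * (2 * √ε) := by gcongr
        _ = _ := by ring
    have h12 : -(σ * (V 1 q).im) ≤ 2 * √ε := by linarith
    ring_nf at h2 ⊢
    nlinarith
  have k1 := key 1 x (by norm_num) hx hx1
  have k2 := key (-1) x (by norm_num) hx hx1
  have k3 := key 1 (-x) (by norm_num) hx.neg (by rwa [norm_neg])
  have k4 := key (-1) (-x) (by norm_num) hx.neg (by rwa [norm_neg])
  simp only [map_neg, LinearMap.neg_apply, Complex.neg_im, Complex.neg_re] at k3 k4
  have h1 : ‖V x q‖ ≤ |(V x q).re| + |(V x q).im| := Complex.norm_le_abs_re_add_abs_im _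
  have h2 : s * (|(V x q).re| + |(V x q).im|) ≤ 3 * s ^ 2 + (V 1 q).re + 5 * √ε := by
    rcases abs_cases (V x q).re with ⟨h, -⟩ | ⟨h, -⟩ <;>
    rcases abs_cases (V x q).im with ⟨h', -⟩ | ⟨h', -⟩ <;> rw [h, h'] <;> linarith
  have h3 : 3 * s + ((V 1 q).re + 5 * √ε) / s = (3 * s ^ 2 + (V 1 q).re + 5 * √ε) / s := by
    field_simp; ring
  rw [h3, le_div_iff₀ hs]
  nlinarith
end NearMax
end

section
set_option linter.style.haveILetI false

def clampAt (j : ℕ) (t : ℝ) : ℝ := max 0 (min 1 (t - j))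

lemma clampAt_cont (j : ℕ) : Continuous (clampAt j) := by unfold clampAt; fun_prop

lemma clampAt_nonneg (j : ℕ) (t : ℝ) : 0 ≤ clampAt j t := le_max_left _ _

lemma clampAt_le_one (j : ℕ) (t : ℝ) : clampAt j t ≤ 1 := max_le zero_le_one (min_le_left _ _)

lemma clampAt_bound (j : ℕ) (t : ℝ) : ((j : ℝ) + 1) ^ 4 * clampAt j t ≤ 8 * (1 + t ^ 4) := by
  by_cases h : t ≤ j
  · have : clampAt j t = 0 := by
      unfold clampAt
      apply max_eq_left
      exact (min_le_right _ _).trans (by linarith)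
    rw [this, mul_zero]; positivity
  · push Not at h
    have h0 : (0 : ℝ) ≤ j := by positivity
    have h1 : ((j : ℝ) + 1) ^ 4 * clampAt j t ≤ ((j : ℝ) + 1) ^ 4 * 1 := by
      gcongr; exact clampAt_le_one j t
    have h2 : ((j : ℝ) + 1) ^ 4 ≤ (t + 1) ^ 4 := by gcongr
    have h3 : (t + 1) ^ 4 ≤ 8 * (1 + t ^ 4) := by
      nlinarith [sq_nonneg (t - 1), sq_nonneg (t ^ 2 - 1), sq_nonneg (t + 1), sq_nonneg (t ^ 2 - t)]
    linarith

lemma clampAt_sum (R : ℕ) (t : ℝ) :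
    ∑ j ∈ Finset.range R, clampAt j t = max 0 (min (R : ℝ) t) := by
  induction R with
  | zero => simp
  | succ n ih =>
    rw [Finset.sum_range_succ, ih]
    unfold clampAt
    push_cast
    have : (0 : ℝ) ≤ n := by positivity
    rcases le_total t 0 with h | h
    · rw [min_eq_right (by linarith), max_eq_left h, min_eq_right (by linarith),
        max_eq_left (by linarith), min_eq_right (by linarith), max_eq_left h]; ring
    rcases le_total t n with h1 | h1
    · rw [min_eq_right (by linarith), max_eq_right h, min_eq_right (by linarith),
        max_eq_left (by linarith), min_eq_right (by linarith), max_eq_right h]; ring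
    rcases le_total t (n + 1) with h2 | h2
    · rw [min_eq_left (by linarith), max_eq_right this, min_eq_right (by linarith),
        max_eq_right (by linarith), min_eq_right (by linarith), max_eq_right h]; ring
    · rw [min_eq_left (by linarith), max_eq_right this, min_eq_left (by linarith),
        max_eq_right (by linarith), min_eq_left (by linarith), max_eq_right (by linarith)]

lemma sum_inv_sq_le (R : ℕ) : ∑ j ∈ Finset.range R, (1 : ℝ) / ((j : ℝ) + 1) ^ 2 ≤ 2 := by
  have : ∑ j ∈ Finset.range R, (1 : ℝ) / ((j : ℝ) + 1) ^ 2 ≤ 2 - 2 / ((R : ℝ) + 1) := by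
    induction R with
    | zero => simp
    | succ n ih =>
      rw [Finset.sum_range_succ]
      have : (1 : ℝ) / ((n : ℝ) + 1) ^ 2 ≤ 2 / ((n : ℝ) + 1) - 2 / ((n : ℝ) + 1 + 1) := by
        have hn : (0 : ℝ) ≤ n := by positivity
        rw [div_sub_div _ _ (by positivity) (by positivity), div_le_div_iff₀ (by positivity) (by positivity)]
        nlinarith
      push_cast
      linarith
  have h2 : 0 ≤ 2 / ((R : ℝ) + 1) := by positivity
  linarith

namespace NearMax
variable {P Q : Type*} [CStarAlgebra P] [CStarAlgebra Q]
  {V : P →ₗ[ℂ] Q →ₗ[ℂ] ℂ} {ε : ℝ}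
variable [PartialOrder Q] [StarOrderedRing Q]

lemma pow4_sa {k : Q} (hk : IsSelfAdjoint k) : k ^ 4 = cfc (fun t : ℝ => t ^ 4) k := by
  rw [cfc_pow (fun t => t) 4 k, cfc_id' ℝ k]

lemma g2_half (h : NearMax V ε) (hε : 0 < ε) (hε1 : ε ≤ 1) {x : P} (hx : IsSelfAdjoint x)
    (hx1 : ‖x‖ ≤ 1) {k : Q} (hk : IsSelfAdjoint k) {R : ℕ} (hR : ‖k‖ ≤ R) :
    ‖V x (cfc (fun t : ℝ => max 0 (min (R : ℝ) t)) k)‖ ≤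
      2 * (3 + (8 * (1 + (V 1 (k ^ 4)).re) + 8 * ε * (1 + (R : ℝ) ^ 4))) + 5 * √ε * (R : ℝ) ^ 3 := by
  have e : cfc (fun t : ℝ => max 0 (min (R : ℝ) t)) k
      = ∑ j ∈ Finset.range R, cfc (clampAt j) k := by
    have := cfc_sum (fun j => clampAt j) k (Finset.range R) (fun j _ => (clampAt_cont j).continuousOn)
    rw [← this]
    congr 1
    funext t
    rw [Finset.sum_apply, clampAt_sum]
  set Λ := 8 * (1 + (V 1 (k ^ 4)).re) + 8 * ε * (1 + (R : ℝ) ^ 4) with hΛ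
  have hV1 : (V 1 1).re ≤ 1 := (Complex.re_le_norm _).trans (h.avg one_avg one_avg)
  have hk4 : 0 ≤ 1 + k ^ 4 := by
    rw [pow4_sa hk]
    exact add_nonneg zero_le_one (cfc_nonneg (fun t _ => by positivity))
  have hk4n : ‖(1 : Q) + k ^ 4‖ ≤ 1 + (R : ℝ) ^ 4 := by
    refine (norm_add_le _ _).trans ?_
    gcongr
    · rcases subsingleton_or_nontrivial Q with hs | hs
      · rw [Subsingleton.elim (1 : Q) 0, norm_zero]; exact zero_le_one
      · rw [CStarRing.norm_one]
    · refine (norm_pow_le' k (by norm_num)).trans ?_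
      gcongr
  have hΛ0 : 0 ≤ Λ := by
    have := h.psi_ge hk4 (by positivity) hk4n
    rw [map_add, Complex.add_re] at this
    rw [hΛ]; nlinarith
  have hj : ∀ j ∈ Finset.range R, ‖V x (cfc (clampAt j) k)‖ ≤
      (3 + Λ) * ((1 : ℝ) / ((j : ℝ) + 1) ^ 2) + 5 * √ε * (R : ℝ) ^ 2 := by
    intro j hj
    set q := cfc (clampAt j) k with hq
    have hq0 : 0 ≤ q := cfc_nonneg (fun t _ => clampAt_nonneg j t)
    have hq1 : ‖q‖ ≤ 1 := by
      apply norm_cfc_le zero_le_one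
      intro t _
      rw [Real.norm_of_nonneg (clampAt_nonneg j t)]
      exact clampAt_le_one j t
    have hj1 : (0 : ℝ) < (j : ℝ) + 1 := by positivity
    have h1 := h.g1 hε hε1 hx hx1 hq0 hq1 (s := 1 / ((j : ℝ) + 1) ^ 2) (by positivity) (by
      rw [div_le_one (by positivity)]
      have : (0 : ℝ) ≤ j := by positivity
      nlinarith)
    have hr0 : 0 ≤ (8 : ℝ) • (1 + k ^ 4) - (((j : ℝ) + 1) ^ 4) • q := by
      rw [sub_nonneg]
      have e1 : (((j : ℝ) + 1) ^ 4) • q = cfc (fun t => ((j : ℝ) + 1) ^ 4 * clampAt j t) k := by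
        rw [cfc_const_mul _ _ _ (clampAt_cont j).continuousOn]
      have e2 : (8 : ℝ) • (1 + k ^ 4) = cfc (fun t : ℝ => 8 * (1 + t ^ 4)) k := by
        rw [cfc_const_mul .., cfc_add .., cfc_const_one ℝ k, pow4_sa hk]
      rw [e1, e2]
      apply cfc_mono (fun t _ => clampAt_bound j t) _ (by fun_prop)
      have := clampAt_cont j
      fun_prop
    have hrn : ‖(8 : ℝ) • (1 + k ^ 4) - (((j : ℝ) + 1) ^ 4) • q‖ ≤ 8 * (1 + (R : ℝ) ^ 4) := by
      calc _ ≤ ‖(8 : ℝ) • (1 + k ^ 4)‖ := by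
            apply CStarAlgebra.norm_le_norm_of_nonneg_of_le hr0
            rw [sub_le_self_iff]
            exact smul_nonneg (by positivity) hq0
        _ ≤ _ := by rw [norm_smul]; norm_num; linarith
    have h2 := h.psi_ge hr0 (by positivity) hrn
    rw [← Complex.coe_smul, ← Complex.coe_smul] at h2
    simp only [map_sub, map_smul, map_add, smul_eq_mul, Complex.sub_re, Complex.re_ofReal_mul,
      Complex.add_re] at h2
    have h3 : ((j : ℝ) + 1) ^ 4 * (V 1 q).re ≤ Λ := by rw [hΛ]; nlinarith
    have h4 : (V 1 q).re ≤ Λ / ((j : ℝ) + 1) ^ 4 := by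
      rw [le_div_iff₀ (by positivity)]; linarith
    have hjR : (j : ℝ) + 1 ≤ R := by
      have := Finset.mem_range.1 hj
      exact_mod_cast this
    calc ‖V x q‖ ≤ _ := h1
      _ = 3 * (1 / ((j : ℝ) + 1) ^ 2) + (V 1 q).re * ((j : ℝ) + 1) ^ 2
          + 5 * √ε * ((j : ℝ) + 1) ^ 2 := by
            field_simp; ring
      _ ≤ 3 * (1 / ((j : ℝ) + 1) ^ 2) + Λ / ((j : ℝ) + 1) ^ 4 * ((j : ℝ) + 1) ^ 2
          + 5 * √ε * (R : ℝ) ^ 2 := by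
            gcongr
      _ = _ := by field_simp
  rw [e, map_sum]
  refine (norm_sum_le _ _).trans ((Finset.sum_le_sum hj).trans ?_)
  rw [Finset.sum_add_distrib, ← Finset.mul_sum, Finset.sum_const, Finset.card_range, nsmul_eq_mul]
  have := sum_inv_sq_le R
  nlinarith

lemma g2 (h : NearMax V ε) (hε : 0 < ε) (hε1 : ε ≤ 1) {x : P} (hx : IsSelfAdjoint x)
    (hx1 : ‖x‖ ≤ 1) {k : Q} (hk : IsSelfAdjoint k) {R : ℕ} (hR : ‖k‖ ≤ R) :
    ‖V x k‖ ≤ 44 + 32 * (V 1 (k ^ 4)).re + (32 * ε * (1 + (R : ℝ) ^ 4) + 10 * √ε * (R : ℝ) ^ 3) := by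
  have h1 := h.g2_half hε hε1 hx hx1 hk hR
  have h2 := h.g2_half hε hε1 hx hx1 hk.neg (R := R) (by rwa [norm_neg])
  have e : k = cfc (fun t : ℝ => max 0 (min (R : ℝ) t)) k
      - cfc (fun t : ℝ => max 0 (min (R : ℝ) t)) (-k) := by
    rw [← cfc_comp_neg (fun t : ℝ => max 0 (min (R : ℝ) t)) k, ← cfc_sub ..]
    conv_lhs => rw [← cfc_id' ℝ k]
    apply cfc_congr
    intro t ht
    have h3 := abs_le.1 ((spec_norm_le ht).trans hR)
    have hR0 : (0 : ℝ) ≤ R := by positivity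
    simp only
    rw [min_eq_right h3.2, min_eq_right (by linarith)]
    rcases le_total t 0 with h | h
    · rw [max_eq_left h, max_eq_right (by linarith)]; ring
    · rw [max_eq_right h, max_eq_left (by linarith)]; ring
  have h4 : (-k) ^ 4 = k ^ 4 := by rw [Even.neg_pow (by decide)]
  rw [h4] at h2
  calc ‖V x k‖ = ‖V x (cfc (fun t : ℝ => max 0 (min (R : ℝ) t)) k)
      - V x (cfc (fun t : ℝ => max 0 (min (R : ℝ) t)) (-k))‖ := by
        rw [← map_sub, ← e]
    _ ≤ _ := norm_sub_le _ _
    _ ≤ _ := by linarith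
end NearMax
end

section
/-- Rademacher signs. -/
def sgn {n : ℕ} (ω : Fin n → Bool) (j : Fin n) : ℝ := if ω j then 1 else -1

def radSum {n : ℕ} {W : Type*} [AddCommGroup W] [Module ℝ W] (x : Fin n → W) (ω : Fin n → Bool) : W :=
  ∑ j, sgn ω j • x j

lemma sgn_sq {n : ℕ} (ω : Fin n → Bool) (j : Fin n) : sgn ω j * sgn ω j = 1 := by
  unfold sgn; split_ifs <;> norm_num

lemma sgn_orth {n : ℕ} (i j : Fin n) :
    ∑ ω : Fin n → Bool, sgn ω i * sgn ω j = if i = j then (2 : ℝ) ^ n else 0 := by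
  split_ifs with h
  · subst h
    simp [sgn_sq]
  · have hinv : Function.Involutive (fun ω : Fin n → Bool => Function.update ω i (!ω i)) := by
      intro ω; ext k; by_cases hk : k = i
      · subst hk; simp
      · simp [hk]
    have key : ∑ ω : Fin n → Bool, sgn ω i * sgn ω j = ∑ ω : Fin n → Bool, -(sgn ω i * sgn ω j) := by
      apply Fintype.sum_equiv (Function.Involutive.toPerm _ hinv)
      intro ω
      have h1 : sgn (Function.Involutive.toPerm _ hinv ω) i = - sgn ω i := by
        simp only [Function.Involutive.coe_toPerm, sgn, Function.update_self]
        cases ω i <;> simp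
      have h2 : sgn (Function.Involutive.toPerm _ hinv ω) j = sgn ω j := by
        simp [sgn, Function.update_of_ne (Ne.symm h)]
      rw [h1, h2]; ring
    rw [Finset.sum_neg_distrib] at key
    linarith

lemma radSum_bilin {n : ℕ} {W₁ W₂ W₃ : Type*} [AddCommGroup W₁] [Module ℝ W₁] [AddCommGroup W₂]
    [Module ℝ W₂] [AddCommGroup W₃] [Module ℝ W₃] (F : W₁ →ₗ[ℝ] W₂ →ₗ[ℝ] W₃)
    (x : Fin n → W₁) (y : Fin n → W₂) :
    ∑ ω, F (radSum x ω) (radSum y ω) = (2 : ℝ) ^ n • ∑ j, F (x j) (y j) := by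
  have e : ∀ ω : Fin n → Bool, F (radSum x ω) (radSum y ω) =
      ∑ j, ∑ i, (sgn ω i * sgn ω j) • F (x i) (y j) := by
    intro ω
    simp only [radSum, map_sum, map_smul, LinearMap.sum_apply, LinearMap.smul_apply, Finset.smul_sum]
    refine Finset.sum_congr rfl fun j _ => Finset.sum_congr rfl fun i _ => ?_
    rw [smul_smul, mul_comm]
  have : ∀ j, ∑ ω : Fin n → Bool, ∑ i, (sgn ω i * sgn ω j) • F (x i) (y j) = (2 : ℝ) ^ n • F (x j) (y j) := by
    intro j
    rw [Finset.sum_comm]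
    simp_rw [← Finset.sum_smul, sgn_orth]
    simp
  simp only [e]
  rw [Finset.sum_comm, Finset.smul_sum]
  exact Finset.sum_congr rfl fun j _ => this j

lemma radSum_cons {n : ℕ} {W : Type*} [AddCommGroup W] [Module ℝ W] (x : Fin (n + 1) → W) (b : Bool)
    (ω : Fin n → Bool) : radSum x (Fin.cons b ω) =
      (if b then (1 : ℝ) else -1) • x 0 + radSum (fun i => x i.succ) ω := by
  simp [radSum, Fin.sum_univ_succ, sgn]

lemma sum_bool_cons {n : ℕ} {W : Type*} [AddCommGroup W] (F : (Fin (n + 1) → Bool) → W) :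
    ∑ ω, F ω = ∑ ω : Fin n → Bool, (F (Fin.cons true ω) + F (Fin.cons false ω)) := by
  rw [← Fintype.sum_equiv (Fin.consEquiv (fun _ : Fin (n + 1) => Bool)) (fun p => F (Fin.cons p.1 p.2)) F (fun p => rfl),
    Fintype.sum_prod_type, Fintype.sum_bool, Finset.sum_add_distrib]

section moment
variable {P : Type*} [CStarAlgebra P] [PartialOrder P] [StarOrderedRing P]

lemma radSum_sa {n : ℕ} {x : Fin n → P} (hx : ∀ j, IsSelfAdjoint (x j)) (ω : Fin n → Bool) :
    IsSelfAdjoint (radSum x ω) := by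
  unfold radSum
  apply isSelfAdjoint_sum
  intro j _
  exact IsSelfAdjoint.smul (by simp [IsSelfAdjoint]) (hx j)

lemma radSum_mid {n : ℕ} (x : Fin n → P) (b : P) :
    ∑ ω, radSum x ω * b * radSum x ω = (2 : ℝ) ^ n • ∑ j, x j * b * x j := by
  have := radSum_bilin ((LinearMap.mul ℝ P).comp (LinearMap.mulRight ℝ b)) x x
  simpa using this

lemma radSum_sq {n : ℕ} (x : Fin n → P) :
    ∑ ω, radSum x ω * radSum x ω = (2 : ℝ) ^ n • ∑ j, x j * x j := by
  have := radSum_bilin (LinearMap.mul ℝ P) x x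
  simpa using this

lemma sa_mul_self_nonneg {a : P} (ha : IsSelfAdjoint a) : 0 ≤ a * a := by
  have := star_mul_self_nonneg a
  rwa [ha.star_eq] at this

lemma sa_conj_nonneg {a b : P} (ha : IsSelfAdjoint a) (hb : 0 ≤ b) : 0 ≤ a * b * a := by
  have := star_left_conjugate_nonneg hb a
  rwa [ha.star_eq] at this

lemma fourth_aux {a S : P} (ha : IsSelfAdjoint a) (hS : IsSelfAdjoint S) :
    (a + S) ^ 4 + (-a + S) ^ 4 ≤ (2 : ℝ) • (S ^ 4 + a ^ 4 + ((S * S) * (a * a) + (a * a) * (S * S)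
      + (2 : ℝ) • (S * (a * a) * S) + (2 : ℝ) • (a * (S * S) * a))) := by
  have h := star_mul_self_nonneg (S * a - a * S)
  rw [star_sub, star_mul, star_mul, ha.star_eq, hS.star_eq] at h
  rw [← sub_nonneg]
  have h2 : (0 : P) ≤ (2 : ℝ) • ((a * S - S * a) * (S * a - a * S)) := smul_nonneg (by norm_num) h
  convert h2 using 1
  simp only [two_smul]
  noncomm_ring

lemma fourth_moment {n : ℕ} (x : Fin n → P) (hx : ∀ j, IsSelfAdjoint (x j)) :
    ∑ ω, (radSum x ω) ^ 4 ≤ (2 : ℝ) ^ n • ((∑ j, x j * x j) * (∑ j, x j * x j)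
      + (2 : ℝ) • ∑ j, x j * (∑ i, x i * x i) * x j) := by
  induction n with
  | zero => simp [radSum]
  | succ n ih =>
    rw [sum_bool_cons]
    simp only [radSum_cons, if_true, one_smul, Bool.false_eq_true, if_false, neg_smul]
    set a := x 0
    set z : Fin n → P := fun i => x i.succ with hz
    have ha : IsSelfAdjoint a := hx 0
    have hzs : ∀ j, IsSelfAdjoint (z j) := fun j => hx _
    have ih := ih z hzs
    have e1 := Finset.sum_le_sum (fun ω (_ : ω ∈ (Finset.univ : Finset (Fin n → Bool))) =>
      fourth_aux ha (radSum_sa hzs ω))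
    refine e1.trans ?_
    rw [← Finset.smul_sum, pow_succ (2 : ℝ) n, mul_comm ((2 : ℝ) ^ n) 2, mul_smul]
    apply smul_le_smul_of_nonneg_left _ (by norm_num : (0 : ℝ) ≤ 2)
    have hsq := radSum_sq z
    have hmid := radSum_mid z (a * a)
    simp only [Finset.sum_add_distrib, ← Finset.smul_sum, ← Finset.sum_mul, ← Finset.mul_sum,
      hsq, hmid]
    rw [Fin.sum_univ_succ, Fin.sum_univ_succ (f := fun j => x j * (x 0 * x 0 + ∑ i : Fin n, x i.succ * x i.succ) * x j)]
    change _ ≤ (2 : ℝ) ^ n • ((a * a + ∑ i, z i * z i) * (a * a + ∑ i, z i * z i) + (2 : ℝ) •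
      (a * (a * a + ∑ i, z i * z i) * a + ∑ j, z j * (a * a + ∑ i, z i * z i) * z j))
    have e2 : ∑ j, z j * (a * a + ∑ i, z i * z i) * z j = ∑ j, z j * (a * a) * z j +
        ∑ j, z j * (∑ i, z i * z i) * z j := by
      rw [← Finset.sum_add_distrib]; simp only [mul_add, add_mul]
    rw [e2]
    set q := ∑ i, z i * z i
    set r1 := ∑ j, z j * (a * a) * z j
    set r2 := ∑ j, z j * q * z j
    have h4 : (0 : P) ≤ (2 : ℝ) ^ n • ((2 : ℝ) • (a ^ 4)) := by
      refine smul_nonneg (by positivity) (smul_nonneg (by norm_num) ?_)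
      have := sa_mul_self_nonneg (ha.pow 2)
      rwa [← pow_add] at this
    have e3 : (∑ ω : Fin n → Bool, a ^ 4) = (2 : ℝ) ^ n • a ^ 4 := by
      rw [Finset.sum_const, Finset.card_univ, Fintype.card_fun, Fintype.card_bool, Fintype.card_fin,
        ← Nat.cast_smul_eq_nsmul ℝ]; push_cast; rfl
    rw [e3, ← sub_nonneg]
    have h5 := add_nonneg (sub_nonneg.2 ih) h4
    convert h5 using 1
    rw [smul_mul_assoc, mul_smul_comm]
    simp only [two_smul, mul_add, add_mul, smul_add, smul_sub]
    noncomm_ring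

lemma fourth_moment_le {n : ℕ} (x : Fin n → P) (hx : ∀ j, IsSelfAdjoint (x j))
    (h1 : ∑ j, x j * x j ≤ 1) :
    ∑ ω, (radSum x ω) ^ 4 ≤ (2 : ℝ) ^ n • ((3 : ℝ) • (1 : P)) := by
  refine (fourth_moment x hx).trans (smul_le_smul_of_nonneg_left ?_ (by positivity))
  set q := ∑ j, x j * x j with hq
  have hq0 : 0 ≤ q := Finset.sum_nonneg fun j _ => sa_mul_self_nonneg (hx j)
  have h2 : q * q ≤ 1 := by
    have h0 := sa_mul_self_nonneg hq0.isSelfAdjoint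
    rw [← CStarAlgebra.norm_le_one_iff_of_nonneg _ h0]
    rw [← CStarAlgebra.norm_le_one_iff_of_nonneg _ hq0] at h1
    exact (norm_mul_le _ _).trans (mul_le_one₀ h1 (norm_nonneg _) h1)
  have h3 : ∑ j, x j * q * x j ≤ q := by
    rw [hq]
    apply Finset.sum_le_sum
    intro j _
    rw [← sub_nonneg]
    have := sa_conj_nonneg (hx j) (sub_nonneg.2 h1)
    convert this using 1
    noncomm_ring
  calc _ ≤ 1 + (2 : ℝ) • (1 : P) := add_le_add h2 (smul_le_smul_of_nonneg_left (h3.trans h1) (by norm_num))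
    _ = _ := by rw [show (3 : ℝ) = 1 + 2 by norm_num, add_smul, one_smul]

lemma bessel {n : ℕ} (r : (Fin n → Bool) → P) (hr : ∀ ω, IsSelfAdjoint (r ω)) (x : Fin n → P)
    (hx : ∀ j, (2 : ℝ) ^ n • x j = ∑ ω, sgn ω j • r ω) :
    (2 : ℝ) ^ n • ∑ j, x j * x j ≤ ∑ ω, r ω * r ω := by
  have hxs : ∀ j, IsSelfAdjoint (x j) := by
    intro j
    have : x j = ((2 : ℝ) ^ n)⁻¹ • ∑ ω, sgn ω j • r ω := by
      rw [← hx, smul_smul, inv_mul_cancel₀ (by positivity), one_smul]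
    rw [this]
    refine IsSelfAdjoint.smul (by simp [IsSelfAdjoint]) (isSelfAdjoint_sum _ fun ω _ => ?_)
    exact IsSelfAdjoint.smul (by simp [IsSelfAdjoint]) (hr ω)
  have h0 : 0 ≤ ∑ ω, (r ω - radSum x ω) * (r ω - radSum x ω) :=
    Finset.sum_nonneg fun ω _ => sa_mul_self_nonneg ((hr ω).sub (radSum_sa hxs ω))
  have e1 : ∑ ω, r ω * radSum x ω = (2 : ℝ) ^ n • ∑ j, x j * x j := by
    simp only [radSum, Finset.mul_sum, mul_smul_comm]
    rw [Finset.sum_comm, Finset.smul_sum]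
    refine Finset.sum_congr rfl fun j _ => ?_
    rw [← smul_mul_assoc, hx, Finset.sum_mul]
    simp only [smul_mul_assoc]
  have e2 : ∑ ω, radSum x ω * r ω = (2 : ℝ) ^ n • ∑ j, x j * x j := by
    simp only [radSum, Finset.sum_mul, smul_mul_assoc]
    rw [Finset.sum_comm, Finset.smul_sum]
    refine Finset.sum_congr rfl fun j _ => ?_
    rw [← mul_smul_comm, hx, Finset.mul_sum]
    simp only [mul_smul_comm]
  have e3 := radSum_sq x
  simp only [mul_sub, sub_mul, Finset.sum_sub_distrib, e1, e2, e3] at h0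
  rw [← sub_nonneg]
  convert h0 using 1
  abel
end moment
end

section
section GT
variable {P Q : Type*} [CStarAlgebra P] [CStarAlgebra Q]
  [PartialOrder P] [StarOrderedRing P] [PartialOrder Q] [StarOrderedRing Q]

/-- real bilinear form from complex one -/
def toRealBilin (V : P →ₗ[ℂ] Q →ₗ[ℂ] ℂ) : P →ₗ[ℝ] Q →ₗ[ℝ] ℂ :=
  LinearMap.mk₂ ℝ (fun x y => V x y) (by simp) (by intro c m n; rw [← Complex.coe_smul, map_smul]; simp)
    (by simp) (by intro c m n; rw [← Complex.coe_smul, map_smul]; simp)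

lemma norm_radSum_le {n : ℕ} (x : Fin n → P) (hx : ∀ j, ‖x j‖ ≤ 1) (ω : Fin n → Bool) :
    ‖radSum x ω‖ ≤ n := by
  unfold radSum
  refine (norm_sum_le _ _).trans ((Finset.sum_le_sum (g := fun _ => (1 : ℝ)) ?_).trans (by simp))
  intro j _
  rw [norm_smul]
  have : ‖sgn ω j‖ = 1 := by unfold sgn; split_ifs <;> simp
  rw [this, one_mul]; exact hx j

lemma sa_norm_le_one_of_sq {a : P} (ha : IsSelfAdjoint a) (h : a * a ≤ 1) : ‖a‖ ≤ 1 := by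
  have h0 := sa_mul_self_nonneg ha
  rw [← CStarAlgebra.norm_le_one_iff_of_nonneg _ h0, ha.norm_mul_self] at h
  nlinarith [norm_nonneg a]

lemma norm_le_of_sum_sq {n : ℕ} {x : Fin n → P} (hx : ∀ j, IsSelfAdjoint (x j))
    (h1 : ∑ j, x j * x j ≤ 1) (j : Fin n) : ‖x j‖ ≤ 1 := by
  apply sa_norm_le_one_of_sq (hx j)
  exact (Finset.single_le_sum (f := fun j => x j * x j) (fun i _ => sa_mul_self_nonneg (hx i))
    (Finset.mem_univ j)).trans h1

def gtErr (n : ℕ) (ε : ℝ) : ℝ := 96 * ε + 32 * ε * (1 + (n : ℝ) ^ 4) + 10 * √ε * (n : ℝ) ^ 3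

/-- averaged bound for a near-maximal form -/
lemma NearMax.g3 {V : P →ₗ[ℂ] Q →ₗ[ℂ] ℂ} {ε : ℝ} (h : NearMax V ε) (hε : 0 < ε) (hε1 : ε ≤ 1)
    {n : ℕ} (p : (Fin n → Bool) → P) (hp : ∀ ω, IsSelfAdjoint (p ω)) (hp4 : ∀ ω, ‖p ω‖ ≤ 4)
    (k : Fin n → Q) (hk : ∀ j, IsSelfAdjoint (k j)) (hk1 : ∑ j, k j * k j ≤ 1) :
    ∑ ω, ‖V (p ω) (radSum k ω)‖ ≤ 2 ^ n * (4 * (140 + gtErr n ε)) := by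
  have hb : ∀ ω, ‖V (p ω) (radSum k ω)‖ ≤ 4 * (44 + 32 * (V 1 ((radSum k ω) ^ 4)).re +
      (32 * ε * (1 + (n : ℝ) ^ 4) + 10 * √ε * (n : ℝ) ^ 3)) := by
    intro ω
    have h1 := h.g2 hε hε1 (x := (4⁻¹ : ℝ) • p ω)
      (IsSelfAdjoint.smul (by simp [IsSelfAdjoint]) (hp ω))
      (by rw [norm_smul]; norm_num; linarith [hp4 ω]) (radSum_sa hk ω)
      (norm_radSum_le k (norm_le_of_sum_sq hk hk1) ω)
    rw [← Complex.coe_smul, map_smul, LinearMap.smul_apply, norm_smul] at h1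
    norm_num at h1
    linarith
  have h3 : (∑ ω, (V 1 ((radSum k ω) ^ 4)).re) ≤ 2 ^ n * (3 + 3 * ε) := by
    have h4 := fourth_moment_le k hk hk1
    have hnn : 0 ≤ ∑ ω, (radSum k ω) ^ 4 := Finset.sum_nonneg fun ω _ => by
      have := sa_mul_self_nonneg ((radSum_sa hk ω).pow 2)
      rwa [← pow_add] at this
    have h5 := h.psi_ge (sub_nonneg.2 h4) (r := 2 ^ n * 3) (by positivity) (by
      refine (CStarAlgebra.norm_le_norm_of_nonneg_of_le (sub_nonneg.2 h4) (sub_le_self _ hnn)).trans ?_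
      rw [norm_smul, norm_smul]
      rcases subsingleton_or_nontrivial Q with hs | hs
      · rw [Subsingleton.elim (1 : Q) 0, norm_zero]; simp
      · rw [CStarRing.norm_one]; simp)
    have hV1 : (V 1 1).re ≤ 1 := (Complex.re_le_norm _).trans (h.avg NearMax.one_avg NearMax.one_avg)
    rw [← Complex.coe_smul, ← Complex.coe_smul (3 : ℝ)] at h5
    simp only [map_sub, map_smul, map_sum, smul_eq_mul, Complex.sub_re, Complex.re_ofReal_mul,
      Complex.re_sum] at h5
    have : (2 : ℝ) ^ n * (3 * (V 1 1).re) ≤ 2 ^ n * (3 * 1) := by gcongr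
    linarith
  refine (Finset.sum_le_sum fun ω _ => hb ω).trans ?_
  have hc : ∀ c : ℝ, ∑ ω : Fin n → Bool, c = 2 ^ n * c := by intro c; simp
  rw [← Finset.mul_sum, Finset.sum_add_distrib, Finset.sum_add_distrib, ← Finset.mul_sum, hc, hc]
  unfold gtErr
  linarith

lemma re_im_parts (z : Q) : ∃ k l : Q, IsSelfAdjoint k ∧ IsSelfAdjoint l ∧ z = k + Complex.I • l ∧
    ‖k‖ ≤ ‖z‖ ∧ ‖l‖ ≤ ‖z‖ ∧ k * k + l * l = (2⁻¹ : ℝ) • (star z * z + z * star z) := by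
  refine ⟨(realPart z : Q), (imaginaryPart z : Q), (realPart z).2, (imaginaryPart z).2,
    (realPart_add_I_smul_imaginaryPart z).symm, ?_, ?_, ?_⟩
  · rw [realPart_apply_coe, norm_smul]
    have := norm_add_le z (star z)
    rw [norm_star] at this
    norm_num; linarith
  · rw [imaginaryPart_apply_coe, norm_smul, norm_smul]
    have := norm_sub_le z (star z)
    rw [norm_star] at this
    norm_num; linarith
  · rw [realPart_apply_coe, imaginaryPart_apply_coe]
    simp only [← Complex.coe_smul, smul_mul_smul_comm, smul_smul, mul_add, add_mul, mul_sub, sub_mul]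
    simp only [smul_add, smul_sub, smul_smul]
    have e1 : (-Complex.I * ((2⁻¹ : ℝ) : ℂ) * (-Complex.I * ((2⁻¹ : ℝ) : ℂ))) = -(((2⁻¹:ℝ):ℂ) * ((2⁻¹:ℝ):ℂ)) := by
      linear_combination (((2⁻¹ : ℝ) : ℂ) * ((2⁻¹ : ℝ) : ℂ)) * Complex.I_mul_I
    have e2 : (((2⁻¹:ℝ):ℂ)) = (((2⁻¹:ℝ):ℂ) * ((2⁻¹:ℝ):ℂ)) + (((2⁻¹:ℝ):ℂ) * ((2⁻¹:ℝ):ℂ)) := by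
      push_cast; norm_num
    simp only [e1, neg_smul]
    conv_rhs => rw [e2]
    simp only [add_smul]
    abel

/-- the one-step improvement -/
lemma gt_step (U : P →ₗ[ℂ] Q →ₗ[ℂ] ℂ)
    (H : ∀ ε : ℝ, 0 < ε → ∃ (θ : ℂ) (u : unitary P) (v : unitary Q), ‖θ‖ = 1 ∧
      NearMax (LinearMap.mk₂ ℂ (fun x y => θ * U ((u : P) * x) ((v : Q) * y))
        (by intros; simp [mul_add]) (by intros; simp; ring) (by intros; simp [mul_add])
        (by intros; simp; ring)) ε)
    {n : ℕ} {c : ℝ}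
    (hc : ∀ (x : Fin n → P) (y : Fin n → Q), (∀ j, IsSelfAdjoint (x j)) → (∀ j, IsSelfAdjoint (y j)) →
      ∑ j, x j * x j ≤ 1 → ∑ j, y j * y j ≤ 1 → ‖∑ j, U (x j) (y j)‖ ≤ c)
    (x : Fin n → P) (y : Fin n → Q) (hx : ∀ j, IsSelfAdjoint (x j)) (hy : ∀ j, IsSelfAdjoint (y j))
    (hx1 : ∑ j, x j * x j ≤ 1) (hy1 : ∑ j, y j * y j ≤ 1) : ‖∑ j, U (x j) (y j)‖ ≤ 2241 + c / 2 := by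
  set S := radSum x with hS
  set Y := radSum y with hY
  set cl : ℝ → ℝ := fun t => max (-4) (min 4 t) with hcl
  have hclc : Continuous cl := by rw [hcl]; fun_prop
  set h : (Fin n → Bool) → P := fun ω => cfc cl (S ω) with hh
  have hSs : ∀ ω, IsSelfAdjoint (S ω) := radSum_sa hx
  have hsa : ∀ ω, IsSelfAdjoint (h ω) := fun ω => cfc_predicate _ _
  have h4 : ∀ ω, ‖h ω‖ ≤ 4 := fun ω => norm_cfc_le (by norm_num) fun t _ => by
    rw [Real.norm_eq_abs, abs_le]
    exact ⟨le_max_left _ _, max_le (by norm_num) (min_le_left _ _)⟩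
  have hN : (0 : ℝ) < 2 ^ n := by positivity
  -- decomposition
  have e0 : ∑ ω, U (S ω) (Y ω) = (2 : ℝ) ^ n • ∑ j, U (x j) (y j) := by
    have := radSum_bilin (toRealBilin U) x y
    simpa [toRealBilin] using this
  set x' : Fin n → P := fun j => ((2 : ℝ) ^ n)⁻¹ • ∑ ω, sgn ω j • (S ω - h ω) with hx'
  have hx'e : ∀ j, (2 : ℝ) ^ n • x' j = ∑ ω, sgn ω j • (S ω - h ω) := by
    intro j; rw [hx', smul_smul, mul_inv_cancel₀ hN.ne', one_smul]
  have e1 : ∑ ω, U (S ω - h ω) (Y ω) = (2 : ℝ) ^ n • ∑ j, U (x' j) (y j) := by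
    have l : ∀ (a : P) (r : ℝ) (b : Q), U (r • a) b = (r : ℂ) * U a b := by
      intro a r b; rw [← Complex.coe_smul, map_smul]; simp
    have l2 : ∀ (a : P) (r : ℝ) (b : Q), U a (r • b) = (r : ℂ) * U a b := by
      intro a r b; rw [← Complex.coe_smul, map_smul]; simp
    rw [Finset.smul_sum]
    have : ∀ j, (2 : ℝ) ^ n • U (x' j) (y j) = ∑ ω, U (S ω - h ω) (sgn ω j • y j) := by
      intro j
      rw [Complex.real_smul, ← l, hx'e, map_sum, LinearMap.sum_apply]
      refine Finset.sum_congr rfl fun ω _ => ?_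
      rw [l, l2]
    simp only [this]
    rw [Finset.sum_comm]
    refine Finset.sum_congr rfl fun ω _ => ?_
    rw [hY, radSum, map_sum]
  -- second term
  have hrem : ∀ ω, IsSelfAdjoint (S ω - h ω) := fun ω => (hSs ω).sub (hsa ω)
  have hb := bessel (fun ω => S ω - h ω) hrem x' hx'e
  have hrb : ∀ ω, (S ω - h ω) * (S ω - h ω) ≤ (16⁻¹ : ℝ) • (S ω) ^ 4 := by
    intro ω
    have e : S ω - h ω = cfc (fun t => t - cl t) (S ω) := by
      rw [cfc_sub _ _ _ (by fun_prop) hclc.continuousOn, cfc_id' ℝ (S ω)]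
    have hc1 : ContinuousOn (fun t => t - cl t) (spectrum ℝ (S ω)) := by
      exact (continuous_id.sub hclc).continuousOn
    rw [e, ← cfc_mul _ _ _ hc1 hc1, NearMax.pow4_sa (hSs ω), ← cfc_const_mul ..]
    apply cfc_mono _ (hc1.mul hc1) (by fun_prop)
    intro t _
    change (t - max (-4) (min 4 t)) * (t - max (-4) (min 4 t)) ≤ 16⁻¹ * t ^ 4
    rcases le_total t (-4) with h | h
    · rw [min_eq_right (by linarith), max_eq_left h]
      nlinarith [sq_nonneg (t*t - 16), mul_self_nonneg t]
    rcases le_total t 4 with h2 | h2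
    · rw [min_eq_right (by linarith), max_eq_right h]
      have : 0 ≤ t ^ 4 := by positivity
      nlinarith
    · rw [min_eq_left (by linarith), max_eq_right (by linarith)]
      nlinarith [sq_nonneg (t*t - 16), mul_self_nonneg t]
  have hb2 : ∑ j, x' j * x' j ≤ (16⁻¹ * 3 : ℝ) • (1 : P) := by
    have h1 : (2 : ℝ) ^ n • ∑ j, x' j * x' j ≤ (2 : ℝ) ^ n • ((16⁻¹ * 3 : ℝ) • (1 : P)) := by
      refine hb.trans ((Finset.sum_le_sum fun ω _ => hrb ω).trans ?_)
      rw [← Finset.smul_sum, mul_smul, smul_comm ((2 : ℝ) ^ n)]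
      exact smul_le_smul_of_nonneg_left (fourth_moment_le x hx hx1) (by norm_num)
    exact le_of_smul_le_smul_left h1 hN
  have hx's : ∀ j, IsSelfAdjoint (x' j) := by
    intro j
    refine IsSelfAdjoint.smul (by simp [IsSelfAdjoint]) (isSelfAdjoint_sum _ fun ω _ => ?_)
    exact IsSelfAdjoint.smul (by simp [IsSelfAdjoint]) (hrem ω)
  have ht2 : ‖∑ j, U (x' j) (y j)‖ ≤ c / 2 := by
    have := hc (fun j => (2 : ℝ) • x' j) y
      (fun j => IsSelfAdjoint.smul (by simp [IsSelfAdjoint]) (hx's j)) hy (by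
        simp only [smul_mul_smul_comm]
        rw [← Finset.smul_sum]
        calc _ ≤ (2 * 2 : ℝ) • ((16⁻¹ * 3 : ℝ) • (1 : P)) := smul_le_smul_of_nonneg_left hb2 (by norm_num)
          _ = (3 / 4 : ℝ) • (1 : P) := by rw [smul_smul]; norm_num
          _ ≤ (1 : ℝ) • (1 : P) := smul_le_smul_of_nonneg_right (by norm_num) zero_le_one
          _ = 1 := one_smul _ _) hy1
    have e : ∑ j, U ((2 : ℝ) • x' j) (y j) = 2 * ∑ j, U (x' j) (y j) := by
      rw [Finset.mul_sum]
      refine Finset.sum_congr rfl fun j _ => ?_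
      rw [← Complex.coe_smul, map_smul]; simp
    rw [e, norm_mul] at this
    norm_num at this
    linarith
  -- first term
  obtain ⟨ε, hε, hε1, hεe⟩ : ∃ ε : ℝ, 0 < ε ∧ ε ≤ 1 ∧ gtErr n ε ≤ 1 / 16 := by
    have hcont : Continuous (gtErr n) := by unfold gtErr; fun_prop
    have h0 : gtErr n 0 = 0 := by simp [gtErr]
    have := hcont.tendsto 0
    rw [h0] at this
    have h1 := (this.eventually_lt_const (show (0 : ℝ) < 1 / 16 by norm_num)).filter_mono
      (nhdsWithin_le_nhds (s := Set.Ioi 0))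
    have h2 : ∀ᶠ e : ℝ in nhdsWithin 0 (Set.Ioi 0), e < 1 :=
      (eventually_lt_nhds (show (0 : ℝ) < 1 by norm_num)).filter_mono nhdsWithin_le_nhds
    obtain ⟨ε, h3, h4, h5⟩ := (h1.and (h2.and self_mem_nhdsWithin)).exists
    exact ⟨ε, h5, h4.le, h3.le⟩
  obtain ⟨θ, u, v, hθ, hV⟩ := H ε hε
  set V := (LinearMap.mk₂ ℂ (fun x y => θ * U ((u : P) * x) ((v : Q) * y))
        (by intros; simp [mul_add]) (by intros; simp; ring) (by intros; simp [mul_add])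
        (by intros; simp; ring)) with hVdef
  have hUV : ∀ a b, ‖U a b‖ = ‖V (star (u : P) * a) (star (v : Q) * b)‖ := by
    intro a b
    rw [hVdef, LinearMap.mk₂_apply, norm_mul, hθ, one_mul, ← mul_assoc, ← mul_assoc,
      Unitary.mul_star_self_of_mem u.2, Unitary.mul_star_self_of_mem v.2, one_mul, one_mul]
  have ht1 : ∑ ω, ‖U (h ω) (Y ω)‖ ≤ 2 ^ n * 2241 := by
    choose p p' hp hp' hpe hpn hpn' _ using fun ω => re_im_parts (star (u : P) * h ω)
    choose k k' hk hk' hke _ _ hks using fun j => re_im_parts (star (v : Q) * y j)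
    have hun : ∀ ω, ‖star (u : P) * h ω‖ ≤ 4 := by
      intro ω
      have hh := CStarRing.norm_coe_unitary_mul (star u) (h ω)
      rw [Unitary.coe_star] at hh
      rw [hh]; exact h4 ω
    have hkk : ∑ j, (k j * k j + k' j * k' j) ≤ 1 := by
      simp only [hks, star_mul, star_star]
      have e : ∀ j, star (y j) * (v : Q) * (star (v : Q) * y j) + star (v : Q) * y j * (star (y j) * v)
          = y j * y j + star (v : Q) * (y j * y j) * v := by
        intro j
        rw [(hy j).star_eq]
        congr 1
        · rw [mul_assoc, ← mul_assoc (v : Q), Unitary.mul_star_self_of_mem v.2, one_mul]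
        · noncomm_ring
      simp only [e]
      rw [← Finset.smul_sum, Finset.sum_add_distrib, ← Finset.sum_mul, ← Finset.mul_sum]
      have h1 := star_left_conjugate_le_conjugate hy1 (v : Q)
      rw [mul_one, Unitary.star_mul_self_of_mem v.2] at h1
      calc _ ≤ (2⁻¹ : ℝ) • ((1 : Q) + 1) := smul_le_smul_of_nonneg_left (add_le_add hy1 h1) (by norm_num)
        _ = 1 := by rw [← two_smul ℝ (1 : Q), smul_smul]; norm_num
    rw [Finset.sum_add_distrib] at hkk
    have hk1 : ∑ j, k j * k j ≤ 1 := le_trans (le_add_of_nonneg_right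
      (Finset.sum_nonneg fun j _ => sa_mul_self_nonneg (hk' j))) hkk
    have hk'1 : ∑ j, k' j * k' j ≤ 1 := le_trans (le_add_of_nonneg_left
      (Finset.sum_nonneg fun j _ => sa_mul_self_nonneg (hk j))) hkk
    have hYe : ∀ ω, star (v : Q) * Y ω = radSum k ω + Complex.I • radSum k' ω := by
      intro ω
      simp only [hY, radSum, Finset.mul_sum, mul_smul_comm, hke, smul_add, Finset.sum_add_distrib,
        Finset.smul_sum]
      congr 1
      refine Finset.sum_congr rfl fun j _ => smul_comm _ _ _
    have b1 := hV.g3 hε hε1 p hp (fun ω => (hpn ω).trans (hun ω)) k hk hk1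
    have b2 := hV.g3 hε hε1 p hp (fun ω => (hpn ω).trans (hun ω)) k' hk' hk'1
    have b3 := hV.g3 hε hε1 p' hp' (fun ω => (hpn' ω).trans (hun ω)) k hk hk1
    have b4 := hV.g3 hε hε1 p' hp' (fun ω => (hpn' ω).trans (hun ω)) k' hk' hk'1
    have hb : ∀ ω, ‖U (h ω) (Y ω)‖ ≤ ‖V (p ω) (radSum k ω)‖ + ‖V (p ω) (radSum k' ω)‖
        + ‖V (p' ω) (radSum k ω)‖ + ‖V (p' ω) (radSum k' ω)‖ := by
      intro ω
      rw [hUV, hYe, hpe]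
      simp only [map_add, map_smul, LinearMap.add_apply, LinearMap.smul_apply]
      have nI : ∀ z : ℂ, ‖Complex.I • z‖ = ‖z‖ := by intro z; simp
      refine (norm_add_le _ _).trans (le_trans (add_le_add (norm_add_le _ _) ((nI _).trans_le (norm_add_le _ _))) ?_)
      simp only [nI]
      linarith
    refine (Finset.sum_le_sum fun ω _ => hb ω).trans ?_
    simp only [Finset.sum_add_distrib]
    have : (2 : ℝ) ^ n * (4 * (140 + gtErr n ε)) ≤ 2 ^ n * (4 * (140 + 1 / 16)) := by gcongr
    linarith
  have e2 : (2 : ℝ) ^ n • ∑ j, U (x j) (y j) = ∑ ω, U (h ω) (Y ω) + (2 : ℝ) ^ n • ∑ j, U (x' j) (y j) := by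
    rw [← e0, ← e1, ← Finset.sum_add_distrib]
    refine Finset.sum_congr rfl fun ω _ => ?_
    rw [map_sub, LinearMap.sub_apply]; ring
  have e3 : 2 ^ n * ‖∑ j, U (x j) (y j)‖ ≤ 2 ^ n * 2241 + 2 ^ n * (c / 2) := by
    have := congrArg norm e2
    rw [norm_smul, Real.norm_of_nonneg hN.le] at this
    rw [this]
    refine (norm_add_le _ _).trans (add_le_add ((norm_sum_le _ _).trans ht1) ?_)
    rw [norm_smul, Real.norm_of_nonneg hN.le]
    gcongr
  rw [← mul_add] at e3
  exact le_of_mul_le_mul_left e3 hN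
end GT
end

section
section GT
variable {P Q : Type*} [CStarAlgebra P] [CStarAlgebra Q]

lemma avg_scaled {U : P →ₗ[ℂ] Q →ₗ[ℂ] ℂ} {s : ℝ} (h : ∀ (u : unitary P) (v : unitary Q), ‖U u v‖ ≤ s)
    {x : P} {y : Q} (hx : IsAvgUnitary x) (hy : IsAvgUnitary y) : ‖U x y‖ ≤ s := by
  obtain ⟨u, w, hx⟩ := hx
  obtain ⟨u', w', hy⟩ := hy
  have e : (4 : ℂ) * U x y = U u u' + U u w' + U w u' + U w w' := by
    have : U ((2 : ℂ) • x) ((2 : ℂ) • y) = U u u' + U u w' + U w u' + U w w' := by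
      rw [← hx, ← hy]; simp only [map_add, LinearMap.add_apply]; ring
    rw [← this]; simp; ring
  have h1 := congrArg norm e
  rw [norm_mul] at h1
  have h2 := norm_add_le (U u u' + U u w' + U w u') (U w w')
  have h3 := norm_add_le (U u u' + U u w') (U w u')
  have h4 := norm_add_le (U u u') (U u w')
  have := h u u'; have := h u w'; have := h w u'; have := h w w'
  norm_num at h1
  linarith

variable [PartialOrder P] [StarOrderedRing P] [PartialOrder Q] [StarOrderedRing Q]

lemma gt_norm (U : P →ₗ[ℂ] Q →ₗ[ℂ] ℂ) (hU : ∀ (u : unitary P) (v : unitary Q), ‖U u v‖ ≤ 1)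
    (H : ∀ ε : ℝ, 0 < ε → ∃ (θ : ℂ) (u : unitary P) (v : unitary Q), ‖θ‖ = 1 ∧
      NearMax (LinearMap.mk₂ ℂ (fun x y => θ * U ((u : P) * x) ((v : Q) * y))
        (by intros; simp [mul_add]) (by intros; simp; ring) (by intros; simp [mul_add])
        (by intros; simp; ring)) ε)
    {n : ℕ} (x : Fin n → P) (y : Fin n → Q) (hx : ∀ j, IsSelfAdjoint (x j))
    (hy : ∀ j, IsSelfAdjoint (y j))
    (hx1 : ∑ j, x j * x j ≤ 1) (hy1 : ∑ j, y j * y j ≤ 1) : ‖∑ j, U (x j) (y j)‖ ≤ 4482 := by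
  set T : Set ℝ := {r | ∃ (x : Fin n → P) (y : Fin n → Q), (∀ j, IsSelfAdjoint (x j)) ∧
    (∀ j, IsSelfAdjoint (y j)) ∧ ∑ j, x j * x j ≤ 1 ∧ ∑ j, y j * y j ≤ 1 ∧
      r = ‖∑ j, U (x j) (y j)‖} with hT
  have hbdd : BddAbove T := by
    refine ⟨n, ?_⟩
    rintro r ⟨x, y, hx, hy, hx1, hy1, rfl⟩
    refine (norm_sum_le _ _).trans ((Finset.sum_le_sum (g := fun _ => (1 : ℝ)) fun j _ => ?_).trans (by simp))
    exact avg_scaled hU (isAvgUnitary_of_sa (hx j) (norm_le_of_sum_sq hx hx1 j))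
      (isAvgUnitary_of_sa (hy j) (norm_le_of_sum_sq hy hy1 j))
  have hle : ∀ r ∈ T, r ≤ 2241 + sSup T / 2 := by
    rintro r ⟨x, y, hx, hy, hx1, hy1, rfl⟩
    exact gt_step U H (fun x y hx hy hx1 hy1 => le_csSup hbdd ⟨x, y, hx, hy, hx1, hy1, rfl⟩)
      x y hx hy hx1 hy1
  have hmem : ‖∑ j, U (x j) (y j)‖ ∈ T := ⟨x, y, hx, hy, hx1, hy1, rfl⟩
  have h1 := csSup_le ⟨_, hmem⟩ hle
  have h2 := le_csSup hbdd hmem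
  linarith

/-- Non-commutative Grothendieck inequality, self-adjoint tuples. -/
theorem gt_sa (U : P →ₗ[ℂ] Q →ₗ[ℂ] ℂ) (hU : ∀ (u : unitary P) (v : unitary Q), ‖U u v‖ ≤ 1)
    {n : ℕ} (x : Fin n → P) (y : Fin n → Q) (hx : ∀ j, IsSelfAdjoint (x j))
    (hy : ∀ j, IsSelfAdjoint (y j))
    (hx1 : ∑ j, x j * x j ≤ 1) (hy1 : ∑ j, y j * y j ≤ 1) : ‖∑ j, U (x j) (y j)‖ ≤ 4482 := by
  set T : Set ℝ := {r | ∃ (u : unitary P) (v : unitary Q), r = ‖U u v‖} with hT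
  have hbdd : BddAbove T := ⟨1, by rintro r ⟨u, v, rfl⟩; exact hU u v⟩
  have hne : T.Nonempty := ⟨_, 1, 1, rfl⟩
  set s := sSup T with hs
  have hub : ∀ u v, ‖U (u : unitary P) (v : unitary Q)‖ ≤ s := fun u v => le_csSup hbdd ⟨u, v, rfl⟩
  have hs1 : s ≤ 1 := csSup_le hne (by rintro r ⟨u, v, rfl⟩; exact hU u v)
  have hs0 : 0 ≤ s := (norm_nonneg _).trans (hub 1 1)
  rcases hs0.eq_or_lt with h0 | h0
  · have : ∀ j, U (x j) (y j) = 0 := by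
      intro j
      have := avg_scaled hub (isAvgUnitary_of_sa (hx j) (norm_le_of_sum_sq hx hx1 j))
        (isAvgUnitary_of_sa (hy j) (norm_le_of_sum_sq hy hy1 j))
      rw [← h0] at this
      exact norm_le_zero_iff.1 this
    simp [this]
  · have hsn : ‖((s⁻¹ : ℝ) : ℂ)‖ = s⁻¹ := by rw [Complex.norm_real, Real.norm_of_nonneg (by positivity)]
    have hU' : ∀ (u : unitary P) (v : unitary Q), ‖(((s⁻¹ : ℝ) : ℂ) • U) u v‖ ≤ 1 := by
      intro u v
      rw [LinearMap.smul_apply, LinearMap.smul_apply, norm_smul, hsn, inv_mul_le_iff₀ h0, mul_one]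
      exact hub u v
    have key := gt_norm (((s⁻¹ : ℝ) : ℂ) • U) hU' (by
      intro ε hε
      obtain ⟨r, ⟨u, v, rfl⟩, hr⟩ := exists_lt_of_lt_csSup hne (show s * (1 - ε) < sSup T by
        rw [← hs]; nlinarith)
      obtain ⟨θ, hθ, hθe⟩ := RCLike.exists_norm_eq_mul_self ((((s⁻¹ : ℝ) : ℂ) • U) u v)
      refine ⟨θ, u, v, hθ, ?_, ?_⟩
      · intro u' v'
        rw [LinearMap.mk₂_apply, norm_mul, hθ, one_mul]
        exact hU' (u * u') (v * v')
      · rw [LinearMap.mk₂_apply, mul_one, mul_one, ← hθe]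
        rw [LinearMap.smul_apply, LinearMap.smul_apply, norm_smul, hsn]
        simp only [Complex.coe_algebraMap, Complex.ofReal_re]
        have : s⁻¹ * (s * (1 - ε)) ≤ s⁻¹ * ‖U u v‖ := by gcongr
        rwa [← mul_assoc, inv_mul_cancel₀ h0.ne', one_mul] at this) x y hx hy hx1 hy1
    simp only [LinearMap.smul_apply, ← Finset.smul_sum] at key
    rw [norm_smul, hsn, inv_mul_le_iff₀ h0] at key
    nlinarith

lemma re_im_tuple {ι : Type*} [Fintype ι] (a : ι → P) (h1 : ∑ i, star (a i) * a i ≤ 1)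
    (h2 : ∑ i, a i * star (a i) ≤ 1) : ∃ k l : ι → P, (∀ i, IsSelfAdjoint (k i)) ∧
      (∀ i, IsSelfAdjoint (l i)) ∧ (∀ i, a i = k i + Complex.I • l i) ∧ ∑ i, k i * k i ≤ 1 ∧
      ∑ i, l i * l i ≤ 1 := by
  choose k l hk hl he _ _ hs using fun i => re_im_parts (a i)
  have hkk : ∑ j, (k j * k j + l j * l j) ≤ 1 := by
    simp only [hs]
    rw [← Finset.smul_sum, Finset.sum_add_distrib]
    calc _ ≤ (2⁻¹ : ℝ) • ((1 : P) + 1) := smul_le_smul_of_nonneg_left (add_le_add h1 h2) (by norm_num)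
      _ = 1 := by rw [← two_smul ℝ (1 : P), smul_smul]; norm_num
  rw [Finset.sum_add_distrib] at hkk
  exact ⟨k, l, hk, hl, he, le_trans (le_add_of_nonneg_right
      (Finset.sum_nonneg fun j _ => sa_mul_self_nonneg (hl j))) hkk, le_trans (le_add_of_nonneg_left
      (Finset.sum_nonneg fun j _ => sa_mul_self_nonneg (hk j))) hkk⟩

lemma gt_sa_fintype (U : P →ₗ[ℂ] Q →ₗ[ℂ] ℂ) (hU : ∀ (u : unitary P) (v : unitary Q), ‖U u v‖ ≤ 1)
    {ι : Type*} [Fintype ι] (x : ι → P) (y : ι → Q) (hx : ∀ j, IsSelfAdjoint (x j))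
    (hy : ∀ j, IsSelfAdjoint (y j))
    (hx1 : ∑ j, x j * x j ≤ 1) (hy1 : ∑ j, y j * y j ≤ 1) : ‖∑ j, U (x j) (y j)‖ ≤ 4482 := by
  set e := (Fintype.equivFin ι).symm
  have := gt_sa U hU (fun i => x (e i)) (fun i => y (e i)) (fun _ => hx _) (fun _ => hy _)
    (by rw [e.sum_comp (fun j => x j * x j)]; exact hx1) (by rw [e.sum_comp (fun j => y j * y j)]; exact hy1)
  rwa [e.sum_comp (fun j => U (x j) (y j))] at this

/-- Non-commutative Grothendieck inequality, general tuples. -/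
theorem gt_cplx (U : P →ₗ[ℂ] Q →ₗ[ℂ] ℂ) (hU : ∀ (u : unitary P) (v : unitary Q), ‖U u v‖ ≤ 1)
    {ι : Type*} [Fintype ι] (a : ι → P) (b : ι → Q) (ha1 : ∑ i, star (a i) * a i ≤ 1)
    (ha2 : ∑ i, a i * star (a i) ≤ 1) (hb1 : ∑ i, star (b i) * b i ≤ 1)
    (hb2 : ∑ i, b i * star (b i) ≤ 1) : ‖∑ i, U (a i) (b i)‖ ≤ 17928 := by
  obtain ⟨k, l, hk, hl, he, hk1, hl1⟩ := re_im_tuple a ha1 ha2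
  obtain ⟨k', l', hk', hl', he', hk1', hl1'⟩ := re_im_tuple b hb1 hb2
  have b1 := gt_sa_fintype U hU k k' hk hk' hk1 hk1'
  have b2 := gt_sa_fintype U hU k l' hk hl' hk1 hl1'
  have b3 := gt_sa_fintype U hU l k' hl hk' hl1 hk1'
  have b4 := gt_sa_fintype U hU l l' hl hl' hl1 hl1'
  have nI : ∀ z : ℂ, ‖Complex.I • z‖ = ‖z‖ := by intro z; simp
  simp only [he, he', map_add, map_smul, LinearMap.add_apply, LinearMap.smul_apply,
    Finset.sum_add_distrib, ← Finset.smul_sum]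
  refine (norm_add_le _ _).trans (le_trans (add_le_add (norm_add_le _ _) ((nI _).trans_le (norm_add_le _ _))) ?_)
  simp only [nI]
  linarith
end GT
end

section
section Banach
variable {Y : Type*} [NonUnitalNormedRing Y] [CompleteSpace Y]

lemma exists_quasi_inv (x : Y) (hx : ‖x‖ < 1) : ∃ y : Y, y = x + y * x := by
  have hc : ContractingWith ‖x‖₊ (fun y : Y => x + y * x) := by
    refine ⟨by exact_mod_cast hx, LipschitzWith.of_dist_le_mul fun a b => ?_⟩
    rw [dist_eq_norm, dist_eq_norm, add_sub_add_left_eq_sub, ← sub_mul, mul_comm]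
    exact norm_mul_le _ _
  haveI : Nonempty Y := ⟨0⟩
  exact ⟨hc.fixedPoint, hc.fixedPoint_isFixedPt.symm⟩

/-- relative unit stays at distance ≥ 1 from a proper modular ideal -/
lemma TwoSidedIdeal.univ_of_near (K : TwoSidedIdeal Y) {e : Y}
    (he : ∀ x, x * e - x ∈ K ∧ e * x - x ∈ K) {m : Y} (hm : m ∈ K) (h : ‖e - m‖ < 1) :
    (K : Set Y) = Set.univ := by
  obtain ⟨y, hy⟩ := exists_quasi_inv (e - m) h
  have h1 : y * e - y ∈ K := (he y).1
  have h2 : y * m ∈ K := K.mul_mem_left _ _ hm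
  have h3 : e - m ∈ K := by
    have : e - m = -(y * e - y) + y * m := by
      nth_rewrite 1 [show e - m = y - y * (e - m) from by nth_rewrite 1 [hy]; abel]
      rw [mul_sub]; abel
    rw [this]; exact K.add_mem (K.neg_mem h1) h2
  have h4 : e ∈ K := by simpa using K.add_mem h3 hm
  rw [Set.eq_univ_iff_forall]
  intro x
  have := K.sub_mem (K.mul_mem_right _ x h4) (he x).2
  simpa using this

/-- closure of a two-sided ideal -/
def TwoSidedIdeal.clo (K : TwoSidedIdeal Y) : TwoSidedIdeal Y :=
  TwoSidedIdeal.mk' (closure (K : Set Y)) (subset_closure K.zero_mem)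
    (fun {x y} hx hy => map_mem_closure₂ continuous_add hx hy fun a ha b hb => K.add_mem ha hb)
    (fun {x} hx => map_mem_closure continuous_neg hx fun a ha => K.neg_mem ha)
    (fun {x y} hy => map_mem_closure (continuous_const_mul x) hy fun a ha => K.mul_mem_left _ _ ha)
    (fun {x y} hx => map_mem_closure (f := fun z => z * y) (continuous_mul_const y) hx fun a ha => K.mul_mem_right _ _ ha)

lemma TwoSidedIdeal.coe_clo (K : TwoSidedIdeal Y) : (K.clo : Set Y) = closure (K : Set Y) := by
  unfold TwoSidedIdeal.clo; ext x; simp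

lemma TwoSidedIdeal.mem_clo (K : TwoSidedIdeal Y) (x : Y) : x ∈ K.clo ↔ x ∈ closure (K : Set Y) := by
  rw [← K.coe_clo]; rfl

lemma TwoSidedIdeal.clo_ne_univ (K : TwoSidedIdeal Y) {e : Y}
    (he : ∀ x, x * e - x ∈ K ∧ e * x - x ∈ K) (hK : (K : Set Y) ≠ Set.univ) :
    closure (K : Set Y) ≠ Set.univ := by
  intro h
  have : e ∈ closure (K : Set Y) := by rw [h]; trivial
  rw [Metric.mem_closure_iff] at this
  obtain ⟨m, hm, hd⟩ := this 1 one_pos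
  rw [dist_eq_norm] at hd
  exact hK (K.univ_of_near he hm hd)

lemma IsMaximalModularIdeal.isClosed {Y : Type u} [NonUnitalNormedRing Y] [CompleteSpace Y]
    {K : TwoSidedIdeal Y} (h : IsMaximalModularIdeal K) :
    IsClosed (K : Set Y) := by
  obtain ⟨⟨e, he⟩, hp, hm⟩ := h
  have h1 := K.clo_ne_univ he hp
  rcases hm K.clo (by rw [K.coe_clo]; exact subset_closure) with h2 | h2
  · rw [← h2, K.coe_clo]; exact isClosed_closure
  · rw [K.coe_clo] at h2; exact absurd h2 h1

lemma modular_smul_mem {Y : Type*} [NonUnitalNormedRing Y] [NormedSpace ℂ Y] [IsScalarTower ℂ Y Y]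
    [SMulCommClass ℂ Y Y] {K : TwoSidedIdeal Y} {e : Y}
    (he : ∀ x, x * e - x ∈ K ∧ e * x - x ∈ K) (c : ℂ) {x : Y} (hx : x ∈ K) : c • x ∈ K := by
  have h1 := (he (c • x)).2
  have h2 : (c • e) * x ∈ K := K.mul_mem_left _ _ hx
  rw [mul_smul_comm, ← smul_mul_assoc] at h1
  have := K.sub_mem h2 h1
  simpa using this
end Banach

section ApproxUnit
variable {A : Type*} [NonUnitalCStarAlgebra A]

lemma norm_one_sub_inr_le {u : A} (hu : IsSelfAdjoint u) (h0 : ∀ t ∈ quasispectrum ℝ u, 0 ≤ t ∧ t ≤ 1) :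
    ‖(1 : Unitization ℂ A) - (u : Unitization ℂ A)‖ ≤ 1 := by
  have hs : IsSelfAdjoint (u : Unitization ℂ A) := (Unitization.isSelfAdjoint_inr (R := ℂ)).2 hu
  have : (1 : Unitization ℂ A) - (u : Unitization ℂ A) = cfc (fun t : ℝ => 1 - t) (u : Unitization ℂ A) := by
    rw [cfc_sub .., cfc_const_one ℝ _, cfc_id' ℝ _]
  rw [this]
  apply norm_cfc_le zero_le_one
  intro t ht
  have ht' : t ∈ quasispectrum ℝ u := by
    rw [Unitization.quasispectrum_eq_spectrum_inr' ℝ ℂ]; exact ht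
  rw [Real.norm_eq_abs, abs_le]
  constructor <;> linarith [(h0 t ht').1, (h0 t ht').2]

structure IsUnitInterval (u : A) : Prop where
  sa : IsSelfAdjoint u
  sp : ∀ t ∈ quasispectrum ℝ u, 0 ≤ t ∧ t ≤ 1

lemma IsUnitInterval.norm_le {u : A} (h : IsUnitInterval u) : ‖u‖ ≤ 1 := by
  have : u = cfcₙ (fun t : ℝ => t) u := (cfcₙ_id' ℝ u h.sa).symm
  rw [this]
  apply norm_cfcₙ_le
  intro t ht
  rw [Real.norm_of_nonneg (h.sp t ht).1]; exact (h.sp t ht).2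

lemma IsUnitInterval.norm_sub_mul {u : A} (h : IsUnitInterval u) (y : A) : ‖y - y * u‖ ≤ ‖y‖ := by
  rw [← Unitization.norm_inr (𝕜 := ℂ) (a := y - y * u), ← Unitization.norm_inr (𝕜 := ℂ) (a := y)]
  have : ((y - y * u : A) : Unitization ℂ A) = (y : Unitization ℂ A) * (1 - (u : Unitization ℂ A)) := by
    rw [mul_sub, mul_one, ← Unitization.inr_mul, Unitization.inr_sub]
  rw [this]
  refine (norm_mul_le _ _).trans ?_
  exact mul_le_of_le_one_right (norm_nonneg _) (norm_one_sub_inr_le h.sa h.sp)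

lemma IsUnitInterval.norm_mul_sub {u : A} (h : IsUnitInterval u) (y : A) : ‖y - u * y‖ ≤ ‖y‖ := by
  have := h.norm_sub_mul (star y)
  rwa [← norm_star, star_sub, star_mul, star_star, h.sa.star_eq, norm_star] at this

/-- approximate units: for finitely many elements of an ideal, `u` in the ideal with `m ≈ u m` -/
lemma exists_approx_unit_left {I : Set A} (hadd : ∀ x ∈ I, ∀ y ∈ I, x + y ∈ I) (h0 : (0 : A) ∈ I)
    (hmul : ∀ x ∈ I, ∀ y, x * y ∈ I) {n : ℕ} (m : Fin n → A) (hm : ∀ i, m i ∈ I) {ε : ℝ} (hε : 0 < ε) :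
    ∃ u ∈ I, IsUnitInterval u ∧ ∀ i, ‖m i - u * m i‖ ≤ ε := by
  letI := CStarAlgebra.spectralOrder A
  haveI := CStarAlgebra.spectralOrderedRing A
  set a := ∑ i, m i * star (m i) with ha
  have hI : a ∈ I := by
    rw [ha]
    exact Finset.sum_induction _ (· ∈ I) (fun x y hx hy => hadd x hx y hy) h0 (fun i _ => hmul _ (hm i) _)
  have ha0 : 0 ≤ a := Finset.sum_nonneg fun i _ => mul_star_self_nonneg _
  have hsa : IsSelfAdjoint a := .of_nonneg ha0
  set δ := ε ^ 4 with hδ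
  have hδ0 : 0 < δ := by positivity
  set f : ℝ → ℝ := fun t => t ^ 2 / (t ^ 2 + δ) with hf
  set g : ℝ → ℝ := fun t => t / (t ^ 2 + δ) with hg
  have hpos : ∀ t : ℝ, 0 < t ^ 2 + δ := fun t => by positivity
  have hfc : Continuous f := by
    rw [hf]; exact Continuous.div (by fun_prop) (by fun_prop) fun t => (hpos t).ne'
  have hgc : Continuous g := by
    rw [hg]; exact Continuous.div (by fun_prop) (by fun_prop) fun t => (hpos t).ne'
  have hf0 : f 0 = 0 := by simp [hf]
  have hg0 : g 0 = 0 := by simp [hg]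
  set u := cfcₙ f a with hu
  have hue : u = a * cfcₙ g a := by
    have := cfcₙ_mul (fun t => t) g a (by fun_prop) rfl hgc.continuousOn hg0
    rw [cfcₙ_id' ℝ a] at this
    rw [hu, ← this]
    congr 1
    funext t
    simp only [hf, hg]; ring
  have husa : IsSelfAdjoint u := cfcₙ_predicate _ _
  refine ⟨u, hue ▸ hmul _ hI _, ⟨husa, ?_⟩, ?_⟩
  · intro t ht
    rw [hu, cfcₙ_map_quasispectrum f a hfc.continuousOn hf0] at ht
    obtain ⟨s, _, rfl⟩ := ht
    simp only [hf]
    exact ⟨by positivity, (div_le_one (hpos s)).2 (by linarith)⟩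
  · intro i
    have h1 : (m i - u * m i) * star (m i - u * m i) ≤ a - u * a - a * u + u * a * u := by
      have e : a - u * a - a * u + u * a * u = ∑ j, (m j - u * m j) * star (m j - u * m j) := by
        simp only [star_sub, star_mul, husa.star_eq, mul_sub, sub_mul, Finset.sum_sub_distrib]
        simp only [ha, Finset.mul_sum, Finset.sum_mul, mul_assoc]
        abel
      rw [e]
      exact Finset.single_le_sum (f := fun j => (m j - u * m j) * star (m j - u * m j))
        (fun j _ => mul_star_self_nonneg _) (Finset.mem_univ i)
    have h2 : a - u * a - a * u + u * a * u = cfcₙ (fun t => t - f t * t - t * f t + f t * t * f t) a := by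
      have c1 : ContinuousOn (fun t => f t * t) (quasispectrum ℝ a) := (hfc.mul continuous_id).continuousOn
      have c2 : ContinuousOn (fun t => t * f t) (quasispectrum ℝ a) := (continuous_id.mul hfc).continuousOn
      have c3 : ContinuousOn (fun t => f t * t * f t) (quasispectrum ℝ a) := ((hfc.mul continuous_id).mul hfc).continuousOn
      rw [cfcₙ_add (fun t => t - f t * t - t * f t) (fun t => f t * t * f t) a
          ((continuousOn_id.sub c1).sub c2) (by simp [hf0]) c3 (by simp [hf0]),
        cfcₙ_sub (fun t => t - f t * t) (fun t => t * f t) a (continuousOn_id.sub c1) (by simp [hf0]) c2 (by simp [hf0]),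
        cfcₙ_sub (fun t => t) (fun t => f t * t) a continuousOn_id rfl c1 (by simp [hf0]),
        cfcₙ_mul (fun t => f t * t) f a c1 (by simp [hf0]) hfc.continuousOn hf0,
        cfcₙ_mul f (fun t => t) a hfc.continuousOn hf0 continuousOn_id rfl,
        cfcₙ_mul (fun t => t) f a continuousOn_id rfl hfc.continuousOn hf0, cfcₙ_id' ℝ a]
    have h3 : ‖a - u * a - a * u + u * a * u‖ ≤ ε ^ 2 := by
      rw [h2]
      apply norm_cfcₙ_le
      intro t _
      have e : t - f t * t - t * f t + f t * t * f t = t * δ ^ 2 / (t ^ 2 + δ) ^ 2 := by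
        simp only [hf]
        have := (hpos t).ne'
        field_simp
        ring
      rw [e, Real.norm_eq_abs, abs_div, abs_of_pos (pow_pos (hpos t) 2), div_le_iff₀ (pow_pos (hpos t) 2),
        abs_mul, abs_of_pos (pow_pos hδ0 2)]
      have h5 : |t| * ε ^ 2 ≤ t ^ 2 + δ := by
        rw [hδ]; nlinarith [sq_abs t, sq_nonneg (|t| - ε ^ 2), abs_nonneg t, sq_nonneg t, pow_pos hε 4]
      have h6 : δ ≤ t ^ 2 + δ := by nlinarith [sq_nonneg t]
      have h7 : (|t| * ε ^ 2) * δ ≤ (t ^ 2 + δ) * (t ^ 2 + δ) := mul_le_mul h5 h6 hδ0.le (hpos t).le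
      have : |t| * δ ^ 2 = ε ^ 2 * ((|t| * ε ^ 2) * δ) := by rw [hδ]; ring
      rw [this, pow_two (t ^ 2 + δ)]
      gcongr
    have h4 := CStarAlgebra.norm_le_norm_of_nonneg_of_le (mul_star_self_nonneg (m i - u * m i)) h1
    rw [CStarRing.norm_self_mul_star] at h4
    nlinarith [norm_nonneg (m i - u * m i)]

end ApproxUnit
end

section
section Quot
variable {A : Type u} [NonUnitalCStarAlgebra A]

lemma TwoSidedIdeal.star_mem_of_closed {M : TwoSidedIdeal A} (hc : IsClosed (M : Set A)) {m : A}
    (hm : m ∈ M) : star m ∈ M := by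
  have : star m ∈ closure (M : Set A) := by
    rw [Metric.mem_closure_iff]
    intro ε hε
    obtain ⟨u, hu, hui, hm'⟩ := exists_approx_unit_left (I := (M : Set A)) (fun x hx y hy => M.add_mem hx hy)
      M.zero_mem (fun x hx y => M.mul_mem_right _ _ hx) (n := 1) (fun _ => m) (fun _ => hm) (half_pos hε)
    refine ⟨star m * u, M.mul_mem_left _ _ hu, ?_⟩
    have := hm' 0
    rw [dist_eq_norm]
    rw [← norm_star, star_sub, star_mul, hui.sa.star_eq] at this
    linarith
  rwa [hc.closure_eq] at this

lemma cstar_quot_ineq {M : TwoSidedIdeal A} (hc : IsClosed (M : Set A)) (x z : A)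
    (hz : z - star x * x ∈ M) {δ : ℝ} (hδ : 0 < δ) :
    ∃ m ∈ M, ‖x - m‖ ^ 2 ≤ ‖z‖ + δ := by
  obtain ⟨u, hu, hui, hm'⟩ := exists_approx_unit_left (I := (M : Set A)) (fun x hx y hy => M.add_mem hx hy)
      M.zero_mem (fun x hx y => M.mul_mem_right _ _ hx) (n := 1) (fun _ => star (z - star x * x))
      (fun _ => TwoSidedIdeal.star_mem_of_closed hc hz) hδ
  refine ⟨x * u, M.mul_mem_left _ _ hu, ?_⟩
  have h1 := hm' 0
  rw [← norm_star, star_sub, star_mul, hui.sa.star_eq, star_star] at h1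
  rw [pow_two, ← CStarRing.norm_star_mul_self]
  have e : star (x - x * u) * (x - x * u) =
      (star x * x - star x * x * u) - u * (star x * x - star x * x * u) := by
    rw [star_sub, star_mul, hui.sa.star_eq]; noncomm_ring
  rw [e]
  refine (hui.norm_mul_sub _).trans ?_
  have e2 : star x * x - star x * x * u = (z - z * u) - ((z - star x * x) - (z - star x * x) * u) := by
    noncomm_ring
  rw [e2]
  exact (norm_sub_le _ _).trans (add_le_add (hui.norm_sub_mul _) h1)

theorem exists_quotient (M : TwoSidedIdeal A) (hc : IsClosed (M : Set A)) (e : A)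
    (he : ∀ x, x * e - x ∈ M ∧ e * x - x ∈ M) :
    ∃ (C : Type u) (_ : CStarAlgebra C) (π : A →⋆ₙₐ[ℂ] C), Function.Surjective π ∧
      (∀ a, π a = 0 ↔ a ∈ M) ∧ π e = 1 := by
  let S : Submodule ℂ A :=
    { carrier := (M : Set A), add_mem' := fun hx hy => M.add_mem hx hy, zero_mem' := M.zero_mem,
      smul_mem' := fun c x hx => modular_smul_mem he c hx }
  have hS : ∀ x, x ∈ S ↔ x ∈ M := fun x => Iff.rfl
  haveI : IsClosed (S : Set A) := hc
  let Q := A ⧸ S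
  have hrel : ∀ x y, (S.quotientRel x y) ↔ x - y ∈ M := fun x y => by
    rw [Submodule.quotientRel_def]; rfl
  let mulQ : Q → Q → Q := Quotient.map₂ (fun x y => x * y) (fun a b hab c d hcd => by
    have h1 := (hrel _ _).1 hab
    have h2 := (hrel _ _).1 hcd
    refine (hrel _ _).2 ?_
    have : a * c - b * d = (a - b) * c + b * (c - d) := by noncomm_ring
    rw [this]
    exact M.add_mem (M.mul_mem_right _ _ h1) (M.mul_mem_left _ _ h2))
  let starQ : Q → Q := Quotient.map (fun x => star x) (fun a b hab => by
    have h1 := (hrel _ _).1 hab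
    refine (hrel _ _).2 ?_
    rw [← star_sub]
    exact TwoSidedIdeal.star_mem_of_closed hc h1)
  let mk : A → Q := fun x => Submodule.Quotient.mk x
  have hmk : ∀ q : Q, ∃ x, mk x = q := fun q => Submodule.Quotient.mk_surjective S q
  have hmul : ∀ x y, mulQ (mk x) (mk y) = mk (x * y) := fun x y => rfl
  have hstar : ∀ x, starQ (mk x) = mk (star x) := fun x => rfl
  have hadd : ∀ x y, mk x + mk y = mk (x + y) := fun x y => rfl
  have hsmul : ∀ (c : ℂ) x, c • mk x = mk (c • x) := fun c x => rfl
  have hmk0 : ∀ x, mk x = 0 ↔ x ∈ M := fun x => Submodule.Quotient.mk_eq_zero S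
  have hmkeq : ∀ x y, mk x = mk y ↔ x - y ∈ M := fun x y => Submodule.Quotient.eq S
  have hlift : ∀ (q : Q) {ε : ℝ}, 0 < ε → ∃ x, mk x = q ∧ ‖x‖ < ‖q‖ + ε := fun q ε h =>
    Submodule.Quotient.norm_mk_lt q h
  have hle : ∀ x, ‖mk x‖ ≤ ‖x‖ := fun x => Submodule.Quotient.norm_mk_le S x
  letI nr : NormedRing Q :=
    { Submodule.Quotient.normedAddCommGroup S with
      mul := mulQ
      one := mk e
      left_distrib := fun a b c => by
        obtain ⟨a, rfl⟩ := hmk a; obtain ⟨b, rfl⟩ := hmk b; obtain ⟨c, rfl⟩ := hmk c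
        change mk (a * (b + c)) = mk (a * b + a * c)
        rw [mul_add]
      right_distrib := fun a b c => by
        obtain ⟨a, rfl⟩ := hmk a; obtain ⟨b, rfl⟩ := hmk b; obtain ⟨c, rfl⟩ := hmk c
        change mk ((a + b) * c) = mk (a * c + b * c)
        rw [add_mul]
      zero_mul := fun a => by
        obtain ⟨a, rfl⟩ := hmk a
        change mk (0 * a) = mk 0
        rw [zero_mul]
      mul_zero := fun a => by
        obtain ⟨a, rfl⟩ := hmk a
        change mk (a * 0) = mk 0
        rw [mul_zero]
      mul_assoc := fun a b c => by
        obtain ⟨a, rfl⟩ := hmk a; obtain ⟨b, rfl⟩ := hmk b; obtain ⟨c, rfl⟩ := hmk c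
        change mk ((a * b) * c) = mk (a * (b * c))
        rw [mul_assoc]
      one_mul := fun a => by
        obtain ⟨a, rfl⟩ := hmk a
        change mk (e * a) = mk a
        rw [hmkeq]; exact (he a).2
      mul_one := fun a => by
        obtain ⟨a, rfl⟩ := hmk a
        change mk (a * e) = mk a
        rw [hmkeq]; exact (he a).1
      norm_mul_le := fun a b => by
        change ‖mulQ a b‖ ≤ ‖a‖ * ‖b‖
        have key : ∀ ε : ℝ, 0 < ε → ‖mulQ a b‖ ≤ (‖a‖ + ε) * (‖b‖ + ε) := by
          intro ε hε
          obtain ⟨x, hx, hxn⟩ := hlift a hε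
          obtain ⟨y, hy, hyn⟩ := hlift b hε
          rw [← hx, ← hy, hmul, hx, hy]
          calc _ ≤ ‖x * y‖ := hle _
            _ ≤ ‖x‖ * ‖y‖ := norm_mul_le _ _
            _ ≤ _ := mul_le_mul hxn.le hyn.le (norm_nonneg _) (by positivity)
        have hcont : Filter.Tendsto (fun ε : ℝ => (‖a‖ + ε) * (‖b‖ + ε)) (nhdsWithin 0 (Set.Ioi 0)) (nhds ((‖a‖ + 0) * (‖b‖ + 0))) :=
          (Continuous.tendsto (by fun_prop) 0).mono_left nhdsWithin_le_nhds
        rw [add_zero, add_zero] at hcont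
        exact ge_of_tendsto hcont (Filter.eventually_of_mem self_mem_nhdsWithin fun ε hε => key ε hε) }
  letI alg : Algebra ℂ Q := Algebra.ofModule
    (fun c a b => by
        obtain ⟨a, rfl⟩ := hmk a; obtain ⟨b, rfl⟩ := hmk b
        change mk ((c • a) * b) = mk (c • (a * b))
        rw [smul_mul_assoc])
    (fun c a b => by
        obtain ⟨a, rfl⟩ := hmk a; obtain ⟨b, rfl⟩ := hmk b
        change mk (a * (c • b)) = mk (c • (a * b))
        rw [mul_smul_comm])
  letI nalg : NormedAlgebra ℂ Q := { alg with norm_smul_le := fun c q => norm_smul_le c (q : A ⧸ S) }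
  letI sr : StarRing Q :=
    { star := starQ
      star_involutive := fun a => by
        obtain ⟨a, rfl⟩ := hmk a
        change mk (star (star a)) = mk a
        rw [star_star]
      star_mul := fun a b => by
        obtain ⟨a, rfl⟩ := hmk a; obtain ⟨b, rfl⟩ := hmk b
        change mk (star (a * b)) = mk (star b * star a)
        rw [star_mul]
      star_add := fun a b => by
        obtain ⟨a, rfl⟩ := hmk a; obtain ⟨b, rfl⟩ := hmk b
        change mk (star (a + b)) = mk (star a + star b)
        rw [star_add] }
  haveI cs : CStarRing Q := ⟨fun {q} => by
    obtain ⟨x, rfl⟩ := hmk q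
    have key : ∀ ε : ℝ, 0 < ε → ‖mk x‖ * ‖mk x‖ ≤ ‖star (mk x) * mk x‖ + ε := by
      intro ε hε
      obtain ⟨z, hz, hzn⟩ := hlift (star (mk x) * mk x) (half_pos hε)
      have h1 : mk z = mk (star x * x) := hz
      obtain ⟨m, hm, hmn⟩ := cstar_quot_ineq hc x z ((hmkeq _ _).1 h1) (half_pos hε)
      have h2 : mk x = mk (x - m) := by rw [hmkeq]; simpa using hm
      have h3 : ‖mk x‖ ≤ ‖x - m‖ := by rw [h2]; exact hle _
      have h4 : 0 ≤ ‖mk x‖ := norm_nonneg (mk x : A ⧸ S)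
      nlinarith
    exact le_of_forall_pos_le_add key⟩
  haveI sm : StarModule ℂ Q := ⟨fun c a => by
    obtain ⟨a, rfl⟩ := hmk a
    change mk (star (c • a)) = mk (star c • star a)
    rw [star_smul]⟩
  haveI cpl : CompleteSpace Q := Submodule.Quotient.completeSpace S
  letI cstar : CStarAlgebra Q := { nr, sr, nalg with
    complete := cpl.complete
    norm_mul_self_le := cs.norm_mul_self_le
    star_smul := sm.star_smul }
  refine ⟨Q, cstar,
    { toFun := mk
      map_smul' := fun c x => rfl
      map_zero' := rfl
      map_add' := fun x y => rfl
      map_mul' := fun x y => rfl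
      map_star' := fun x => rfl }, hmk, hmk0, rfl⟩
end Quot
end

section
/-- algebraic simplicity in usable form -/
def IsSimpleAlg (C : Type*) [Ring C] : Prop :=
  ∀ k : C, k ≠ 0 → ∃ (n : ℕ) (c d : Fin n → C), (1 : C) = ∑ i, c i * k * d i

lemma quot_simple {A C : Type u} [NonUnitalCStarAlgebra A] [CStarAlgebra C] {M : TwoSidedIdeal A}
    (hM : IsMaximalModularIdeal M) (π : A →⋆ₙₐ[ℂ] C) (hs : Function.Surjective π)
    (hk : ∀ a, π a = 0 ↔ a ∈ M) : Nontrivial C ∧ IsSimpleAlg C := by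
  obtain ⟨hmod, hp, hmax⟩ := hM
  constructor
  · by_contra h
    rw [not_nontrivial_iff_subsingleton] at h
    exact hp (Set.eq_univ_of_forall fun a => (hk a).1 (Subsingleton.elim _ _))
  intro k hk0
  let L : TwoSidedIdeal A := TwoSidedIdeal.mk'
    {a | ∃ (n : ℕ) (c d : Fin n → C), π a = ∑ i, c i * k * d i}
    ⟨0, Fin.elim0, Fin.elim0, by simp⟩
    (by
      rintro x y ⟨n, c, d, h⟩ ⟨n', c', d', h'⟩
      exact ⟨n + n', Fin.append c c', Fin.append d d', by simp [Fin.sum_univ_add, h, h']⟩)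
    (by
      rintro x ⟨n, c, d, h⟩
      exact ⟨n, fun i => - c i, d, by simp [h, Finset.sum_neg_distrib]⟩)
    (by
      rintro x y ⟨n, c, d, h⟩
      exact ⟨n, fun i => π x * c i, d, by simp [h, Finset.mul_sum, mul_assoc]⟩)
    (by
      rintro x y ⟨n, c, d, h⟩
      exact ⟨n, c, fun i => d i * π y, by simp [h, Finset.sum_mul, mul_assoc]⟩)
  have hL : ∀ a, a ∈ L ↔ ∃ (n : ℕ) (c d : Fin n → C), π a = ∑ i, c i * k * d i := fun a => by
    simp [L, TwoSidedIdeal.mem_mk']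
  rcases hmax L (fun a ha => (hL a).2 ⟨0, Fin.elim0, Fin.elim0, by simpa using (hk a).2 ha⟩) with h | h
  · exfalso
    obtain ⟨a, ha⟩ := hs k
    have : a ∈ (L : Set A) := (hL a).2 ⟨1, 1, 1, by simp [ha]⟩
    rw [h] at this
    exact hk0 (by rw [← ha]; exact (hk a).2 this)
  · obtain ⟨a, ha⟩ := hs 1
    have : a ∈ (L : Set A) := by rw [h]; trivial
    obtain ⟨n, c, d, h⟩ := (hL a).1 this
    exact ⟨n, c, d, by rw [← h, ha]⟩

lemma lift_sa {A D : Type*} [NonUnitalCStarAlgebra A] [NonUnitalCStarAlgebra D] (φ : A →⋆ₙₐ[ℂ] D)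
    (hs : Function.Surjective φ) {y : D} (hy : IsSelfAdjoint y) (hn : ‖y‖ ≤ 1) :
    ∃ x : A, ‖x‖ ≤ 1 ∧ φ x = y := by
  obtain ⟨x1, hx1⟩ := hs y
  set x0 : A := (2⁻¹ : ℂ) • (x1 + star x1) with hx0
  have hsa : IsSelfAdjoint x0 := by
    simp only [IsSelfAdjoint, hx0, star_smul, star_add, star_star, add_comm (star x1)]
    congr 1; simp
  have hφ0 : φ x0 = y := by
    simp only [hx0, map_smul, map_add, map_star, hx1, hy.star_eq]
    rw [← two_smul ℂ y, smul_smul]; norm_num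
  have hc : Continuous φ := AddMonoidHomClass.continuous_of_bound φ 1 fun x => by
    rw [one_mul]; exact NonUnitalStarAlgHom.norm_apply_le φ x
  set f : ℝ → ℝ := fun t => max (-1) (min 1 t) with hf
  have hfc : Continuous f := by rw [hf]; fun_prop
  have hf0 : f 0 = 0 := by simp [hf]
  refine ⟨cfcₙ f x0, ?_, ?_⟩
  · apply norm_cfcₙ_le
    intro t _
    rw [Real.norm_eq_abs, abs_le]
    exact ⟨le_max_left _ _, max_le (by norm_num) (min_le_left _ _)⟩
  · rw [NonUnitalStarAlgHom.map_cfcₙ φ f x0 hfc.continuousOn hf0 hc hsa (by rw [hφ0]; exact hy), hφ0]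
    conv_rhs => rw [← cfcₙ_id' ℝ y]
    apply cfcₙ_congr
    intro t ht
    have h1 : |t| ≤ 1 := by
      have h2 : ‖t‖ ≤ ‖y‖ := by
        have := norm_apply_le_norm_cfcₙ (fun t : ℝ => t) y ht
        rwa [cfcₙ_id' ℝ y] at this
      rw [Real.norm_eq_abs] at h2
      linarith
    rw [abs_le] at h1
    simp only [hf]
    rw [min_eq_right h1.2, max_eq_right h1.1]

lemma lift_two {A D : Type*} [NonUnitalCStarAlgebra A] [NonUnitalCStarAlgebra D] (φ : A →⋆ₙₐ[ℂ] D)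
    (hs : Function.Surjective φ) {y : D} (hn : ‖y‖ ≤ 1) :
    ∃ x : A, ‖x‖ ≤ 2 ∧ φ x = y := by
  obtain ⟨k, hk, hk'⟩ := lift_sa φ hs (y := realPart y) (realPart y).2 ((realPart.norm_le y).trans hn)
  obtain ⟨l, hl, hl'⟩ := lift_sa φ hs (y := imaginaryPart y) (imaginaryPart y).2 ((imaginaryPart.norm_le y).trans hn)
  refine ⟨k + Complex.I • l, ?_, ?_⟩
  · refine (norm_add_le _ _).trans ?_
    rw [norm_smul, Complex.norm_I]; linarith
  · rw [map_add, map_smul, hk', hl', realPart_add_I_smul_imaginaryPart]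

/-- jointly completely bounded bilinear forms, with constant `κ` -/
def IsJCB {C D : Type*} [NonUnitalCStarAlgebra C] [PartialOrder C] [StarOrderedRing C]
    [NonUnitalCStarAlgebra D] [PartialOrder D] [StarOrderedRing D]
    (T : C →ₗ[ℂ] D →ₗ[ℂ] ℂ) (κ : ℝ) : Prop :=
  ∀ (p q : ℕ) (α β : Fin p × Fin q → ℂ) (v : CStarMatrix (Fin p) (Fin p) C)
    (w : CStarMatrix (Fin q) (Fin q) D), ∑ i, ‖α i‖ ^ 2 ≤ 1 → ∑ i, ‖β i‖ ^ 2 ≤ 1 → ‖v‖ ≤ 1 → ‖w‖ ≤ 1 →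
    ‖∑ ik : Fin p × Fin q, ∑ jl : Fin p × Fin q, α ik * β jl * T (v ik.1 jl.1) (w ik.2 jl.2)‖ ≤ κ

/-- the standing data of the completed tensor product, with matrix norms made canonical -/
structure TensorData {A B X : Type u} [NonUnitalCStarAlgebra A] [NonUnitalCStarAlgebra B]
    [NonUnitalNormedRing X] [NormedSpace ℂ X] (ι : A ⊗[ℂ] B →ₗ[ℂ] X) : Prop where
  dense : DenseRange ι
  mul_tmul : ∀ (a c : A) (b d : B),
    ι (a ⊗ₜ[ℂ] b) * ι (c ⊗ₜ[ℂ] d) = ι ((a * c) ⊗ₜ[ℂ] (b * d))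
  norm_rep : ∀ [PartialOrder A] [StarOrderedRing A] [PartialOrder B] [StarOrderedRing B]
    (p q : ℕ) (α β : Fin p × Fin q → ℂ) (v : CStarMatrix (Fin p) (Fin p) A)
    (w : CStarMatrix (Fin q) (Fin q) B),
    ‖ι (∑ ik : Fin p × Fin q, ∑ jl : Fin p × Fin q,
            (α ik * β jl) • (v ik.1 jl.1 ⊗ₜ[ℂ] w ik.2 jl.2))‖ ≤
      Real.sqrt (∑ ik, ‖α ik‖ ^ 2) * ‖v‖ * ‖w‖ * Real.sqrt (∑ jl, ‖β jl‖ ^ 2)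
  exists_rep : ∀ [PartialOrder A] [StarOrderedRing A] [PartialOrder B] [StarOrderedRing B]
    (u : A ⊗[ℂ] B) (r : ℝ), ‖ι u‖ < r →
    ∃ (p q : ℕ) (α β : Fin p × Fin q → ℂ) (v : CStarMatrix (Fin p) (Fin p) A)
    (w : CStarMatrix (Fin q) (Fin q) B),
     u = ∑ ik : Fin p × Fin q, ∑ jl : Fin p × Fin q,
            (α ik * β jl) • (v ik.1 jl.1 ⊗ₜ[ℂ] w ik.2 jl.2) ∧
      Real.sqrt (∑ ik, ‖α ik‖ ^ 2) * ‖v‖ * ‖w‖ * Real.sqrt (∑ jl, ‖β jl‖ ^ 2) < r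

lemma exists_fin_rep {A B : Type*} [AddCommGroup A] [Module ℂ A] [AddCommGroup B] [Module ℂ B]
    (u : A ⊗[ℂ] B) : ∃ (n : ℕ) (a : Fin n → A) (b : Fin n → B), u = ∑ i, a i ⊗ₜ[ℂ] b i := by
  induction u using TensorProduct.induction_on with
  | zero => exact ⟨0, Fin.elim0, Fin.elim0, by simp⟩
  | tmul a b => exact ⟨1, fun _ => a, fun _ => b, by simp⟩
  | add x y hx hy =>
    obtain ⟨n, a, b, h⟩ := hx
    obtain ⟨n', a', b', h'⟩ := hy
    exact ⟨n + n', Fin.append a a', Fin.append b b', by simp [Fin.sum_univ_add, h, h']⟩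

lemma IsTensorCompletion.tensorData {A B X : Type u} [NonUnitalCStarAlgebra A] [NonUnitalCStarAlgebra B]
    [NonUnitalNormedRing X] [StarRing X] [NormedSpace ℂ X] [CompleteSpace X]
    {NA : ∀ p : ℕ, Matrix (Fin p) (Fin p) A → ℝ}
    {NB : ∀ q : ℕ, Matrix (Fin q) (Fin q) B → ℝ}
    (hNA : ∀ p, IsCStarNorm (NA p)) (hNB : ∀ q, IsCStarNorm (NB q))
    {ι : A ⊗[ℂ] B →ₗ[ℂ] X} (hX : IsTensorCompletion (osProjNorm NA NB) X ι) : TensorData ι where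
  dense := hX.dense
  mul_tmul := hX.mul_tmul
  norm_rep := by
    intro _ _ _ _ p q α β v w
    rw [hX.norm_eq, osProjNorm]
    apply csInf_le
    · refine ⟨0, ?_⟩
      rintro r ⟨p, q, α, v, w, β, -, rfl⟩
      rw [matrix_norm_unique (hNA p) v, matrix_norm_unique (hNB q) w]
      exact mul_nonneg (mul_nonneg (mul_nonneg (Real.sqrt_nonneg _)
        (norm_nonneg (show CStarMatrix (Fin p) (Fin p) A from v))) (norm_nonneg (show CStarMatrix (Fin q) (Fin q) B from w)))
        (Real.sqrt_nonneg _)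
    · refine ⟨p, q, α, v, w, β, rfl, ?_⟩
      rw [matrix_norm_unique (hNA p) v, matrix_norm_unique (hNB q) w]
  exists_rep := by
    intro _ _ _ _ u r hr
    rw [hX.norm_eq, osProjNorm] at hr
    obtain ⟨s, ⟨p, q, α, v, w, β, hu, rfl⟩, hs⟩ := exists_lt_of_csInf_lt (by
      obtain ⟨n, a, b, hab⟩ := exists_fin_rep u
      refine ⟨_, n, n, fun ik => if ik.1 = ik.2 then 1 else 0, Matrix.diagonal a, Matrix.diagonal b,
        fun ik => if ik.1 = ik.2 then 1 else 0, ?_, rfl⟩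
      rw [hab]
      simp only [Fintype.sum_prod_type, ite_mul, mul_ite, one_mul, mul_one, zero_mul, mul_zero, ite_smul, one_smul,
        zero_smul, Finset.sum_ite_eq, Finset.sum_ite_eq', Finset.mem_univ, if_true, Matrix.diagonal_apply]
      refine Finset.sum_congr rfl fun i _ => ?_
      rw [Finset.sum_eq_single i, Finset.sum_eq_single i]
      · simp
      · intro j _ hj
        simp [Ne.symm hj]
      · simp
      · intro j _ hj
        simp [Ne.symm hj]
      · simp) hr
    refine ⟨p, q, α, β, v, w, hu, ?_⟩
    rw [matrix_norm_unique (hNA p) v, matrix_norm_unique (hNB q) w] at hs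
    exact hs
end

section
section CS
variable {C : Type*} [CStarAlgebra C] [PartialOrder C] [StarOrderedRing C]

/-- Cauchy–Schwarz with a row contraction -/
lemma cs_row {I : Type*} [Fintype I] (a b : I → C) (ha : ∑ i, a i * star (a i) ≤ 1) :
    star (∑ i, a i * b i) * (∑ i, a i * b i) ≤ ∑ i, star (b i) * b i := by
  set s := ∑ i, a i * b i with hs
  have h0 : 0 ≤ ∑ i, star (b i - star (a i) * s) * (b i - star (a i) * s) :=
    Finset.sum_nonneg fun i _ => star_mul_self_nonneg _
  have e : ∑ i, star (b i - star (a i) * s) * (b i - star (a i) * s) =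
      ∑ i, star (b i) * b i - star s * s - star s * s + star s * (∑ i, a i * star (a i)) * s := by
    have h1 : star s * s = ∑ i, star s * (a i * b i) := by rw [← Finset.mul_sum]
    have h2 : star s * s = ∑ i, (star (b i) * star (a i)) * s := by
      rw [← Finset.sum_mul, hs, star_sum]; simp only [star_mul]
    have h3 : ∑ i, star (b i) * b i - star s * s - star s * s = ∑ i, star (b i) * b i - ∑ i, star s * (a i * b i) -
        ∑ i, (star (b i) * star (a i)) * s := by rw [← h1, ← h2]
    clear_value s
    rw [h3, Finset.mul_sum, Finset.sum_mul, ← Finset.sum_sub_distrib, ← Finset.sum_sub_distrib, ← Finset.sum_add_distrib]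
    refine Finset.sum_congr rfl fun i _ => ?_
    rw [star_sub, star_mul, star_star]; noncomm_ring
  have h3 : star s * (∑ i, a i * star (a i)) * s ≤ star s * 1 * s := star_left_conjugate_le_conjugate ha s
  rw [mul_one] at h3
  rw [e] at h0
  have : 0 ≤ ∑ i, star (b i) * b i - star s * s := by
    refine h0.trans ?_
    calc _ ≤ ∑ i, star (b i) * b i - star s * s - star s * s + star s * s := by gcongr
      _ = _ := by abel
  exact sub_nonneg.1 this

lemma norm_le_of_star_mul_self_le {x : C} {r : ℝ} (hr : 0 ≤ r) (h : star x * x ≤ (r ^ 2) • (1 : C)) : ‖x‖ ≤ r := by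
  rcases subsingleton_or_nontrivial C with hC | hC
  · rw [Subsingleton.elim x 0, norm_zero]; exact hr
  have h1 := CStarAlgebra.norm_le_norm_of_nonneg_of_le (star_mul_self_nonneg x) h
  rw [CStarRing.norm_star_mul_self, norm_smul, norm_one, mul_one, Real.norm_of_nonneg (sq_nonneg r)] at h1
  nlinarith [norm_nonneg x]

lemma star_mul_self_le_smul (x : C) {r : ℝ} (h : ‖x‖ ≤ r) : star x * x ≤ (r ^ 2) • (1 : C) := by
  refine (CStarAlgebra.star_mul_le_algebraMap_norm_sq).trans ?_
  rw [Algebra.algebraMap_eq_smul_one]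
  exact smul_le_smul_of_nonneg_right (pow_le_pow_left₀ (norm_nonneg _) h 2) zero_le_one

lemma mul_star_self_le_smul (x : C) {r : ℝ} (h : ‖x‖ ≤ r) : x * star x ≤ (r ^ 2) • (1 : C) := by
  have := star_mul_self_le_smul (star x) (r := r) (by rwa [norm_star])
  rwa [star_star] at this

lemma exists_defect (v : C) : ∃ Z : C, (‖v‖ ^ 2) • (1 : C) - star v * v = star Z * Z := by
  have h := star_mul_self_le_smul v (le_refl ‖v‖)
  rw [← sub_nonneg] at h
  exact CStarAlgebra.nonneg_iff_eq_star_mul_self.1 h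

lemma mat_col {p : ℕ} (v : CStarMatrix (Fin p) (Fin p) C) (x : Fin p → C) :
    ∑ i, star (∑ j, v i j * x j) * (∑ j, v i j * x j) ≤ (‖v‖ ^ 2) • ∑ j, star (x j) * x j := by
  obtain ⟨Z, hZ⟩ := exists_defect v
  have hZ' : ∀ i j, ∑ k, star (v k i) * v k j + ∑ k, star (Z k i) * Z k j = if i = j then (‖v‖ ^ 2) • 1 else 0 := by
    intro i j
    have := congrFun (congrFun hZ i) j
    simp only [CStarMatrix.sub_apply, CStarMatrix.mul_apply, CStarMatrix.star_apply, CStarMatrix.smul_apply, CStarMatrix.one_apply] at this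
    rw [← this, add_sub_cancel]
    change (‖v‖ ^ 2) • ((1 : CStarMatrix (Fin p) (Fin p) C) i j) = _
    rw [CStarMatrix.one_apply]
    split_ifs <;> simp
  have key : ∀ w : CStarMatrix (Fin p) (Fin p) C, ∑ i, star (∑ j, w i j * x j) * (∑ j, w i j * x j) =
      ∑ i, ∑ j, star (x i) * (∑ k, star (w k i) * w k j) * x j := by
    intro w
    simp only [star_sum, star_mul, Finset.sum_mul, Finset.mul_sum]
    rw [Finset.sum_comm]
    simp_rw [mul_assoc]
    rw [Finset.sum_congr rfl fun i _ => Finset.sum_comm]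
    rw [Finset.sum_comm]
  have h2 : 0 ≤ ∑ i, star (∑ j, Z i j * x j) * (∑ j, Z i j * x j) := Finset.sum_nonneg fun i _ => star_mul_self_nonneg _
  have h3 : ∑ i, star (∑ j, v i j * x j) * (∑ j, v i j * x j) + ∑ i, star (∑ j, Z i j * x j) * (∑ j, Z i j * x j)
      = (‖v‖ ^ 2) • ∑ j, star (x j) * x j := by
    rw [key, key, ← Finset.sum_add_distrib, Finset.smul_sum]
    refine Finset.sum_congr rfl fun i _ => ?_
    rw [← Finset.sum_add_distrib]
    simp_rw [← add_mul, ← mul_add, hZ']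
    simp
  rw [← h3]
  exact le_add_of_nonneg_right h2

lemma mat_row {p : ℕ} (v : CStarMatrix (Fin p) (Fin p) C) (x : Fin p → C) :
    ∑ j, (∑ i, x i * v i j) * star (∑ i, x i * v i j) ≤ (‖v‖ ^ 2) • ∑ j, x j * star (x j) := by
  have := mat_col (star v) (fun i => star (x i))
  simp only [CStarMatrix.star_apply, ← star_mul, ← star_sum, star_star, norm_star] at this
  exact this
end CS

section Ext
/-- extension of bounded linear maps to the completion -/
lemma exists_extension {V X F : Type*} [AddCommGroup V] [Module ℂ V] [NormedAddCommGroup X] [NormedSpace ℂ X]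
    [NormedAddCommGroup F] [NormedSpace ℂ F] [CompleteSpace F] (ι : V →ₗ[ℂ] X) (hd : DenseRange ι)
    (g : V →ₗ[ℂ] F) (c : ℝ) (hc : 0 ≤ c) (hg : ∀ u, ‖g u‖ ≤ c * ‖ι u‖) :
    ∃ G : X →L[ℂ] F, (∀ u, G (ι u) = g u) ∧ ∀ x, ‖G x‖ ≤ c * ‖x‖ :=
  ⟨g.extendOfNorm ι, fun u => LinearMap.extendOfNorm_eq hd ⟨c, hg⟩ u,
    fun x => LinearMap.norm_extendOfNorm_apply_le hd c hg x⟩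
end Ext
end

section
section JCB
variable {C D : Type*} [NonUnitalCStarAlgebra C] [PartialOrder C] [StarOrderedRing C]
    [NonUnitalCStarAlgebra D] [PartialOrder D] [StarOrderedRing D]

lemma IsJCB.bound {T : C →ₗ[ℂ] D →ₗ[ℂ] ℂ} {κ : ℝ} (h : IsJCB T κ) {p q : ℕ} (α β : Fin p × Fin q → ℂ)
    (v : CStarMatrix (Fin p) (Fin p) C) (w : CStarMatrix (Fin q) (Fin q) D) :
    ‖∑ ik : Fin p × Fin q, ∑ jl : Fin p × Fin q, α ik * β jl * T (v ik.1 jl.1) (w ik.2 jl.2)‖ ≤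
      κ * (Real.sqrt (∑ ik, ‖α ik‖ ^ 2) * ‖v‖ * ‖w‖ * Real.sqrt (∑ jl, ‖β jl‖ ^ 2)) := by
  set sα := Real.sqrt (∑ ik, ‖α ik‖ ^ 2) with hsα
  set sβ := Real.sqrt (∑ ik, ‖β ik‖ ^ 2) with hsβ
  have hα0 : 0 ≤ sα := Real.sqrt_nonneg _
  have hβ0 : 0 ≤ sβ := Real.sqrt_nonneg _
  have key : ∀ δ : ℝ, 0 < δ → ‖∑ ik : Fin p × Fin q, ∑ jl : Fin p × Fin q, α ik * β jl * T (v ik.1 jl.1) (w ik.2 jl.2)‖ ≤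
      κ * ((sα + δ) * (‖v‖ + δ) * (‖w‖ + δ) * (sβ + δ)) := by
    intro δ hδ
    have scal : ∀ (γ : Fin p × Fin q → ℂ) (s : ℝ), s = Real.sqrt (∑ ik, ‖γ ik‖ ^ 2) → 
        ∑ i, ‖((s + δ)⁻¹ : ℂ) * γ i‖ ^ 2 ≤ 1 := by
      intro γ s hs
      have hs0 : 0 ≤ s := hs ▸ Real.sqrt_nonneg _
      have h1 : ∑ i, ‖γ i‖ ^ 2 = s ^ 2 := by rw [hs, Real.sq_sqrt (Finset.sum_nonneg fun i _ => sq_nonneg _)]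
      have h2 : ‖((s + δ)⁻¹ : ℂ)‖ = (s + δ)⁻¹ := by
        rw [← Complex.ofReal_add, ← Complex.ofReal_inv, Complex.norm_real, Real.norm_of_nonneg (by positivity)]
      simp_rw [norm_mul, mul_pow, ← Finset.mul_sum, h1, h2]
      rw [inv_pow, inv_mul_le_iff₀ (by positivity)]
      nlinarith
    have scal2 : ∀ (P : Type _) [NormedAddCommGroup P] [NormedSpace ℂ P] (x : P), ‖((‖x‖ + δ)⁻¹ : ℂ) • x‖ ≤ 1 := by
      intro P _ _ x
      have h2 : ‖(((‖x‖ : ℝ) + δ)⁻¹ : ℂ)‖ = (‖x‖ + δ)⁻¹ := by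
        rw [← Complex.ofReal_add, ← Complex.ofReal_inv, Complex.norm_real, Real.norm_of_nonneg (by positivity)]
      rw [norm_smul, h2, inv_mul_le_iff₀ (by positivity)]
      linarith
    have scal3 : ∀ (P : Type _) [NormedAddCommGroup P] [NormedSpace ℂ P] (x : P), ‖((‖x‖ + δ)⁻¹ : ℂ) • x‖ ≤ 1 := by
      intro P _ _ x
      have h2 : ‖(((‖x‖ : ℝ) + δ)⁻¹ : ℂ)‖ = (‖x‖ + δ)⁻¹ := by
        rw [← Complex.ofReal_add, ← Complex.ofReal_inv, Complex.norm_real, Real.norm_of_nonneg (by positivity)]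
      rw [norm_smul, h2, inv_mul_le_iff₀ (by positivity)]
      linarith
    have := h p q (fun i => ((sα + δ)⁻¹ : ℂ) * α i) (fun i => ((sβ + δ)⁻¹ : ℂ) * β i)
      (((‖v‖ + δ)⁻¹ : ℂ) • v) (((‖w‖ + δ)⁻¹ : ℂ) • w) (scal α sα hsα) (scal β sβ hsβ) (scal2 _ v) (scal3 _ w)
    set N : ℝ := (sα + δ) * (‖v‖ + δ) * (‖w‖ + δ) * (sβ + δ) with hN
    have hNpos : 0 < N := by positivity
    have e : ∑ ik : Fin p × Fin q, ∑ jl : Fin p × Fin q, ((sα + δ)⁻¹ : ℂ) * α ik * (((sβ + δ)⁻¹ : ℂ) * β jl) *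
        T ((((‖v‖ + δ)⁻¹ : ℂ) • v) ik.1 jl.1) ((((‖w‖ + δ)⁻¹ : ℂ) • w) ik.2 jl.2) =
        ((N⁻¹ : ℝ) : ℂ) * ∑ ik : Fin p × Fin q, ∑ jl : Fin p × Fin q, α ik * β jl * T (v ik.1 jl.1) (w ik.2 jl.2) := by
      simp only [Finset.mul_sum]
      refine Finset.sum_congr rfl fun ik _ => Finset.sum_congr rfl fun jl _ => ?_
      rw [CStarMatrix.smul_apply, CStarMatrix.smul_apply, map_smul, map_smul, LinearMap.smul_apply, smul_eq_mul, smul_eq_mul, hN]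
      push_cast
      simp only [mul_inv]
      ring
    rw [e, norm_mul, Complex.norm_real, Real.norm_of_nonneg (by positivity), inv_mul_le_iff₀ hNpos] at this
    rwa [mul_comm κ]
  have hcont : Filter.Tendsto (fun δ : ℝ => κ * ((sα + δ) * (‖v‖ + δ) * (‖w‖ + δ) * (sβ + δ))) (nhdsWithin 0 (Set.Ioi 0))
      (nhds (κ * ((sα + 0) * (‖v‖ + 0) * (‖w‖ + 0) * (sβ + 0)))) :=
    (Continuous.tendsto (by fun_prop) 0).mono_left nhdsWithin_le_nhds
  simp only [add_zero] at hcont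
  exact ge_of_tendsto hcont (Filter.eventually_of_mem self_mem_nhdsWithin fun ε hε => key ε hε)

lemma IsJCB.nonneg {T : C →ₗ[ℂ] D →ₗ[ℂ] ℂ} {κ : ℝ} (h : IsJCB T κ) : 0 ≤ κ :=
  (norm_nonneg _).trans (h 0 0 0 0 0 0 (by simp) (by simp) (by simp) (by simp))
end JCB

lemma matrix_map_norm_le {A C : Type*} [NonUnitalCStarAlgebra A] [PartialOrder A] [StarOrderedRing A]
    [NonUnitalCStarAlgebra C] [PartialOrder C] [StarOrderedRing C] (π : A →⋆ₙₐ[ℂ] C) {p : ℕ}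
    (v : CStarMatrix (Fin p) (Fin p) A) : ‖CStarMatrix.mapₙₐ π v‖ ≤ ‖v‖ :=
  NonUnitalStarAlgHom.norm_apply_le (CStarMatrix.mapₙₐ π) v

lemma matrix_lift {A C : Type*} [NonUnitalCStarAlgebra A] [PartialOrder A] [StarOrderedRing A]
    [NonUnitalCStarAlgebra C] [PartialOrder C] [StarOrderedRing C] (π : A →⋆ₙₐ[ℂ] C) (hs : Function.Surjective π) {p : ℕ}
    (v : CStarMatrix (Fin p) (Fin p) C) (hv : ‖v‖ ≤ 1) :
    ∃ v' : CStarMatrix (Fin p) (Fin p) A, ‖v'‖ ≤ 2 ∧ ∀ i j, π (v' i j) = v i j := by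
  have : Function.Surjective (CStarMatrix.mapₙₐ (n := Fin p) π) := by
    intro y
    choose f hf using hs
    refine ⟨fun i j => f (y i j), ?_⟩
    ext i j
    exact hf _
  obtain ⟨x, hx, hxy⟩ := lift_two (CStarMatrix.mapₙₐ (n := Fin p) π) this hv
  exact ⟨x, hx, fun i j => congrFun (congrFun hxy i) j⟩

section Q
variable {A B X : Type u} [NonUnitalCStarAlgebra A] [NonUnitalCStarAlgebra B]
    [NonUnitalNormedRing X] [NormedSpace ℂ X] {ι : A ⊗[ℂ] B →ₗ[ℂ] X}
    {C D : Type u} [CStarAlgebra C] [PartialOrder C] [StarOrderedRing C]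
    [CStarAlgebra D] [PartialOrder D] [StarOrderedRing D]

/-- `(π ⊗ π')` -/
def qmap (π : A →⋆ₙₐ[ℂ] C) (π' : B →⋆ₙₐ[ℂ] D) : A ⊗[ℂ] B →ₗ[ℂ] C ⊗[ℂ] D :=
  TensorProduct.map (π : A →ₗ[ℂ] C) (π' : B →ₗ[ℂ] D)

@[simp] lemma qmap_tmul (π : A →⋆ₙₐ[ℂ] C) (π' : B →⋆ₙₐ[ℂ] D) (a : A) (b : B) :
    qmap π π' (a ⊗ₜ b) = π a ⊗ₜ π' b := rfl

lemma IsJCB.norm_lift_le (hX : TensorData ι) (π : A →⋆ₙₐ[ℂ] C) (π' : B →⋆ₙₐ[ℂ] D)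
    {T : C →ₗ[ℂ] D →ₗ[ℂ] ℂ} {κ : ℝ} (h : IsJCB T κ) (u : A ⊗[ℂ] B) :
    ‖TensorProduct.lift T (qmap π π' u)‖ ≤ κ * ‖ι u‖ := by
  letI := CStarAlgebra.spectralOrder A
  haveI := CStarAlgebra.spectralOrderedRing A
  letI := CStarAlgebra.spectralOrder B
  haveI := CStarAlgebra.spectralOrderedRing B
  have key : ∀ ε : ℝ, 0 < ε → ‖TensorProduct.lift T (qmap π π' u)‖ ≤ κ * (‖ι u‖ + ε) := by
    intro ε hε
    obtain ⟨p, q, α, β, v, w, hu, hr⟩ := hX.exists_rep u (‖ι u‖ + ε) (by linarith)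
    have := h.bound α β (CStarMatrix.mapₙₐ π v) (CStarMatrix.mapₙₐ π' w)
    have e : TensorProduct.lift T (qmap π π' u) = ∑ ik : Fin p × Fin q, ∑ jl : Fin p × Fin q, α ik * β jl *
        T ((CStarMatrix.mapₙₐ π v) ik.1 jl.1) ((CStarMatrix.mapₙₐ π' w) ik.2 jl.2) := by
      rw [hu]
      simp only [map_sum, map_smul, qmap_tmul, TensorProduct.lift.tmul, smul_eq_mul]
      rfl
    rw [e]
    refine this.trans (mul_le_mul_of_nonneg_left (le_trans ?_ hr.le) h.nonneg)
    gcongr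
    · exact matrix_map_norm_le π v
    · exact matrix_map_norm_le π' w
  have hcont : Filter.Tendsto (fun ε : ℝ => κ * (‖ι u‖ + ε)) (nhdsWithin 0 (Set.Ioi 0)) (nhds (κ * (‖ι u‖ + 0))) :=
    (Continuous.tendsto (by fun_prop) 0).mono_left nhdsWithin_le_nhds
  rw [add_zero] at hcont
  exact ge_of_tendsto hcont (Filter.eventually_of_mem self_mem_nhdsWithin fun ε hε => key ε hε)

lemma exists_bar (hX : TensorData ι) {π : A →⋆ₙₐ[ℂ] C} {π' : B →⋆ₙₐ[ℂ] D} (hs : Function.Surjective π)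
    (hs' : Function.Surjective π') (T : X →L[ℂ] ℂ) (h1 : ∀ a b, π a = 0 → T (ι (a ⊗ₜ b)) = 0)
    (h2 : ∀ a b, π' b = 0 → T (ι (a ⊗ₜ b)) = 0) :
    ∃ S : C →ₗ[ℂ] D →ₗ[ℂ] ℂ, (∀ a b, S (π a) (π' b) = T (ι (a ⊗ₜ b))) ∧
      (∀ u, TensorProduct.lift S (qmap π π' u) = T (ι u)) ∧ IsJCB S (‖T‖ * 4) := by
  letI := CStarAlgebra.spectralOrder A
  haveI := CStarAlgebra.spectralOrderedRing A
  letI := CStarAlgebra.spectralOrder B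
  haveI := CStarAlgebra.spectralOrderedRing B
  obtain ⟨s, hs1⟩ := LinearMap.exists_rightInverse_of_surjective (π : A →ₗ[ℂ] C) (LinearMap.range_eq_top.2 hs)
  obtain ⟨s', hs1'⟩ := LinearMap.exists_rightInverse_of_surjective (π' : B →ₗ[ℂ] D) (LinearMap.range_eq_top.2 hs')
  have es : ∀ c, π (s c) = c := fun c => LinearMap.congr_fun hs1 c
  have es' : ∀ c, π' (s' c) = c := fun c => LinearMap.congr_fun hs1' c
  let S : C →ₗ[ℂ] D →ₗ[ℂ] ℂ := (((TensorProduct.mk ℂ A B).compr₂ ((T : X →ₗ[ℂ] ℂ) ∘ₗ ι)).compl₁₂ s s')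
  have hS : ∀ c d, S c d = T (ι (s c ⊗ₜ s' d)) := fun c d => rfl
  have hSa : ∀ a b, S (π a) (π' b) = T (ι (a ⊗ₜ b)) := by
    intro a b
    rw [hS]
    have e1 : T (ι ((s (π a) - a) ⊗ₜ s' (π' b))) = 0 := h1 _ _ (by rw [map_sub, es, sub_self])
    have e2 : T (ι (a ⊗ₜ (s' (π' b) - b))) = 0 := h2 _ _ (by rw [map_sub, es', sub_self])
    rw [TensorProduct.sub_tmul, map_sub, map_sub, sub_eq_zero] at e1
    rw [TensorProduct.tmul_sub, map_sub, map_sub, sub_eq_zero] at e2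
    rw [e1, e2]
  refine ⟨S, hSa, ?_, ?_⟩
  · intro u
    induction u using TensorProduct.induction_on with
    | zero => simp
    | tmul a b => exact hSa a b
    | add x y hx hy => simp only [map_add, hx, hy]
  · intro p q α β v w hα hβ hv hw
    obtain ⟨v', hv', hvv⟩ := matrix_lift π hs v hv
    obtain ⟨w', hw', hww⟩ := matrix_lift π' hs' w hw
    have := hX.norm_rep p q α β v' w'
    have e : ∑ ik : Fin p × Fin q, ∑ jl : Fin p × Fin q, α ik * β jl * S (v ik.1 jl.1) (w ik.2 jl.2) =
        T (ι (∑ ik : Fin p × Fin q, ∑ jl : Fin p × Fin q,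
            (α ik * β jl) • (v' ik.1 jl.1 ⊗ₜ[ℂ] w' ik.2 jl.2))) := by
      simp only [map_sum, map_smul, smul_eq_mul, ← hSa, hvv, hww]
    rw [e]
    refine (T.le_opNorm _).trans (mul_le_mul_of_nonneg_left (this.trans ?_) (norm_nonneg _))
    have s1 : Real.sqrt (∑ ik, ‖α ik‖ ^ 2) ≤ 1 := Real.sqrt_le_one.2 hα
    have s2 : Real.sqrt (∑ ik, ‖β ik‖ ^ 2) ≤ 1 := Real.sqrt_le_one.2 hβ
    calc _ ≤ 1 * 2 * 2 * (1 : ℝ) := by gcongr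
      _ = 4 := by norm_num

/-- Haagerup-type representation with row/column bounds -/
def HRep (z : C ⊗[ℂ] D) (r : ℝ) : Prop :=
  ∃ (n : ℕ) (a : Fin n → C) (b : Fin n → D), z = ∑ i, a i ⊗ₜ[ℂ] b i ∧
    ∑ i, a i * star (a i) ≤ r • (1 : C) ∧ ∑ i, star (b i) * b i ≤ r • (1 : D)

def HRep' (z : C ⊗[ℂ] D) (r : ℝ) : Prop :=
  ∃ (n : ℕ) (a : Fin n → C) (b : Fin n → D), z = ∑ i, a i ⊗ₜ[ℂ] b i ∧
    ∑ i, star (a i) * a i ≤ r • (1 : C) ∧ ∑ i, b i * star (b i) ≤ r • (1 : D)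

lemma hrep'_comm (z : C ⊗[ℂ] D) (r : ℝ) : HRep' z r ↔ HRep (TensorProduct.comm ℂ C D z) r := by
  constructor
  · rintro ⟨n, a, b, rfl, h1, h2⟩
    exact ⟨n, b, a, by simp, h2, h1⟩
  · rintro ⟨n, a, b, h, h1, h2⟩
    refine ⟨n, b, a, ?_, h2, h1⟩
    apply (TensorProduct.comm ℂ C D).injective
    rw [h]; simp

lemma exists_scale {P Q r : ℝ} (hP : 0 ≤ P) (hQ : 0 ≤ Q) (h : P * Q < r) :
    ∃ t : ℝ, 0 < t ∧ t ^ 2 * P ^ 2 ≤ r ∧ t⁻¹ ^ 2 * Q ^ 2 ≤ r := by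
  have hr : 0 < r := lt_of_le_of_lt (by positivity) h
  rcases hP.eq_or_lt with rfl | hP'
  · refine ⟨(Q + 1) / Real.sqrt r, by positivity, by simpa using hr.le, ?_⟩
    rw [inv_div, div_pow, Real.sq_sqrt hr.le, div_mul_eq_mul_div, div_le_iff₀ (by positivity)]
    nlinarith
  · refine ⟨Real.sqrt r / P, by positivity, ?_, ?_⟩
    · rw [div_pow, Real.sq_sqrt hr.le, div_mul_cancel₀ _ (by positivity)]
    · rw [inv_div, div_pow, Real.sq_sqrt hr.le, div_mul_eq_mul_div, div_le_iff₀ hr]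
      nlinarith [mul_nonneg hP hQ]

lemma hrep_of_fintype {I : Type*} [Fintype I] (a : I → C) (b : I → D) {P Q r : ℝ} (hP : 0 ≤ P) (hQ : 0 ≤ Q)
    (h : P * Q < r) (ha : ∑ i, a i * star (a i) ≤ (P ^ 2) • (1 : C)) (hb : ∑ i, star (b i) * b i ≤ (Q ^ 2) • (1 : D)) :
    HRep (∑ i, a i ⊗ₜ[ℂ] b i) r := by
  obtain ⟨t, ht, h1, h2⟩ := exists_scale hP hQ h
  let e := Fintype.equivFin I
  refine ⟨Fintype.card I, fun i => t • a (e.symm i), fun i => t⁻¹ • b (e.symm i), ?_, ?_, ?_⟩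
  · rw [← e.symm.sum_comp]
    refine Finset.sum_congr rfl fun i _ => ?_
    change _ = (t • a (e.symm i)) ⊗ₜ[ℂ] (t⁻¹ • b (e.symm i))
    rw [← Complex.coe_smul t, ← Complex.coe_smul t⁻¹, TensorProduct.smul_tmul_smul, ← Complex.ofReal_mul,
      mul_inv_cancel₀ ht.ne', Complex.ofReal_one, one_smul]
  · rw [e.symm.sum_comp (fun i => (t • a i) * star (t • a i))]
    simp only [star_smul, smul_mul_smul_comm, star_trivial, ← Finset.smul_sum, ← pow_two]
    calc _ ≤ t ^ 2 • (P ^ 2) • (1 : C) := smul_le_smul_of_nonneg_left ha (by positivity)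
      _ ≤ _ := by rw [smul_smul]; exact smul_le_smul_of_nonneg_right h1 zero_le_one
  · rw [e.symm.sum_comp (fun i => star (t⁻¹ • b i) * (t⁻¹ • b i))]
    simp only [star_smul, smul_mul_smul_comm, star_trivial, ← Finset.smul_sum, ← pow_two]
    calc _ ≤ t⁻¹ ^ 2 • (Q ^ 2) • (1 : D) := smul_le_smul_of_nonneg_left hb (by positivity)
      _ ≤ _ := by rw [smul_smul]; exact smul_le_smul_of_nonneg_right h2 zero_le_one

lemma row_bound {p q : ℕ} (α : Fin p × Fin q → ℂ) (v : CStarMatrix (Fin p) (Fin p) C) :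
    ∑ kj : Fin q × Fin p, (∑ i, α (i, kj.1) • v i kj.2) * star (∑ i, α (i, kj.1) • v i kj.2) ≤
      ((Real.sqrt (∑ ik, ‖α ik‖ ^ 2) * ‖v‖) ^ 2) • (1 : C) := by
  rw [Fintype.sum_prod_type, mul_pow, Real.sq_sqrt (Finset.sum_nonneg fun i _ => sq_nonneg _)]
  have : ∀ k : Fin q, ∑ j : Fin p, (∑ i, α (i, k) • v i j) * star (∑ i, α (i, k) • v i j) ≤
      (‖v‖ ^ 2 * ∑ i, ‖α (i, k)‖ ^ 2) • (1 : C) := by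
    intro k
    have := mat_row v (fun i => α (i, k) • (1 : C))
    simp only [smul_mul_assoc, one_mul, star_smul, star_one, mul_smul_comm] at this
    refine this.trans (le_of_eq ?_)
    rw [mul_smul, Finset.sum_smul]
    congr 1
    refine Finset.sum_congr rfl fun i _ => ?_
    rw [smul_smul, Complex.star_def, Complex.conj_mul', ← Complex.ofReal_pow, Complex.coe_smul]
  refine (Finset.sum_le_sum fun k _ => this k).trans (le_of_eq ?_)
  rw [← Finset.sum_smul, ← Finset.mul_sum, Finset.sum_comm, ← Fintype.sum_prod_type (fun ik => ‖α ik‖ ^ 2), mul_comm]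

lemma col_bound {p q : ℕ} (β : Fin p × Fin q → ℂ) (w : CStarMatrix (Fin p) (Fin p) C) :
    ∑ kj : Fin q × Fin p, star (∑ l, β (l, kj.1) • w kj.2 l) * (∑ l, β (l, kj.1) • w kj.2 l) ≤
      ((Real.sqrt (∑ ik, ‖β ik‖ ^ 2) * ‖w‖) ^ 2) • (1 : C) := by
  have := row_bound (fun ik => star (β ik)) (star w)
  simp only [norm_star, CStarMatrix.star_apply, ← star_smul, ← star_sum, star_star] at this
  exact this

lemma hrep_of_norm_lt (hX : TensorData ι) (π : A →⋆ₙₐ[ℂ] C) (π' : B →⋆ₙₐ[ℂ] D) (u : A ⊗[ℂ] B) {r : ℝ}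
    (hr : ‖ι u‖ < r) : HRep (qmap π π' u) r ∧ HRep' (qmap π π' u) r := by
  letI := CStarAlgebra.spectralOrder A
  haveI := CStarAlgebra.spectralOrderedRing A
  letI := CStarAlgebra.spectralOrder B
  haveI := CStarAlgebra.spectralOrderedRing B
  obtain ⟨p, q, α, β, v, w, hu, hr'⟩ := hX.exists_rep u r hr
  set v' := CStarMatrix.mapₙₐ π v with hv'
  set w' := CStarMatrix.mapₙₐ π' w with hw'
  have hv : ‖v'‖ ≤ ‖v‖ := matrix_map_norm_le π v
  have hw : ‖w'‖ ≤ ‖w‖ := matrix_map_norm_le π' w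
  have hz : qmap π π' u = ∑ ik : Fin p × Fin q, ∑ jl : Fin p × Fin q,
            (α ik * β jl) • (v' ik.1 jl.1 ⊗ₜ[ℂ] w' ik.2 jl.2) := by
    rw [hu]
    simp only [map_sum, map_smul, qmap_tmul]
    rfl
  have hlt : Real.sqrt (∑ ik, ‖α ik‖ ^ 2) * ‖v'‖ * ‖w'‖ * Real.sqrt (∑ jl, ‖β jl‖ ^ 2) < r :=
    lt_of_le_of_lt (by gcongr) hr'
  constructor
  · have hb := col_bound (fun lj : Fin q × Fin p => β (lj.2, lj.1)) w'
    rw [← (Equiv.prodComm (Fin q) (Fin p)).sum_comp] at hb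
    rw [show ∑ ik : Fin q × Fin p, ‖β (ik.2, ik.1)‖ ^ 2 = ∑ jl, ‖β jl‖ ^ 2 from
      (Equiv.prodComm (Fin q) (Fin p)).sum_comp (fun jl => ‖β jl‖ ^ 2)] at hb
    have := hrep_of_fintype (fun kj : Fin q × Fin p => ∑ i, α (i, kj.1) • v' i kj.2)
      (fun kj : Fin q × Fin p => ∑ l, β (kj.2, l) • w' kj.1 l) (r := r) (mul_nonneg (Real.sqrt_nonneg _) (norm_nonneg _))
      (mul_nonneg (Real.sqrt_nonneg _) (norm_nonneg _)) (by linarith) (row_bound α v') hb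
    convert this using 1
    rw [hz]
    simp only [Fintype.sum_prod_type, TensorProduct.sum_tmul, TensorProduct.tmul_sum, TensorProduct.smul_tmul_smul]
    rw [Finset.sum_comm]
    refine Finset.sum_congr rfl fun k _ => ?_
    rw [Finset.sum_comm]
    refine Finset.sum_congr rfl fun i _ => ?_
    rw [Finset.sum_comm]
  · rw [hrep'_comm]
    have ha := col_bound β v'
    have hb := row_bound (fun lj : Fin q × Fin p => α (lj.2, lj.1)) w'
    rw [← (Equiv.prodComm (Fin q) (Fin p)).sum_comp] at hb
    rw [show ∑ ik : Fin q × Fin p, ‖α (ik.2, ik.1)‖ ^ 2 = ∑ jl, ‖α jl‖ ^ 2 from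
      (Equiv.prodComm (Fin q) (Fin p)).sum_comp (fun jl => ‖α jl‖ ^ 2)] at hb
    have := hrep_of_fintype 
      (fun kj : Fin q × Fin p => ∑ l, α (kj.2, l) • w' l kj.1) (fun kj : Fin q × Fin p => ∑ i, β (i, kj.1) • v' kj.2 i)
      (r := r) (mul_nonneg (Real.sqrt_nonneg _) (norm_nonneg _))
      (mul_nonneg (Real.sqrt_nonneg _) (norm_nonneg _)) (by linarith) hb ha
    convert this using 1
    rw [hz]
    simp only [map_sum, map_smul, TensorProduct.comm_tmul]
    simp only [Fintype.sum_prod_type, TensorProduct.sum_tmul, TensorProduct.tmul_sum, TensorProduct.smul_tmul_smul]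
    symm
    rw [Finset.sum_comm]
    refine Finset.sum_congr rfl fun i _ => ?_
    rw [Finset.sum_comm]
    symm
    rw [Finset.sum_comm]
    refine Finset.sum_congr rfl fun j _ => ?_
    rw [Finset.sum_comm]
end Q
end

section
lemma ind_le_one {K : ℕ} (P : Fin (K + 1) → Prop) [DecidablePred P] (h : ∀ k k', P k → P k' → k = k') :
    ∑ k, (if P k then (1 : ℝ) else 0) ≤ 1 := by
  rw [Finset.sum_boole]
  have : (Finset.univ.filter P).card ≤ 1 := by
    rw [Finset.card_le_one]
    intro a ha b hb
    simp only [Finset.mem_filter, Finset.mem_univ, true_and] at ha hb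
    exact h a b ha hb
  exact_mod_cast this

lemma exists_dyadic {t : ℝ} (ht : 0 < t) : ∃ m : ℤ, (2 : ℝ) ^ (-m) ≤ t ∧ (2 : ℝ) ^ m ≤ 2 * t⁻¹ := by
  obtain ⟨n, h1, h2⟩ := exists_mem_Ico_zpow (y := (2 : ℝ)) ht one_lt_two
  refine ⟨-n, by rwa [neg_neg], ?_⟩
  rw [zpow_neg, inv_le_iff_one_le_mul₀ (by positivity)]
  rw [zpow_add₀ two_ne_zero, zpow_one] at h2
  rw [mul_assoc, mul_comm t⁻¹, ← mul_assoc, ← div_eq_mul_inv, le_div_iff₀ ht]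
  linarith

lemma count_half {K : ℕ} {m : ℤ} (hm : 2 * |m| ≤ K) :
    ((K : ℝ) + 1) / 2 ≤ ∑ j : Fin (K + 1), ∑ k : Fin (K + 1), (if (k : ℤ) = j + m then (1 : ℝ) else 0) := by
  have h1 : ∀ j : Fin (K + 1), (if 0 ≤ (j : ℤ) + m ∧ (j : ℤ) + m ≤ K then (1 : ℝ) else 0) ≤
      ∑ k : Fin (K + 1), (if (k : ℤ) = j + m then (1 : ℝ) else 0) := by
    intro j
    split_ifs with h
    · have hk : (((j : ℤ) + m).toNat) < K + 1 := by omega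
      refine le_trans ?_ (Finset.single_le_sum (f := fun k : Fin (K + 1) => (if (k : ℤ) = j + m then (1 : ℝ) else 0))
        (fun k _ => by positivity) (Finset.mem_univ ⟨((j : ℤ) + m).toNat, hk⟩))
      simp only
      rw [if_pos]
      omega
    · exact Finset.sum_nonneg fun k _ => by positivity
  refine le_trans ?_ (Finset.sum_le_sum fun j _ => h1 j)
  rw [Finset.sum_boole]
  rcases le_total 0 m with h0 | h0
  · rw [abs_of_nonneg h0] at hm
    have hL : ∀ i : Fin (K + 1 - m.toNat), (i : ℕ) < K + 1 := fun i => by omega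
    have : (Finset.univ.image (fun i : Fin (K + 1 - m.toNat) => (⟨i, hL i⟩ : Fin (K + 1)))) ⊆
        Finset.univ.filter (fun j : Fin (K + 1) => 0 ≤ (j : ℤ) + m ∧ (j : ℤ) + m ≤ K) := by
      intro j hj
      simp only [Finset.mem_image, Finset.mem_univ, true_and, Finset.mem_filter] at hj ⊢
      obtain ⟨i, rfl⟩ := hj
      simp only
      omega
    have h2 := Finset.card_le_card this
    rw [Finset.card_image_of_injective _ (fun a b h => by simpa [Fin.ext_iff] using h), Finset.card_univ, Fintype.card_fin] at h2
    have h3 : (K + 1 : ℕ) ≤ 2 * (Finset.univ.filter (fun j : Fin (K + 1) => 0 ≤ (j : ℤ) + m ∧ (j : ℤ) + m ≤ K)).card := by omega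
    have h4 : ((K + 1 : ℕ) : ℝ) ≤ ((2 * (Finset.univ.filter (fun j : Fin (K + 1) => 0 ≤ (j : ℤ) + m ∧ (j : ℤ) + m ≤ K)).card : ℕ) : ℝ) := by
      exact_mod_cast h3
    push_cast at h4
    linarith
  · rw [abs_of_nonpos h0] at hm
    have hL : ∀ i : Fin (K + 1 - (-m).toNat), (i : ℕ) + (-m).toNat < K + 1 := fun i => by omega
    have : (Finset.univ.image (fun i : Fin (K + 1 - (-m).toNat) => (⟨i + (-m).toNat, hL i⟩ : Fin (K + 1)))) ⊆
        Finset.univ.filter (fun j : Fin (K + 1) => 0 ≤ (j : ℤ) + m ∧ (j : ℤ) + m ≤ K) := by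
      intro j hj
      simp only [Finset.mem_image, Finset.mem_univ, true_and, Finset.mem_filter] at hj ⊢
      obtain ⟨i, rfl⟩ := hj
      simp only
      push_cast
      omega
    have h2 := Finset.card_le_card this
    rw [Finset.card_image_of_injective _ (fun a b h => by simpa [Fin.ext_iff] using h), Finset.card_univ, Fintype.card_fin] at h2
    have h3 : (K + 1 : ℕ) ≤ 2 * (Finset.univ.filter (fun j : Fin (K + 1) => 0 ≤ (j : ℤ) + m ∧ (j : ℤ) + m ≤ K)).card := by omega
    have h4 : ((K + 1 : ℕ) : ℝ) ≤ ((2 * (Finset.univ.filter (fun j : Fin (K + 1) => 0 ≤ (j : ℤ) + m ∧ (j : ℤ) + m ≤ K)).card : ℕ) : ℝ) := by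
      exact_mod_cast h3
    push_cast at h4
    linarith

/-- the combinatorial weight system -/
lemma exists_weights {I : Type*} [Fintype I] (t : I → ℝ) (ht : ∀ i, 0 < t i) :
    ∃ (n : ℕ) (ρ : Fin n → ℝ) (x y : I → Fin n → Fin n → ℝ), (∀ r, 0 ≤ ρ r) ∧ ∑ r, ρ r ≤ 1 ∧
      (∀ i r, ∑ s, x i r s ^ 2 ≤ 1) ∧ (∀ i s, ∑ r, x i r s ^ 2 ≤ t i) ∧
      (∀ i s, ∑ r, y i r s ^ 2 ≤ 1) ∧ (∀ i r, ∑ s, y i r s ^ 2 ≤ (t i)⁻¹) ∧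
      ∀ i, 1 / 4 ≤ ∑ r, ∑ s, Real.sqrt (ρ r) * Real.sqrt (ρ s) * (x i r s * y i r s) := by
  choose m hm1 hm2 using fun i => exists_dyadic (ht i)
  obtain ⟨K, hK⟩ : ∃ K : ℕ, ∀ i, 2 * |m i| ≤ K := by
    refine ⟨∑ i, (2 * |m i|).toNat, fun i => ?_⟩
    have h := Finset.single_le_sum (f := fun i => (2 * |m i|).toNat) (fun _ _ => Nat.zero_le _) (Finset.mem_univ i)
    omega
  let R := Σ k : Fin (K + 1), Fin (2 ^ k.val)
  let blk : R → Fin (K + 1) := fun r => r.1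
  have hsum : ∀ f : Fin (K + 1) → ℝ, ∑ r : R, f (blk r) = ∑ k : Fin (K + 1), (2 : ℝ) ^ k.val * f k := by
    intro f
    rw [Fintype.sum_sigma]
    simp [blk]
  let g : Fin (K + 1) → ℝ := fun k => ((2 : ℝ) ^ k.val)⁻¹
  have hg : ∀ k, 0 < g k := fun k => by positivity
  let ρ : R → ℝ := fun r => g (blk r) / (K + 1)
  let δ : I → R → R → ℝ := fun i r s => if ((blk s : ℕ) : ℤ) = (blk r : ℕ) + m i then 1 else 0
  let x : I → R → R → ℝ := fun i r s => δ i r s * Real.sqrt (g (blk s))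
  let y : I → R → R → ℝ := fun i r s => δ i r s * (1 / 2 * Real.sqrt (g (blk r)))
  have hδ : ∀ i r s, δ i r s ^ 2 = δ i r s := fun i r s => by simp only [δ]; split_ifs <;> norm_num
  have hx2 : ∀ i r s, x i r s ^ 2 = (if ((blk s : ℕ) : ℤ) = (blk r : ℕ) + m i then 1 else 0) * g (blk s) := fun i r s => by
    simp only [x, mul_pow, hδ, Real.sq_sqrt (hg _).le, δ]
  have hy2 : ∀ i r s, y i r s ^ 2 = (if ((blk s : ℕ) : ℤ) = (blk r : ℕ) + m i then 1 else 0) * (1 / 4 * g (blk r)) := fun i r s => by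
    simp only [y, mul_pow, hδ, Real.sq_sqrt (hg _).le, δ]; norm_num
  have hzp : ∀ (j k : Fin (K + 1)) (z : ℤ), (k : ℤ) = j + z → (2 : ℝ) ^ k.val = 2 ^ j.val * 2 ^ z := by
    intro j k z h
    rw [← zpow_natCast, h, zpow_add₀ two_ne_zero, zpow_natCast]
  have main : (∀ r, 0 ≤ ρ r) ∧ ∑ r, ρ r ≤ 1 ∧
      (∀ i r, ∑ s, x i r s ^ 2 ≤ 1) ∧ (∀ i s, ∑ r, x i r s ^ 2 ≤ t i) ∧
      (∀ i s, ∑ r, y i r s ^ 2 ≤ 1) ∧ (∀ i r, ∑ s, y i r s ^ 2 ≤ (t i)⁻¹) ∧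
      ∀ i, 1 / 4 ≤ ∑ r, ∑ s, Real.sqrt (ρ r) * Real.sqrt (ρ s) * (x i r s * y i r s) := by
    refine ⟨fun r => by positivity, ?_, ?_, ?_, ?_, ?_, ?_⟩
    · simp only [ρ]
      rw [hsum (fun k => g k / (K + 1))]
      have : ∀ k : Fin (K + 1), (2 : ℝ) ^ k.val * (g k / (K + 1)) = 1 / (K + 1) := fun k => by
        simp only [g]; field_simp
      simp only [this, Finset.sum_const, Finset.card_univ, Fintype.card_fin, nsmul_eq_mul]
      push_cast
      rw [mul_one_div_cancel (by positivity)]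
    · intro i r
      simp only [hx2]
      rw [hsum (fun k => (if ((k : ℕ) : ℤ) = (blk r : ℕ) + m i then 1 else 0) * g k)]
      have : ∀ k : Fin (K + 1), (2 : ℝ) ^ k.val * ((if ((k : ℕ) : ℤ) = (blk r : ℕ) + m i then 1 else 0) * g k) =
          if ((k : ℕ) : ℤ) = (blk r : ℕ) + m i then 1 else 0 := fun k => by
        simp only [g]; field_simp
      simp only [this]
      exact ind_le_one _ fun k k' h h' => by ext; omega
    · intro i s
      simp only [hx2]
      rw [hsum (fun j => (if ((blk s : ℕ) : ℤ) = (j : ℕ) + m i then 1 else 0) * g (blk s))]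
      have : ∀ j : Fin (K + 1), (2 : ℝ) ^ j.val * ((if ((blk s : ℕ) : ℤ) = (j : ℕ) + m i then 1 else 0) * g (blk s)) =
          2 ^ (-m i) * if ((blk s : ℕ) : ℤ) = (j : ℕ) + m i then 1 else 0 := fun k => by
        split_ifs with h
        · simp only [g, one_mul, mul_one]
          rw [hzp _ _ _ h, mul_inv, ← mul_assoc, mul_inv_cancel₀ (by positivity), one_mul, zpow_neg]
        · simp
      simp only [this, ← Finset.mul_sum]
      refine le_trans ?_ (hm1 i)
      refine mul_le_of_le_one_right (by positivity) (ind_le_one _ fun k k' h h' => by ext; omega)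
    · intro i s
      simp only [hy2]
      rw [hsum (fun j => (if ((blk s : ℕ) : ℤ) = (j : ℕ) + m i then 1 else 0) * (1 / 4 * g j))]
      have : ∀ j : Fin (K + 1), (2 : ℝ) ^ j.val * ((if ((blk s : ℕ) : ℤ) = (j : ℕ) + m i then 1 else 0) * (1 / 4 * g j)) =
          1 / 4 * if ((blk s : ℕ) : ℤ) = (j : ℕ) + m i then 1 else 0 := fun k => by
        simp only [g]; field_simp
      simp only [this, ← Finset.mul_sum]
      have := ind_le_one (K := K) (fun j => ((blk s : ℕ) : ℤ) = (j : ℕ) + m i) fun k k' h h' => by ext; omega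
      linarith
    · intro i r
      simp only [hy2]
      rw [hsum (fun k => (if ((k : ℕ) : ℤ) = (blk r : ℕ) + m i then 1 else 0) * (1 / 4 * g (blk r)))]
      have : ∀ k : Fin (K + 1), (2 : ℝ) ^ k.val * ((if ((k : ℕ) : ℤ) = (blk r : ℕ) + m i then 1 else 0) * (1 / 4 * g (blk r))) =
          1 / 4 * 2 ^ (m i) * if ((k : ℕ) : ℤ) = (blk r : ℕ) + m i then 1 else 0 := fun k => by
        split_ifs with h
        · simp only [g, one_mul, mul_one]
          rw [hzp _ _ _ h]
          field_simp
        · simp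
      simp only [this, ← Finset.mul_sum]
      have h1 := ind_le_one (K := K) (fun k => ((k : ℕ) : ℤ) = (blk r : ℕ) + m i) fun k k' h h' => by ext; omega
      have h2 : (0 : ℝ) < 2 ^ (m i) := by positivity
      have h3 : 0 < (t i)⁻¹ := inv_pos.2 (ht i)
      have h4 := hm2 i
      calc _ ≤ 1 / 4 * 2 ^ (m i) * (1 : ℝ) := mul_le_mul_of_nonneg_left h1 (by positivity)
        _ ≤ _ := by linarith
    · intro i
      have e : ∀ r s, Real.sqrt (ρ r) * Real.sqrt (ρ s) * (x i r s * y i r s) =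
          (1 / (2 * (K + 1))) * ((if ((blk s : ℕ) : ℤ) = (blk r : ℕ) + m i then 1 else 0) * g (blk r) * g (blk s)) := by
        intro r s
        simp only [ρ, x, y]
        rw [Real.sqrt_div' _ (by positivity), Real.sqrt_div' _ (by positivity)]
        have h1 := Real.mul_self_sqrt (hg (blk r)).le
        have h2 := Real.mul_self_sqrt (hg (blk s)).le
        have h3 : Real.sqrt ((K : ℝ) + 1) * Real.sqrt ((K : ℝ) + 1) = K + 1 := Real.mul_self_sqrt (by positivity)
        calc _ = (δ i r s ^ 2 * (Real.sqrt (g (blk r)) * Real.sqrt (g (blk r))) * (Real.sqrt (g (blk s)) * Real.sqrt (g (blk s)))) * (1 / 2)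
              / (Real.sqrt ((K : ℝ) + 1) * Real.sqrt ((K : ℝ) + 1)) := by ring
          _ = _ := by
            rw [h1, h2, h3, hδ]; simp only [δ]; field_simp
      simp only [e, ← Finset.mul_sum]
      have e2 : ∀ r, ∑ s, ((if ((blk s : ℕ) : ℤ) = (blk r : ℕ) + m i then 1 else 0) * g (blk r) * g (blk s)) =
          g (blk r) * ∑ k : Fin (K + 1), if ((k : ℕ) : ℤ) = (blk r : ℕ) + m i then 1 else 0 := by
        intro r
        rw [hsum (fun k => (if ((k : ℕ) : ℤ) = (blk r : ℕ) + m i then 1 else 0) * g (blk r) * g k), Finset.mul_sum]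
        refine Finset.sum_congr rfl fun k _ => ?_
        simp only [g]; field_simp
      simp only [e2]
      rw [hsum (fun j => g j * ∑ k : Fin (K + 1), if ((k : ℕ) : ℤ) = (j : ℕ) + m i then 1 else 0)]
      have e3 : ∀ j : Fin (K + 1), (2 : ℝ) ^ j.val * (g j * ∑ k : Fin (K + 1), if ((k : ℕ) : ℤ) = (j : ℕ) + m i then 1 else 0) =
          ∑ k : Fin (K + 1), if ((k : ℕ) : ℤ) = (j : ℕ) + m i then (1 : ℝ) else 0 := fun j => by
        rw [← mul_assoc]; simp only [g]; rw [mul_inv_cancel₀ (by positivity), one_mul]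
      simp only [e3]
      have := count_half (hK i)
      calc (1 / 4 : ℝ) = 1 / (2 * (K + 1)) * (((K : ℝ) + 1) / 2) := by field_simp; norm_num
        _ ≤ _ := mul_le_mul_of_nonneg_left this (by positivity)
  let e := Fintype.equivFin R
  obtain ⟨m1, m2, m3, m4, m5, m6, m7⟩ := main
  refine ⟨Fintype.card R, fun r => ρ (e.symm r), fun i r s => x i (e.symm r) (e.symm s), fun i r s => y i (e.symm r) (e.symm s),
    fun r => m1 _, ?_, fun i r => ?_, fun i s => ?_, fun i s => ?_, fun i r => ?_, fun i => ?_⟩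
  · rw [e.symm.sum_comp ρ]; exact m2
  · rw [e.symm.sum_comp (fun s => x i (e.symm r) s ^ 2)]; exact m3 _ _
  · rw [e.symm.sum_comp (fun r => x i r (e.symm s) ^ 2)]; exact m4 _ _
  · rw [e.symm.sum_comp (fun r => y i r (e.symm s) ^ 2)]; exact m5 _ _
  · rw [e.symm.sum_comp (fun s => y i (e.symm r) s ^ 2)]; exact m6 _ _
  · refine (m7 i).trans (le_of_eq ?_)
    rw [← e.symm.sum_comp]
    refine Finset.sum_congr rfl fun r _ => ?_
    rw [← e.symm.sum_comp]
end

section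
section HM
variable {C D : Type*} [CStarAlgebra C] [PartialOrder C] [StarOrderedRing C]
  [CStarAlgebra D] [PartialOrder D] [StarOrderedRing D]

/-- diagonal matrix -/
def cdiag {n : ℕ} (d : Fin n → C) : CStarMatrix (Fin n) (Fin n) C := fun i j => if i = j then d i else 0

/-- matrix unit with coefficient -/
def cunit {n : ℕ} (r s : Fin n) (a : C) : CStarMatrix (Fin n) (Fin n) C :=
  fun i j => if i = r then (if j = s then a else 0) else 0

lemma cdiag_le_one {n : ℕ} [PartialOrder (CStarMatrix (Fin n) (Fin n) C)]
    [StarOrderedRing (CStarMatrix (Fin n) (Fin n) C)] (d : Fin n → C) (hd : ∀ i, d i ≤ 1) : cdiag d ≤ 1 := by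
  have : ∀ i, ∃ z : C, 1 - d i = star z * z := fun i =>
    CStarAlgebra.nonneg_iff_eq_star_mul_self.1 (sub_nonneg.2 (hd i))
  choose z hz using this
  rw [← sub_nonneg]
  have e : (1 : CStarMatrix (Fin n) (Fin n) C) - cdiag d = star (cdiag z) * cdiag z := by
    ext i j
    simp only [CStarMatrix.sub_apply, CStarMatrix.one_apply, CStarMatrix.mul_apply, CStarMatrix.star_apply, cdiag]
    by_cases h : i = j
    · subst h
      rw [Finset.sum_eq_single i (by intro k _ hk; simp [hk]) (by simp)]
      simp [hz]
    · rw [Finset.sum_eq_zero]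
      · simp [h]
      · intro k _
        by_cases hk : k = i
        · subst hk; simp [h]
        · simp [hk]
  rw [e]
  exact star_mul_self_nonneg _

lemma cunit_star_mul {n : ℕ} (r s : Fin n) (a : C) : star (cunit r s a) * cunit r s a = cunit s s (star a * a) := by
  ext i j
  simp only [CStarMatrix.mul_apply, CStarMatrix.star_apply, cunit]
  rw [Finset.sum_eq_single r (by intro k _ hk; simp [hk]) (by simp)]
  by_cases h : i = s <;> by_cases h' : j = s <;> simp [h, h']

lemma cunit_mul_star {n : ℕ} (r s : Fin n) (a : C) : cunit r s a * star (cunit r s a) = cunit r r (a * star a) := by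
  ext i j
  simp only [CStarMatrix.mul_apply, CStarMatrix.star_apply, cunit]
  rw [Finset.sum_eq_single s (by intro k _ hk; simp [hk]) (by simp)]
  by_cases h : i = r <;> by_cases h' : j = r <;> simp [h, h']

lemma csum_apply {n : ℕ} {I : Type*} (s : Finset I) (f : I → CStarMatrix (Fin n) (Fin n) C) (i j : Fin n) :
    (∑ k ∈ s, f k) i j = ∑ k ∈ s, f k i j := by
  classical
  induction s using Finset.induction_on with
  | empty => simp
  | insert a s ha ih => rw [Finset.sum_insert ha, Finset.sum_insert ha, CStarMatrix.add_apply, ih]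

lemma tuple_star_mul {n : ℕ} {I : Type*} [Fintype I] (a : I → C) (x : I → Fin n → Fin n → ℝ) :
    ∑ j : I × Fin n × Fin n, star (cunit j.2.1 j.2.2 (x j.1 j.2.1 j.2.2 • a j.1)) *
      cunit j.2.1 j.2.2 (x j.1 j.2.1 j.2.2 • a j.1) =
    cdiag fun s => ∑ i, (∑ r, x i r s ^ 2) • (star (a i) * a i) := by
  simp only [cunit_star_mul, Fintype.sum_prod_type]
  ext k l
  simp only [csum_apply, cdiag, cunit]
  by_cases h : k = l
  · subst h
    simp only [if_true]
    refine Finset.sum_congr rfl fun i _ => ?_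
    rw [Finset.sum_smul]
    refine Finset.sum_congr rfl fun r _ => ?_
    rw [Finset.sum_eq_single k (by intro s _ hs; simp [hs.symm]) (by simp)]
    simp [pow_two, mul_smul]
  · rw [if_neg h]
    refine Finset.sum_eq_zero fun i _ => Finset.sum_eq_zero fun r _ => Finset.sum_eq_zero fun s _ => ?_
    by_cases h1 : k = s
    · subst h1; simp [Ne.symm h]
    · simp [h1]

lemma tuple_mul_star {n : ℕ} {I : Type*} [Fintype I] (a : I → C) (x : I → Fin n → Fin n → ℝ) :
    ∑ j : I × Fin n × Fin n, cunit j.2.1 j.2.2 (x j.1 j.2.1 j.2.2 • a j.1) *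
      star (cunit j.2.1 j.2.2 (x j.1 j.2.1 j.2.2 • a j.1)) =
    cdiag fun r => ∑ i, (∑ s, x i r s ^ 2) • (a i * star (a i)) := by
  simp only [cunit_mul_star, Fintype.sum_prod_type]
  ext k l
  simp only [csum_apply, cdiag, cunit]
  by_cases h : k = l
  · subst h
    simp only [if_true]
    refine Finset.sum_congr rfl fun i _ => ?_
    rw [Finset.sum_eq_single k (by intro s _ hs; simp [hs.symm]) (by simp)]
    rw [Finset.sum_smul]
    refine Finset.sum_congr rfl fun r _ => ?_
    simp [pow_two, mul_smul]
  · rw [if_neg h]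
    refine Finset.sum_eq_zero fun i _ => Finset.sum_eq_zero fun r _ => Finset.sum_eq_zero fun s _ => ?_
    by_cases h1 : k = r
    · subst h1; simp [Ne.symm h]
    · simp [h1]

lemma sum_smul_le {I : Type*} [Fintype I] {x t : I → ℝ} {p : I → C} (hp : ∀ i, 0 ≤ p i) (hx : ∀ i, x i ≤ t i)
    (h : ∑ i, t i • p i ≤ 1) : ∑ i, x i • p i ≤ 1 :=
  (Finset.sum_le_sum fun i _ => smul_le_smul_of_nonneg_right (hx i) (hp i)).trans h

/-- the amplified form -/
def ampForm {n : ℕ} (ρ : Fin n → ℝ) (T : C →ₗ[ℂ] D →ₗ[ℂ] ℂ) :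
    CStarMatrix (Fin n) (Fin n) C →ₗ[ℂ] CStarMatrix (Fin n) (Fin n) D →ₗ[ℂ] ℂ :=
  LinearMap.mk₂ ℂ (fun v w => ∑ r, ∑ s, ((Real.sqrt (ρ r) * Real.sqrt (ρ s) : ℝ) : ℂ) * T (v r s) (w r s))
    (by intro a b c; simp only [CStarMatrix.add_apply, map_add, LinearMap.add_apply, mul_add, Finset.sum_add_distrib])
    (by intro a b c; simp only [CStarMatrix.smul_apply, map_smul, LinearMap.smul_apply, smul_eq_mul, Finset.mul_sum]
        refine Finset.sum_congr rfl fun i _ => Finset.sum_congr rfl fun j _ => ?_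
        ring)
    (by intro a b c; simp only [CStarMatrix.add_apply, map_add, LinearMap.add_apply, mul_add, Finset.sum_add_distrib])
    (by intro a b c; simp only [CStarMatrix.smul_apply, map_smul, LinearMap.smul_apply, smul_eq_mul, Finset.mul_sum]
        refine Finset.sum_congr rfl fun i _ => Finset.sum_congr rfl fun j _ => ?_
        ring)

lemma ampForm_apply {n : ℕ} (ρ : Fin n → ℝ) (T : C →ₗ[ℂ] D →ₗ[ℂ] ℂ) (v : CStarMatrix (Fin n) (Fin n) C)
    (w : CStarMatrix (Fin n) (Fin n) D) : ampForm ρ T v w =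
    ∑ r, ∑ s, ((Real.sqrt (ρ r) * Real.sqrt (ρ s) : ℝ) : ℂ) * T (v r s) (w r s) := rfl

lemma ampForm_bound {n : ℕ} (ρ : Fin n → ℝ) (hρ : ∀ r, 0 ≤ ρ r) (hρ1 : ∑ r, ρ r ≤ 1) {T : C →ₗ[ℂ] D →ₗ[ℂ] ℂ}
    {κ : ℝ} (h : IsJCB T κ) (v : CStarMatrix (Fin n) (Fin n) C)
    (w : CStarMatrix (Fin n) (Fin n) D) (hv : ‖v‖ ≤ 1) (hw : ‖w‖ ≤ 1) : ‖ampForm ρ T v w‖ ≤ κ := by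
  let α : Fin n × Fin n → ℂ := fun i => if i.1 = i.2 then (Real.sqrt (ρ i.1) : ℂ) else 0
  have hα : ∑ i, ‖α i‖ ^ 2 ≤ 1 := by
    refine le_trans (le_of_eq ?_) hρ1
    rw [Fintype.sum_prod_type]
    refine Finset.sum_congr rfl fun i _ => ?_
    rw [Finset.sum_eq_single i (by intro k _ hk; simp [α, hk.symm]) (by simp)]
    simp [α, Real.sq_sqrt (hρ i)]
  have := h n n α α v w hα hα hv hw
  refine le_trans (le_of_eq ?_) this
  rw [ampForm_apply]
  congr 1
  rw [Fintype.sum_prod_type]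
  refine Finset.sum_congr rfl fun r _ => ?_
  symm
  rw [Finset.sum_eq_single r (by intro k _ hk; simp [α, hk.symm]) (by simp), Fintype.sum_prod_type]
  refine Finset.sum_congr rfl fun s _ => ?_
  rw [Finset.sum_eq_single s (by intro k _ hk; simp [α, hk.symm]) (by simp)]
  simp [α]

lemma gt_scaled {P Q : Type*} [CStarAlgebra P] [CStarAlgebra Q] [PartialOrder P] [StarOrderedRing P]
    [PartialOrder Q] [StarOrderedRing Q] (U : P →ₗ[ℂ] Q →ₗ[ℂ] ℂ) {κ : ℝ}
    (hU : ∀ (u : P) (v : Q), ‖u‖ ≤ 1 → ‖v‖ ≤ 1 → ‖U u v‖ ≤ κ)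
    {ι : Type*} [Fintype ι] (a : ι → P) (b : ι → Q) (ha1 : ∑ i, star (a i) * a i ≤ 1)
    (ha2 : ∑ i, a i * star (a i) ≤ 1) (hb1 : ∑ i, star (b i) * b i ≤ 1)
    (hb2 : ∑ i, b i * star (b i) ≤ 1) : ‖∑ i, U (a i) (b i)‖ ≤ 17928 * κ := by
  have key : ∀ δ : ℝ, 0 < δ → ‖∑ i, U (a i) (b i)‖ ≤ 17928 * (κ + δ) := by
    intro δ hδ
    have hκ : 0 ≤ κ := (norm_nonneg _).trans (hU 0 0 (by simp) (by simp))
    have hpos : 0 < κ + δ := by linarith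
    have := gt_cplx ((((κ + δ)⁻¹ : ℝ) : ℂ) • U) (fun u v => by
      rw [LinearMap.smul_apply, LinearMap.smul_apply, norm_smul, Complex.norm_real, Real.norm_of_nonneg (by positivity)]
      rw [inv_mul_le_iff₀ hpos]
      have h1 : ‖(u : P)‖ ≤ 1 := by
        rcases subsingleton_or_nontrivial P with h | h
        · rw [Subsingleton.elim (u : P) 0]; simp
        · exact (CStarRing.norm_coe_unitary u).le
      have h2 : ‖(v : Q)‖ ≤ 1 := by
        rcases subsingleton_or_nontrivial Q with h | h
        · rw [Subsingleton.elim (v : Q) 0]; simp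
        · exact (CStarRing.norm_coe_unitary v).le
      have := hU u v h1 h2
      linarith) a b ha1 ha2 hb1 hb2
    simp only [LinearMap.smul_apply, ← Finset.smul_sum] at this
    rw [norm_smul, Complex.norm_real, Real.norm_of_nonneg (by positivity), inv_mul_le_iff₀ hpos] at this
    linarith
  refine ge_of_tendsto (x := nhdsWithin (0:ℝ) (Set.Ioi 0)) (f := fun δ => 17928 * (κ + δ)) ?_ ?_
  · refine Filter.Tendsto.mono_left ?_ nhdsWithin_le_nhds
    have : Continuous (fun δ : ℝ => 17928 * (κ + δ)) := by fun_prop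
    simpa using this.tendsto 0
  · filter_upwards [self_mem_nhdsWithin] with δ hδ using key δ hδ

lemma gt_matrix {n : ℕ} (U : CStarMatrix (Fin n) (Fin n) C →ₗ[ℂ] CStarMatrix (Fin n) (Fin n) D →ₗ[ℂ] ℂ) {κ : ℝ}
    (hU : ∀ u v, ‖u‖ ≤ 1 → ‖v‖ ≤ 1 → ‖U u v‖ ≤ κ) {I : Type*} [Fintype I] (a : I → C) (b : I → D)
    (x y : I → Fin n → Fin n → ℝ) (t : I → ℝ) 
    (h1 : ∀ i r, ∑ s, x i r s ^ 2 ≤ 1) (h2 : ∀ i s, ∑ r, x i r s ^ 2 ≤ t i)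
    (h3 : ∀ i s, ∑ r, y i r s ^ 2 ≤ 1) (h4 : ∀ i r, ∑ s, y i r s ^ 2 ≤ (t i)⁻¹)
    (ha1 : ∑ i, a i * star (a i) ≤ 1) (ha2 : ∑ i, t i • (star (a i) * a i) ≤ 1)
    (hb1 : ∑ i, star (b i) * b i ≤ 1) (hb2 : ∑ i, (t i)⁻¹ • (b i * star (b i)) ≤ 1) :
    ‖∑ j : I × Fin n × Fin n, U (cunit j.2.1 j.2.2 (x j.1 j.2.1 j.2.2 • a j.1))
      (cunit j.2.1 j.2.2 (y j.1 j.2.1 j.2.2 • b j.1))‖ ≤ 17928 * κ := by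
  letI := CStarAlgebra.spectralOrder (CStarMatrix (Fin n) (Fin n) C)
  haveI := CStarAlgebra.spectralOrderedRing (CStarMatrix (Fin n) (Fin n) C)
  letI := CStarAlgebra.spectralOrder (CStarMatrix (Fin n) (Fin n) D)
  haveI := CStarAlgebra.spectralOrderedRing (CStarMatrix (Fin n) (Fin n) D)
  refine gt_scaled U hU _ _ ?_ ?_ ?_ ?_
  · rw [tuple_star_mul]
    exact cdiag_le_one _ fun s => sum_smul_le (fun i => star_mul_self_nonneg _) (fun i => h2 i s) ha2
  · rw [tuple_mul_star]
    exact cdiag_le_one _ fun s => sum_smul_le (t := fun _ => 1) (fun i => mul_star_self_nonneg _) (fun i => h1 i s) (by simpa using ha1)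
  · rw [tuple_star_mul]
    exact cdiag_le_one _ fun s => sum_smul_le (t := fun _ => 1) (fun i => star_mul_self_nonneg _) (fun i => h3 i s) (by simpa using hb1)
  · rw [tuple_mul_star]
    exact cdiag_le_one _ fun s => sum_smul_le (fun i => mul_star_self_nonneg _) (fun i => h4 i s) hb2

lemma ampForm_cunit {n : ℕ} (ρ : Fin n → ℝ) (T : C →ₗ[ℂ] D →ₗ[ℂ] ℂ) (r s : Fin n) (a : C) (b : D) :
    ampForm ρ T (cunit r s a) (cunit r s b) = ((Real.sqrt (ρ r) * Real.sqrt (ρ s) : ℝ) : ℂ) * T a b := by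
  rw [ampForm_apply, Finset.sum_eq_single r (by intro k _ hk; simp [cunit, hk]) (by simp),
    Finset.sum_eq_single s (by intro k _ hk; simp [cunit, hk]) (by simp)]
  simp [cunit]

theorem hm_tuple {T : C →ₗ[ℂ] D →ₗ[ℂ] ℂ} {κ : ℝ} (h : IsJCB T κ) {I : Type*} [Fintype I] (a : I → C) (b : I → D)
    (t : I → ℝ) (ht : ∀ i, 0 < t i)
    (ha1 : ∑ i, a i * star (a i) ≤ 1) (ha2 : ∑ i, t i • (star (a i) * a i) ≤ 1)
    (hb1 : ∑ i, star (b i) * b i ≤ 1) (hb2 : ∑ i, (t i)⁻¹ • (b i * star (b i)) ≤ 1) :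
    ‖∑ i, T (a i) (b i)‖ ≤ 71712 * κ := by
  obtain ⟨n, ρ, x, y, hρ, hρ1, h1, h2, h3, h4, h5⟩ := exists_weights t ht
  set c : I → ℝ := fun i => ∑ r, ∑ s, Real.sqrt (ρ r) * Real.sqrt (ρ s) * (x i r s * y i r s) with hc
  have hc0 : ∀ i, 0 < c i := fun i => lt_of_lt_of_le (by norm_num) (h5 i)
  have hl : ∀ i, (4 * c i)⁻¹ ^ 2 ≤ 1 := fun i => by
    have : (4 * c i)⁻¹ ≤ 1 := inv_le_one_of_one_le₀ (by linarith [h5 i])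
    have h0 : 0 ≤ (4 * c i)⁻¹ := by have := hc0 i; positivity
    nlinarith
  have key := gt_matrix (ampForm ρ T) (fun u v hu hv => ampForm_bound ρ hρ hρ1 h u v hu hv)
    (fun i => (4 * c i)⁻¹ • a i) b x y t h1 h2 h3 h4
    (by
      simp only [star_smul, smul_mul_smul_comm, star_trivial, ← pow_two]
      exact sum_smul_le (t := fun _ => 1) (fun i => mul_star_self_nonneg _) hl (by simpa using ha1))
    (by
      simp only [star_smul, smul_mul_smul_comm, star_trivial, ← pow_two, smul_smul]
      refine sum_smul_le (fun i => star_mul_self_nonneg _) (fun i => ?_) ha2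
      nlinarith [hl i, ht i]) hb1 hb2
  simp only [ampForm_cunit, Fintype.sum_prod_type] at key
  have e : ∀ i, ∑ r, ∑ s, ((Real.sqrt (ρ r) * Real.sqrt (ρ s) : ℝ) : ℂ) * T (x i r s • (4 * c i)⁻¹ • a i) (y i r s • b i)
      = 4⁻¹ * T (a i) (b i) := by
    intro i
    have : ∀ r s, ((Real.sqrt (ρ r) * Real.sqrt (ρ s) : ℝ) : ℂ) * T (x i r s • (4 * c i)⁻¹ • a i) (y i r s • b i) =
        ((Real.sqrt (ρ r) * Real.sqrt (ρ s) * (x i r s * y i r s) : ℝ) : ℂ) * (((4 * c i)⁻¹ : ℝ) * T (a i) (b i)) := by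
      intro r s
      simp only [← Complex.coe_smul, map_smul, LinearMap.smul_apply, smul_eq_mul]
      push_cast; ring
    simp only [this, ← Finset.sum_mul, ← Complex.ofReal_sum]
    change (c i : ℂ) * _ = _
    have := (hc0 i).ne'
    have hcc : (c i : ℂ) ≠ 0 := by exact_mod_cast this
    push_cast
    field_simp
  simp only [e, ← Finset.mul_sum, norm_mul] at key
  norm_num at key
  linarith
end HM
end

section
section MV
open Matrix
/-- action of scalar matrices on tuples -/
def mv {I J V : Type*} [Fintype J] [AddCommMonoid V] [Module ℂ V] (R : Matrix I J ℂ) (x : J → V) : I → V :=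
  fun i => ∑ j, R i j • x j

lemma mv_mv {I J K V : Type*} [Fintype J] [Fintype K] [AddCommMonoid V] [Module ℂ V]
    (R : Matrix I J ℂ) (Q : Matrix J K ℂ) (x : K → V) : mv R (mv Q x) = mv (R * Q) x := by
  ext i
  simp only [mv, Matrix.mul_apply, Finset.smul_sum, smul_smul, Finset.sum_smul]
  rw [Finset.sum_comm]

lemma mv_one {I V : Type*} [Fintype I] [DecidableEq I] [AddCommMonoid V] [Module ℂ V] (x : I → V) :
    mv (1 : Matrix I I ℂ) x = x := by
  ext i
  simp [mv, Matrix.one_apply]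

lemma sum_mv_tmul {I J V W : Type*} [Fintype I] [Fintype J] [AddCommGroup V] [Module ℂ V] [AddCommGroup W] [Module ℂ W]
    (R : Matrix I J ℂ) (x : J → V) (y : I → W) :
    ∑ i, (mv R x i) ⊗ₜ[ℂ] (y i) = ∑ j, (x j) ⊗ₜ[ℂ] (mv Rᵀ y j) := by
  simp only [mv, TensorProduct.sum_tmul, TensorProduct.tmul_sum, TensorProduct.smul_tmul, Matrix.transpose_apply]
  rw [Finset.sum_comm]

section Pos
variable {C : Type*} [CStarAlgebra C] [PartialOrder C] [StarOrderedRing C]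

lemma sum_star_mv_mul {I J : Type*} [Fintype I] [Fintype J] (R : Matrix I J ℂ) (x : J → C) :
    ∑ i, star (mv R x i) * mv R x i = ∑ i, ∑ j, (Rᴴ * R) i j • (star (x i) * x j) := by
  simp only [mv, star_sum, star_smul, Finset.sum_mul, Finset.mul_sum, smul_mul_smul_comm, Matrix.mul_apply,
    Matrix.conjTranspose_apply, Finset.sum_smul]
  rw [Finset.sum_comm]
  rw [Finset.sum_congr rfl fun i _ => Finset.sum_comm]
  rw [Finset.sum_comm]

/-- contractive scalar matrices decrease column squares -/
lemma contr_col {I J : Type*} [Fintype I] [Fintype J] [DecidableEq J] (R : Matrix I J ℂ) {E : Matrix J J ℂ}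
    (hE : 1 - Rᴴ * R = Eᴴ * E) (x : J → C) :
    ∑ i, star (mv R x i) * mv R x i ≤ ∑ j, star (x j) * x j := by
  have h1 : ∑ i, star (mv R x i) * mv R x i + ∑ i, star (mv E x i) * mv E x i = ∑ j, star (x j) * x j := by
    rw [sum_star_mv_mul, sum_star_mv_mul, ← hE, ← Finset.sum_add_distrib]
    refine Finset.sum_congr rfl fun i _ => ?_
    rw [← Finset.sum_add_distrib]
    simp only [← add_smul, Matrix.sub_apply, add_sub_cancel, Matrix.one_apply, ite_smul, one_smul, zero_smul]
    simp
  rw [← h1]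
  exact le_add_of_nonneg_right (Finset.sum_nonneg fun i _ => star_mul_self_nonneg _)

lemma star_mv {I J : Type*} [Fintype J] (R : Matrix I J ℂ) (x : J → C) (i : I) :
    star (mv R x i) = mv (R.map star) (fun j => star (x j)) i := by
  simp [mv]

lemma contr_row {I J : Type*} [Fintype I] [Fintype J] [DecidableEq J] (R : Matrix I J ℂ) {E : Matrix J J ℂ}
    (hE : 1 - Rᴴ * R = Eᴴ * E) (x : J → C) :
    ∑ i, mv R x i * star (mv R x i) ≤ ∑ j, x j * star (x j) := by
  have hs : (R.map star)ᴴ * R.map star = (Rᴴ * R).map star := by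
    ext i j; simp [Matrix.mul_apply]
  have hs' : (E.map star)ᴴ * E.map star = (Eᴴ * E).map star := by
    ext i j; simp [Matrix.mul_apply]
  have := contr_col (R.map star) (E := E.map star) (by
    rw [hs, hs', ← hE]
    ext i j
    rw [Matrix.sub_apply, Matrix.map_apply, Matrix.map_apply, Matrix.sub_apply, star_sub, Matrix.one_apply]
    split_ifs <;> simp) (fun j => star (x j))
  simp only [← star_mv, star_star] at this
  exact this

lemma coiso_eq {I J : Type*} [Fintype I] [Fintype J] [DecidableEq I] [DecidableEq J] {R : Matrix I J ℂ}
    (h : R * Rᴴ = 1) : 1 - Rᴴ * R = (1 - Rᴴ * R)ᴴ * (1 - Rᴴ * R) := by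
  have : (Rᴴ * R) * (Rᴴ * R) = Rᴴ * R := by
    rw [Matrix.mul_assoc, ← Matrix.mul_assoc R, h, Matrix.one_mul]
  rw [Matrix.conjTranspose_sub, Matrix.conjTranspose_one, Matrix.conjTranspose_mul, Matrix.conjTranspose_conjTranspose,
    Matrix.sub_mul, Matrix.mul_sub, Matrix.mul_sub, this]
  simp
end Pos

lemma map_star_coiso {I J : Type*} [Fintype I] [Fintype J] [DecidableEq I] {R : Matrix I J ℂ}
    (h : R * Rᴴ = 1) : R.map star * (R.map star)ᴴ = 1 := by
  have hs : R.map star * (R.map star)ᴴ = (R * Rᴴ).map star := by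
    ext i j; simp [Matrix.mul_apply]
  rw [hs, h]
  ext i j; simp [Matrix.one_apply]

section Red
variable {V W : Type*} [AddCommGroup V] [Module ℂ V] [AddCommGroup W] [Module ℂ W]

lemma exists_reduce {n : ℕ} (a : Fin n → V) : ∃ (r : ℕ) (Q : Matrix (Fin n) (Fin r) ℂ),
    Qᴴ * Q = 1 ∧ a = mv Q (mv Qᴴ a) ∧ LinearIndependent ℂ (mv Qᴴ a) := by
  let L : Module.Dual ℂ V →ₗ[ℂ] EuclideanSpace ℂ (Fin n) :=
    { toFun := fun φ => WithLp.toLp 2 (fun i => φ (a i))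
      map_add' := fun φ ψ => by ext i; simp
      map_smul' := fun c φ => by ext i; simp }
  let S := LinearMap.range L
  let e := stdOrthonormalBasis ℂ S
  let Q : Matrix (Fin n) (Fin (Module.finrank ℂ S)) ℂ := fun i k => (e k : EuclideanSpace ℂ (Fin n)) i
  have hQ : ∀ (y : S) k, ∑ i, star (Q i k) * (y : EuclideanSpace ℂ (Fin n)) i = e.repr y k := by
    intro y k
    rw [OrthonormalBasis.repr_apply_apply, Submodule.coe_inner, PiLp.inner_apply]
    refine Finset.sum_congr rfl fun i _ => ?_
    simp [Q, mul_comm]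
  have hQQ : Qᴴ * Q = 1 := by
    ext k l
    rw [Matrix.mul_apply]
    simp only [Matrix.conjTranspose_apply]
    have := hQ (e l) k
    rw [OrthonormalBasis.repr_self] at this
    rw [show ∑ j, star (Q j k) * Q j l = _ from this]
    simp [Matrix.one_apply, EuclideanSpace.single_apply]
  have hrec : ∀ φ : Module.Dual ℂ V, ∀ i, φ (a i) = ∑ k, Q i k * ∑ j, star (Q j k) * φ (a j) := by
    intro φ i
    have h1 := e.sum_repr ⟨L φ, ⟨φ, rfl⟩⟩
    have h2 := congrArg (fun y : S => (y : EuclideanSpace ℂ (Fin n)) i) h1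
    simp only at h2
    rw [show φ (a i) = (L φ) i from rfl, ← h2]
    simp only [Submodule.coe_sum, Submodule.coe_smul, WithLp.ofLp_sum, Finset.sum_apply, WithLp.ofLp_smul, Pi.smul_apply, smul_eq_mul]
    refine Finset.sum_congr rfl fun k _ => ?_
    rw [← hQ, mul_comm]
    rfl
  refine ⟨_, Q, hQQ, ?_, ?_⟩
  · ext i
    rw [← sub_eq_zero]
    refine (Module.forall_dual_apply_eq_zero_iff ℂ _).1 fun φ => ?_
    rw [map_sub, sub_eq_zero]
    simp only [mv, map_sum, map_smul, smul_eq_mul, Matrix.conjTranspose_apply]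
    exact hrec φ i
  · rw [Fintype.linearIndependent_iff]
    intro g hg
    let y : S := ∑ k, star (g k) • e k
    have hy : y = 0 := by
      have : ∀ φ : Module.Dual ℂ V, inner ℂ (y : EuclideanSpace ℂ (Fin n)) (L φ) = 0 := by
        intro φ
        have h1 := congrArg φ hg
        simp only [mv, map_sum, map_smul, smul_eq_mul, Matrix.conjTranspose_apply, map_zero] at h1
        simp only [y, Submodule.coe_sum, Submodule.coe_smul, sum_inner, inner_smul_left, PiLp.inner_apply]
        rw [← h1]
        refine Finset.sum_congr rfl fun k _ => ?_
        congr 1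
        · simp
        · refine Finset.sum_congr rfl fun i _ => ?_
          simp [Q, L, mul_comm]
      obtain ⟨φ, hφ⟩ := y.2
      have h2 := this φ
      rw [hφ, inner_self_eq_zero] at h2
      exact Subtype.ext h2
    intro k
    have h3 := e.toBasis.linearIndependent
    rw [Fintype.linearIndependent_iff] at h3
    have h4 := h3 (fun k => star (g k)) (by simpa [y] using hy) k
    simpa using h4

lemma exists_good {n : ℕ} (a : Fin n → V) (b : Fin n → W) : ∃ (r : ℕ) (R : Matrix (Fin r) (Fin n) ℂ),
    R * Rᴴ = 1 ∧ ∑ i, a i ⊗ₜ[ℂ] b i = ∑ k, mv R a k ⊗ₜ[ℂ] mv (R.map star) b k ∧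
      LinearIndependent ℂ (mv R a) ∧ LinearIndependent ℂ (mv (R.map star) b) := by
  obtain ⟨r, Q, hQ, ha, hli⟩ := exists_reduce a
  obtain ⟨s, P, hP, hb, hli'⟩ := exists_reduce (mv Qᵀ b)
  refine ⟨s, Pᵀ * Qᴴ, ?_, ?_, ?_, ?_⟩
  · rw [Matrix.conjTranspose_mul, Matrix.conjTranspose_conjTranspose, Matrix.mul_assoc, ← Matrix.mul_assoc Qᴴ, hQ, Matrix.one_mul]
    have := congrArg Matrix.transpose hP
    rw [Matrix.transpose_mul, Matrix.transpose_one] at this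
    exact this
  · have e1 : (Pᵀ * Qᴴ).map star = Pᴴ * Qᵀ := by
      ext i j; simp [Matrix.mul_apply]
    rw [e1, ← mv_mv, ← mv_mv, sum_mv_tmul, Matrix.transpose_transpose, ← hb]
    conv_lhs => rw [ha]
    rw [sum_mv_tmul]
  · rw [← mv_mv]
    rw [Fintype.linearIndependent_iff] at hli ⊢
    intro g hg
    have h1 : ∑ i, (∑ k, g k * P i k) • mv Qᴴ a i = 0 := by
      rw [← hg]
      conv_rhs => enter [2, k]; rw [mv]
      simp only [Finset.smul_sum, Finset.sum_smul, smul_smul, Matrix.transpose_apply]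
      rw [Finset.sum_comm]
    have h2 := hli _ h1
    intro k
    have h3 : g k = ∑ i, star (P i k) * ∑ l, g l * P i l := by
      have : ∀ l, ∑ i, star (P i k) * P i l = if k = l then 1 else 0 := by
        intro l
        have := congrFun (congrFun hP k) l
        rw [Matrix.mul_apply, Matrix.one_apply] at this
        exact this
      simp only [Finset.mul_sum]
      rw [Finset.sum_comm]
      have e : ∀ l, ∑ i, star (P i k) * (g l * P i l) = g l * (if k = l then 1 else 0) := by
        intro l
        rw [← this, Finset.mul_sum]
        refine Finset.sum_congr rfl fun i _ => by ring
      rw [Finset.sum_congr rfl fun l _ => e l]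
      simp
    rw [h3]
    simp [h2]
  · have e1 : (Pᵀ * Qᴴ).map star = Pᴴ * Qᵀ := by
      ext i j; simp [Matrix.mul_apply]
    rw [e1, ← mv_mv]
    exact hli'

lemma exists_dual {r : ℕ} (b : Fin r → W) (hb : LinearIndependent ℂ b) :
    ∃ f : Fin r → Module.Dual ℂ W, ∀ i j, f i (b j) = if i = j then 1 else 0 := by
  classical
  have hb' := hb.linearIndepOn_id
  let e := Module.Basis.extend hb'
  refine ⟨fun i => e.coord ⟨b i, hb'.subset_extend _ ⟨i, rfl⟩⟩, fun i j => ?_⟩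
  have : b j = e ⟨b j, hb'.subset_extend _ ⟨j, rfl⟩⟩ := by
    rw [Module.Basis.extend_apply_self]
  rw [this, Module.Basis.coord_apply, Module.Basis.repr_self, Finsupp.single_apply]
  by_cases h : i = j
  · subst h; simp
  · rw [if_neg, if_neg h]
    intro h'
    apply h
    have := congrArg Subtype.val h'
    exact hb.injective this.symm

lemma tmul_eq_right {r : ℕ} {a : Fin r → V} (ha : LinearIndependent ℂ a) {b b' : Fin r → W}
    (h : ∑ i, a i ⊗ₜ[ℂ] b i = ∑ i, a i ⊗ₜ[ℂ] b' i) : b = b' := by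
  obtain ⟨f, hf⟩ := exists_dual a ha
  ext k
  have := congrArg ((TensorProduct.lid ℂ W).toLinearMap ∘ₗ TensorProduct.map (f k) LinearMap.id) h
  simpa [hf, Finset.sum_ite_eq] using this

lemma transition {r s : ℕ} {a : Fin r → V} {b : Fin r → W} {a' : Fin s → V} {b' : Fin s → W}
    (hb : LinearIndependent ℂ b) 
    (h : ∑ i, a i ⊗ₜ[ℂ] b i = ∑ i, a' i ⊗ₜ[ℂ] b' i) : ∃ S : Matrix (Fin r) (Fin s) ℂ, a = mv S a' := by
  obtain ⟨f, hf⟩ := exists_dual b hb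
  refine ⟨fun i j => f i (b' j), ?_⟩
  ext k
  have := congrArg ((TensorProduct.rid ℂ V).toLinearMap ∘ₗ TensorProduct.map LinearMap.id (f k)) h
  simpa [hf, mv] using this

lemma mv_inj {r s : ℕ} {a : Fin r → V} (ha : LinearIndependent ℂ a) {S S' : Matrix (Fin s) (Fin r) ℂ}
    (h : mv S a = mv S' a) : S = S' := by
  ext i j
  have h1 := congrFun h i
  simp only [mv] at h1
  rw [← sub_eq_zero, ← Finset.sum_sub_distrib] at h1
  simp only [← sub_smul] at h1
  exact sub_eq_zero.1 (Fintype.linearIndependent_iff.1 ha _ h1 j)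
end Red
end MV
end

section
section HB
open Matrix
variable {C D : Type u} [CStarAlgebra C] [PartialOrder C] [StarOrderedRing C]
  [CStarAlgebra D] [PartialOrder D] [StarOrderedRing D]

open scoped ComplexOrder in
lemma diag_data {r s : ℕ} (S : Matrix (Fin r) (Fin s) ℂ) (S' : Matrix (Fin s) (Fin r) ℂ) (h1 : S * S' = 1) (h2 : S' * S = 1) :
    ∃ (U : Matrix (Fin r) (Fin r) ℂ) (l : Fin r → ℝ), (∀ k, 0 < l k) ∧ Uᴴ * U = 1 ∧ U * Uᴴ = 1 ∧
      (diagonal (fun k => ((l k)⁻¹ : ℂ)) * Uᴴ * S) * (diagonal (fun k => ((l k)⁻¹ : ℂ)) * Uᴴ * S)ᴴ = 1 ∧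
      (diagonal (fun k => (l k : ℂ)) * Uᵀ * S'ᵀ) * (diagonal (fun k => (l k : ℂ)) * Uᵀ * S'ᵀ)ᴴ = 1 := by
  have hpd : (S * Sᴴ).PosDef := by
    refine Matrix.PosDef.mul_conjTranspose_self S ?_
    intro x y hxy
    have := congrArg (fun v => v ᵥ* S') hxy
    simpa [Matrix.vecMul_vecMul, h1] using this
  set U : Matrix (Fin r) (Fin r) ℂ := (hpd.1.eigenvectorUnitary : Matrix (Fin r) (Fin r) ℂ) with hU
  have hUU : Uᴴ * U = 1 := (Unitary.mem_iff.1 hpd.1.eigenvectorUnitary.2).1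
  have hUU' : U * Uᴴ = 1 := (Unitary.mem_iff.1 hpd.1.eigenvectorUnitary.2).2
  have hspec : S * Sᴴ = U * diagonal (fun k => (hpd.1.eigenvalues k : ℂ)) * Uᴴ := hpd.1.spectral_theorem
  set l : Fin r → ℝ := fun k => Real.sqrt (hpd.1.eigenvalues k) with hl
  have hl0 : ∀ k, 0 < l k := fun k => Real.sqrt_pos.2 (hpd.eigenvalues_pos k)
  have hl0' : ∀ k, (l k : ℂ) ≠ 0 := fun k => by exact_mod_cast (hl0 k).ne'
  set D1 : Matrix (Fin r) (Fin r) ℂ := diagonal (fun k => ((l k)⁻¹ : ℂ)) with hD1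
  set D2 : Matrix (Fin r) (Fin r) ℂ := diagonal (fun k => (l k : ℂ)) with hD2
  have e22 : diagonal (fun k => (hpd.1.eigenvalues k : ℂ)) = D2 * D2 := by
    rw [hD2, diagonal_mul_diagonal]
    congr 1; ext k
    rw [← Complex.ofReal_mul, hl]
    simp only
    rw [Real.mul_self_sqrt (hpd.eigenvalues_pos k).le]
  have e12 : D1 * D2 = 1 := by
    rw [hD1, hD2, diagonal_mul_diagonal, ← diagonal_one]
    congr 1; ext k
    exact inv_mul_cancel₀ (hl0' k)
  have e21 : D2 * D1 = 1 := by
    rw [hD1, hD2, diagonal_mul_diagonal, ← diagonal_one]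
    congr 1; ext k
    exact mul_inv_cancel₀ (hl0' k)
  have d1 : D1ᴴ = D1 := by
    rw [hD1, diagonal_conjTranspose]; congr 1; ext k; simp
  have d2 : D2ᴴ = D2 := by
    rw [hD2, diagonal_conjTranspose]; congr 1; ext k; simp
  rw [e22] at hspec
  have hΛ : Uᴴ * (S * Sᴴ) * U = D2 * D2 := by
    rw [hspec]
    calc Uᴴ * (U * (D2 * D2) * Uᴴ) * U = (Uᴴ * U) * (D2 * D2) * (Uᴴ * U) := by simp only [Matrix.mul_assoc]
      _ = _ := by rw [hUU]; simp
  have hG : (D2 * D2) * (Uᴴ * (S'ᴴ * S') * U) = 1 := by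
    rw [← hΛ]
    calc Uᴴ * (S * Sᴴ) * U * (Uᴴ * (S'ᴴ * S') * U) = Uᴴ * (S * (Sᴴ * ((U * Uᴴ) * S'ᴴ)) * S') * U := by simp only [Matrix.mul_assoc]
      _ = Uᴴ * (S * S') * U := by rw [hUU', Matrix.one_mul, ← Matrix.conjTranspose_mul, h2, Matrix.conjTranspose_one, Matrix.mul_one]
      _ = 1 := by rw [h1, Matrix.mul_one, hUU]
  have hG' : D2 * (Uᴴ * (S'ᴴ * S') * U) * D2 = 1 := by
    have : D2 * (Uᴴ * (S'ᴴ * S') * U) = D1 := by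
      calc D2 * (Uᴴ * (S'ᴴ * S') * U) = (D1 * D2) * (D2 * (Uᴴ * (S'ᴴ * S') * U)) := by rw [e12, Matrix.one_mul]
        _ = D1 * ((D2 * D2) * (Uᴴ * (S'ᴴ * S') * U)) := by simp only [Matrix.mul_assoc]
        _ = D1 := by rw [hG, Matrix.mul_one]
    rw [this, e12]
  refine ⟨U, l, hl0, hUU, hUU', ?_, ?_⟩
  · rw [Matrix.conjTranspose_mul, Matrix.conjTranspose_mul, d1, Matrix.conjTranspose_conjTranspose]
    calc D1 * Uᴴ * S * (Sᴴ * (U * D1)) = D1 * (Uᴴ * (S * Sᴴ) * U) * D1 := by simp only [Matrix.mul_assoc]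
      _ = (D1 * D2) * (D2 * D1) := by rw [hΛ]; simp only [Matrix.mul_assoc]
      _ = 1 := by rw [e12, e21, Matrix.one_mul]
  · have t2 : D2ᵀ = D2 := by rw [hD2, diagonal_transpose]
    have : D2 * Uᵀ * S'ᵀ * (D2 * Uᵀ * S'ᵀ)ᴴ = (D2 * (Uᴴ * (S'ᴴ * S') * U) * D2)ᵀ := by
      have e : D2 * (Uᴴ * (S'ᴴ * S') * U) * D2 = (S' * U * D2)ᴴ * (S' * U * D2) := by
        rw [Matrix.conjTranspose_mul, Matrix.conjTranspose_mul, d2]; simp only [Matrix.mul_assoc]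
      rw [e, Matrix.transpose_mul]
      have e2 : (S' * U * D2)ᵀ = D2 * Uᵀ * S'ᵀ := by
        rw [Matrix.transpose_mul, Matrix.transpose_mul, t2, Matrix.mul_assoc]
      rw [← e2]
      rfl
    rw [this, hG', Matrix.transpose_one]

lemma mv_diagonal {r : ℕ} {V : Type*} [AddCommMonoid V] [Module ℂ V] (d : Fin r → ℂ) (x : Fin r → V) (k : Fin r) :
    mv (diagonal d) x k = d k • x k := by
  simp [mv, diagonal_apply]

theorem hm_bound_one {T : C →ₗ[ℂ] D →ₗ[ℂ] ℂ} {κ : ℝ} (h : IsJCB T κ) {z : C ⊗[ℂ] D} (hz : HRep z 1) (hz' : HRep' z 1) :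
    ‖TensorProduct.lift T z‖ ≤ 71712 * κ := by
  obtain ⟨n, a0, b0, rfl, ha0, hb0⟩ := hz
  obtain ⟨m, a1, b1, he, ha1, hb1⟩ := hz'
  rw [one_smul] at ha0 hb0 ha1 hb1
  obtain ⟨r, R0, hR0, hz0, la, lb⟩ := exists_good a0 b0
  obtain ⟨s, R1, hR1, hz1, la', lb'⟩ := exists_good a1 b1
  have ha := (contr_row R0 (coiso_eq hR0) a0).trans ha0
  have hb := (contr_col _ (coiso_eq (map_star_coiso hR0)) b0).trans hb0
  have ha' := (contr_col R1 (coiso_eq hR1) a1).trans ha1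
  have hb' := (contr_row _ (coiso_eq (map_star_coiso hR1)) b1).trans hb1
  rw [hz0]
  rw [hz0, hz1] at he
  generalize mv R0 a0 = a at *
  generalize mv (R0.map star) b0 = b at *
  generalize mv R1 a1 = a' at *
  generalize mv (R1.map star) b1 = b' at *
  obtain ⟨S, hS⟩ := transition lb he
  obtain ⟨S', hS'⟩ := transition lb' he.symm
  have h1 : S * S' = 1 := mv_inj la (by rw [← mv_mv, ← hS', ← hS, mv_one])
  have h2 : S' * S = 1 := mv_inj la' (by rw [← mv_mv, ← hS, ← hS', mv_one])
  have hSb : b = mv S'ᵀ b' := by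
    refine tmul_eq_right la ?_
    rw [he]
    conv_lhs => rw [hS']
    rw [sum_mv_tmul]
  obtain ⟨U, l, hl, hUU, hUU', hR, hR'⟩ := diag_data S S' h1 h2
  have eU : (Uᴴ)ᵀ = U.map star := rfl
  have hsum : ∑ i, a i ⊗ₜ[ℂ] b i = ∑ i, mv Uᴴ a i ⊗ₜ[ℂ] mv Uᵀ b i := by
    rw [sum_mv_tmul, mv_mv, ← Matrix.transpose_mul, hUU', Matrix.transpose_one, mv_one]
  rw [hsum, map_sum]
  simp only [TensorProduct.lift.tmul]
  have cU : Uᴴ * (Uᴴ)ᴴ = 1 := by rw [Matrix.conjTranspose_conjTranspose, hUU]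
  have cU' : Uᵀ * (Uᵀ)ᴴ = 1 := by
    have := congrArg Matrix.transpose hUU
    rw [Matrix.transpose_mul, Matrix.transpose_one] at this
    exact this
  refine hm_tuple h (mv Uᴴ a) (mv Uᵀ b) (fun k => (l k ^ 2)⁻¹) (fun k => by have := hl k; positivity) ?_ ?_ ?_ ?_
  · exact (contr_row _ (coiso_eq cU) a).trans ha
  · refine le_trans (le_of_eq ?_) ((contr_col _ (coiso_eq hR) a').trans ha')
    rw [← mv_mv, ← hS, ← mv_mv]
    refine Finset.sum_congr rfl fun k _ => ?_
    rw [mv_diagonal, star_smul, smul_mul_smul_comm, ← Complex.coe_smul]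
    congr 1
    simp [pow_two]
  · exact (contr_col _ (coiso_eq cU') b).trans hb
  · refine le_trans (le_of_eq ?_) ((contr_row _ (coiso_eq hR') b').trans hb')
    rw [← mv_mv, ← hSb, ← mv_mv]
    refine Finset.sum_congr rfl fun k _ => ?_
    rw [mv_diagonal, star_smul, smul_mul_smul_comm, ← Complex.coe_smul]
    congr 1
    simp [pow_two]

lemma HRep.smul {z : C ⊗[ℂ] D} {r c : ℝ} (hc : 0 ≤ c) (h : HRep z r) : HRep ((c : ℂ) • z) (c * r) := by
  obtain ⟨n, a, b, rfl, h1, h2⟩ := h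
  refine ⟨n, fun i => Real.sqrt c • a i, fun i => Real.sqrt c • b i, ?_, ?_, ?_⟩
  · rw [Finset.smul_sum]
    refine Finset.sum_congr rfl fun i _ => ?_
    change _ = (Real.sqrt c • a i) ⊗ₜ[ℂ] (Real.sqrt c • b i)
    rw [← Complex.coe_smul, ← Complex.coe_smul, TensorProduct.smul_tmul_smul, ← Complex.ofReal_mul, Real.mul_self_sqrt hc]
  · simp only [star_smul, smul_mul_smul_comm, star_trivial, ← Finset.smul_sum, Real.mul_self_sqrt hc]
    rw [mul_smul]
    exact smul_le_smul_of_nonneg_left h1 hc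
  · simp only [star_smul, smul_mul_smul_comm, star_trivial, ← Finset.smul_sum, Real.mul_self_sqrt hc]
    rw [mul_smul]
    exact smul_le_smul_of_nonneg_left h2 hc

lemma HRep'.smul {z : C ⊗[ℂ] D} {r c : ℝ} (hc : 0 ≤ c) (h : HRep' z r) : HRep' ((c : ℂ) • z) (c * r) := by
  rw [hrep'_comm] at h ⊢
  have := h.smul hc
  rwa [map_smul]

theorem hm_bound {T : C →ₗ[ℂ] D →ₗ[ℂ] ℂ} {κ : ℝ} (h : IsJCB T κ) {z : C ⊗[ℂ] D} {r : ℝ} (hr : 0 < r)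
    (hz : HRep z r) (hz' : HRep' z r) : ‖TensorProduct.lift T z‖ ≤ 71712 * κ * r := by
  have h1 := hz.smul (inv_pos.2 hr).le
  have h2 := hz'.smul (inv_pos.2 hr).le
  rw [inv_mul_cancel₀ hr.ne'] at h1 h2
  have h3 := hm_bound_one h h1 h2
  rw [map_smul, norm_smul, Complex.norm_real, Real.norm_of_nonneg (inv_pos.2 hr).le, inv_mul_le_iff₀ hr] at h3
  linarith

lemma HRep.add {z z' : C ⊗[ℂ] D} {r r' : ℝ} (h : HRep z r) (h' : HRep z' r') : HRep (z + z') (r + r') := by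
  obtain ⟨n, a, b, rfl, h1, h2⟩ := h
  obtain ⟨n', a', b', rfl, h1', h2'⟩ := h'
  refine ⟨n + n', Fin.append a a', Fin.append b b', by simp [Fin.sum_univ_add], ?_, ?_⟩
  · simp only [Fin.sum_univ_add, Fin.append_left, Fin.append_right, add_smul]
    exact add_le_add h1 h1'
  · simp only [Fin.sum_univ_add, Fin.append_left, Fin.append_right, add_smul]
    exact add_le_add h2 h2'

lemma HRep.mono {z : C ⊗[ℂ] D} {r r' : ℝ} (h : HRep z r) (hr : r ≤ r') : HRep z r' := by
  obtain ⟨n, a, b, he, h1, h2⟩ := h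
  exact ⟨n, a, b, he, h1.trans (smul_le_smul_of_nonneg_right hr zero_le_one), h2.trans (smul_le_smul_of_nonneg_right hr zero_le_one)⟩

lemma HRep.sum {I : Type*} (s : Finset I) (z : I → C ⊗[ℂ] D) (r : I → ℝ) (h : ∀ i ∈ s, HRep (z i) (r i)) :
    HRep (∑ i ∈ s, z i) (∑ i ∈ s, r i) := by
  classical
  induction s using Finset.induction_on with
  | empty => exact ⟨0, Fin.elim0, Fin.elim0, by simp, by simp, by simp⟩
  | insert i s hi ih =>
    rw [Finset.sum_insert hi, Finset.sum_insert hi]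
    exact (h i (Finset.mem_insert_self _ _)).add (ih fun j hj => h j (Finset.mem_insert_of_mem hj))
end HB
end

section
section PA
variable {C : Type*} [CStarAlgebra C] [PartialOrder C] [StarOrderedRing C]

/-- bound for scalar combinations of a bounded row -/
lemma lin_row {J : Type*} (a : J → C) (s : Finset J) {ρ : ℝ} (hρ : 0 < ρ)
    (ha : ∑ j ∈ s, a j * star (a j) ≤ (ρ ^ 2) • (1 : C)) (c : J → ℂ) :
    ‖∑ j ∈ s, c j • a j‖ ≤ ρ * Real.sqrt (∑ j ∈ s, ‖c j‖ ^ 2) := by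
  have h1 : ∑ i : s, (ρ⁻¹ • a i) * star (ρ⁻¹ • a i) ≤ 1 := by
    simp only [star_smul, smul_mul_smul_comm, star_trivial, ← Finset.smul_sum]
    rw [Finset.sum_coe_sort s (fun j => a j * star (a j))]
    calc _ ≤ (ρ⁻¹ * ρ⁻¹) • ((ρ ^ 2) • (1 : C)) := smul_le_smul_of_nonneg_left ha (by positivity)
      _ = 1 := by rw [smul_smul]; have : ρ⁻¹ * ρ⁻¹ * ρ ^ 2 = 1 := by field_simp
                  rw [this, one_smul]
  have h2 := cs_row _ (fun i : s => c i • (1 : C)) h1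
  have h3 : ∑ i : s, star (c i • (1 : C)) * (c i • (1 : C)) = ((Real.sqrt (∑ j ∈ s, ‖c j‖ ^ 2)) ^ 2) • (1 : C) := by
    rw [Real.sq_sqrt (Finset.sum_nonneg fun i _ => sq_nonneg _), ← Complex.coe_smul, Complex.ofReal_sum,
      Finset.sum_smul, ← Finset.sum_coe_sort s]
    refine Finset.sum_congr rfl fun i _ => ?_
    rw [star_smul, star_one, smul_mul_smul_comm, one_mul]
    congr 1
    simp [Complex.conj_mul']
  rw [h3] at h2
  have h4 := norm_le_of_star_mul_self_le (Real.sqrt_nonneg _) h2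
  have h5 : ∑ i : s, (ρ⁻¹ • a i) * (c i • (1 : C)) = ρ⁻¹ • ∑ j ∈ s, c j • a j := by
    rw [Finset.smul_sum, ← Finset.sum_coe_sort s]
    refine Finset.sum_congr rfl fun i _ => ?_
    rw [smul_mul_assoc, mul_smul_comm, mul_one]
  rw [h5, norm_smul, norm_inv, Real.norm_of_nonneg hρ.le, inv_mul_le_iff₀ hρ] at h4
  exact h4

lemma func_sq {J : Type*} (a : J → C) (s : Finset J) {ρ : ℝ} (hρ : 0 < ρ)
    (ha : ∑ j ∈ s, a j * star (a j) ≤ (ρ ^ 2) • (1 : C)) (φ : C →L[ℂ] ℂ) :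
    ∑ j ∈ s, ‖φ (a j)‖ ^ 2 ≤ (‖φ‖ * ρ) ^ 2 := by
  have h1 := lin_row a s hρ ha (fun j => star (φ (a j)))
  have h2 : φ (∑ j ∈ s, star (φ (a j)) • a j) = ((∑ j ∈ s, ‖φ (a j)‖ ^ 2 : ℝ) : ℂ) := by
    simp [Complex.conj_mul']
  have h3 := φ.le_opNorm (∑ j ∈ s, star (φ (a j)) • a j)
  have h0 : 0 ≤ ∑ j ∈ s, ‖φ (a j)‖ ^ 2 := Finset.sum_nonneg fun i _ => sq_nonneg _
  rw [h2, Complex.norm_real, Real.norm_of_nonneg h0] at h3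
  simp only [norm_star] at h1
  set q := ∑ j ∈ s, ‖φ (a j)‖ ^ 2 with hq
  clear_value q
  have h4 : q ≤ ‖φ‖ * (ρ * Real.sqrt q) := h3.trans (mul_le_mul_of_nonneg_left h1 (norm_nonneg _))
  have h5 := Real.sq_sqrt h0
  have h6 := Real.sqrt_nonneg q
  have h7 : Real.sqrt q ≤ ‖φ‖ * ρ := by
    rcases h6.eq_or_lt with h | h
    · rw [← h]; positivity
    · refine le_of_mul_le_mul_right ?_ h
      nlinarith
  nlinarith

open scoped ComplexOrder in
lemma posSemidef_sq {J : Type*} [Fintype J] [DecidableEq J] {M : Matrix J J ℂ} (h : M.PosSemidef) :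
    ∃ E : Matrix J J ℂ, M = E.conjTranspose * E := by
  have := h.1.spectral_theorem
  set U : Matrix J J ℂ := (h.1.eigenvectorUnitary : Matrix J J ℂ) with hU
  have h2 : M = U * Matrix.diagonal (fun i => (h.1.eigenvalues i : ℂ)) * star U := this
  refine ⟨Matrix.diagonal (fun i => (Real.sqrt (h.1.eigenvalues i) : ℂ)) * star U, ?_⟩
  conv_lhs => rw [h2]
  rw [Matrix.conjTranspose_mul, Matrix.diagonal_conjTranspose, Matrix.star_eq_conjTranspose, Matrix.conjTranspose_conjTranspose]
  have : Matrix.diagonal (fun i => (h.1.eigenvalues i : ℂ)) =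
      Matrix.diagonal (star fun i => (Real.sqrt (h.1.eigenvalues i) : ℂ)) * Matrix.diagonal (fun i => (Real.sqrt (h.1.eigenvalues i) : ℂ)) := by
    rw [Matrix.diagonal_mul_diagonal]
    congr 1
    ext i
    simp only [Pi.star_apply, Complex.star_def, Complex.conj_ofReal]
    rw [← Complex.ofReal_mul, Real.mul_self_sqrt (h.eigenvalues_nonneg i)]
  rw [this]
  simp only [Matrix.mul_assoc]

open scoped ComplexOrder in
lemma contr_fin {J : Type*} [DecidableEq J] (P : lp (fun _ : J => ℂ) 2 →L[ℂ] lp (fun _ : J => ℂ) 2) (hP : ‖P‖ ≤ 1)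
    (s t : Finset J) (a : J → C) :
    ∑ j ∈ s, (∑ l ∈ t, (P (lp.single 2 l (1:ℂ)) : J → ℂ) j • a l) * star (∑ l ∈ t, (P (lp.single 2 l (1:ℂ)) : J → ℂ) j • a l)
      ≤ ∑ l ∈ t, a l * star (a l) := by
  let R : Matrix s t ℂ := fun j l => (P (lp.single 2 (l : J) (1:ℂ)) : J → ℂ) j
  have hpos : (1 - R.conjTranspose * R).PosSemidef := by
    refine Matrix.PosSemidef.of_dotProduct_mulVec_nonneg ?_ ?_
    · rw [Matrix.IsHermitian, Matrix.conjTranspose_sub, Matrix.conjTranspose_one, Matrix.conjTranspose_mul,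
        Matrix.conjTranspose_conjTranspose]
    · intro x
      rw [Matrix.sub_mulVec, Matrix.one_mulVec, ← Matrix.mulVec_mulVec, dotProduct_sub,
        Matrix.dotProduct_mulVec (star x), ← Matrix.star_mulVec]
      have e : ∀ {K : Type _} [Fintype K] (y : K → ℂ), star y ⬝ᵥ y = ((∑ k, ‖y k‖ ^ 2 : ℝ) : ℂ) := by
        intro K _ y
        simp [dotProduct, Complex.conj_mul']
      rw [e, e, ← Complex.ofReal_sub, Complex.zero_le_real, sub_nonneg]
      let f : J → ℂ := fun l => if h : l ∈ t then x ⟨l, h⟩ else 0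
      let ξ : lp (fun _ : J => ℂ) 2 := ∑ l ∈ t, lp.single 2 l (f l)
      have h1 : ∀ j : s, R.mulVec x j = (P ξ : J → ℂ) j := by
        intro j
        simp only [ξ, map_sum, lp.coeFn_sum, Finset.sum_apply, Matrix.mulVec, dotProduct, R]
        rw [← Finset.sum_coe_sort t]
        refine Finset.sum_congr rfl fun l _ => ?_
        have : (lp.single 2 (l : J) (f l) : lp (fun _ : J => ℂ) 2) = (f l) • lp.single 2 (l : J) (1:ℂ) := by
          rw [← lp.single_smul]; simp
        rw [this, map_smul, lp.coeFn_smul, Pi.smul_apply, smul_eq_mul, mul_comm]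
        simp [f]
      have h2 : ∑ j : s, ‖R.mulVec x j‖ ^ 2 ≤ ‖P ξ‖ ^ 2 := by
        simp only [h1]
        rw [Finset.sum_coe_sort s (fun j => ‖(P ξ : J → ℂ) j‖ ^ 2)]
        have := lp.sum_rpow_le_norm_rpow (p := 2) (by norm_num) (P ξ) s
        simpa using this
      have h3 : ‖ξ‖ ^ 2 = ∑ l : t, ‖x l‖ ^ 2 := by
        have := lp.norm_sum_single (p := 2) (by norm_num) f t
        simp only [ENNReal.toReal_ofNat, Real.rpow_ofNat] at this
        rw [this, ← Finset.sum_coe_sort t]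
        refine Finset.sum_congr rfl fun l _ => ?_
        simp [f]
      rw [← h3]
      refine h2.trans ?_
      have : ‖P ξ‖ ≤ ‖ξ‖ := (P.le_opNorm ξ).trans (mul_le_of_le_one_left (norm_nonneg _) hP)
      gcongr
  obtain ⟨E, hE⟩ := posSemidef_sq hpos
  have := contr_row R hE (fun l : t => a l)
  rw [Finset.sum_coe_sort t (fun l => a l * star (a l))] at this
  refine le_trans (le_of_eq ?_) this
  rw [← Finset.sum_coe_sort s]
  refine Finset.sum_congr rfl fun j _ => ?_
  have : ∑ l ∈ t, (P (lp.single 2 l (1:ℂ)) : J → ℂ) j • a l = mv R (fun l : t => a l) j := by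
    rw [mv, ← Finset.sum_coe_sort t]
  rw [this]

end PA
end

section
section PB
variable {C : Type*} [CStarAlgebra C] [PartialOrder C] [StarOrderedRing C]

lemma add_mul_star_le (x y : C) : (x + y) * star (x + y) ≤ (2:ℝ) • (x * star x) + (2:ℝ) • (y * star y) := by
  have h : 0 ≤ (x - y) * star (x - y) := mul_star_self_nonneg _
  have e : (2:ℝ) • (x * star x) + (2:ℝ) • (y * star y) = (x + y) * star (x + y) + (x - y) * star (x - y) := by
    simp only [two_smul, star_add, star_sub]; noncomm_ring
  rw [e]; exact le_add_of_nonneg_right h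

/-- vector of functional values in ℓ² -/
def fvec {J : Type*} (a : J → C) {ρ : ℝ} (hρ : 0 < ρ)
    (ha : ∀ s : Finset J, ∑ j ∈ s, a j * star (a j) ≤ (ρ ^ 2) • (1 : C)) (φ : C →L[ℂ] ℂ) : lp (fun _ : J => ℂ) 2 :=
  ⟨fun j => φ (a j), memℓp_gen' (C := (‖φ‖ * ρ) ^ 2) (fun s => by
    simpa using func_sq a s hρ (ha s) φ)⟩

lemma fvec_apply {J : Type*} (a : J → C) {ρ : ℝ} (hρ : 0 < ρ)
    (ha : ∀ s : Finset J, ∑ j ∈ s, a j * star (a j) ≤ (ρ ^ 2) • (1 : C)) (φ : C →L[ℂ] ℂ) (j : J) :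
    (fvec a hρ ha φ : J → ℂ) j = φ (a j) := rfl

def fspace {J : Type*} (a : J → C) {ρ : ℝ} (hρ : 0 < ρ)
    (ha : ∀ s : Finset J, ∑ j ∈ s, a j * star (a j) ≤ (ρ ^ 2) • (1 : C)) : Submodule ℂ (lp (fun _ : J => ℂ) 2) where
  carrier := Set.range (fvec a hρ ha)
  add_mem' := by
    rintro _ _ ⟨φ, rfl⟩ ⟨ψ, rfl⟩
    exact ⟨φ + ψ, by ext j; simp [fvec_apply]⟩
  zero_mem' := ⟨0, by ext j; simp [fvec_apply]⟩
  smul_mem' := by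
    rintro c _ ⟨φ, rfl⟩
    exact ⟨c • φ, by ext j; simp [fvec_apply]⟩

theorem proj_approx {J : Type*} (a : J → C) {ρ : ℝ} (hρ : 0 < ρ)
    (ha : ∀ s : Finset J, ∑ j ∈ s, a j * star (a j) ≤ (ρ ^ 2) • (1 : C))
    (hc : ∀ ε : ℝ, 0 < ε → ∃ F : Finset J, ∀ s : Finset J, Disjoint s F → ∑ j ∈ s, a j * star (a j) ≤ (ε ^ 2) • (1 : C))
    {ε : ℝ} (hε : 0 < ε) :
    ∃ (F : Finset J) (φ : J → C →L[ℂ] ℂ), ∀ s : Finset J,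
      ∑ j ∈ s, (a j - ∑ l ∈ F, φ l (a j) • a l) * star (a j - ∑ l ∈ F, φ l (a j) • a l) ≤ (ε ^ 2) • (1 : C) := by
  classical
  let S : Submodule ℂ (lp (fun _ : J => ℂ) 2) := (fspace a hρ ha).topologicalClosure
  haveI : CompleteSpace S := (Submodule.isClosed_topologicalClosure _).completeSpace_coe
  let P : lp (fun _ : J => ℂ) 2 →L[ℂ] lp (fun _ : J => ℂ) 2 := S.starProjection
  have hP : ‖P‖ ≤ 1 := S.starProjection_norm_le
  have hPv : ∀ φ, P (fvec a hρ ha φ) = fvec a hρ ha φ := fun φ =>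
    Submodule.starProjection_eq_self_iff.2 (Submodule.le_topologicalClosure _ ⟨φ, rfl⟩)
  let p : J → J → ℂ := fun j l => (P (lp.single 2 l (1:ℂ)) : J → ℂ) j
  have hcontr : ∀ s t : Finset J, ∑ j ∈ s, (∑ l ∈ t, p j l • a l) * star (∑ l ∈ t, p j l • a l) ≤ ∑ l ∈ t, a l * star (a l) :=
    fun s t => contr_fin P hP s t a
  have hsum : ∀ j, Summable (fun l => p j l • a l) := by
    intro j
    rw [summable_iff_vanishing_norm]
    intro δ hδ
    obtain ⟨F, hF⟩ := hc (δ / 2) (by linarith)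
    refine ⟨F, fun t ht => ?_⟩
    have h1 := (hcontr {j} t).trans (hF t ht)
    rw [Finset.sum_singleton] at h1
    have h2 := norm_le_of_star_mul_self_le (x := star (∑ l ∈ t, p j l • a l)) (r := δ / 2) (by linarith) (by rwa [star_star])
    rw [norm_star] at h2
    linarith
  have hcoord : ∀ (j : J), Continuous (fun x : lp (fun _ : J => ℂ) 2 => (x : J → ℂ) j) := by
    intro j
    have : LipschitzWith 1 (fun x : lp (fun _ : J => ℂ) 2 => (x : J → ℂ) j) := by
      refine LipschitzWith.of_dist_le_mul fun x y => ?_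
      rw [dist_eq_norm, dist_eq_norm, NNReal.coe_one, one_mul]
      exact lp.norm_apply_le_norm (by norm_num) (x - y) j
    exact this.continuous
  have htsum : ∀ j, HasSum (fun l => p j l • a l) (a j) := by
    intro j
    have h1 := (hsum j).hasSum
    have h2 : ∑' l, p j l • a l = a j := by
      by_contra hne
      obtain ⟨φ, hφ⟩ := SeparatingDual.exists_ne_zero (R := ℂ) (sub_ne_zero.2 hne)
      apply hφ
      rw [map_sub, sub_eq_zero]
      have h3 : HasSum (fun l => p j l * φ (a l)) (φ (∑' l, p j l • a l)) := by
        have := φ.hasSum h1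
        simpa using this
      refine h3.unique ?_
      have h4 := P.hasSum (lp.hasSum_single (by norm_num) (fvec a hρ ha φ))
      rw [hPv] at h4
      let cj : lp (fun _ : J => ℂ) 2 →+ ℂ := ⟨⟨fun x => (x : J → ℂ) j, rfl⟩, fun x y => rfl⟩
      have h5 := h4.map cj (hcoord j)
      refine (show HasSum _ (cj (fvec a hρ ha φ)) from ?_)
      convert h5 using 1
      ext l
      have h6 : (lp.single 2 l ((fvec a hρ ha φ : J → ℂ) l) : lp (fun _ : J => ℂ) 2) = (φ (a l)) • lp.single 2 l (1:ℂ) := by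
        rw [← lp.single_smul]; simp [fvec_apply]
      change _ = (P (lp.single 2 l ((fvec a hρ ha φ : J → ℂ) l)) : J → ℂ) j
      rw [h6, map_smul, lp.coeFn_smul, Pi.smul_apply, smul_eq_mul, mul_comm]
    rwa [h2] at h1
  obtain ⟨F, hF⟩ := hc (ε / 2) (by linarith)
  have hp : ∀ s : Finset J, ∑ j ∈ s, (a j - ∑ l ∈ F, p j l • a l) * star (a j - ∑ l ∈ F, p j l • a l) ≤ ((ε / 2) ^ 2) • (1 : C) := by
    intro s
    have hl : ∀ j, Filter.Tendsto (fun t : Finset J => ∑ l ∈ t \ F, p j l • a l) Filter.atTop (nhds (a j - ∑ l ∈ F, p j l • a l)) := by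
      intro j
      have h1 : Filter.Tendsto (fun t : Finset J => ∑ l ∈ t, p j l • a l - ∑ l ∈ F, p j l • a l) Filter.atTop (nhds (a j - ∑ l ∈ F, p j l • a l)) :=
        (show Filter.Tendsto (fun t : Finset J => ∑ l ∈ t, p j l • a l) Filter.atTop (nhds (a j)) from htsum j).sub_const _
      refine h1.congr' ?_
      filter_upwards [Filter.eventually_ge_atTop F] with t ht
      rw [← Finset.sum_sdiff (show F ⊆ t from ht), add_sub_cancel_right]
    refine le_of_tendsto (tendsto_finset_sum s fun j _ => (hl j).mul ((hl j).star)) ?_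
    exact Filter.Eventually.of_forall fun t => (hcontr s (t \ F)).trans (hF _ Finset.sdiff_disjoint)
  -- approximate columns
  set Q := ∑ l ∈ F, ‖a l‖ ^ 2 with hQ
  have hQ0 : 0 ≤ Q := Finset.sum_nonneg fun i _ => sq_nonneg _
  set δ : ℝ := (ε / 2) / Real.sqrt ((F.card : ℝ) * Q + 1) with hδ
  have hδ0 : 0 < δ := by positivity
  have happ : ∀ l, ∃ φ : C →L[ℂ] ℂ, ‖P (lp.single 2 l (1:ℂ)) - fvec a hρ ha φ‖ < δ := by
    intro l
    have h1 : P (lp.single 2 l (1:ℂ)) ∈ S := Submodule.starProjection_apply_mem _ _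
    have h2 : P (lp.single 2 l (1:ℂ)) ∈ closure (fspace a hρ ha : Set (lp (fun _ : J => ℂ) 2)) := h1
    obtain ⟨y, ⟨φ, rfl⟩, hy⟩ := Metric.mem_closure_iff.1 h2 δ hδ0
    exact ⟨φ, by rwa [dist_eq_norm] at hy⟩
  choose φ hφ using happ
  refine ⟨F, φ, fun s => ?_⟩
  let q : J → C := fun j => ∑ l ∈ F, (p j l - φ l (a j)) • a l
  have hx : ∀ j, a j - ∑ l ∈ F, φ l (a j) • a l = (a j - ∑ l ∈ F, p j l • a l) + q j := by
    intro j
    simp only [q, sub_smul, Finset.sum_sub_distrib]; abel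
  have hq1 : ∀ j, q j * star (q j) ≤ ((∑ l ∈ F, ‖p j l - φ l (a j)‖ ^ 2) * Q) • (1 : C) := by
    intro j
    have h1 : ‖q j‖ ≤ Real.sqrt ((∑ l ∈ F, ‖p j l - φ l (a j)‖ ^ 2) * Q) := by
      refine Real.le_sqrt_of_sq_le ?_
      have h2 : ‖q j‖ ≤ ∑ l ∈ F, ‖p j l - φ l (a j)‖ * ‖a l‖ := (norm_sum_le _ _).trans (Finset.sum_le_sum fun l _ => norm_smul_le _ _)
      exact (pow_le_pow_left₀ (norm_nonneg _) h2 2).trans (Finset.sum_mul_sq_le_sq_mul_sq _ _ _)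
    have := mul_star_self_le_smul (q j) h1
    rwa [Real.sq_sqrt (mul_nonneg (Finset.sum_nonneg fun i _ => sq_nonneg _) hQ0)] at this
  have hq : ∑ j ∈ s, q j * star (q j) ≤ ((ε / 2) ^ 2) • (1 : C) := by
    refine (Finset.sum_le_sum fun j _ => hq1 j).trans ?_
    rw [← Finset.sum_smul]
    refine smul_le_smul_of_nonneg_right ?_ zero_le_one
    rw [← Finset.sum_mul, Finset.sum_comm]
    have h3 : ∀ l ∈ F, ∑ j ∈ s, ‖p j l - φ l (a j)‖ ^ 2 ≤ δ ^ 2 := by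
      intro l _
      have := lp.sum_rpow_le_norm_rpow (p := 2) (by norm_num) (P (lp.single 2 l (1:ℂ)) - fvec a hρ ha (φ l)) s
      have h4 : ∑ j ∈ s, ‖p j l - φ l (a j)‖ ^ 2 ≤ ‖P (lp.single 2 l (1:ℂ)) - fvec a hρ ha (φ l)‖ ^ 2 := by
        simpa [fvec_apply] using this
      exact h4.trans (pow_le_pow_left₀ (norm_nonneg _) (hφ l).le 2)
    have h5 := Finset.sum_le_sum h3
    rw [Finset.sum_const, nsmul_eq_mul] at h5
    have h6 : δ ^ 2 * ((F.card : ℝ) * Q + 1) = (ε / 2) ^ 2 := by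
      rw [hδ, div_pow, Real.sq_sqrt (by positivity)]; field_simp
    have h7 := mul_le_mul_of_nonneg_right h5 hQ0
    nlinarith [sq_nonneg δ]
  calc _ ≤ ∑ j ∈ s, ((2:ℝ) • ((a j - ∑ l ∈ F, p j l • a l) * star (a j - ∑ l ∈ F, p j l • a l)) + (2:ℝ) • (q j * star (q j))) := by
        refine Finset.sum_le_sum fun j _ => ?_
        rw [hx]; exact add_mul_star_le _ _
    _ = (2:ℝ) • ∑ j ∈ s, (a j - ∑ l ∈ F, p j l • a l) * star (a j - ∑ l ∈ F, p j l • a l) + (2:ℝ) • ∑ j ∈ s, q j * star (q j) := by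
        rw [Finset.sum_add_distrib, Finset.smul_sum, Finset.smul_sum]
    _ ≤ (2:ℝ) • ((ε / 2) ^ 2) • (1 : C) + (2:ℝ) • ((ε / 2) ^ 2) • (1 : C) :=
        add_le_add (smul_le_smul_of_nonneg_left (hp s) (by norm_num)) (smul_le_smul_of_nonneg_left hq (by norm_num))
    _ = (ε ^ 2) • (1 : C) := by
        rw [smul_smul, ← add_smul]; congr 1; ring

end PB
end

section
section PC
variable {C D : Type u} [CStarAlgebra C] [PartialOrder C] [StarOrderedRing C]
  [CStarAlgebra D] [PartialOrder D] [StarOrderedRing D]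

/-- product functional on the algebraic tensor product -/
def pf (φ : C →L[ℂ] ℂ) (ψ : D →L[ℂ] ℂ) : C ⊗[ℂ] D →ₗ[ℂ] ℂ :=
  TensorProduct.lift ((LinearMap.mul ℂ ℂ).compl₁₂ (φ : C →ₗ[ℂ] ℂ) (ψ : D →ₗ[ℂ] ℂ))

@[simp] lemma pf_tmul (φ : C →L[ℂ] ℂ) (ψ : D →L[ℂ] ℂ) (c : C) (d : D) : pf φ ψ (c ⊗ₜ d) = φ c * ψ d := by
  simp [pf]

lemma sigma_sum_le {n : ℕ → ℕ} (g : ∀ k, Fin (n k) → C) (hg : ∀ k i, 0 ≤ g k i) {r : ℕ → ℝ}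
    (h : ∀ k, ∑ i, g k i ≤ r k • (1 : C)) (s : Finset (Σ k, Fin (n k))) :
    ∑ j ∈ s, g j.1 j.2 ≤ (∑ k ∈ s.image Sigma.fst, r k) • (1 : C) := by
  have h1 : s ⊆ (s.image Sigma.fst).sigma (fun _ => Finset.univ) := by
    intro j hj; simp only [Finset.mem_sigma, Finset.mem_univ, and_true]; exact Finset.mem_image_of_mem _ hj
  refine (Finset.sum_le_sum_of_subset_of_nonneg h1 fun j _ _ => hg _ _).trans ?_
  rw [Finset.sum_sigma, Finset.sum_smul]
  exact Finset.sum_le_sum fun k _ => h k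

lemma sigma_small {n : ℕ → ℕ} (g : ∀ k, Fin (n k) → C) (hg : ∀ k i, 0 ≤ g k i) {r : ℕ → ℝ}
    (hr : ∀ k, 0 ≤ r k) (hs : Summable r)
    (h : ∀ k, ∑ i, g k i ≤ r k • (1 : C)) :
    (∀ s : Finset (Σ k, Fin (n k)), ∑ j ∈ s, g j.1 j.2 ≤ ((Real.sqrt (∑' k, r k + 1)) ^ 2) • (1 : C)) ∧
    ∀ ε : ℝ, 0 < ε → ∃ F : Finset (Σ k, Fin (n k)), ∀ s : Finset (Σ k, Fin (n k)), Disjoint s F →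
      ∑ j ∈ s, g j.1 j.2 ≤ (ε ^ 2) • (1 : C) := by
  constructor
  · intro s
    refine (sigma_sum_le g hg h s).trans (smul_le_smul_of_nonneg_right ?_ zero_le_one)
    have h0 : 0 ≤ ∑' k, r k := tsum_nonneg hr
    rw [Real.sq_sqrt (by linarith)]
    have := hs.sum_le_tsum (s.image Sigma.fst) (fun k _ => hr k)
    linarith
  · intro ε hε
    obtain ⟨F0, hF0⟩ := summable_iff_vanishing_norm.1 hs (ε ^ 2) (by positivity)
    refine ⟨F0.sigma fun _ => Finset.univ, fun s hd => ?_⟩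
    refine (sigma_sum_le g hg h s).trans (smul_le_smul_of_nonneg_right ?_ zero_le_one)
    have h1 : Disjoint (s.image Sigma.fst) F0 := by
      rw [Finset.disjoint_left] at hd ⊢
      intro k hk hk'
      obtain ⟨j, hj, rfl⟩ := Finset.mem_image.1 hk
      exact hd hj (by simp [hk'])
    exact (le_abs_self _).trans (hF0 _ h1).le

theorem hrep_tendsto (z : ℕ → C ⊗[ℂ] D) {r : ℕ → ℝ} (hr : ∀ k, 0 ≤ r k) (hs : Summable r)
    (hz : ∀ k, HRep (z k) (r k))
    (hf : ∀ (φ : C →L[ℂ] ℂ) (ψ : D →L[ℂ] ℂ),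
      Filter.Tendsto (fun K => pf φ ψ (∑ k ∈ Finset.range K, z k)) Filter.atTop (nhds 0)) {ε : ℝ} (hε : 0 < ε) :
    ∀ᶠ K in Filter.atTop, HRep (∑ k ∈ Finset.range K, z k) ε := by
  classical
  choose n a b hab ha hb using hz
  let J := Σ k, Fin (n k)
  obtain ⟨ha1, ha2⟩ := sigma_small (fun k i => a k i * star (a k i)) (fun k i => mul_star_self_nonneg _) hr hs ha
  obtain ⟨hb1, hb2⟩ := sigma_small (fun k i => star (b k i) * b k i) (fun k i => star_mul_self_nonneg _) hr hs hb
  set ρ := Real.sqrt (∑' k, r k + 1) with hρ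
  have hρ0 : 0 < ρ := Real.sqrt_pos.2 (by have h0 : 0 ≤ ∑' k, r k := tsum_nonneg hr; linarith)
  clear_value ρ
  let a' : J → C := fun j => a j.1 j.2
  let b' : J → D := fun j => b j.1 j.2
  let F : ℕ → Finset J := fun K => (Finset.range K).sigma fun _ => Finset.univ
  have hFt : Filter.Tendsto F Filter.atTop Filter.atTop := by
    refine Filter.tendsto_atTop_finset_of_monotone ?_ ?_
    · intro K K' h j hj
      have h1 := (Finset.mem_sigma.1 hj).1
      rw [Finset.mem_range] at h1
      exact Finset.mem_sigma.2 ⟨Finset.mem_range.2 (lt_of_lt_of_le h1 h), Finset.mem_univ _⟩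
    · intro j
      exact ⟨j.1 + 1, Finset.mem_sigma.2 ⟨Finset.mem_range.2 (Nat.lt_succ_self _), Finset.mem_univ _⟩⟩
  have hZ : ∀ K, ∑ k ∈ Finset.range K, z k = ∑ j ∈ F K, a' j ⊗ₜ[ℂ] b' j := by
    intro K
    rw [Finset.sum_sigma]
    exact Finset.sum_congr rfl fun k _ => hab k
  obtain ⟨F0, φ, hφ⟩ := proj_approx a' hρ0 ha1 ha2 (ε := ε / (4 * ρ)) (by positivity)
  -- the slices tend to zero
  have hw : ∀ l, Filter.Tendsto (fun K => ∑ j ∈ F K, φ l (a' j) • b' j) Filter.atTop (nhds 0) := by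
    intro l
    have hsm : Summable (fun j => φ l (a' j) • b' j) := by
      rw [summable_iff_vanishing_norm]
      intro δ hδ
      set η := δ / (2 * (‖φ l‖ * ρ + 1)) with hη
      have hη0 : 0 < η := by positivity
      obtain ⟨G, hG⟩ := hb2 η hη0
      refine ⟨G, fun t ht => ?_⟩
      have h1 := lin_row (fun j => star (b' j)) t hη0 (by simpa only [star_star] using hG t ht) (fun j => star (φ l (a' j)))
      have h2 : ∑ j ∈ t, star (φ l (a' j)) • star (b' j) = star (∑ j ∈ t, φ l (a' j) • b' j) := by
        simp [star_sum, star_smul]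
      rw [h2, norm_star] at h1
      simp only [norm_star] at h1
      have h3 := func_sq a' t hρ0 (ha1 t) (φ l)
      have h4 : Real.sqrt (∑ j ∈ t, ‖φ l (a' j)‖ ^ 2) ≤ ‖φ l‖ * ρ := Real.sqrt_le_iff.2 ⟨by positivity, h3⟩
      have h5 : η * (‖φ l‖ * ρ + 1) = δ / 2 := by rw [hη]; field_simp
      have h6 := mul_le_mul_of_nonneg_left h4 hη0.le
      nlinarith
    have h0 : ∑' j, φ l (a' j) • b' j = 0 := by
      by_contra hne
      obtain ⟨ψ, hψ⟩ := SeparatingDual.exists_ne_zero (R := ℂ) hne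
      apply hψ
      have h1 := (ψ.hasSum hsm.hasSum)
      have h2 := (show Filter.Tendsto _ Filter.atTop _ from h1).comp hFt
      refine tendsto_nhds_unique h2 ((hf (φ l) ψ).congr fun K => ?_)
      rw [hZ, map_sum]
      simp
    have := (show Filter.Tendsto _ Filter.atTop _ from hsm.hasSum).comp hFt
    rw [h0] at this
    exact this
  have hev : ∀ᶠ K in Filter.atTop, ∀ l ∈ F0, ‖a' l‖ * ‖∑ j ∈ F K, φ l (a' j) • b' j‖ < ε / (2 * (F0.card + 1)) := by
    rw [Filter.eventually_all_finset]
    intro l _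
    have := ((hw l).norm.const_mul ‖a' l‖)
    rw [norm_zero, mul_zero] at this
    exact this.eventually_lt_const (by positivity)
  filter_upwards [hev] with K hK
  have e1 : ∑ k ∈ Finset.range K, z k = ∑ j ∈ F K, (a' j - ∑ l ∈ F0, φ l (a' j) • a' l) ⊗ₜ[ℂ] b' j
      + ∑ l ∈ F0, a' l ⊗ₜ[ℂ] (∑ j ∈ F K, φ l (a' j) • b' j) := by
    rw [hZ]
    simp only [TensorProduct.sub_tmul, TensorProduct.sum_tmul, TensorProduct.tmul_sum, Finset.sum_sub_distrib]
    rw [Finset.sum_comm (s := F0), eq_comm]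
    convert sub_add_cancel _ _ using 2
    refine Finset.sum_congr rfl fun j _ => Finset.sum_congr rfl fun l _ => ?_
    rw [TensorProduct.smul_tmul]
  rw [e1]
  have t1 : HRep (∑ j ∈ F K, (a' j - ∑ l ∈ F0, φ l (a' j) • a' l) ⊗ₜ[ℂ] b' j) (ε / 2) := by
    have := hrep_of_fintype (I := F K) (fun j => a' j - ∑ l ∈ F0, φ l (a' j) • a' l) (fun j => b' j) (P := ε / (4 * ρ)) (Q := ρ) (r := ε / 2)
      (by positivity) hρ0.le (by field_simp; linarith)
      (by rw [Finset.sum_coe_sort (F K) (fun j => (a' j - ∑ l ∈ F0, φ l (a' j) • a' l) * star (a' j - ∑ l ∈ F0, φ l (a' j) • a' l))]; exact hφ _)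
      (by rw [Finset.sum_coe_sort (F K) (fun j => star (b' j) * b' j)]; exact hb1 _)
    rwa [Finset.sum_coe_sort (F K) (fun j => (a' j - ∑ l ∈ F0, φ l (a' j) • a' l) ⊗ₜ[ℂ] b' j)] at this
  have t2 : HRep (∑ l ∈ F0, a' l ⊗ₜ[ℂ] (∑ j ∈ F K, φ l (a' j) • b' j)) (∑ l ∈ F0, ε / (2 * (F0.card + 1))) := by
    refine HRep.sum _ _ _ fun l hl => ?_
    have := hrep_of_fintype (I := Unit) (fun _ => a' l) (fun _ => ∑ j ∈ F K, φ l (a' j) • b' j) (norm_nonneg _) (norm_nonneg _) (hK l hl)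
      (by simpa using mul_star_self_le_smul (a' l) le_rfl) (by rw [Fintype.sum_unique]; exact star_mul_self_le_smul _ le_rfl)
    simpa using this
  refine (t1.add t2).mono ?_
  rw [Finset.sum_const, nsmul_eq_mul]
  have : (F0.card : ℝ) * (ε / (2 * (F0.card + 1))) ≤ ε / 2 := by
    rw [mul_div_assoc', div_le_div_iff₀ (by positivity) (by positivity)]
    nlinarith
  linarith

theorem hrep'_tendsto (z : ℕ → C ⊗[ℂ] D) {r : ℕ → ℝ} (hr : ∀ k, 0 ≤ r k) (hs : Summable r)
    (hz : ∀ k, HRep' (z k) (r k))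
    (hf : ∀ (φ : C →L[ℂ] ℂ) (ψ : D →L[ℂ] ℂ),
      Filter.Tendsto (fun K => pf φ ψ (∑ k ∈ Finset.range K, z k)) Filter.atTop (nhds 0)) {ε : ℝ} (hε : 0 < ε) :
    ∀ᶠ K in Filter.atTop, HRep' (∑ k ∈ Finset.range K, z k) ε := by
  have h1 : ∀ (φ : C →L[ℂ] ℂ) (ψ : D →L[ℂ] ℂ) (w : C ⊗[ℂ] D), pf ψ φ (TensorProduct.comm ℂ C D w) = pf φ ψ w := by
    intro φ ψ w
    induction w with
    | zero => simp
    | tmul c d => simp [mul_comm]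
    | add x y hx hy => rw [map_add, map_add, map_add, hx, hy]
  have := hrep_tendsto (fun k => TensorProduct.comm ℂ C D (z k)) hr hs (fun k => (hrep'_comm _ _).1 (hz k))
    (fun φ ψ => by
      refine (hf ψ φ).congr fun K => ?_
      rw [← map_sum, h1]) hε
  filter_upwards [this] with K hK
  rw [hrep'_comm, map_sum]; exact hK

end PC
end

section
section INJ
variable {A B X : Type u} [NonUnitalCStarAlgebra A] [NonUnitalCStarAlgebra B]
    [NonUnitalNormedRing X] [NormedSpace ℂ X] {ι : A ⊗[ℂ] B →ₗ[ℂ] X}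
    {C D : Type u} [CStarAlgebra C] [PartialOrder C] [StarOrderedRing C]
    [CStarAlgebra D] [PartialOrder D] [StarOrderedRing D]

lemma pf_hrep_le {z : C ⊗[ℂ] D} {r : ℝ} (hr : 0 < r) (h : HRep z r) (φ : C →L[ℂ] ℂ) (ψ : D →L[ℂ] ℂ) :
    ‖pf φ ψ z‖ ≤ ‖φ‖ * ‖ψ‖ * r := by
  obtain ⟨n, a, b, rfl, h1, h2⟩ := h
  have hs : 0 < Real.sqrt r := Real.sqrt_pos.2 hr
  have e := Real.sq_sqrt hr.le
  have k1 := func_sq a Finset.univ hs (by rw [e]; exact h1) φ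
  let ψ' : D → ℂ := fun d => ψ d
  have k2 : ∑ i, ‖ψ (b i)‖ ^ 2 ≤ (‖ψ‖ * Real.sqrt r) ^ 2 := by
    let ψs : D →L[ℂ] ℂ := LinearMap.mkContinuous
      { toFun := fun d => star (ψ (star d)), map_add' := fun x y => by simp, map_smul' := fun c x => by simp } ‖ψ‖
      (fun x => by
        change ‖star (ψ (star x))‖ ≤ _
        rw [norm_star]; exact (ψ.le_opNorm _).trans (by rw [norm_star]))
    have hn : ‖ψs‖ ≤ ‖ψ‖ := LinearMap.mkContinuous_norm_le _ (norm_nonneg _) _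
    have := func_sq (fun i => star (b i)) Finset.univ hs (by simpa only [star_star, e] using h2) ψs
    have e2 : ∀ i, ‖ψs (star (b i))‖ = ‖ψ (b i)‖ := by
      intro i
      change ‖star (ψ (star (star (b i))))‖ = _
      rw [norm_star, star_star]
    simp only [e2] at this
    refine this.trans ?_
    gcongr
  rw [map_sum]
  simp only [pf_tmul]
  have h3 : ‖∑ i, φ (a i) * ψ (b i)‖ ≤ ∑ i, ‖φ (a i)‖ * ‖ψ (b i)‖ := (norm_sum_le _ _).trans (Finset.sum_le_sum fun i _ => (norm_mul_le _ _))
  have h4 := Finset.sum_mul_sq_le_sq_mul_sq Finset.univ (fun i => ‖φ (a i)‖) (fun i => ‖ψ (b i)‖)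
  have h5 := mul_le_mul k1 k2 (Finset.sum_nonneg fun i _ => sq_nonneg _) (by positivity)
  have h6 : (∑ i, ‖φ (a i)‖ * ‖ψ (b i)‖) ^ 2 ≤ (‖φ‖ * ‖ψ‖ * r) ^ 2 := by
    refine (h4.trans h5).trans (le_of_eq ?_)
    rw [mul_pow, mul_pow, e]; ring
  exact h3.trans (abs_le_of_sq_le_sq' h6 (by positivity)).2

lemma pf_norm_le (hX : TensorData ι) (π : A →⋆ₙₐ[ℂ] C) (π' : B →⋆ₙₐ[ℂ] D) (φ : C →L[ℂ] ℂ) (ψ : D →L[ℂ] ℂ) (u : A ⊗[ℂ] B) :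
    ‖pf φ ψ (qmap π π' u)‖ ≤ ‖φ‖ * ‖ψ‖ * ‖ι u‖ := by
  have key : ∀ ε : ℝ, 0 < ε → ‖pf φ ψ (qmap π π' u)‖ ≤ ‖φ‖ * ‖ψ‖ * (‖ι u‖ + ε) := fun ε hε =>
    pf_hrep_le (by positivity) (hrep_of_norm_lt hX π π' u (by linarith)).1 φ ψ
  have hcont : Filter.Tendsto (fun ε : ℝ => ‖φ‖ * ‖ψ‖ * (‖ι u‖ + ε)) (nhdsWithin 0 (Set.Ioi 0)) (nhds (‖φ‖ * ‖ψ‖ * (‖ι u‖ + 0))) :=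
    (Continuous.tendsto (by fun_prop) 0).mono_left nhdsWithin_le_nhds
  rw [add_zero] at hcont
  exact ge_of_tendsto hcont (Filter.eventually_of_mem self_mem_nhdsWithin fun ε hε => key ε hε)

lemma exists_pf (hX : TensorData ι) (π : A →⋆ₙₐ[ℂ] C) (π' : B →⋆ₙₐ[ℂ] D) (φ : C →L[ℂ] ℂ) (ψ : D →L[ℂ] ℂ) :
    ∃ G : X →L[ℂ] ℂ, (∀ u, G (ι u) = pf φ ψ (qmap π π' u)) ∧ ∀ x, ‖G x‖ ≤ ‖φ‖ * ‖ψ‖ * ‖x‖ :=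
  exists_extension ι hX.dense (pf φ ψ ∘ₗ qmap π π') _ (by positivity) (pf_norm_le hX π π' φ ψ)

theorem inj_main (hX : TensorData ι) {π : A →⋆ₙₐ[ℂ] C} {π' : B →⋆ₙₐ[ℂ] D} (hs : Function.Surjective π)
    (hs' : Function.Surjective π') (T : X →L[ℂ] ℂ) (h1 : ∀ a b, π a = 0 → T (ι (a ⊗ₜ b)) = 0)
    (h2 : ∀ a b, π' b = 0 → T (ι (a ⊗ₜ b)) = 0) (z : X)
    (hz : ∀ (φ : C →L[ℂ] ℂ) (ψ : D →L[ℂ] ℂ) (G : X →L[ℂ] ℂ), (∀ u, G (ι u) = pf φ ψ (qmap π π' u)) → G z = 0) :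
    T z = 0 := by
  obtain ⟨S, -, hS, hJ⟩ := exists_bar hX hs hs' T h1 h2
  set c := ‖z‖ + 1 with hc
  have hc0 : 0 < c := by positivity
  have hv : ∀ k : ℕ, ∃ v : A ⊗[ℂ] B, ‖z - ι v‖ < c * (1/2) ^ k ∧ (k = 0 → v = 0) := by
    intro k
    rcases Nat.eq_zero_or_pos k with rfl | hk
    · exact ⟨0, by simp [hc], fun _ => rfl⟩
    · obtain ⟨v, hv⟩ := hX.dense.exists_dist_lt z (show 0 < c * (1/2) ^ k by positivity)
      exact ⟨v, by rwa [dist_eq_norm] at hv, fun h => by omega⟩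
  choose v hv hv0 using hv
  have hv0' := hv0 0 rfl
  let z' : ℕ → C ⊗[ℂ] D := fun k => qmap π π' (v (k+1) - v k)
  have hzs : ∀ K, ∑ k ∈ Finset.range K, z' k = qmap π π' (v K) := by
    intro K
    rw [← map_sum, Finset.sum_range_sub, hv0', sub_zero]
  have hlt : ∀ k, ‖ι (v (k+1) - v k)‖ < 2 * c * (1/2) ^ k := by
    intro k
    have e : ι (v (k+1) - v k) = (z - ι (v k)) - (z - ι (v (k+1))) := by rw [map_sub]; abel
    rw [e]
    have := norm_sub_le (z - ι (v k)) (z - ι (v (k+1)))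
    have a1 := hv k
    have a2 := hv (k+1)
    rw [pow_succ] at a2
    have : 0 < c * (1/2 : ℝ) ^ k := by positivity
    nlinarith
  have hvt : Filter.Tendsto (fun K => ι (v K)) Filter.atTop (nhds z) := by
    rw [tendsto_iff_norm_sub_tendsto_zero]
    have : Filter.Tendsto (fun k : ℕ => c * (1/2 : ℝ) ^ k) Filter.atTop (nhds (c * 0)) :=
      (tendsto_pow_atTop_nhds_zero_of_lt_one (by norm_num) (by norm_num)).const_mul c
    rw [mul_zero] at this
    refine squeeze_zero (fun _ => norm_nonneg _) (fun k => ?_) this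
    rw [norm_sub_rev]; exact (hv k).le
  have hr : ∀ k : ℕ, 0 ≤ 2 * c * (1/2 : ℝ) ^ k := fun k => by positivity
  have hsm : Summable (fun k : ℕ => 2 * c * (1/2 : ℝ) ^ k) := summable_geometric_two.mul_left _
  have hf : ∀ (φ : C →L[ℂ] ℂ) (ψ : D →L[ℂ] ℂ),
      Filter.Tendsto (fun K => pf φ ψ (∑ k ∈ Finset.range K, z' k)) Filter.atTop (nhds 0) := by
    intro φ ψ
    obtain ⟨G, hG, -⟩ := exists_pf hX π π' φ ψ
    have := (G.continuous.tendsto z).comp hvt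
    rw [hz φ ψ G hG] at this
    refine this.congr fun K => ?_
    rw [hzs, Function.comp_apply, hG]
  have hT := ((T.continuous.tendsto z).comp hvt).norm
  set κ := 71712 * (‖T‖ * 4) with hκ
  have hκ0 : 0 ≤ κ := by positivity
  have key : ∀ ε : ℝ, 0 < ε → ‖T z‖ ≤ κ * ε := by
    intro ε hε
    refine le_of_tendsto hT ?_
    filter_upwards [hrep_tendsto z' hr hsm (fun k => (hrep_of_norm_lt hX π π' _ (hlt k)).1) hf hε,
      hrep'_tendsto z' hr hsm (fun k => (hrep_of_norm_lt hX π π' _ (hlt k)).2) hf hε] with K hK hK'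
    have := hm_bound hJ hε hK hK'
    rwa [hzs, hS] at this
  have hcont : Filter.Tendsto (fun ε : ℝ => κ * ε) (nhdsWithin 0 (Set.Ioi 0)) (nhds (κ * 0)) :=
    (Continuous.tendsto (by fun_prop) 0).mono_left nhdsWithin_le_nhds
  rw [mul_zero] at hcont
  have := ge_of_tendsto hcont (Filter.eventually_of_mem self_mem_nhdsWithin fun ε hε => key ε hε)
  exact norm_le_zero_iff.1 this
end INJ
end

section
section EXC
variable {C : Type*} [CStarAlgebra C] [PartialOrder C] [StarOrderedRing C]

/-- piecewise linear bump -/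
def bmp (a b t : ℝ) : ℝ := max 0 (min 1 ((t - a) / (b - a)))

lemma bmp_cont {a b : ℝ} : Continuous (bmp a b) := by unfold bmp; fun_prop
lemma bmp_nonneg (a b t : ℝ) : 0 ≤ bmp a b t := le_max_left _ _
lemma bmp_le (a b t : ℝ) : bmp a b t ≤ 1 := max_le (by norm_num) (min_le_left _ _)
lemma bmp_zero {a b t : ℝ} (h : a < b) (ht : t ≤ a) : bmp a b t = 0 := by
  unfold bmp
  refine max_eq_left (min_le_of_right_le ?_)
  exact div_nonpos_of_nonpos_of_nonneg (by linarith) (by linarith)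
lemma bmp_one {a b t : ℝ} (h : a < b) (ht : b ≤ t) : bmp a b t = 1 := by
  unfold bmp
  have : 1 ≤ (t - a) / (b - a) := by rw [le_div_iff₀ (by linarith)]; linarith
  rw [min_eq_left this]; norm_num
lemma bmp_mul {a b c : ℝ} (h : a < b) (h' : b < c) (t : ℝ) : bmp a b t * bmp b c t = bmp b c t := by
  rcases le_total t b with ht | ht
  · rw [bmp_zero h' ht, mul_zero]
  · rw [bmp_one h ht, one_mul]

/-- an admissible pair -/
structure Adm (g k : C) : Prop where
  g0 : 0 ≤ g
  g1 : ‖g‖ ≤ 1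
  k0 : 0 ≤ k
  kne : k ≠ 0
  gk : g * k = k

lemma norm_mem_spec [Nontrivial C] {y : C} (hy : 0 ≤ y) : ‖y‖ ∈ spectrum ℝ y := by
  rcases CStarAlgebra.norm_or_neg_norm_mem_spectrum (IsSelfAdjoint.of_nonneg hy) with h | h
  · exact h
  · have := spectrum_nonneg_of_nonneg hy h
    have h0 := norm_nonneg y
    have : ‖y‖ = 0 := by linarith
    rw [this] at h ⊢; simpa using h

lemma adm_of [Nontrivial C] {y : C} (hy : 0 ≤ y) {a b : ℝ} (ha : 0 < a) (hab : a < b) (hb : b < ‖y‖) :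
    Adm (cfc (bmp a b) y) (cfc (bmp b ‖y‖) y) ∧ ∀ g0 : C, g0 * y = y → g0 * cfc (bmp a b) y = cfc (bmp a b) y := by
  have hsa : IsSelfAdjoint y := IsSelfAdjoint.of_nonneg hy
  have c1 : Continuous (bmp a b) := bmp_cont
  have c2 : Continuous (bmp b ‖y‖) := bmp_cont
  refine ⟨⟨cfc_nonneg fun x _ => bmp_nonneg _ _ _, norm_cfc_le zero_le_one fun x _ => ?_, cfc_nonneg fun x _ => bmp_nonneg _ _ _, ?_, ?_⟩, ?_⟩
  · rw [Real.norm_of_nonneg (bmp_nonneg _ _ _)]; exact bmp_le _ _ _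
  · intro h0
    have := norm_apply_le_norm_cfc (bmp b ‖y‖) y (norm_mem_spec hy) c2.continuousOn hsa
    rw [h0, norm_zero, bmp_one hb le_rfl] at this
    norm_num at this
  · rw [← cfc_mul _ _ y c1.continuousOn c2.continuousOn]
    exact cfc_congr fun t _ => bmp_mul hab hb t
  · intro g0 hg0
    have c3 : Continuous (fun t => bmp a b t / max t a) := c1.div (by fun_prop) fun t => (lt_max_of_lt_right ha).ne'
    have : cfc (bmp a b) y = y * cfc (fun t => bmp a b t / max t a) y := by
      conv_rhs => rw [← cfc_id' ℝ y hsa]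
      conv_rhs => arg 2; rw [cfc_id' ℝ y hsa]
      rw [← cfc_mul (fun t : ℝ => t) _ y (by fun_prop) c3.continuousOn]
      refine cfc_congr fun t _ => ?_
      change bmp a b t = t * (bmp a b t / max t a)
      rcases le_total t a with ht | ht
      · rw [bmp_zero hab ht]; simp
      · have hne : t ≠ 0 := (lt_of_lt_of_le ha ht).ne'
        rw [max_eq_left ht, mul_div_assoc', mul_comm t, mul_div_cancel_right₀ _ hne]
    rw [this, ← mul_assoc, hg0]

lemma sq_le_self_of {g : C} (h0 : 0 ≤ g) (h1 : ‖g‖ ≤ 1) : g * g ≤ g := by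
  have hsa : IsSelfAdjoint g := IsSelfAdjoint.of_nonneg h0
  have e1 : g = cfc (fun t : ℝ => t) g := (cfc_id' ℝ g hsa).symm
  have e2 : g * g = cfc (fun t : ℝ => t * t) g := by
    rw [cfc_mul (fun t : ℝ => t) (fun t => t) g, ← e1]
  rw [e2]
  conv_rhs => rw [e1]
  refine cfc_mono fun t ht => ?_
  have h2 := spectrum_nonneg_of_nonneg h0 ht
  have h3 : ‖t‖ ≤ ‖g‖ := by
    rcases subsingleton_or_nontrivial C with h | h
    · exact absurd ht (by rw [spectrum.of_subsingleton]; simp)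
    · exact spectrum.norm_le_norm_of_mem ht
  rw [Real.norm_of_nonneg h2] at h3
  nlinarith

lemma exc_step [Nontrivial C] {g0 k0 : C} (h : Adm g0 k0) {x : C} (hx : 1 ≤ x) {ε : ℝ} (hε : 0 < ε) :
    ∃ (g k : C) (t : ℝ), Adm g k ∧ g0 * g = g ∧ ‖g * (x - t • 1) * g‖ ≤ ε := by
  have hx0 : 0 ≤ x := zero_le_one.trans hx
  have hxn : 1 ≤ ‖x‖ := by
    have := CStarAlgebra.norm_le_norm_of_nonneg_of_le zero_le_one hx
    rwa [CStarRing.norm_one] at this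
  -- refinement of pairs
  have href : ∀ k : C, 0 ≤ k → k ≠ 0 → ∃ g2 k2 : C, Adm g2 k2 ∧ ∀ g0 : C, g0 * k = k → g0 * g2 = g2 := by
    intro k hk hkn
    have : 0 < ‖k‖ := norm_pos_iff.2 hkn
    obtain ⟨h1, h2⟩ := adm_of hk (a := ‖k‖ / 4) (b := ‖k‖ / 2) (by linarith) (by linarith) (by linarith)
    exact ⟨_, _, h1, h2⟩
  let S : Set ℝ := {r | ∃ g k : C, Adm g k ∧ g0 * g = g ∧ r = ‖g * x * g‖}
  have hne : S.Nonempty := by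
    obtain ⟨g, k, h1, h2⟩ := href k0 h.k0 h.kne
    exact ⟨_, g, k, h1, h2 g0 h.gk, rfl⟩
  have hlow : ∀ r ∈ S, 1 ≤ r := by
    rintro _ ⟨g, k, h1, h2, rfl⟩
    have a1 : g * g ≤ g * x * g := by
      have := (IsSelfAdjoint.of_nonneg h1.g0).conjugate_le_conjugate hx
      rwa [mul_one] at this
    have a2 : 0 ≤ g * g := by
      have := star_mul_self_nonneg g
      rwa [(IsSelfAdjoint.of_nonneg h1.g0).star_eq] at this
    have a3 := CStarAlgebra.norm_le_norm_of_nonneg_of_le a2 a1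
    have a4 : ‖k‖ ≤ ‖g * g‖ * ‖k‖ := by
      have : g * g * k = k := by rw [mul_assoc, h1.gk, h1.gk]
      conv_lhs => rw [← this]
      exact norm_mul_le _ _
    have a5 : 0 < ‖k‖ := norm_pos_iff.2 h1.kne
    have a6 : 1 ≤ ‖g * g‖ := by
      by_contra hh
      push Not at hh
      nlinarith
    linarith
  have hbdd : BddBelow S := ⟨1, hlow⟩
  set s := sInf S with hs
  have hs1 : 1 ≤ s := le_csInf hne hlow
  set τ : ℝ := min (1/2) (ε / (3 * ‖x‖)) with hτ
  have hτ0 : 0 < τ := by positivity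
  have hτ1 : τ ≤ 1/2 := min_le_left _ _
  have hτ2 : τ * (3 * ‖x‖) ≤ ε := by
    have := min_le_right (1/2) (ε / (3 * ‖x‖))
    rwa [← hτ, le_div_iff₀ (by positivity)] at this
  clear_value τ
  set δ := τ ^ 2 / 2 with hδ
  have hδ0 : 0 < δ := by positivity
  have hδ1 : δ ≤ 1/8 := by nlinarith
  clear_value s
  obtain ⟨N, ⟨g1, k1, hA1, hg01, rfl⟩, hN⟩ : ∃ N ∈ S, N < s * (1 + δ) :=
    exists_lt_of_csInf_lt hne (by rw [← hs]; nlinarith)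
  obtain ⟨g2, k2, hA2, hr2⟩ := href k1 hA1.k0 hA1.kne
  have sa1 : IsSelfAdjoint g1 := IsSelfAdjoint.of_nonneg hA1.g0
  have sa2 : IsSelfAdjoint g2 := IsSelfAdjoint.of_nonneg hA2.g0
  have h12 : g1 * g2 = g2 := hr2 g1 hA1.gk
  have h21 : g2 * g1 = g2 := by
    have := congrArg star h12
    rwa [star_mul, sa1.star_eq, sa2.star_eq] at this
  have h02 : g0 * g2 = g2 := by rw [← h12, ← mul_assoc, hg01]
  set N := ‖g1 * x * g1‖ with hNdef
  set y := g2 * x * g2 with hy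
  have hy0 : 0 ≤ y := sa2.conjugate_nonneg hx0
  have hsr : s ≤ ‖y‖ := hs ▸ csInf_le hbdd ⟨g2, k2, hA2, h02, rfl⟩
  have hrx : ‖y‖ ≤ ‖x‖ := by
    calc ‖y‖ ≤ ‖g2‖ * ‖x‖ * ‖g2‖ := norm_mul₃_le
      _ ≤ 1 * ‖x‖ * 1 := by gcongr; exact hA2.g1; exact hA2.g1
      _ = ‖x‖ := by ring
  set r := ‖y‖ with hr
  have hr0 : 0 < r := by linarith
  obtain ⟨hA3, h3⟩ := adm_of hy0 (a := r * (1 - δ)) (b := r * (1 - δ / 2)) (by nlinarith) (by nlinarith) (by nlinarith)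
  set g3 := cfc (bmp (r * (1 - δ)) (r * (1 - δ / 2))) y with hg3
  have sa3 : IsSelfAdjoint g3 := IsSelfAdjoint.of_nonneg hA3.g0
  have h03 : g0 * g3 = g3 := h3 g0 (by rw [hy, ← mul_assoc, ← mul_assoc, h02])
  have sub01 : r * (1 - δ) < r * (1 - δ / 2) := by nlinarith
  have ysa : IsSelfAdjoint y := IsSelfAdjoint.of_nonneg hy0
  -- functional calculus facts about g3
  have hcf : ∀ c : ℝ, g3 * (y - c • 1) * g3 = cfc (fun t => bmp (r * (1 - δ)) (r * (1 - δ / 2)) t * (t - c) * bmp (r * (1 - δ)) (r * (1 - δ / 2)) t) y := by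
    intro c
    have c1 : Continuous (bmp (r * (1 - δ)) (r * (1 - δ / 2))) := bmp_cont
    have e : y - c • 1 = cfc (fun t : ℝ => t - c) y := by
      rw [cfc_sub (fun t : ℝ => t) (fun _ => c) y, cfc_id' ℝ y, cfc_const c y, Algebra.algebraMap_eq_smul_one]
    rw [cfc_mul _ _ y (by fun_prop) (by fun_prop), cfc_mul _ _ y (by fun_prop) (by fun_prop), ← e]
  have hup : ‖g3 * (y - r • 1) * g3‖ ≤ r * δ := by
    rw [hcf]
    refine norm_cfc_le (by positivity) fun t ht => ?_
    have ht1 : t ≤ r := (le_abs_self _).trans (spectrum.norm_le_norm_of_mem ht)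
    set β := bmp (r * (1 - δ)) (r * (1 - δ / 2)) t with hβ
    have b0 : 0 ≤ β := bmp_nonneg _ _ _
    have b1 : β ≤ 1 := bmp_le _ _ _
    rcases le_total t (r * (1 - δ)) with hh | hh
    · rw [hβ, bmp_zero sub01 hh]; simp; positivity
    · have : ‖t - r‖ ≤ r * δ := by rw [Real.norm_eq_abs, abs_le]; constructor <;> nlinarith
      rw [norm_mul, norm_mul, Real.norm_of_nonneg b0]
      calc β * ‖t - r‖ * β ≤ 1 * (r * δ) * 1 := by gcongr
        _ = r * δ := by ring
  have hlo : (r * (1 - δ)) • (g3 * g3) ≤ g3 * y * g3 := by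
    have : 0 ≤ g3 * (y - (r * (1 - δ)) • 1) * g3 := by
      rw [hcf]
      refine cfc_nonneg fun t ht => ?_
      rcases le_total t (r * (1 - δ)) with hh | hh
      · rw [bmp_zero sub01 hh]; simp
      · have := bmp_nonneg (r * (1 - δ)) (r * (1 - δ / 2)) t
        exact mul_nonneg (mul_nonneg this (by linarith)) this
    rw [mul_sub, sub_mul, mul_smul_comm, mul_one, smul_mul_assoc] at this
    exact sub_nonneg.1 this
  -- g2 almost a unit for g3
  have hN0 : 0 < N := lt_of_lt_of_le (by linarith) (hlow N ⟨g1, k1, hA1, hg01, rfl⟩)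
  have hsN : s ≤ N := hs ▸ csInf_le hbdd ⟨g1, k1, hA1, hg01, rfl⟩
  have hyN : y ≤ N • (g2 * g2) := by
    have a1 : g1 * x * g1 ≤ N • (1 : C) := by
      have := IsSelfAdjoint.le_algebraMap_norm_self (a := g1 * x * g1) (IsSelfAdjoint.of_nonneg (sa1.conjugate_nonneg hx0))
      rwa [Algebra.algebraMap_eq_smul_one] at this
    have := sa2.conjugate_le_conjugate a1
    have e : g2 * (g1 * x * g1) * g2 = y := by
      rw [hy]; calc _ = (g2 * g1) * x * (g1 * g2) := by noncomm_ring
        _ = _ := by rw [h21, h12]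
    rw [e, mul_smul_comm, mul_one, smul_mul_assoc] at this
    exact this
  set d := (1 - g2) * g3 with hd
  have hdn : ‖d‖ ≤ τ := by
    refine norm_le_of_star_mul_self_le hτ0.le ?_
    have a1 : star d * d = g3 * ((1 - g2) * (1 - g2)) * g3 := by
      rw [hd, star_mul, sa3.star_eq, star_sub, star_one, sa2.star_eq]; noncomm_ring
    have a2 : (1 - g2) * (1 - g2) ≤ 1 - g2 * g2 := by
      have b1 := sq_le_self_of hA2.g0 hA2.g1
      have b2 : 1 - g2 * g2 = (1 - g2) * (1 - g2) + (g2 - g2 * g2) + (g2 - g2 * g2) := by noncomm_ring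
      rw [b2, add_assoc]
      exact le_add_of_nonneg_right (add_nonneg (sub_nonneg.2 b1) (sub_nonneg.2 b1))
    have a3 := sa3.conjugate_le_conjugate a2
    have a4 : g3 * (1 - g2 * g2) * g3 = g3 * g3 - g3 * (g2 * g2) * g3 := by noncomm_ring
    have a5 := sa3.conjugate_le_conjugate hyN
    rw [mul_smul_comm, smul_mul_assoc] at a5
    have a6 : (r * (1 - δ) / N) • (g3 * g3) ≤ g3 * (g2 * g2) * g3 := by
      have := smul_le_smul_of_nonneg_left (hlo.trans a5) (inv_pos.2 hN0).le
      rw [smul_smul, smul_smul, inv_mul_cancel₀ hN0.ne', one_smul] at this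
      rwa [div_eq_inv_mul]
    have a7 : 1 - r * (1 - δ) / N ≤ τ ^ 2 := by
      have : (1 - τ ^ 2) * N ≤ r * (1 - δ) := by
        have : τ ^ 2 = 2 * δ := by rw [hδ]; ring
        rw [this]
        nlinarith
      have := (le_div_iff₀ hN0).2 this
      linarith
    rw [a1]
    refine a3.trans ?_
    rw [a4]
    have g3sq : g3 * g3 ≤ 1 := by
      have := star_mul_self_le_smul g3 hA3.g1
      rwa [sa3.star_eq, one_pow, one_smul] at this
    have g3pos : 0 ≤ g3 * g3 := by
      have := star_mul_self_nonneg g3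
      rwa [sa3.star_eq] at this
    calc _ ≤ g3 * g3 - (r * (1 - δ) / N) • (g3 * g3) := sub_le_sub_left a6 _
      _ = (1 - r * (1 - δ) / N) • (g3 * g3) := by rw [sub_smul, one_smul]
      _ ≤ (τ ^ 2) • (g3 * g3) := smul_le_smul_of_nonneg_right a7 g3pos
      _ ≤ (τ ^ 2) • 1 := smul_le_smul_of_nonneg_left g3sq (by positivity)
  refine ⟨g3, _, r, hA3, h03, ?_⟩
  have e : g3 * (x - r • 1) * g3 = g3 * (y - r • 1) * g3 + star d * x * g3 + g3 * g2 * x * d := by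
    rw [hd, star_mul, sa3.star_eq, star_sub, star_one, sa2.star_eq, hy]
    noncomm_ring
  rw [e]
  have n1 : ‖star d * x * g3‖ ≤ τ * ‖x‖ * 1 := norm_mul₃_le.trans (by rw [norm_star]; gcongr; exact hA3.g1)
  have n2 : ‖g3 * g2 * x * d‖ ≤ 1 * 1 * ‖x‖ * τ := by
    refine (norm_mul_le _ _).trans ?_
    have : ‖g3 * g2 * x‖ ≤ 1 * 1 * ‖x‖ := norm_mul₃_le.trans (by gcongr; exact hA3.g1; exact hA2.g1)
    gcongr
  have n3 := norm_add₃_le (a := g3 * (y - r • 1) * g3) (b := star d * x * g3) (c := g3 * g2 * x * d)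
  have n4 : r * δ ≤ ‖x‖ * τ := by
    have : δ ≤ τ := by rw [hδ]; nlinarith
    gcongr
  nlinarith

end EXC
end

section
section AVG
variable {C : Type*} [CStarAlgebra C] [PartialOrder C] [StarOrderedRing C]

lemma avg_norm_le {J : Type*} [Fintype J] (p : J → C) (hp : ∑ j, star (p j) * p j ≤ 1) (y : C) :
    ‖∑ j, star (p j) * y * p j‖ ≤ ‖y‖ := by
  refine norm_le_of_star_mul_self_le (norm_nonneg y) ?_
  have h1 := cs_row (fun j => star (p j)) (fun j => y * p j) (by simpa using hp)
  simp only [← mul_assoc] at h1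
  refine h1.trans ?_
  calc ∑ j, star (y * p j) * y * p j = ∑ j, star (p j) * (star y * y) * p j := by
        refine Finset.sum_congr rfl fun j _ => ?_
        rw [star_mul]; noncomm_ring
    _ ≤ ∑ j, star (p j) * ((‖y‖ ^ 2) • (1 : C)) * p j :=
        Finset.sum_le_sum fun j _ => star_left_conjugate_le_conjugate (star_mul_self_le_smul y le_rfl) _
    _ = (‖y‖ ^ 2) • ∑ j, star (p j) * p j := by
        rw [Finset.smul_sum]
        refine Finset.sum_congr rfl fun j _ => ?_
        rw [mul_smul_comm, mul_one, smul_mul_assoc]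
    _ ≤ (‖y‖ ^ 2) • 1 := smul_le_smul_of_nonneg_left hp (by positivity)

lemma exc_step_sa [Nontrivial C] {g0 k0 : C} (h : Adm g0 k0) {x : C} (hx : IsSelfAdjoint x) {ε : ℝ} (hε : 0 < ε) :
    ∃ (g k : C) (t : ℝ), Adm g k ∧ g0 * g = g ∧ ‖g * (x - t • 1) * g‖ ≤ ε := by
  have h1 : 1 ≤ x + (‖x‖ + 1) • (1 : C) := by
    have := hx.neg_algebraMap_norm_le_self
    rw [Algebra.algebraMap_eq_smul_one] at this
    have h2 := add_le_add_left this ((‖x‖ + 1) • (1 : C))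
    calc (1 : C) = -(‖x‖ • (1 : C)) + (‖x‖ + 1) • (1 : C) := by rw [add_smul, one_smul]; abel
      _ ≤ _ := h2
  obtain ⟨g, k, t, hA, hg, ht⟩ := exc_step h h1 hε
  refine ⟨g, k, t - (‖x‖ + 1), hA, hg, ?_⟩
  convert ht using 4
  rw [sub_smul]; abel

lemma adm_persist {g0 g y : C} (h0 : 0 ≤ g0) (hg : 0 ≤ g) (hg1 : ‖g‖ ≤ 1) (h : g0 * g = g) :
    ‖g * y * g‖ ≤ ‖g0 * y * g0‖ := by
  have h' : g * g0 = g := by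
    have := congrArg star h
    rwa [star_mul, (IsSelfAdjoint.of_nonneg h0).star_eq, (IsSelfAdjoint.of_nonneg hg).star_eq] at this
  have e : g * y * g = g * (g0 * y * g0) * g := by
    calc _ = (g * g0) * y * (g0 * g) := by rw [h, h']
      _ = _ := by noncomm_ring
  rw [e]
  calc _ ≤ ‖g‖ * ‖g0 * y * g0‖ * ‖g‖ := norm_mul₃_le
    _ ≤ 1 * ‖g0 * y * g0‖ * 1 := by gcongr
    _ = _ := by ring

lemma exc_step_c [Nontrivial C] {g0 k0 : C} (h : Adm g0 k0) (x : C) {ε : ℝ} (hε : 0 < ε) :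
    ∃ (g k : C) (t : ℂ), Adm g k ∧ g0 * g = g ∧ ‖g * (x - t • 1) * g‖ ≤ ε := by
  obtain ⟨g1, k1, t1, hA1, hg1, ht1⟩ := exc_step_sa h (realPart x).2 (half_pos hε)
  obtain ⟨g2, k2, t2, hA2, hg2, ht2⟩ := exc_step_sa hA1 (imaginaryPart x).2 (half_pos hε)
  refine ⟨g2, k2, t1 + Complex.I * t2, hA2, by rw [← hg2, ← mul_assoc, hg1], ?_⟩
  have e : g2 * (x - ((t1 : ℂ) + Complex.I * t2) • 1) * g2 = g2 * ((realPart x : C) - t1 • 1) * g2 +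
      Complex.I • (g2 * ((imaginaryPart x : C) - t2 • 1) * g2) := by
    conv_lhs => rw [← realPart_add_I_smul_imaginaryPart x]
    rw [add_smul, mul_smul, Complex.coe_smul, Complex.coe_smul, ← smul_mul_assoc, ← mul_smul_comm, ← add_mul, ← mul_add, smul_sub]
    congr 2
    abel
  rw [e]
  have := norm_add_le (g2 * ((realPart x : C) - t1 • 1) * g2) (Complex.I • (g2 * ((imaginaryPart x : C) - t2 • 1) * g2))
  rw [norm_smul, Complex.norm_I, one_mul] at this
  have h3 := (adm_persist (y := (realPart x : C) - t1 • 1) hA1.g0 hA2.g0 hA2.g1 hg2).trans ht1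
  linarith

lemma exc_seq [Nontrivial C] (x : ℕ → C) {ε : ℝ} (hε : 0 < ε) (n : ℕ) :
    ∃ (g k : C) (t : ℕ → ℂ), Adm g k ∧ ∀ i < n, ‖g * (x i - t i • 1) * g‖ ≤ ε := by
  induction n with
  | zero => exact ⟨1, 1, fun _ => 0, ⟨zero_le_one, by simp, zero_le_one, one_ne_zero, by simp⟩, by simp⟩
  | succ n ih =>
    obtain ⟨g, k, t, hA, ht⟩ := ih
    obtain ⟨g', k', t', hA', hg', ht'⟩ := exc_step_c hA (x n) hε
    refine ⟨g', k', Function.update t n t', hA', fun i hi => ?_⟩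
    rcases Nat.lt_succ_iff_lt_or_eq.1 hi with h | rfl
    · rw [Function.update_of_ne h.ne]
      exact (adm_persist hA.g0 hA'.g0 hA'.g1 hg').trans (ht i h)
    · rw [Function.update_self]; exact ht'

lemma exc_spread (hC : IsSimpleAlg C) {g k : C} (h : Adm g k) :
    ∃ (J : Type) (_ : Fintype J) (p : J → C), ∑ j, star (p j) * p j = 1 ∧ ∀ j, g * p j = p j := by
  have ksa : IsSelfAdjoint k := IsSelfAdjoint.of_nonneg h.k0
  have hk2 : k * k ≠ 0 := by
    intro h0
    have := CStarRing.norm_star_mul_self (x := k)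
    rw [ksa.star_eq, h0, norm_zero] at this
    exact h.kne (norm_eq_zero.1 (mul_self_eq_zero.1 this.symm))
  obtain ⟨n, c, d, hcd⟩ := hC (k * k) hk2
  let b : Fin n ⊕ Fin n → C := Sum.elim (fun i => star (c i)) d
  set Q : C := ∑ j, star (k * b j) * (k * b j) with hQ
  have hQ2 : 1 ≤ Q := by
    have e : Q - 1 - 1 = ∑ i, star (k * star (c i) - k * d i) * (k * star (c i) - k * d i) := by
      have h1 : (1 : C) = ∑ i, star (d i) * (k * k) * star (c i) := by
        have := congrArg star hcd
        rw [star_one, star_sum] at this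
        rw [this]
        refine Finset.sum_congr rfl fun i _ => ?_
        simp only [star_mul, ksa.star_eq]; noncomm_ring
      conv_lhs => 
        arg 2; rw [h1]
      conv_lhs =>
        arg 1; arg 2; rw [hcd]
      rw [hQ, Fintype.sum_sum_type, ← Finset.sum_add_distrib, ← Finset.sum_sub_distrib, ← Finset.sum_sub_distrib]
      refine Finset.sum_congr rfl fun i _ => ?_
      simp only [b, Sum.elim_inl, Sum.elim_inr, star_mul, star_sub, star_star, ksa.star_eq]; noncomm_ring
    have h0 : 0 ≤ Q - 1 - 1 := by rw [e]; exact Finset.sum_nonneg fun i _ => star_mul_self_nonneg _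
    have h1 : (1 : C) + 1 ≤ Q := by
      have := sub_nonneg.1 h0
      exact le_sub_iff_add_le.1 this
    exact (le_add_of_nonneg_right zero_le_one).trans h1
  have hQs : IsStrictlyPositive Q := by
    refine ⟨zero_le_one.trans hQ2, ?_⟩
    exact CStarAlgebra.isUnit_of_le 1 hQ2 (h := IsStrictlyPositive.iff_of_unital.mpr ⟨zero_le_one, isUnit_one⟩)
  set r := Q ^ (-(1/2) : ℝ) with hr
  have hrr : r * Q * r = 1 := by
    have := CFC.conjugate_rpow_neg_one_half Q hQs
    rw [hr]; convert this using 3 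
  have rsa : IsSelfAdjoint r := IsSelfAdjoint.of_nonneg CFC.rpow_nonneg
  refine ⟨Fin n ⊕ Fin n, inferInstance, fun j => k * b j * r, ?_, fun j => ?_⟩
  · rw [← hrr, hQ, Finset.mul_sum, Finset.sum_mul]
    refine Finset.sum_congr rfl fun j _ => ?_
    rw [star_mul, rsa.star_eq]; noncomm_ring
  · rw [← mul_assoc, ← mul_assoc, h.gk]

lemma exc_main [Nontrivial C] (hC : IsSimpleAlg C) (n : ℕ) (x : Fin n → C) {ε : ℝ} (hε : 0 < ε) :
    ∃ (J : Type) (_ : Fintype J) (p : J → C) (t : Fin n → ℂ), ∑ j, star (p j) * p j = 1 ∧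
      ∀ i, ‖∑ j, star (p j) * x i * p j - t i • 1‖ ≤ ε := by
  obtain ⟨g, k, t, hA, ht⟩ := exc_seq (fun i => if h : i < n then x ⟨i, h⟩ else 0) hε n
  obtain ⟨J, hJ, p, hp, hgp⟩ := exc_spread hC hA
  have gsa := IsSelfAdjoint.of_nonneg hA.g0
  have hpg : ∀ j, star (p j) * g = star (p j) := fun j => by
    have := congrArg star (hgp j)
    rwa [star_mul, gsa.star_eq] at this
  refine ⟨J, hJ, p, fun i => t i, hp, fun i => ?_⟩
  have e : ∑ j, star (p j) * x i * p j - t i • 1 = ∑ j, star (p j) * (g * (x i - t i • 1) * g) * p j := by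
    conv_lhs => rw [← hp, Finset.smul_sum, ← Finset.sum_sub_distrib]
    refine Finset.sum_congr rfl fun j _ => ?_
    calc star (p j) * x i * p j - t i • (star (p j) * p j) = star (p j) * (x i - t i • 1) * p j := by
          rw [mul_sub, sub_mul, mul_smul_comm, mul_one, smul_mul_assoc]
      _ = (star (p j) * g) * (x i - t i • 1) * (g * p j) := by rw [hpg, hgp]
      _ = _ := by noncomm_ring
  rw [e]
  refine (avg_norm_le p hp.le _).trans ?_
  have := ht i i.2
  simpa using this

lemma avg_mat_le {J : Type*} [Fintype J] (p : J → C) (hp : ∑ j, star (p j) * p j = 1) {n : ℕ}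
    (v w : CStarMatrix (Fin n) (Fin n) C) (hw : ∀ i k, w i k = ∑ j, star (p j) * v i k * p j) : ‖w‖ ≤ ‖v‖ := by
  letI := CStarAlgebra.spectralOrder (CStarMatrix (Fin n) (Fin n) C)
  haveI := CStarAlgebra.spectralOrderedRing (CStarMatrix (Fin n) (Fin n) C)
  let P : J → CStarMatrix (Fin n) (Fin n) C := fun j => CStarMatrix.ofMatrix (Matrix.diagonal fun _ => p j)
  have hP : ∀ j i k, P j i k = if i = k then p j else 0 := fun j i k => by
    show Matrix.diagonal (fun _ => p j) i k = _
    rw [Matrix.diagonal_apply]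
  have hs : ∀ (f : J → CStarMatrix (Fin n) (Fin n) C) i k, (∑ j, f j) i k = ∑ j, f j i k := by
    intro f i k
    exact (congrFun (Finset.sum_apply i Finset.univ f) k).trans (Finset.sum_apply k _ _)
  have h1 : ∑ j, star (P j) * P j = 1 := by
    ext i k
    rw [hs]
    simp only [CStarMatrix.mul_apply, CStarMatrix.star_apply, hP, CStarMatrix.one_apply]
    rcases eq_or_ne i k with rfl | hik
    · simp [apply_ite star, hp]
    · simp [apply_ite star, hik, hik.symm]
  have h2 : w = ∑ j, star (P j) * v * P j := by
    ext i k
    rw [hs, hw]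
    simp only [CStarMatrix.mul_apply, CStarMatrix.star_apply, hP]
    simp [apply_ite star]
  rw [h2]
  exact avg_norm_le P h1.le v

end AVG
end

section
/-- constant `1 × 1` matrices -/
def cst (A : Type*) [NonUnitalCStarAlgebra A] : A →⋆ₙₐ[ℂ] CStarMatrix (Fin 1) (Fin 1) A where
  toFun a := CStarMatrix.ofMatrix fun _ _ => a
  map_smul' c a := rfl
  map_zero' := rfl
  map_add' a b := rfl
  map_mul' a b := by ext i j; rw [CStarMatrix.mul_apply]; simp; rfl
  map_star' a := rfl

lemma cst_norm_le {A : Type*} [NonUnitalCStarAlgebra A] [PartialOrder A] [StarOrderedRing A] (a : A) : ‖cst A a‖ ≤ ‖a‖ :=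
  NonUnitalStarAlgHom.norm_apply_le (cst A) a

lemma IsJCB.bound_one {C D : Type*} [NonUnitalCStarAlgebra C] [PartialOrder C] [StarOrderedRing C]
    [NonUnitalCStarAlgebra D] [PartialOrder D] [StarOrderedRing D]
    {T : C →ₗ[ℂ] D →ₗ[ℂ] ℂ} {κ : ℝ} (h : IsJCB T κ) (c : C) (d : D) : ‖T c d‖ ≤ κ * (‖c‖ * ‖d‖) := by
  have := h.bound (fun _ => 1) (fun _ => 1) (cst C c) (cst D d)
  have e : ∀ (i j : Fin 1 × Fin 1), T (cst C c i.1 j.1) (cst D d i.2 j.2) = T c d := fun _ _ => rfl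
  simp only [e] at this
  simp at this
  refine this.trans (mul_le_mul_of_nonneg_left ?_ h.nonneg)
  gcongr <;> exact cst_norm_le _

section HB
lemma exists_sep {X : Type*} [NormedAddCommGroup X] [NormedSpace ℂ X] (L : Submodule ℂ X) (hL : IsClosed (L : Set X))
    (x : X) (hx : x ∉ L) : ∃ T : X →L[ℂ] ℂ, (∀ z ∈ L, T z = 0) ∧ T x = 1 := by
  haveI : IsClosed (L : Set X) := hL
  have h0 : L.mkQL x ≠ 0 := by
    intro h
    exact hx ((Submodule.Quotient.mk_eq_zero L).1 (by simpa using h))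
  obtain ⟨f, hf⟩ := SeparatingDual.exists_eq_one (R := ℂ) h0
  refine ⟨f.comp L.mkQL, fun z hz => ?_, hf⟩
  have : L.mkQL z = 0 := (Submodule.Quotient.mk_eq_zero L).2 hz
  simp only [ContinuousLinearMap.comp_apply, this, map_zero]
end HB

section SLICE
variable {A B X : Type u} [NonUnitalCStarAlgebra A] [NonUnitalCStarAlgebra B]
    [NonUnitalNormedRing X] [NormedSpace ℂ X] {ι : A ⊗[ℂ] B →ₗ[ℂ] X}

lemma TensorData.norm_tmul_le (hX : TensorData ι) (a : A) (b : B) : ‖ι (a ⊗ₜ b)‖ ≤ ‖a‖ * ‖b‖ := by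
  letI := CStarAlgebra.spectralOrder A
  haveI := CStarAlgebra.spectralOrderedRing A
  letI := CStarAlgebra.spectralOrder B
  haveI := CStarAlgebra.spectralOrderedRing B
  have := hX.norm_rep 1 1 (fun _ => 1) (fun _ => 1) (cst A a) (cst B b)
  have e : ∀ (i j : Fin 1 × Fin 1), (cst A a i.1 j.1) ⊗ₜ[ℂ] (cst B b i.2 j.2) = a ⊗ₜ[ℂ] b := fun _ _ => rfl
  simp only [e] at this
  simp at this
  refine this.trans ?_
  gcongr <;> exact cst_norm_le _

variable {C D : Type u} [CStarAlgebra C] [PartialOrder C] [StarOrderedRing C]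
    [CStarAlgebra D] [PartialOrder D] [StarOrderedRing D]

lemma exists_sliceL (hX : TensorData ι) (π : A →⋆ₙₐ[ℂ] C) (π' : B →⋆ₙₐ[ℂ] D) (ψ : D →L[ℂ] ℂ) :
    ∃ R : X →L[ℂ] C, (∀ a b, R (ι (a ⊗ₜ b)) = ψ (π' b) • π a) ∧
      (∀ (φ : C →L[ℂ] ℂ) u, φ (R (ι u)) = pf φ ψ (qmap π π' u)) ∧ ∀ x, ‖R x‖ ≤ ‖ψ‖ * ‖x‖ := by
  let g : A ⊗[ℂ] B →ₗ[ℂ] C := (TensorProduct.rid ℂ C).toLinearMap ∘ₗ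
    TensorProduct.map (π : A →ₗ[ℂ] C) ((ψ : D →ₗ[ℂ] ℂ) ∘ₗ (π' : B →ₗ[ℂ] D))
  have hg : ∀ a b, g (a ⊗ₜ b) = ψ (π' b) • π a := fun a b => by simp [g]
  have hφ : ∀ (φ : C →L[ℂ] ℂ) u, φ (g u) = pf φ ψ (qmap π π' u) := by
    intro φ u
    induction u using TensorProduct.induction_on with
    | zero => simp
    | tmul a b => rw [hg, qmap_tmul, pf_tmul, map_smul, smul_eq_mul, mul_comm]
    | add x y hx hy => simp only [map_add, hx, hy]
  obtain ⟨R, h1, h2⟩ := exists_extension ι hX.dense g ‖ψ‖ (norm_nonneg _) (fun u => by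
    refine NormedSpace.norm_le_dual_bound ℂ _ (by positivity) fun φ => ?_
    rw [hφ]
    refine (pf_norm_le hX π π' φ ψ u).trans (le_of_eq (by ring)))
  exact ⟨R, fun a b => by rw [h1, hg], fun φ u => by rw [h1, hφ], h2⟩

lemma exists_sliceR (hX : TensorData ι) (π : A →⋆ₙₐ[ℂ] C) (π' : B →⋆ₙₐ[ℂ] D) (φ : C →L[ℂ] ℂ) :
    ∃ R : X →L[ℂ] D, (∀ a b, R (ι (a ⊗ₜ b)) = φ (π a) • π' b) ∧
      (∀ (ψ : D →L[ℂ] ℂ) u, ψ (R (ι u)) = pf φ ψ (qmap π π' u)) ∧ ∀ x, ‖R x‖ ≤ ‖φ‖ * ‖x‖ := by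
  let g : A ⊗[ℂ] B →ₗ[ℂ] D := (TensorProduct.lid ℂ D).toLinearMap ∘ₗ
    TensorProduct.map ((φ : C →ₗ[ℂ] ℂ) ∘ₗ (π : A →ₗ[ℂ] C)) (π' : B →ₗ[ℂ] D)
  have hg : ∀ a b, g (a ⊗ₜ b) = φ (π a) • π' b := fun a b => by simp [g]
  have hφ : ∀ (ψ : D →L[ℂ] ℂ) u, ψ (g u) = pf φ ψ (qmap π π' u) := by
    intro ψ u
    induction u using TensorProduct.induction_on with
    | zero => simp
    | tmul a b => rw [hg, qmap_tmul, pf_tmul, map_smul, smul_eq_mul]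
    | add x y hx hy => simp only [map_add, hx, hy]
  obtain ⟨R, h1, h2⟩ := exists_extension ι hX.dense g ‖φ‖ (norm_nonneg _) (fun u => by
    refine NormedSpace.norm_le_dual_bound ℂ _ (by positivity) fun ψ => ?_
    rw [hφ]
    refine (pf_norm_le hX π π' φ ψ u).trans (le_of_eq (by ring)))
  exact ⟨R, fun a b => by rw [h1, hg], fun φ u => by rw [h1, hφ], h2⟩

/-- continuous maps additive on `X` are determined on elementary tensors -/
lemma TensorData.ext_tmul (hX : TensorData ι) {F : Type*} [NormedAddCommGroup F] {f g : X → F} (hf : Continuous f) (hg : Continuous g)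
    (fa : ∀ x y, f (x + y) = f x + f y) (ga : ∀ x y, g (x + y) = g x + g y)
    (h : ∀ a b, f (ι (a ⊗ₜ b)) = g (ι (a ⊗ₜ b))) (x : X) : f x = g x := by
  have f0 : f 0 = 0 := by simpa using fa 0 0
  have g0 : g 0 = 0 := by simpa using ga 0 0
  refine congrFun (hX.dense.equalizer hf hg (funext fun u => ?_)) x
  simp only [Function.comp]
  induction u using TensorProduct.induction_on with
  | zero => rw [map_zero, f0, g0]
  | tmul a b => exact h a b
  | add x y hx hy => rw [map_add, fa, ga, hx, hy]

lemma sliceL_conj (hX : TensorData ι) {π : A →⋆ₙₐ[ℂ] C} {π' : B →⋆ₙₐ[ℂ] D} {ψ : D →L[ℂ] ℂ} {R : X →L[ℂ] C}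
    (hR : ∀ a b, R (ι (a ⊗ₜ b)) = ψ (π' b) • π a) {f : B} (hf : π' f = 1) (a a' : A) (z : X) :
    R (ι (a ⊗ₜ f) * z * ι (a' ⊗ₜ f)) = π a * R z * π a' := by
  refine hX.ext_tmul (f := fun z => R (ι (a ⊗ₜ f) * z * ι (a' ⊗ₜ f))) (g := fun z => π a * R z * π a')
    (by fun_prop) (by fun_prop) (fun x y => by simp only [mul_add, add_mul, map_add])
    (fun x y => by simp only [mul_add, add_mul, map_add]) (fun c b => ?_) z
  simp only [hX.mul_tmul, hR, map_mul, hf, one_mul, mul_one, mul_smul_comm, smul_mul_assoc]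

lemma sliceR_conj (hX : TensorData ι) {π : A →⋆ₙₐ[ℂ] C} {π' : B →⋆ₙₐ[ℂ] D} {φ : C →L[ℂ] ℂ} {R : X →L[ℂ] D}
    (hR : ∀ a b, R (ι (a ⊗ₜ b)) = φ (π a) • π' b) {e : A} (he : π e = 1) (b b' : B) (z : X) :
    R (ι (e ⊗ₜ b) * z * ι (e ⊗ₜ b')) = π' b * R z * π' b' := by
  refine hX.ext_tmul (f := fun z => R (ι (e ⊗ₜ b) * z * ι (e ⊗ₜ b'))) (g := fun z => π' b * R z * π' b')
    (by fun_prop) (by fun_prop) (fun x y => by simp only [mul_add, add_mul, map_add])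
    (fun x y => by simp only [mul_add, add_mul, map_add]) (fun c b => ?_) z
  simp only [hX.mul_tmul, hR, map_mul, he, one_mul, mul_one, mul_smul_comm, smul_mul_assoc]

end SLICE
end

section
section CORE
variable {A B X : Type u} [NonUnitalCStarAlgebra A] [NonUnitalCStarAlgebra B]
    [NonUnitalNormedRing X] [NormedSpace ℂ X] {ι : A ⊗[ℂ] B →ₗ[ℂ] X}
    {C D : Type u} [CStarAlgebra C] [PartialOrder C] [StarOrderedRing C]
    [CStarAlgebra D] [PartialOrder D] [StarOrderedRing D]

lemma core_one (hX : TensorData ι) {π : A →⋆ₙₐ[ℂ] C} {π' : B →⋆ₙₐ[ℂ] D} (hs : Function.Surjective π)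
    [Nontrivial C] (hC : IsSimpleAlg C) {f : B} (hf : π' f = 1)
    (L : TwoSidedIdeal X) (T : X →L[ℂ] ℂ) (hTL : ∀ z ∈ L, T z = 0) {κ : ℝ}
    (S : C →ₗ[ℂ] D →ₗ[ℂ] ℂ) (hS : ∀ a b, S (π a) (π' b) = T (ι (a ⊗ₜ b))) (hJ : IsJCB S κ)
    (ψ : D →L[ℂ] ℂ) (hψ : ∀ d, ψ d = S 1 d) (R : X →L[ℂ] C)
    (hR : ∀ a b, R (ι (a ⊗ₜ b)) = ψ (π' b) • π a) (hRn : ∀ x, ‖R x‖ ≤ ‖ψ‖ * ‖x‖) (z : X) (hz : z ∈ L) : R z ≠ 1 := by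
  intro hRz
  have hκ := hJ.nonneg
  set ε : ℝ := 1 / (4 * (κ + ‖ψ‖ + 1)) with hε
  have hε0 : 0 < ε := by positivity
  have hε1 : (κ + ‖ψ‖) * ε ≤ 1/4 := by
    have : (κ + ‖ψ‖ + 1) * ε = 1/4 := by rw [hε]; field_simp
    nlinarith
  clear_value ε
  obtain ⟨u, hu⟩ := hX.dense.exists_dist_lt z hε0
  obtain ⟨n, a, b, rfl⟩ := exists_fin_rep u
  set w := ι (∑ i, a i ⊗ₜ[ℂ] b i) with hw
  have hwz : ‖w - z‖ ≤ ε := by rw [← dist_eq_norm, dist_comm]; exact hu.le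
  set σ := ∑ i, (κ * ‖π' (b i)‖ + ‖ψ (π' (b i))‖) with hσ
  have hσ0 : 0 ≤ σ := Finset.sum_nonneg fun i _ => by positivity
  obtain ⟨δ, hδ0, hδ1⟩ : ∃ δ : ℝ, 0 < δ ∧ σ * δ ≤ 1/4 :=
    ⟨1 / (4 * (σ + 1)), by positivity, by
      rw [mul_one_div, div_le_iff₀ (by positivity)]; linarith⟩
  obtain ⟨J, _, p, t, hp, ht⟩ := exc_main hC n (fun i => π (a i)) hδ0
  choose q hq using fun j => hs (p j)
  let Φ : C →ₗ[ℂ] C :=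
    { toFun := fun x => ∑ j, star (p j) * x * p j
      map_add' := fun x y => by simp only [mul_add, add_mul, Finset.sum_add_distrib]
      map_smul' := fun c x => by simp only [mul_smul_comm, smul_mul_assoc, Finset.smul_sum, RingHom.id_apply] }
  have hΦ : ∀ x, Φ x = ∑ j, star (p j) * x * p j := fun x => rfl
  have hΦn : ∀ x, ‖Φ x‖ ≤ ‖x‖ := fun x => avg_norm_le p hp.le x
  have hΦ1 : Φ 1 = 1 := by rw [hΦ]; simpa using hp
  have hJ' : IsJCB (S ∘ₗ Φ) κ := by
    intro p' q' α β v w hα hβ hv hw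
    let v' : CStarMatrix (Fin p') (Fin p') C := CStarMatrix.ofMatrix fun i j => Φ (v i j)
    exact hJ p' q' α β v' w hα hβ ((avg_mat_le p hp v v' fun i k => rfl).trans hv) hw
  let Tl : X → ℂ := fun x => ∑ j, T (ι (star (q j) ⊗ₜ f) * x * ι (q j ⊗ₜ f))
  have hTlc : Continuous Tl := by fun_prop
  have hTla : ∀ x y, Tl (x + y) = Tl x + Tl y := fun x y => by
    simp only [Tl, mul_add, add_mul, map_add, Finset.sum_add_distrib]
  have hTl : ∀ a b, Tl (ι (a ⊗ₜ b)) = S (Φ (π a)) (π' b) := by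
    intro a b
    simp only [Tl, hX.mul_tmul, ← hS, map_mul, hf, one_mul, mul_one, map_star, hq, hΦ, map_sum, LinearMap.sum_apply]
  have hTlu : ∀ u, Tl (ι u) = TensorProduct.lift (S ∘ₗ Φ) (qmap π π' u) := by
    intro u
    have h0 : Tl 0 = 0 := by simpa using hTla 0 0
    induction u using TensorProduct.induction_on with
    | zero => simp [h0]
    | tmul a b => rw [hTl, qmap_tmul, TensorProduct.lift.tmul]; rfl
    | add x y hx hy => rw [map_add, hTla, hx, hy, map_add, map_add]
  have hTln : ∀ x, ‖Tl x‖ ≤ κ * ‖x‖ := by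
    intro x
    refine hX.dense.induction_on x (isClosed_le (by fun_prop) (by fun_prop)) fun u => ?_
    rw [hTlu]
    exact hJ'.norm_lift_le hX π π' u
  have hTlL : Tl z = 0 := Finset.sum_eq_zero fun j _ => hTL _ (L.mul_mem_right _ _ (L.mul_mem_left _ _ hz))
  set τ := ∑ i, t i * ψ (π' (b i)) with hτ
  have ha : ‖Tl w‖ ≤ κ * ε := by
    have : Tl w = Tl (w - z) := by
      have := hTla (w - z) z
      rw [sub_add_cancel, hTlL, add_zero] at this
      exact this
    rw [this]
    exact (hTln _).trans (by gcongr)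
  have hb : ‖Tl w - τ‖ ≤ ∑ i, κ * ‖π' (b i)‖ * δ := by
    have e : Tl w - τ = ∑ i, S (Φ (π (a i)) - t i • 1) (π' (b i)) := by
      rw [hw, hTlu, hτ, map_sum, map_sum, ← Finset.sum_sub_distrib]
      refine Finset.sum_congr rfl fun i _ => ?_
      rw [qmap_tmul, TensorProduct.lift.tmul, map_sub, LinearMap.sub_apply, map_smul, LinearMap.smul_apply, hψ]
      rfl
    rw [e]
    refine (norm_sum_le _ _).trans (Finset.sum_le_sum fun i _ => ?_)
    refine (hJ.bound_one _ _).trans ?_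
    calc κ * (‖Φ (π (a i)) - t i • 1‖ * ‖π' (b i)‖) ≤ κ * (δ * ‖π' (b i)‖) := by gcongr; exact ht i
      _ = _ := by ring
  have hc : ‖Φ (R w) - τ • 1‖ ≤ ∑ i, ‖ψ (π' (b i))‖ * δ := by
    have e : Φ (R w) - τ • 1 = ∑ i, ψ (π' (b i)) • (Φ (π (a i)) - t i • 1) := by
      rw [hw, hτ, map_sum, map_sum, map_sum, Finset.sum_smul, ← Finset.sum_sub_distrib]
      refine Finset.sum_congr rfl fun i _ => ?_
      rw [hR, map_smul, smul_sub, smul_smul, mul_comm (t i)]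
    rw [e]
    refine (norm_sum_le _ _).trans (Finset.sum_le_sum fun i _ => ?_)
    rw [norm_smul]
    gcongr
    exact ht i
  have hd : ‖Φ (R w) - 1‖ ≤ ‖ψ‖ * ε := by
    have e : Φ (R w) - 1 = Φ (R (w - z)) := by rw [map_sub, map_sub, hRz, hΦ1]
    rw [e]
    exact (hΦn _).trans ((hRn _).trans (by gcongr))
  have h1 : (1 : ℝ) ≤ ‖Φ (R w) - 1‖ + ‖Φ (R w) - τ • 1‖ + ‖τ‖ := by
    have e : (1 : C) = -(Φ (R w) - 1) + (Φ (R w) - τ • 1) + τ • 1 := by abel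
    calc (1 : ℝ) = ‖(1 : C)‖ := by rw [CStarRing.norm_one]
      _ = ‖-(Φ (R w) - 1) + (Φ (R w) - τ • 1) + τ • (1 : C)‖ := by rw [← e]
      _ ≤ ‖-(Φ (R w) - 1)‖ + ‖Φ (R w) - τ • 1‖ + ‖τ • (1 : C)‖ := norm_add₃_le
      _ = _ := by rw [norm_neg, norm_smul τ, CStarRing.norm_one, mul_one]
  have h2 : ‖τ‖ ≤ ‖Tl w‖ + ‖Tl w - τ‖ := by
    have : τ = Tl w - (Tl w - τ) := by ring
    conv_lhs => rw [this]
    exact norm_sub_le _ _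
  have h3 : ∑ i, κ * ‖π' (b i)‖ * δ + ∑ i, ‖ψ (π' (b i))‖ * δ = σ * δ := by
    rw [hσ, Finset.sum_mul, ← Finset.sum_add_distrib]
    exact Finset.sum_congr rfl fun i _ => by ring
  nlinarith

theorem core [IsScalarTower ℂ X X] [SMulCommClass ℂ X X] (hX : TensorData ι) {π : A →⋆ₙₐ[ℂ] C} {π' : B →⋆ₙₐ[ℂ] D} (hs : Function.Surjective π)
    (hs' : Function.Surjective π')
    [Nontrivial C] (hC : IsSimpleAlg C) (hD : IsSimpleAlg D) {e : A} {f : B} (he : π e = 1) (hf : π' f = 1)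
    (L : TwoSidedIdeal X) (hLc : IsClosed (L : Set X)) (hsm : ∀ (c : ℂ), ∀ x ∈ L, c • x ∈ L)
    (hK1 : ∀ a b, π a = 0 → ι (a ⊗ₜ b) ∈ L) (hK2 : ∀ a b, π' b = 0 → ι (a ⊗ₜ b) ∈ L)
    (hef : ι (e ⊗ₜ f) ∉ L) (z : X) (hz : z ∈ L) (U : X →L[ℂ] ℂ)
    (hU1 : ∀ a b, π a = 0 → U (ι (a ⊗ₜ b)) = 0) (hU2 : ∀ a b, π' b = 0 → U (ι (a ⊗ₜ b)) = 0) : U z = 0 := by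
  let Ls : Submodule ℂ X :=
    { carrier := L
      add_mem' := fun ha hb => L.add_mem ha hb
      zero_mem' := L.zero_mem
      smul_mem' := fun c x hx => hsm c x hx }
  obtain ⟨T, hTL, hT1⟩ := exists_sep Ls hLc _ hef
  have hTL' : ∀ z ∈ L, T z = 0 := hTL
  obtain ⟨S, hS, -, hJ⟩ := exists_bar hX hs hs' T (fun a b h => hTL _ (hK1 a b h)) (fun a b h => hTL _ (hK2 a b h))
  let ψ : D →L[ℂ] ℂ := LinearMap.mkContinuous (S 1) (‖T‖ * 4 * ‖(1 : C)‖) fun d => (hJ.bound_one 1 d).trans (le_of_eq (by ring))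
  have hψ : ∀ d, ψ d = S 1 d := fun d => rfl
  have hψ1 : ψ 1 = 1 := by rw [hψ, ← he, ← hf, hS, hT1]
  obtain ⟨R, hR, hRφ, hRn⟩ := exists_sliceL hX π π' ψ
  have hR0 : ∀ z ∈ L, R z = 0 := by
    intro z hz
    by_contra h0
    obtain ⟨n, c, d, hcd⟩ := hC (R z) h0
    choose c' hc' using fun i => hs (c i)
    choose d' hd' using fun i => hs (d i)
    refine core_one hX hs hC hf L T hTL' S hS hJ ψ hψ R hR hRn (∑ i, ι (c' i ⊗ₜ f) * z * ι (d' i ⊗ₜ f)) ?_ ?_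
    · exact sum_mem fun i _ => L.mul_mem_right _ _ (L.mul_mem_left _ _ hz)
    · rw [map_sum, hcd]
      exact Finset.sum_congr rfl fun i _ => by rw [sliceL_conj hX hR hf, hc', hd']
  refine inj_main hX hs hs' U hU1 hU2 z fun φ ψ' G hG => ?_
  obtain ⟨R', hR', hRψ, hRn'⟩ := exists_sliceR hX π π' φ
  have hcomm : ∀ x, ψ (R' x) = φ (R x) := fun x => 
    congrFun (hX.dense.equalizer (g := fun x => ψ (R' x)) (h := fun x => φ (R x)) (by fun_prop) (by fun_prop) (funext fun u => by
      simp only [Function.comp, hRψ, hRφ])) x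
  have hR'0 : R' z = 0 := by
    by_contra h0
    obtain ⟨n, c, d, hcd⟩ := hD (R' z) h0
    choose c' hc' using fun i => hs' (c i)
    choose d' hd' using fun i => hs' (d i)
    have h1 : R' (∑ i, ι (e ⊗ₜ c' i) * z * ι (e ⊗ₜ d' i)) = 1 := by
      rw [map_sum, hcd]
      exact Finset.sum_congr rfl fun i _ => by rw [sliceR_conj hX hR' he, hc', hd']
    have h2 := hcomm (∑ i, ι (e ⊗ₜ c' i) * z * ι (e ⊗ₜ d' i))
    rw [h1, hψ1, hR0 _ (sum_mem fun i _ => L.mul_mem_right _ _ (L.mul_mem_left _ _ hz)), map_zero] at h2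
    exact one_ne_zero h2
  have : G z = ψ' (R' z) := congrFun (hX.dense.equalizer (g := fun x => G x) (h := fun x => ψ' (R' x)) (by fun_prop) (by fun_prop) (funext fun u => by
      simp only [Function.comp, hRψ, hG])) z
  rw [this, hR'0, map_zero]

end CORE
end

section
lemma sum_closed_of_controlled {X : Type*} [NormedAddCommGroup X] [NormedSpace ℂ X] [CompleteSpace X] (I J : Submodule ℂ X)
    (hI : IsClosed (I : Set X)) (hJ : IsClosed (J : Set X))
    (h : ∀ i ∈ I, ∀ j ∈ J, ∃ i' ∈ I, ∃ j' ∈ J, i' + j' = i + j ∧ ‖i'‖ ≤ 2 * ‖i + j‖) :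
    IsClosed ((I ⊔ J : Submodule ℂ X) : Set X) := by
  haveI : CompleteSpace I := hI.completeSpace_coe
  haveI : CompleteSpace J := hJ.completeSpace_coe
  let fl : I × J →L[ℂ] X := I.subtypeL.coprod J.subtypeL
  let f : NormedAddGroupHom (I × J) X := fl.toLinearMap.toAddMonoidHom.mkNormedAddGroupHom ‖fl‖ fl.le_opNorm
  have hf : ∀ x, f x = (x.1 : X) + x.2 := fun x => rfl
  have hon : f.SurjectiveOnWith f.range 3 := by
    rintro _ ⟨⟨⟨i, hi⟩, ⟨j, hj⟩⟩, rfl⟩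
    obtain ⟨i', hi', j', hj', e, hn⟩ := h i hi j hj
    refine ⟨(⟨i', hi'⟩, ⟨j', hj'⟩), ?_, ?_⟩
    · exact e
    · change ‖((⟨i', hi'⟩, ⟨j', hj'⟩) : I × J)‖ ≤ 3 * ‖i + j‖
      rw [Prod.norm_def]
      refine max_le ?_ ?_
      · change ‖i'‖ ≤ _
        have := norm_nonneg (i + j)
        linarith
      · change ‖j'‖ ≤ _
        have : j' = (i + j) - i' := by rw [← e]; abel
        rw [this]
        have := norm_sub_le (i + j) i'
        linarith
  have := controlled_closure_of_complete (f := f) (K := f.range) (by norm_num : (0:ℝ) < 3) zero_lt_one hon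
  refine isClosed_of_closure_subset fun x hx => ?_
  have hxr : x ∈ f.range.topologicalClosure := by
    refine closure_mono ?_ hx
    intro y hy
    obtain ⟨i, hi, j, hj, rfl⟩ := Submodule.mem_sup.1 hy
    exact ⟨(⟨i, hi⟩, ⟨j, hj⟩), rfl⟩
  obtain ⟨g, hg, -⟩ := this x hxr
  rw [← hg, hf]
  exact Submodule.mem_sup.2 ⟨_, g.1.2, _, g.2.2, rfl⟩

section TI
variable {A B X : Type u} [NonUnitalCStarAlgebra A] [NonUnitalCStarAlgebra B]
    [NonUnitalNormedRing X] [NormedSpace ℂ X] [CompleteSpace X]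
    [IsScalarTower ℂ X X] [SMulCommClass ℂ X X] {ι : A ⊗[ℂ] B →ₗ[ℂ] X}

/-- the product ideal as a closed subspace -/
def tI (ι : A ⊗[ℂ] B →ₗ[ℂ] X) (S : Set A) (T : Set B) : Submodule ℂ X :=
  ((Submodule.span ℂ (Set.image2 (fun a b => a ⊗ₜ[ℂ] b) S T)).map ι).topologicalClosure

lemma coe_tI [StarRing X] (S : Set A) (T : Set B) : ((tI ι S T : Submodule ℂ X) : Set X) = tensorIdeal ι S T := rfl

lemma tI_closed (S : Set A) (T : Set B) : IsClosed ((tI ι S T : Submodule ℂ X) : Set X) :=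
  Submodule.isClosed_topologicalClosure _

lemma mem_tI {S : Set A} {T : Set B} {a : A} {b : B} (ha : a ∈ S) (hb : b ∈ T) : ι (a ⊗ₜ b) ∈ tI ι S T :=
  Submodule.le_topologicalClosure _ ⟨_, Submodule.subset_span ⟨a, ha, b, hb, rfl⟩, rfl⟩

lemma tI_le {S : Set A} {T : Set B} {W : Submodule ℂ X} (hW : IsClosed (W : Set X))
    (h : ∀ a ∈ S, ∀ b ∈ T, ι (a ⊗ₜ b) ∈ W) : tI ι S T ≤ W := by
  refine Submodule.topologicalClosure_minimal _ ?_ hW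
  rw [Submodule.map_le_iff_le_comap, Submodule.span_le]
  rintro _ ⟨a, ha, b, hb, rfl⟩
  exact h a ha b hb

lemma tI_univ (hX : TensorData ι) : tI ι Set.univ Set.univ = ⊤ := by
  rw [eq_top_iff]
  intro x _
  refine hX.dense.induction_on x (tI_closed (ι := ι) Set.univ Set.univ) fun u => ?_
  induction u using TensorProduct.induction_on with
  | zero => rw [map_zero]; exact zero_mem _
  | tmul a b => exact mem_tI trivial trivial
  | add x y hx hy => rw [map_add]; exact add_mem hx hy

lemma TensorData.all_mem (hX : TensorData ι) {W : Submodule ℂ X} (hW : IsClosed (W : Set X))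
    (h : ∀ a b, ι (a ⊗ₜ b) ∈ W) (x : X) : x ∈ W := by
  have := tI_le (ι := ι) (S := Set.univ) (T := Set.univ) hW (fun a _ b _ => h a b)
  rw [tI_univ hX] at this
  exact this trivial

lemma tI_mul_left (hX : TensorData ι) {S S' : Set A} {T T' : Set B} {a : A} {b : B} (hS : ∀ s ∈ S, a * s ∈ S') (hT : ∀ t ∈ T, b * t ∈ T')
    {x : X} (hx : x ∈ tI ι S T) : ι (a ⊗ₜ b) * x ∈ tI ι S' T' := by
  have : tI ι S T ≤ (tI ι S' T').comap (LinearMap.mulLeft ℂ (ι (a ⊗ₜ b))) := by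
    refine tI_le ?_ fun s hs t ht => ?_
    · exact (tI_closed S' T').preimage (continuous_const_mul _)
    · rw [Submodule.mem_comap, LinearMap.mulLeft_apply, hX.mul_tmul]
      exact mem_tI (hS s hs) (hT t ht)
  exact this hx

lemma tI_mul_right (hX : TensorData ι) {S S' : Set A} {T T' : Set B} {a : A} {b : B} (hS : ∀ s ∈ S, s * a ∈ S') (hT : ∀ t ∈ T, t * b ∈ T')
    {x : X} (hx : x ∈ tI ι S T) : x * ι (a ⊗ₜ b) ∈ tI ι S' T' := by
  have : tI ι S T ≤ (tI ι S' T').comap (LinearMap.mulRight ℂ (ι (a ⊗ₜ b))) := by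
    refine tI_le ?_ fun s hs t ht => ?_
    · exact (tI_closed S' T').preimage (continuous_mul_const _)
    · rw [Submodule.mem_comap, LinearMap.mulRight_apply, hX.mul_tmul]
      exact mem_tI (hS s hs) (hT t ht)
  exact this hx

lemma tI_ideal_left (hX : TensorData ι) {S : Set A} {T : Set B} (hS : ∀ a, ∀ s ∈ S, a * s ∈ S) (hT : ∀ b, ∀ t ∈ T, b * t ∈ T)
    (y : X) {x : X} (hx : x ∈ tI ι S T) : y * x ∈ tI ι S T := by
  have := hX.all_mem (W := (tI ι S T).comap (LinearMap.mulRight ℂ x)) ((tI_closed S T).preimage (continuous_mul_const _))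
    (fun a b => by
      rw [Submodule.mem_comap, LinearMap.mulRight_apply]
      exact tI_mul_left hX (hS a) (hT b) hx) y
  exact this

lemma tI_ideal_right (hX : TensorData ι) {S : Set A} {T : Set B} (hS : ∀ a, ∀ s ∈ S, s * a ∈ S) (hT : ∀ b, ∀ t ∈ T, t * b ∈ T)
    (y : X) {x : X} (hx : x ∈ tI ι S T) : x * y ∈ tI ι S T := by
  have := hX.all_mem (W := (tI ι S T).comap (LinearMap.mulLeft ℂ x)) ((tI_closed S T).preimage (continuous_const_mul _))
    (fun a b => by
      rw [Submodule.mem_comap, LinearMap.mulLeft_apply]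
      exact tI_mul_right hX (hS a) (hT b) hx) y
  exact this

lemma tI_rep {S : Set A} {x : X} (hx : x ∈ tI ι S Set.univ) {ε : ℝ} (hε : 0 < ε) :
    ∃ (n : ℕ) (m : Fin n → A) (b : Fin n → B), (∀ i, m i ∈ S) ∧ ‖x - ι (∑ i, m i ⊗ₜ b i)‖ < ε := by
  obtain ⟨_, ⟨u, hu, rfl⟩, hd⟩ := Metric.mem_closure_iff.1 hx ε hε
  have : ∃ (n : ℕ) (m : Fin n → A) (b : Fin n → B), (∀ i, m i ∈ S) ∧ u = ∑ i, m i ⊗ₜ b i := by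
    refine Submodule.span_induction (p := fun u _ => ∃ (n : ℕ) (m : Fin n → A) (b : Fin n → B), (∀ i, m i ∈ S) ∧ u = ∑ i, m i ⊗ₜ b i) ?_ ?_ ?_ ?_ hu
    · rintro _ ⟨a, ha, b, hb, rfl⟩
      exact ⟨1, fun _ => a, fun _ => b, fun _ => ha, by simp⟩
    · exact ⟨0, Fin.elim0, Fin.elim0, fun i => i.elim0, by simp⟩
    · rintro x y - - ⟨n, a, b, h, rfl⟩ ⟨n', a', b', h', rfl⟩
      refine ⟨n + n', Fin.append a a', Fin.append b b', fun i => ?_, by simp [Fin.sum_univ_add]⟩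
      refine Fin.addCases (fun i => ?_) (fun i => ?_) i
      · rw [Fin.append_left]; exact h i
      · rw [Fin.append_right]; exact h' i
    · rintro c x - ⟨n, a, b, h, rfl⟩
      exact ⟨n, a, fun i => c • b i, h, by simp [Finset.smul_sum]⟩
  obtain ⟨n, m, b, hm, rfl⟩ := this
  exact ⟨n, m, b, hm, by rwa [← dist_eq_norm]⟩

lemma tI_approx (hX : TensorData ι) (M : TwoSidedIdeal A) {x : X} (hx : x ∈ tI ι (M : Set A) Set.univ) {ε : ℝ} (hε : 0 < ε) :
    ∃ u ∈ M, ∃ v : B, ‖u‖ ≤ 1 ∧ ‖v‖ ≤ 1 ∧ ‖x - ι (u ⊗ₜ v) * x‖ ≤ ε := by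
  obtain ⟨n, m, b, hm, hd⟩ := tI_rep hx (show 0 < ε / 4 by linarith)
  set σ := ∑ i, (‖b i‖ + ‖m i‖) with hσ
  have hσ0 : 0 ≤ σ := Finset.sum_nonneg fun i _ => by positivity
  obtain ⟨δ, hδ0, hδ1⟩ : ∃ δ : ℝ, 0 < δ ∧ δ * σ ≤ ε / 4 :=
    ⟨ε / (4 * (σ + 1)), by positivity, by
      rw [div_mul_eq_mul_div, div_le_iff₀ (by positivity)]; nlinarith⟩
  obtain ⟨u, huM, hu, hum⟩ := exists_approx_unit_left (I := (M : Set A)) (fun x hx y hy => M.add_mem hx hy) M.zero_mem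
    (by intros; first | exact M.mul_mem_left _ _ ‹_› | exact M.mul_mem_right _ _ ‹_›) m hm hδ0
  obtain ⟨v, -, hv, hvb⟩ := exists_approx_unit_left (I := (Set.univ : Set B)) (fun x hx y hy => trivial) trivial
    (by intros; trivial) b (fun _ => trivial) hδ0
  refine ⟨u, huM, v, hu.norm_le, hv.norm_le, ?_⟩
  set w := ι (∑ i, m i ⊗ₜ b i) with hw
  have h1 : ‖w - ι (u ⊗ₜ v) * w‖ ≤ δ * σ := by
    have e : w - ι (u ⊗ₜ v) * w = ∑ i, (ι ((m i - u * m i) ⊗ₜ b i) + ι ((u * m i) ⊗ₜ (b i - v * b i))) := by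
      rw [hw, map_sum, Finset.mul_sum, ← Finset.sum_sub_distrib]
      refine Finset.sum_congr rfl fun i _ => ?_
      rw [hX.mul_tmul, ← map_sub, ← map_add, TensorProduct.sub_tmul, TensorProduct.tmul_sub]
      congr 1; abel
    rw [e, hσ, Finset.mul_sum]
    refine (norm_sum_le _ _).trans (Finset.sum_le_sum fun i _ => ?_)
    refine (norm_add_le _ _).trans ?_
    have a1 := hX.norm_tmul_le (m i - u * m i) (b i)
    have a2 := hX.norm_tmul_le (u * m i) (b i - v * b i)
    have a3 : ‖u * m i‖ ≤ ‖m i‖ := (norm_mul_le _ _).trans (by nlinarith [hu.norm_le, norm_nonneg (m i)])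
    have a4 := hum i
    have a5 := hvb i
    calc _ ≤ ‖m i - u * m i‖ * ‖b i‖ + ‖u * m i‖ * ‖b i - v * b i‖ := add_le_add a1 a2
      _ ≤ δ * ‖b i‖ + ‖m i‖ * δ := by gcongr
      _ = _ := by ring
  have h2 : ‖ι (u ⊗ₜ v) * (x - w)‖ ≤ ‖x - w‖ := by
    refine (norm_mul_le _ _).trans ?_
    have : ‖ι (u ⊗ₜ[ℂ] v)‖ ≤ 1 := (hX.norm_tmul_le u v).trans (mul_le_one₀ hu.norm_le (norm_nonneg _) hv.norm_le)
    nlinarith [norm_nonneg (x - w)]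
  have e : x - ι (u ⊗ₜ v) * x = (x - w) + (w - ι (u ⊗ₜ v) * w) + -(ι (u ⊗ₜ v) * (x - w)) := by
    rw [mul_sub]; abel
  rw [e]
  have := norm_add₃_le (a := x - w) (b := w - ι (u ⊗ₜ v) * w) (c := -(ι (u ⊗ₜ v) * (x - w)))
  rw [norm_neg] at this
  linarith

lemma tI_sum_closed (hX : TensorData ι) (M : TwoSidedIdeal A) (N : TwoSidedIdeal B) :
    IsClosed ((tI ι (M : Set A) Set.univ ⊔ tI ι Set.univ (N : Set B) : Submodule ℂ X) : Set X) := by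
  refine sum_closed_of_controlled _ _ (tI_closed _ _) (tI_closed _ _) fun i hi j hj => ?_
  rcases eq_or_ne (i + j) 0 with h0 | h0
  · exact ⟨0, zero_mem _, 0, zero_mem _, by simp [h0], by simp⟩
  · have hpos : 0 < ‖i + j‖ := norm_pos_iff.2 h0
    obtain ⟨u, hu, v, hu1, hv1, hd⟩ := tI_approx hX M hi hpos
    refine ⟨i + ι (u ⊗ₜ v) * j, add_mem hi ?_, j - ι (u ⊗ₜ v) * j, sub_mem hj ?_, by abel, ?_⟩
    · exact tI_mul_left hX (S := Set.univ) (S' := (M : Set A)) (T := (N : Set B)) (T' := Set.univ) (fun s _ => M.mul_mem_right _ _ hu) (fun t _ => Set.mem_univ _) hj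
    · exact tI_ideal_left hX (S := Set.univ) (T := (N : Set B)) (fun a s _ => Set.mem_univ _) (fun b t ht => N.mul_mem_left _ _ ht) _ hj
    · have e : i + ι (u ⊗ₜ v) * j = (i - ι (u ⊗ₜ v) * i) + ι (u ⊗ₜ v) * (i + j) := by rw [mul_add]; abel
      rw [e]
      have h2 : ‖ι (u ⊗ₜ v) * (i + j)‖ ≤ ‖i + j‖ := by
        refine (norm_mul_le _ _).trans ?_
        have : ‖ι (u ⊗ₜ[ℂ] v)‖ ≤ 1 := (hX.norm_tmul_le u v).trans (mul_le_one₀ hu1 (norm_nonneg _) hv1)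
        nlinarith
      have := norm_add_le (i - ι (u ⊗ₜ v) * i) (ι (u ⊗ₜ v) * (i + j))
      linarith

end TI
end

section
section BACK
variable {A B X : Type u} [NonUnitalCStarAlgebra A] [NonUnitalCStarAlgebra B]
    [NonUnitalNormedRing X] [NormedSpace ℂ X] [CompleteSpace X]
    [IsScalarTower ℂ X X] [SMulCommClass ℂ X X] {ι : A ⊗[ℂ] B →ₗ[ℂ] X}

/-- the sum `A ⊗̂ N + M ⊗̂ B` -/
def kz (ι : A ⊗[ℂ] B →ₗ[ℂ] X) (M : TwoSidedIdeal A) (N : TwoSidedIdeal B) : Submodule ℂ X :=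
  tI ι Set.univ (N : Set B) ⊔ tI ι (M : Set A) Set.univ

lemma coe_kz [StarRing X] (M : TwoSidedIdeal A) (N : TwoSidedIdeal B) : ((kz ι M N : Submodule ℂ X) : Set X) =
    tensorIdeal ι (Set.univ : Set A) (N : Set B) + tensorIdeal ι (M : Set A) (Set.univ : Set B) := by
  rw [kz, Submodule.coe_sup, coe_tI, coe_tI]

lemma kz_closed (hX : TensorData ι) (M : TwoSidedIdeal A) (N : TwoSidedIdeal B) : IsClosed ((kz ι M N : Submodule ℂ X) : Set X) := by
  rw [kz, sup_comm]; exact tI_sum_closed hX M N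

lemma kz_left {M : TwoSidedIdeal A} {N : TwoSidedIdeal B} {a : A} (b : B) (h : a ∈ M) : ι (a ⊗ₜ b) ∈ kz ι M N :=
  Submodule.mem_sup_right (mem_tI h (Set.mem_univ _))

lemma kz_right {M : TwoSidedIdeal A} {N : TwoSidedIdeal B} (a : A) {b : B} (h : b ∈ N) : ι (a ⊗ₜ b) ∈ kz ι M N :=
  Submodule.mem_sup_left (mem_tI (Set.mem_univ _) h)

lemma kz_unit (hX : TensorData ι) {M : TwoSidedIdeal A} {N : TwoSidedIdeal B} {e : A} {f : B}
    (he : ∀ x, x * e - x ∈ M ∧ e * x - x ∈ M) (hf : ∀ x, x * f - x ∈ N ∧ f * x - x ∈ N) (x : X) :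
    x * ι (e ⊗ₜ f) - x ∈ kz ι M N ∧ ι (e ⊗ₜ f) * x - x ∈ kz ι M N := by
  constructor
  · refine hX.all_mem (W := (kz ι M N).comap (LinearMap.mulRight ℂ (ι (e ⊗ₜ f)) - LinearMap.id : X →ₗ[ℂ] X))
      ((kz_closed hX M N).preimage (f := ⇑(LinearMap.mulRight ℂ (ι (e ⊗ₜ f)) - LinearMap.id : X →ₗ[ℂ] X)) ((continuous_mul_const (ι (e ⊗ₜ[ℂ] f))).sub continuous_id)) (fun a b => ?_) x
    rw [Submodule.mem_comap, LinearMap.sub_apply, LinearMap.mulRight_apply, LinearMap.id_apply, hX.mul_tmul]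
    have : ι ((a * e) ⊗ₜ[ℂ] (b * f)) - ι (a ⊗ₜ b) = ι ((a * e - a) ⊗ₜ (b * f)) + ι (a ⊗ₜ (b * f - b)) := by
      rw [← map_sub, ← map_add, TensorProduct.sub_tmul, TensorProduct.tmul_sub]; congr 1; abel
    rw [this]
    exact add_mem (kz_left _ (he a).1) (kz_right _ (hf b).1)
  · refine hX.all_mem (W := (kz ι M N).comap (LinearMap.mulLeft ℂ (ι (e ⊗ₜ f)) - LinearMap.id : X →ₗ[ℂ] X))
      ((kz_closed hX M N).preimage (f := ⇑(LinearMap.mulLeft ℂ (ι (e ⊗ₜ f)) - LinearMap.id : X →ₗ[ℂ] X)) ((continuous_const_mul (ι (e ⊗ₜ[ℂ] f))).sub continuous_id)) (fun a b => ?_) x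
    rw [Submodule.mem_comap, LinearMap.sub_apply, LinearMap.mulLeft_apply, LinearMap.id_apply, hX.mul_tmul]
    have : ι ((e * a) ⊗ₜ[ℂ] (f * b)) - ι (a ⊗ₜ b) = ι ((e * a - a) ⊗ₜ (f * b)) + ι (a ⊗ₜ (f * b - b)) := by
      rw [← map_sub, ← map_add, TensorProduct.sub_tmul, TensorProduct.tmul_sub]; congr 1; abel
    rw [this]
    exact add_mem (kz_left _ (he a).2) (kz_right _ (hf b).2)

lemma kz_proper (hX : TensorData ι) {M : TwoSidedIdeal A} {N : TwoSidedIdeal B} (hM : IsMaximalModularIdeal M)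
    (hN : IsMaximalModularIdeal N) {e : A} {f : B}
    (he : ∀ x, x * e - x ∈ M ∧ e * x - x ∈ M) (hf : ∀ x, x * f - x ∈ N ∧ f * x - x ∈ N) :
    ι (e ⊗ₜ f) ∉ kz ι M N := by
  obtain ⟨C, iC, π, hs, hk, he1⟩ := exists_quotient M hM.isClosed e he
  obtain ⟨D, iD, π', hs', hk', hf1⟩ := exists_quotient N hN.isClosed f hf
  letI := CStarAlgebra.spectralOrder C
  haveI := CStarAlgebra.spectralOrderedRing C
  letI := CStarAlgebra.spectralOrder D
  haveI := CStarAlgebra.spectralOrderedRing D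
  obtain ⟨nC, hC⟩ := quot_simple hM π hs hk
  obtain ⟨nD, hD⟩ := quot_simple hN π' hs' hk'
  obtain ⟨φ, hφ⟩ := SeparatingDual.exists_eq_one (R := ℂ) (one_ne_zero : (1 : C) ≠ 0)
  obtain ⟨ψ, hψ⟩ := SeparatingDual.exists_eq_one (R := ℂ) (one_ne_zero : (1 : D) ≠ 0)
  obtain ⟨G, hG, -⟩ := exists_pf hX π π' φ ψ
  have hG' : ∀ a b, G (ι (a ⊗ₜ b)) = φ (π a) * ψ (π' b) := fun a b => by rw [hG, qmap_tmul, pf_tmul]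
  have hc : IsClosed ((LinearMap.ker (G : X →ₗ[ℂ] ℂ) : Submodule ℂ X) : Set X) := G.isClosed_ker
  have hle : kz ι M N ≤ LinearMap.ker (G : X →ₗ[ℂ] ℂ) := by
    refine sup_le (tI_le hc fun a _ b hb => ?_) (tI_le hc fun a ha b _ => ?_)
    · change G _ = 0
      rw [hG', (hk' b).2 hb, map_zero, mul_zero]
    · change G _ = 0
      rw [hG', (hk a).2 ha, map_zero, zero_mul]
  intro h
  have h2 : G _ = 0 := hle h
  rw [hG', he1, hf1, hφ, hψ, mul_one] at h2
  exact one_ne_zero h2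

lemma kz_core (hX : TensorData ι) {M : TwoSidedIdeal A} {N : TwoSidedIdeal B} (hM : IsMaximalModularIdeal M)
    (hN : IsMaximalModularIdeal N) {e : A} {f : B}
    (he : ∀ x, x * e - x ∈ M ∧ e * x - x ∈ M) (hf : ∀ x, x * f - x ∈ N ∧ f * x - x ∈ N)
    (L : TwoSidedIdeal X) (hLc : IsClosed (L : Set X)) (hsm : ∀ (c : ℂ), ∀ x ∈ L, c • x ∈ L)
    (hK1 : ∀ a b, a ∈ M → ι (a ⊗ₜ b) ∈ L) (hK2 : ∀ a b, b ∈ N → ι (a ⊗ₜ b) ∈ L)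
    (hef : ι (e ⊗ₜ f) ∉ L) (z : X) (hz : z ∈ L) : z ∈ kz ι M N := by
  obtain ⟨C, iC, π, hs, hk, he1⟩ := exists_quotient M hM.isClosed e he
  obtain ⟨D, iD, π', hs', hk', hf1⟩ := exists_quotient N hN.isClosed f hf
  letI := CStarAlgebra.spectralOrder C
  haveI := CStarAlgebra.spectralOrderedRing C
  letI := CStarAlgebra.spectralOrder D
  haveI := CStarAlgebra.spectralOrderedRing D
  obtain ⟨nC, hC⟩ := quot_simple hM π hs hk
  obtain ⟨nD, hD⟩ := quot_simple hN π' hs' hk'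
  by_contra hn
  obtain ⟨U, hU, hU1⟩ := exists_sep _ (kz_closed hX M N) z hn
  have := core hX hs hs' hC hD he1 hf1 L hLc hsm (fun a b h => hK1 a b ((hk a).1 h)) (fun a b h => hK2 a b ((hk' b).1 h)) hef z hz U
    (fun a b h => hU _ (kz_left b ((hk a).1 h))) (fun a b h => hU _ (kz_right a ((hk' b).1 h)))
  rw [hU1] at this
  exact one_ne_zero this

theorem backward (hX : TensorData ι) {M : TwoSidedIdeal A} {N : TwoSidedIdeal B} (hM : IsMaximalModularIdeal M)
    (hN : IsMaximalModularIdeal N) (K : TwoSidedIdeal X) (hK : (K : Set X) = (kz ι M N : Submodule ℂ X)) : IsMaximalModularIdeal K := by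
  obtain ⟨e, he⟩ := hM.1
  obtain ⟨f, hf⟩ := hN.1
  have hu := kz_unit hX he hf
  have hp := kz_proper hX hM hN he hf
  have hmem : ∀ x, x ∈ kz ι M N → x ∈ (K : Set X) := fun x hx => by rw [hK]; exact hx
  have hu' : ∀ x, x * ι (e ⊗ₜ f) - x ∈ (K : Set X) ∧ ι (e ⊗ₜ f) * x - x ∈ (K : Set X) := fun x => ⟨hmem _ (hu x).1, hmem _ (hu x).2⟩
  refine ⟨⟨_, hu'⟩, ?_, fun L hL => ?_⟩
  · intro h
    rw [hK] at h
    have : ι (e ⊗ₜ f) ∈ ((kz ι M N : Submodule ℂ X) : Set X) := by rw [h]; trivial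
    exact hp this
  · by_cases hLu : (L : Set X) = Set.univ
    · exact Or.inr hLu
    · left
      refine Set.Subset.antisymm ?_ hL
      have hLe : ∀ x, x * ι (e ⊗ₜ f) - x ∈ L ∧ ι (e ⊗ₜ f) * x - x ∈ L := fun x => ⟨hL (hu' x).1, hL (hu' x).2⟩
      have hcu := L.clo_ne_univ hLe hLu
      rw [← L.coe_clo] at hcu
      have hLc : ∀ x ∈ L, x ∈ L.clo := fun x hx => (L.mem_clo x).2 (subset_closure hx)
      have hce : ∀ x, x * ι (e ⊗ₜ f) - x ∈ L.clo ∧ ι (e ⊗ₜ f) * x - x ∈ L.clo := fun x => ⟨hLc _ (hLe x).1, hLc _ (hLe x).2⟩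
      intro z hz
      rw [hK]
      refine kz_core hX hM hN he hf L.clo (by rw [L.coe_clo]; exact isClosed_closure) (fun c x hx => modular_smul_mem hce c hx)
        (fun a b h => hLc _ (hL (hmem _ (kz_left b h)))) (fun a b h => hLc _ (hL (hmem _ (kz_right a h)))) ?_ z (hLc _ hz)
      intro hin
      apply hcu
      rw [Set.eq_univ_iff_forall]
      intro x
      have := L.clo.sub_mem (L.clo.mul_mem_right _ x hin) (hce x).2
      simpa using this
end BACK
end

section
/-- diagonal matrices -/
def dgn (A : Type*) [NonUnitalCStarAlgebra A] (p : ℕ) : A →⋆ₙₐ[ℂ] CStarMatrix (Fin p) (Fin p) A where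
  toFun a := CStarMatrix.ofMatrix (Matrix.diagonal fun _ => a)
  map_smul' c a := by
    ext i j
    rw [CStarMatrix.smul_apply]
    simp only [CStarMatrix.ofMatrix_apply, Matrix.diagonal_apply, smul_ite, smul_zero, MonoidHom.id_apply]
  map_zero' := by ext i j; simp
  map_add' a b := by
    ext i j
    rw [CStarMatrix.add_apply]
    simp only [CStarMatrix.ofMatrix_apply, Matrix.diagonal_apply]
    split_ifs <;> simp
  map_mul' a b := by
    ext i j
    rw [CStarMatrix.mul_apply]
    simp only [CStarMatrix.ofMatrix_apply, Matrix.diagonal_apply]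
    simp
  map_star' a := by
    ext i j
    rw [CStarMatrix.star_apply]
    simp only [CStarMatrix.ofMatrix_apply, Matrix.diagonal_apply]
    by_cases h : i = j
    · simp [h]
    · simp [h, Ne.symm h]

lemma dgn_mul_apply {A : Type*} [NonUnitalCStarAlgebra A] {p : ℕ} (a : A) (v : CStarMatrix (Fin p) (Fin p) A) (i j : Fin p) :
    (dgn A p a * v) i j = a * v i j := by
  rw [CStarMatrix.mul_apply]
  have : ∀ k, dgn A p a i k = if i = k then a else 0 := fun k => rfl
  simp [this]

section LU
variable {A B X : Type u} [NonUnitalCStarAlgebra A] [NonUnitalCStarAlgebra B]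
    [NonUnitalNormedRing X] [NormedSpace ℂ X] [CompleteSpace X] {ι : A ⊗[ℂ] B →ₗ[ℂ] X}

lemma exists_lu (hX : TensorData ι) (a : A) : ∃ L : X →L[ℂ] X, (∀ c b, L (ι (c ⊗ₜ b)) = ι ((a * c) ⊗ₜ b)) ∧
    ∀ x, ‖L x‖ ≤ ‖a‖ * ‖x‖ := by
  letI := CStarAlgebra.spectralOrder A
  haveI := CStarAlgebra.spectralOrderedRing A
  letI := CStarAlgebra.spectralOrder B
  haveI := CStarAlgebra.spectralOrderedRing B
  let g : A ⊗[ℂ] B →ₗ[ℂ] X := ι ∘ₗ TensorProduct.map (LinearMap.mulLeft ℂ a) LinearMap.id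
  have hg : ∀ c b, g (c ⊗ₜ b) = ι ((a * c) ⊗ₜ b) := fun c b => by simp [g]
  obtain ⟨L, h1, h2⟩ := exists_extension ι hX.dense g ‖a‖ (norm_nonneg _) (fun u => by
    refine le_of_forall_pos_le_add fun ε hε => ?_
    obtain ⟨p, q, α, β, v, w, rfl, hr⟩ := hX.exists_rep u (‖ι u‖ + ε / (‖a‖ + 1)) (by have : 0 < ε / (‖a‖ + 1) := by positivity
                                                                                      linarith)
    have e : g (∑ ik : Fin p × Fin q, ∑ jl : Fin p × Fin q, (α ik * β jl) • (v ik.1 jl.1 ⊗ₜ[ℂ] w ik.2 jl.2)) =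
        ι (∑ ik : Fin p × Fin q, ∑ jl : Fin p × Fin q, (α ik * β jl) • ((dgn A p a * v) ik.1 jl.1 ⊗ₜ[ℂ] w ik.2 jl.2)) := by
      simp only [map_sum, map_smul, hg, dgn_mul_apply]
    rw [e]
    refine (hX.norm_rep p q α β _ w).trans ?_
    have hn : ‖dgn A p a * v‖ ≤ ‖a‖ * ‖v‖ := (norm_mul_le _ _).trans (by gcongr; exact NonUnitalStarAlgHom.norm_apply_le (dgn A p) a)
    set s := ‖ι (∑ ik : Fin p × Fin q, ∑ jl : Fin p × Fin q, (α ik * β jl) • (v ik.1 jl.1 ⊗ₜ[ℂ] w ik.2 jl.2))‖ with hs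
    calc _ ≤ Real.sqrt (∑ ik, ‖α ik‖ ^ 2) * (‖a‖ * ‖v‖) * ‖w‖ * Real.sqrt (∑ jl, ‖β jl‖ ^ 2) := by gcongr
      _ = ‖a‖ * (Real.sqrt (∑ ik, ‖α ik‖ ^ 2) * ‖v‖ * ‖w‖ * Real.sqrt (∑ jl, ‖β jl‖ ^ 2)) := by ring
      _ ≤ ‖a‖ * (s + ε / (‖a‖ + 1)) := by gcongr
      _ = ‖a‖ * s + ε * (‖a‖ / (‖a‖ + 1)) := by ring
      _ ≤ ‖a‖ * s + ε := by
        have : ‖a‖ / (‖a‖ + 1) ≤ 1 := by rw [div_le_one (by positivity)]; linarith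
        nlinarith)
  exact ⟨L, fun c b => by rw [h1, hg], h2⟩

lemma lu_mul (hX : TensorData ι) {a : A} {L : X →L[ℂ] X} (hL : ∀ c b, L (ι (c ⊗ₜ b)) = ι ((a * c) ⊗ₜ b)) (z x : X) :
    L (z * x) = L z * x := by
  refine hX.ext_tmul (f := fun z => L (z * x)) (g := fun z => L z * x) (by fun_prop) (by fun_prop)
    (fun x y => by simp only [add_mul, map_add]) (fun x y => by simp only [add_mul, map_add]) (fun c b => ?_) z
  refine hX.ext_tmul (f := fun x => L (ι (c ⊗ₜ b) * x)) (g := fun x => L (ι (c ⊗ₜ b)) * x) (by fun_prop) (by fun_prop)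
    (fun x y => by simp only [mul_add, map_add]) (fun x y => by simp only [mul_add]) (fun c b => ?_) x
  simp only [hL, hX.mul_tmul, mul_assoc]

lemma univ_approx [IsScalarTower ℂ X X] [SMulCommClass ℂ X X] (hX : TensorData ι) (x : X) {ε : ℝ} (hε : 0 < ε) :
    ∃ u : A, ∃ v : B, ‖u‖ ≤ 1 ∧ ‖v‖ ≤ 1 ∧ ‖x - ι (u ⊗ₜ v) * x‖ ≤ ε := by
  obtain ⟨u, -, v, h⟩ := tI_approx hX (⊤ : TwoSidedIdeal A) (x := x) (by
    have := tI_univ hX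
    have h2 : ((⊤ : TwoSidedIdeal A) : Set A) = Set.univ := by ext; simp
    rw [h2, this]; trivial) hε
  exact ⟨u, v, h⟩

lemma lu_mem [IsScalarTower ℂ X X] [SMulCommClass ℂ X X] (hX : TensorData ι) {a : A} {L : X →L[ℂ] X} (hL : ∀ c b, L (ι (c ⊗ₜ b)) = ι ((a * c) ⊗ₜ b))
    {K : TwoSidedIdeal X} (hK : IsClosed (K : Set X)) {k : X} (hk : k ∈ K) : L k ∈ K := by
  change L k ∈ (K : Set X)
  rw [← hK.closure_eq, Metric.mem_closure_iff]
  intro ε hε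
  obtain ⟨u, v, -, -, h⟩ := univ_approx hX k (show 0 < ε / (‖L‖ + 1) by positivity)
  refine ⟨L (ι (u ⊗ₜ v) * k), ?_, ?_⟩
  · rw [lu_mul hX hL]; exact K.mul_mem_left _ _ hk
  · rw [dist_eq_norm, ← map_sub]
    refine (L.le_opNorm _).trans_lt ?_
    calc ‖L‖ * ‖k - ι (u ⊗ₜ[ℂ] v) * k‖ ≤ ‖L‖ * (ε / (‖L‖ + 1)) := by gcongr
      _ < (‖L‖ + 1) * (ε / (‖L‖ + 1)) := by gcongr; linarith
      _ = ε := by field_simp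

end LU
end

section
/-- the functions `h_k` -/
def hcut (k : ℕ) (t : ℝ) : ℝ := (1 - bmp (1/4) (1/2) t) / max (1/2) (1 - t) ^ k - 1

lemma hcut_pos (t : ℝ) : 0 < max (1/2) (1 - t) := lt_max_of_lt_left (by norm_num)

lemma hcut_cont (k : ℕ) : Continuous (hcut k) := by
  unfold hcut
  exact ((continuous_const.sub bmp_cont).div (by fun_prop) fun t => (pow_pos (hcut_pos t) k).ne').sub continuous_const

lemma hcut_zero (k : ℕ) : hcut k 0 = 0 := by
  unfold hcut
  rw [bmp_zero (by norm_num) (by norm_num)]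
  norm_num

lemma hcut_bound (k : ℕ) (t : ℝ) : ‖hcut k t‖ ≤ 1 + 2 ^ k := by
  unfold hcut
  refine (norm_sub_le _ _).trans ?_
  rw [norm_one, add_comm]
  gcongr
  have h0 := bmp_nonneg (1/4) (1/2) t
  have h1 := bmp_le (1/4) (1/2) t
  have hp := pow_pos (hcut_pos t) k
  rw [Real.norm_of_nonneg (div_nonneg (by linarith) hp.le), div_le_iff₀ hp, ← mul_pow]
  have : 1 ≤ (2 * max (1/2) (1 - t)) ^ k := one_le_pow₀ (by have := le_max_left (1/2) (1 - t); linarith)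
  linarith

lemma hcut_succ (k : ℕ) (t : ℝ) : hcut k t = hcut (k + 1) t - t - t * hcut (k + 1) t := by
  unfold hcut
  rcases le_total t (1/2) with h | h
  · rw [max_eq_right (by linarith)]
    have : 1 - t ≠ 0 := by linarith
    field_simp
    ring
  · rw [bmp_one (by norm_num) h]; simp

lemma exists_cut {A : Type*} [NonUnitalCStarAlgebra A] {u : A} (h : IsUnitInterval u) :
    ∃ w g : A, w = u * g ∧ IsSelfAdjoint w ∧ ∀ a, ∃ y : ℕ → A, y 0 = a - w * a ∧
      (∀ k, y k = y (k + 1) - u * y (k + 1)) ∧ ∀ k, ‖y k‖ ≤ (2 + 2 ^ k) * ‖a‖ := by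
  have hsa := h.sa
  have c3 : Continuous (fun t => bmp (1/4) (1/2) t / max t (1/4)) := bmp_cont.div (by fun_prop) fun t => (lt_max_of_lt_right (by norm_num)).ne'
  have z3 : (fun t => bmp (1/4) (1/2) t / max t (1/4)) 0 = 0 := by
    change bmp (1/4) (1/2) 0 / _ = 0
    rw [bmp_zero (by norm_num) (by norm_num), zero_div]
  have z1 : bmp (1/4) (1/2) 0 = 0 := bmp_zero (by norm_num) (by norm_num)
  refine ⟨cfcₙ (bmp (1/4) (1/2)) u, cfcₙ (fun t => bmp (1/4) (1/2) t / max t (1/4)) u, ?_, cfcₙ_predicate _ _, fun a =>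
    ⟨fun k => a + cfcₙ (hcut k) u * a, ?_, fun k => ?_, fun k => ?_⟩⟩
  · have := cfcₙ_mul (fun t => t) (fun t => bmp (1/4) (1/2) t / max t (1/4)) u continuousOn_id rfl c3.continuousOn z3
    rw [cfcₙ_id' ℝ u] at this
    rw [← this]
    congr 1
    funext t
    change bmp (1/4) (1/2) t = t * (bmp (1/4) (1/2) t / max t (1/4))
    rcases le_total t (1/4) with ht | ht
    · rw [bmp_zero (by norm_num) ht]; simp
    · rw [max_eq_left ht]
      have : t ≠ 0 := by linarith
      field_simp
  · have e : hcut 0 = fun t => -bmp (1/4) (1/2) t := by funext t; simp [hcut]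
    simp only [e]
    rw [cfcₙ_neg, neg_mul, sub_eq_add_neg]
  · have e : hcut k = fun t => hcut (k + 1) t - t - t * hcut (k + 1) t := funext (hcut_succ k)
    have c1 := hcut_cont (k + 1)
    have : cfcₙ (hcut k) u = cfcₙ (hcut (k + 1)) u - u - u * cfcₙ (hcut (k + 1)) u := by
      conv_lhs => rw [e]
      rw [cfcₙ_sub (fun t => hcut (k + 1) t - t) (fun t => t * hcut (k + 1) t) u (c1.sub continuous_id).continuousOn
          (by simp [hcut_zero]) (continuous_id.mul c1).continuousOn (by simp),
        cfcₙ_sub (hcut (k + 1)) (fun t => t) u c1.continuousOn (hcut_zero _) continuousOn_id rfl,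
        cfcₙ_mul (fun t => t) (hcut (k + 1)) u continuousOn_id rfl c1.continuousOn (hcut_zero _), cfcₙ_id' ℝ u]
    simp only [this, sub_mul, mul_add, mul_assoc]
    abel
  · refine (norm_add_le _ _).trans ?_
    have h1 : ‖cfcₙ (hcut k) u‖ ≤ 1 + 2 ^ k := norm_cfcₙ_le fun t _ => hcut_bound k t
    have h2 : ‖cfcₙ (hcut k) u * a‖ ≤ (1 + 2 ^ k) * ‖a‖ := (norm_mul_le _ _).trans (by gcongr)
    linarith
end

section
section UC
variable {A B X : Type u} [NonUnitalCStarAlgebra A] [NonUnitalCStarAlgebra B]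
    [NonUnitalNormedRing X] [NormedSpace ℂ X] [CompleteSpace X] [IsScalarTower ℂ X X] [SMulCommClass ℂ X X] {ι : A ⊗[ℂ] B →ₗ[ℂ] X}

lemma exists_zeta (hX : TensorData ι) {K : TwoSidedIdeal X} (hm : IsMaximalModularIdeal K) (I : TwoSidedIdeal A)
    {a0 : A} (ha0 : a0 ∈ I) {b0 : B} (hn : ι (a0 ⊗ₜ b0) ∉ K) : ∃ ζ ∈ tI ι (I : Set A) Set.univ, ∀ x, ζ * x - x ∈ K := by
  obtain ⟨⟨E, hE⟩, hp, hmax⟩ := hm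
  let W : Submodule ℂ X := tI ι (I : Set A) Set.univ
  have hWl : ∀ y, ∀ x ∈ W, y * x ∈ W := fun y x hx => tI_ideal_left hX (S := (I : Set A)) (T := Set.univ)
    (fun a s hs => I.mul_mem_left _ _ hs) (fun b t ht => Set.mem_univ _) y hx
  have hWr : ∀ y, ∀ x ∈ W, x * y ∈ W := fun y x hx => tI_ideal_right hX (S := (I : Set A)) (T := Set.univ)
    (fun a s hs => I.mul_mem_right _ _ hs) (fun b t ht => Set.mem_univ _) y hx
  let S : Set X := {x | ∃ k ∈ K, ∃ z ∈ W, x = k + z}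
  let J : TwoSidedIdeal X := TwoSidedIdeal.mk' S ⟨0, K.zero_mem, 0, zero_mem _, by simp⟩
    (by
      rintro _ _ ⟨k, hk, z, hz, rfl⟩ ⟨k', hk', z', hz', rfl⟩
      exact ⟨k + k', K.add_mem hk hk', z + z', add_mem hz hz', by abel⟩)
    (by
      rintro _ ⟨k, hk, z, hz, rfl⟩
      exact ⟨-k, K.neg_mem hk, -z, neg_mem hz, by abel⟩)
    (by
      rintro x _ ⟨k, hk, z, hz, rfl⟩
      exact ⟨x * k, K.mul_mem_left _ _ hk, x * z, hWl _ _ hz, mul_add _ _ _⟩)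
    (by
      rintro _ x ⟨k, hk, z, hz, rfl⟩
      exact ⟨k * x, K.mul_mem_right _ _ hk, z * x, hWr _ _ hz, add_mul _ _ _⟩)
  have hJ : ∀ x, x ∈ (J : Set X) ↔ x ∈ S := fun x => by
    change x ∈ J ↔ _
    simp only [J, TwoSidedIdeal.mem_mk']
  have hE2 : E ∈ S := by
    rcases hmax J (fun k hk => (hJ k).2 ⟨k, hk, 0, zero_mem _, by simp⟩) with h | h
    · exfalso
      apply hn
      change _ ∈ (K : Set X)
      rw [← h]
      exact (hJ _).2 ⟨0, K.zero_mem, _, mem_tI (S := (I : Set A)) (T := Set.univ) ha0 (Set.mem_univ b0), by simp⟩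
    · rw [← hJ, h]; trivial
  obtain ⟨k, hk, ζ, hζ, e⟩ := hE2
  refine ⟨ζ, hζ, fun x => ?_⟩
  have : ζ * x - x = (E * x - x) - k * x := by rw [e, add_mul]; abel
  rw [this]
  exact K.sub_mem (hE x).2 (K.mul_mem_right _ _ hk)

lemma exists_eta (hX : TensorData ι) {I : TwoSidedIdeal A} {ζ : X} (hζ : ζ ∈ tI ι (I : Set A) Set.univ) :
    ∃ u ∈ I, IsUnitInterval u ∧ ∀ L : X →L[ℂ] X, (∀ c b, L (ι (c ⊗ₜ b)) = ι ((u * c) ⊗ₜ b)) → (∀ x, ‖L x‖ ≤ ‖u‖ * ‖x‖) →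
      ‖ζ - L ζ‖ ≤ 1 / 4 := by
  obtain ⟨n, m, b, hm, hd⟩ := tI_rep hζ (show (0:ℝ) < 1 / 16 by norm_num)
  set σ := ∑ i, ‖b i‖ with hσ
  have hσ0 : 0 ≤ σ := Finset.sum_nonneg fun i _ => by positivity
  obtain ⟨δ, hδ0, hδ1⟩ : ∃ δ : ℝ, 0 < δ ∧ δ * σ ≤ 1 / 16 :=
    ⟨1 / (16 * (σ + 1)), by positivity, by
      rw [div_mul_eq_mul_div, div_le_iff₀ (by positivity)]; nlinarith⟩
  obtain ⟨u, huM, hu, hum⟩ := exists_approx_unit_left (I := (I : Set A)) (fun x hx y hy => I.add_mem hx hy) I.zero_mem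
    (fun x hx y => I.mul_mem_right _ _ hx) m hm hδ0
  refine ⟨u, huM, hu, fun L hL hLn => ?_⟩
  set w := ι (∑ i, m i ⊗ₜ b i) with hw
  have h1 : ‖w - L w‖ ≤ δ * σ := by
    have e : w - L w = ∑ i, ι ((m i - u * m i) ⊗ₜ b i) := by
      rw [hw, map_sum, map_sum, ← Finset.sum_sub_distrib]
      refine Finset.sum_congr rfl fun i _ => ?_
      rw [hL, ← map_sub, TensorProduct.sub_tmul]
    rw [e, hσ, Finset.mul_sum]
    refine (norm_sum_le _ _).trans (Finset.sum_le_sum fun i _ => ?_)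
    refine (hX.norm_tmul_le _ _).trans ?_
    have := hum i
    gcongr
  have h2 : ‖L (ζ - w)‖ ≤ ‖ζ - w‖ := (hLn _).trans (mul_le_of_le_one_left (norm_nonneg _) hu.norm_le)
  have e : ζ - L ζ = (ζ - w) + (w - L w) + -(L (ζ - w)) := by rw [map_sub]; abel
  rw [e]
  have := norm_add₃_le (a := ζ - w) (b := w - L w) (c := -(L (ζ - w)))
  rw [norm_neg] at this
  linarith

lemma unit_claim (hX : TensorData ι) {K : TwoSidedIdeal X} (hK : IsClosed (K : Set X)) (hm : IsMaximalModularIdeal K) (I : TwoSidedIdeal A)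
    {a0 : A} (ha0 : a0 ∈ I) {b0 : B} (hn : ι (a0 ⊗ₜ b0) ∉ K) :
    ∃ w ∈ I, IsSelfAdjoint w ∧ ∀ a b, ι ((a - w * a) ⊗ₜ b) ∈ K := by
  obtain ⟨ζ, hζ, hζK⟩ := exists_zeta hX hm I ha0 hn
  obtain ⟨u, huI, hu, hη'⟩ := exists_eta hX hζ
  obtain ⟨L, hL, hLn⟩ := exists_lu hX u
  have hη := hη' L hL hLn
  set η := ζ - L ζ with hηd
  obtain ⟨w, g, hwg, hwsa, hy⟩ := exists_cut hu
  refine ⟨w, hwg ▸ I.mul_mem_right _ _ huI, hwsa, fun a b => ?_⟩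
  obtain ⟨y, hy0, hys, hyn⟩ := hy a
  have hx : ∀ x, (x - L x) - η * x ∈ K := by
    intro x
    have : (x - L x) - η * x = -(ζ * x - x) + L (ζ * x - x) := by
      rw [hηd, sub_mul, map_sub, lu_mul hX hL]; abel
    rw [this]
    exact K.add_mem (K.neg_mem (hζK x)) (lu_mem hX hL hK (hζK x))
  have hstep : ∀ k, ι (y k ⊗ₜ b) - η * ι (y (k + 1) ⊗ₜ b) ∈ K := by
    intro k
    have : ι (y k ⊗ₜ b) = ι (y (k + 1) ⊗ₜ b) - L (ι (y (k + 1) ⊗ₜ b)) := by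
      rw [hL, ← map_sub, ← TensorProduct.sub_tmul, ← hys]
    rw [this]
    exact hx _
  have hind : ∀ n k, ∃ z, ι (y k ⊗ₜ b) - z ∈ K ∧ ‖z‖ ≤ (1 / 4) ^ n * ‖ι (y (k + n) ⊗ₜ[ℂ] b)‖ := by
    intro n
    induction n with
    | zero => exact fun k => ⟨ι (y k ⊗ₜ b), by rw [sub_self]; exact K.zero_mem, by simp⟩
    | succ n ih =>
      intro k
      obtain ⟨z, hz, hzn⟩ := ih (k + 1)
      refine ⟨η * z, ?_, ?_⟩
      · have : ι (y k ⊗ₜ b) - η * z = (ι (y k ⊗ₜ b) - η * ι (y (k + 1) ⊗ₜ b)) + η * (ι (y (k + 1) ⊗ₜ b) - z) := by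
          rw [mul_sub]; abel
        rw [this]
        exact K.add_mem (hstep k) (K.mul_mem_left _ _ hz)
      · rw [show k + (n + 1) = k + 1 + n by ring, pow_succ]
        calc ‖η * z‖ ≤ ‖η‖ * ‖z‖ := norm_mul_le _ _
          _ ≤ (1 / 4) * ((1 / 4) ^ n * ‖ι (y (k + 1 + n) ⊗ₜ[ℂ] b)‖) := by gcongr
          _ = _ := by ring
  rw [← hy0]
  change _ ∈ (K : Set X)
  rw [← hK.closure_eq, Metric.mem_closure_iff]
  intro ε hε
  have hpow : ∃ n : ℕ, (1 / 2 : ℝ) ^ n * (3 * (‖a‖ * ‖b‖)) < ε := by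
    have h0 : Filter.Tendsto (fun n : ℕ => (1 / 2 : ℝ) ^ n * (3 * (‖a‖ * ‖b‖))) Filter.atTop (nhds 0) := by
      have := (tendsto_pow_atTop_nhds_zero_of_lt_one (show (0:ℝ) ≤ 1 / 2 by norm_num) (by norm_num)).mul_const (3 * (‖a‖ * ‖b‖))
      rwa [zero_mul] at this
    exact (h0.eventually_lt_const hε).exists
  obtain ⟨n, hn⟩ := hpow
  obtain ⟨z, hz, hzn⟩ := hind n 0
  refine ⟨_, hz, ?_⟩
  rw [dist_eq_norm, sub_sub_cancel]
  refine (hzn.trans ?_).trans_lt hn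
  rw [zero_add]
  have h1 : (2:ℝ) + 2 ^ n ≤ 3 * 2 ^ n := by
    have : (1:ℝ) ≤ 2 ^ n := one_le_pow₀ (by norm_num)
    linarith
  have h2 : (1 / 4 : ℝ) ^ n * 2 ^ n = (1 / 2) ^ n := by rw [← mul_pow]; norm_num
  calc (1 / 4 : ℝ) ^ n * ‖ι (y n ⊗ₜ[ℂ] b)‖ ≤ (1 / 4) ^ n * ((2 + 2 ^ n) * ‖a‖ * ‖b‖) := by
        gcongr
        refine (hX.norm_tmul_le _ _).trans ?_
        have := hyn n
        gcongr
    _ ≤ (1 / 4) ^ n * ((3 * 2 ^ n) * ‖a‖ * ‖b‖) := by gcongr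
    _ = ((1 / 4) ^ n * 2 ^ n) * (3 * (‖a‖ * ‖b‖)) := by ring
    _ = _ := by rw [h2]

end UC
end

section
section FWD
variable {A B X : Type u} [NonUnitalCStarAlgebra A] [NonUnitalCStarAlgebra B]
    [NonUnitalNormedRing X] [NormedSpace ℂ X] [CompleteSpace X] [IsScalarTower ℂ X X] [SMulCommClass ℂ X X] {ι : A ⊗[ℂ] B →ₗ[ℂ] X}

lemma cont_tmul (hX : TensorData ι) (b : B) : Continuous fun a : A => ι (a ⊗ₜ[ℂ] b) := by
  let g : A →ₗ[ℂ] X := ι ∘ₗ (TensorProduct.mk ℂ A B).flip b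
  exact (g.mkContinuous ‖b‖ fun a => (hX.norm_tmul_le a b).trans (le_of_eq (mul_comm _ _))).continuous

lemma tmul_all_mem (hX : TensorData ι) {K : TwoSidedIdeal X} (hK : IsClosed (K : Set X)) {E : X} (hE : ∀ x, x * E - x ∈ K ∧ E * x - x ∈ K)
    (h : ∀ a b, ι (a ⊗ₜ b) ∈ K) : (K : Set X) = Set.univ := by
  let Ks : Submodule ℂ X :=
    { carrier := K
      add_mem' := fun ha hb => K.add_mem ha hb
      zero_mem' := K.zero_mem
      smul_mem' := fun c x hx => modular_smul_mem hE c hx }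
  rw [Set.eq_univ_iff_forall]
  exact fun x => hX.all_mem (W := Ks) hK h x

theorem exists_M (hX : TensorData ι) {K : TwoSidedIdeal X} (hK : IsClosed (K : Set X)) (hm : IsMaximalModularIdeal K) :
    ∃ M : TwoSidedIdeal A, IsMaximalModularIdeal M ∧ ∀ a, a ∈ M ↔ ∀ b, ι (a ⊗ₜ b) ∈ K := by
  let S : Set A := {a | ∀ b, ι (a ⊗ₜ b) ∈ K}
  let M : TwoSidedIdeal A := TwoSidedIdeal.mk' S (fun b => by rw [TensorProduct.zero_tmul, map_zero]; exact K.zero_mem)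
    (fun {x y} hx hy b => by rw [TensorProduct.add_tmul, map_add]; exact K.add_mem (hx b) (hy b))
    (fun {x} hx b => by rw [TensorProduct.neg_tmul, map_neg]; exact K.neg_mem (hx b))
    (fun {x y} hy b => by
      obtain ⟨L, hL, -⟩ := exists_lu hX x
      rw [← hL]
      exact lu_mem hX hL hK (hy b))
    (fun {x y} hx b => by
      change _ ∈ (K : Set X)
      rw [← hK.closure_eq, Metric.mem_closure_iff]
      intro ε hε
      obtain ⟨v, -, -, hv⟩ := exists_approx_unit_left (I := (Set.univ : Set B)) (fun x hx y hy => trivial) trivial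
        (by intros; trivial) (fun _ : Fin 1 => b) (fun _ => trivial) (show 0 < ε / (‖x * y‖ + 1) by positivity)
      refine ⟨ι (x ⊗ₜ v) * ι (y ⊗ₜ b), K.mul_mem_right _ _ (hx v), ?_⟩
      rw [hX.mul_tmul, dist_eq_norm, ← map_sub, ← TensorProduct.tmul_sub]
      refine (hX.norm_tmul_le _ _).trans_lt ?_
      have := hv 0
      calc ‖x * y‖ * ‖b - v * b‖ ≤ ‖x * y‖ * (ε / (‖x * y‖ + 1)) := by gcongr
        _ < (‖x * y‖ + 1) * (ε / (‖x * y‖ + 1)) := by gcongr; linarith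
        _ = ε := by field_simp)
  have hM : ∀ a, a ∈ M ↔ ∀ b, ι (a ⊗ₜ b) ∈ K := fun a => by
    simp only [M, TwoSidedIdeal.mem_mk']; rfl
  have hMc : IsClosed (M : Set A) := by
    have : (M : Set A) = ⋂ b, (fun a : A => ι (a ⊗ₜ[ℂ] b)) ⁻¹' (K : Set X) := by
      ext a
      rw [Set.mem_iInter]
      exact hM a
    rw [this]
    exact isClosed_iInter fun b => hK.preimage (cont_tmul hX b)
  obtain ⟨a0, b0, h0⟩ : ∃ a0 b0, ι (a0 ⊗ₜ b0) ∉ K := by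
    by_contra! h
    obtain ⟨E, hE⟩ := hm.1
    exact hm.2.1 (tmul_all_mem hX hK hE h)
  have hcl : ∀ I : TwoSidedIdeal A, ∀ a1 ∈ I, a1 ∉ M → ∃ w ∈ I, ∀ a, a * w - a ∈ M ∧ w * a - a ∈ M := by
    intro I a1 h1 h2
    rw [hM] at h2
    push Not at h2
    obtain ⟨b1, hb1⟩ := h2
    obtain ⟨w, hwI, hw, hwK⟩ := unit_claim hX hK hm I h1 hb1
    have h3 : ∀ a, w * a - a ∈ M := fun a => by
      have := M.neg_mem ((hM _).2 (hwK a))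
      rwa [neg_sub] at this
    refine ⟨w, hwI, fun a => ⟨?_, h3 a⟩⟩
    have := TwoSidedIdeal.star_mem_of_closed hMc (h3 (star a))
    rwa [star_sub, star_mul, star_star, hw.star_eq] at this
  have ha0 : a0 ∉ M := fun h => h0 ((hM a0).1 h b0)
  refine ⟨M, ⟨?_, ?_, fun L hL => ?_⟩, hM⟩
  · obtain ⟨w, -, hw⟩ := hcl ⊤ a0 (by simp) ha0
    exact ⟨w, hw⟩
  · intro h
    apply ha0
    change a0 ∈ (M : Set A)
    rw [h]; trivial
  · by_cases h : (L : Set A) ⊆ M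
    · exact Or.inl (Set.Subset.antisymm h hL)
    · right
      obtain ⟨a1, h1, h2⟩ := Set.not_subset.1 h
      obtain ⟨w, hwL, hw⟩ := hcl L a1 h1 h2
      rw [Set.eq_univ_iff_forall]
      intro a
      have := L.sub_mem (L.mul_mem_right _ a hwL) (hL (hw a).2)
      simpa using this

lemma TensorData.swap (hX : TensorData ι) : TensorData (ι ∘ₗ (TensorProduct.comm ℂ B A).toLinearMap) := by
  have hs : ∀ (p q : ℕ) (α β : Fin p × Fin q → ℂ) (v : CStarMatrix (Fin p) (Fin p) B) (w : CStarMatrix (Fin q) (Fin q) A),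
      TensorProduct.comm ℂ B A (∑ ik : Fin p × Fin q, ∑ jl : Fin p × Fin q, (α ik * β jl) • (v ik.1 jl.1 ⊗ₜ[ℂ] w ik.2 jl.2)) =
      ∑ ik : Fin q × Fin p, ∑ jl : Fin q × Fin p, (α ik.swap * β jl.swap) • (w ik.1 jl.1 ⊗ₜ[ℂ] v ik.2 jl.2) := by
    intro p q α β v w
    simp only [map_sum, map_smul, TensorProduct.comm_tmul]
    refine Fintype.sum_equiv (Equiv.prodComm _ _) _ _ fun x => ?_
    exact Fintype.sum_equiv (Equiv.prodComm _ _) _ _ fun y => rfl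
  have hn : ∀ (p q : ℕ) (α : Fin p × Fin q → ℂ), ∑ ik : Fin q × Fin p, ‖α ik.swap‖ ^ 2 = ∑ ik, ‖α ik‖ ^ 2 :=
    fun p q α => Fintype.sum_equiv (Equiv.prodComm _ _) _ _ fun x => rfl
  refine ⟨?_, ?_, ?_, ?_⟩
  · have : Set.range (ι ∘ₗ (TensorProduct.comm ℂ B A).toLinearMap) = Set.range ι :=
      (TensorProduct.comm ℂ B A).surjective.range_comp ι
    unfold DenseRange
    rw [this]
    exact hX.dense
  · intro a c b d
    simp only [LinearMap.comp_apply, LinearEquiv.coe_coe, TensorProduct.comm_tmul, hX.mul_tmul]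
  · intro _ _ _ _ p q α β v w
    rw [LinearMap.comp_apply, LinearEquiv.coe_coe, hs]
    refine (hX.norm_rep q p (fun i => α i.swap) (fun i => β i.swap) w v).trans (le_of_eq ?_)
    rw [hn, hn]; ring
  · intro _ _ _ _ u r hr
    obtain ⟨p, q, α, β, v, w, e, h⟩ := hX.exists_rep (TensorProduct.comm ℂ B A u) r hr
    refine ⟨q, p, fun i => α i.swap, fun i => β i.swap, w, v, ?_, ?_⟩
    · apply (TensorProduct.comm ℂ B A).injective
      rw [e, hs]
      rfl
    · rw [hn, hn]
      refine lt_of_eq_of_lt ?_ h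
      ring

theorem forward (hX : TensorData ι) {K : TwoSidedIdeal X} (hK : IsClosed (K : Set X)) (hm : IsMaximalModularIdeal K) :
    ∃ (M : TwoSidedIdeal A) (N : TwoSidedIdeal B), IsMaximalModularIdeal M ∧ IsMaximalModularIdeal N ∧
      (K : Set X) = (kz ι M N : Submodule ℂ X) := by
  obtain ⟨M, hM, hMK⟩ := exists_M hX hK hm
  obtain ⟨N, hN, hNK'⟩ := exists_M hX.swap hK hm
  have hNK : ∀ b, b ∈ N ↔ ∀ a, ι (a ⊗ₜ b) ∈ K := hNK'
  refine ⟨M, N, hM, hN, ?_⟩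
  obtain ⟨E, hE⟩ := hm.1
  obtain ⟨e, he⟩ := hM.1
  obtain ⟨f, hf⟩ := hN.1
  have hsm : ∀ (c : ℂ), ∀ x ∈ K, c • x ∈ K := fun c x hx => modular_smul_mem hE c hx
  let Ks : Submodule ℂ X :=
    { carrier := K
      add_mem' := fun ha hb => K.add_mem ha hb
      zero_mem' := K.zero_mem
      smul_mem' := fun c x hx => hsm c x hx }
  have hle : kz ι M N ≤ Ks :=
    sup_le (tI_le (W := Ks) hK fun a _ b hb => (hNK b).1 hb a) (tI_le (W := Ks) hK fun a ha b _ => (hMK a).1 ha b)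
  refine Set.Subset.antisymm (fun z hz => ?_) hle
  refine kz_core hX hM hN he hf K hK hsm (fun a b h => (hMK a).1 h b) (fun a b h => (hNK b).1 h a) ?_ z hz
  intro hin
  refine hm.2.1 (Set.eq_univ_iff_forall.2 fun x => ?_)
  have h2 : ι (e ⊗ₜ f) * x - x ∈ K := hle (kz_unit hX he hf x).2
  have := K.sub_mem (K.mul_mem_right _ x hin) h2
  simpa using this
end FWD
end

/-- A closed two-sided ideal `K` of `A ⊗̂ B` is maximal modular if and
only if `K = A ⊗̂ N + M ⊗̂ B` for some maximal modular ideals `M` of `A` and `N` of `B`. -/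
theorem maximal_modular_iff {A B X : Type u} [NonUnitalCStarAlgebra A] [NonUnitalCStarAlgebra B]
    [NonUnitalNormedRing X] [StarRing X] [NormedSpace ℂ X] [CompleteSpace X]
    [IsScalarTower ℂ X X] [SMulCommClass ℂ X X]
    (NA : ∀ p : ℕ, Matrix (Fin p) (Fin p) A → ℝ)
    (NB : ∀ q : ℕ, Matrix (Fin q) (Fin q) B → ℝ)
    (hNA : ∀ p, IsCStarNorm (NA p)) (hNB : ∀ q, IsCStarNorm (NB q))
    (ι : A ⊗[ℂ] B →ₗ[ℂ] X) (hX : IsTensorCompletion (osProjNorm NA NB) X ι)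
    (K : TwoSidedIdeal X) (hK : IsClosed (K : Set X)) :
    IsMaximalModularIdeal K ↔
      ∃ (M : TwoSidedIdeal A) (N : TwoSidedIdeal B),
        IsMaximalModularIdeal M ∧ IsMaximalModularIdeal N ∧
        (K : Set X) =
          tensorIdeal ι (Set.univ : Set A) (N : Set B) +
            tensorIdeal ι (M : Set A) (Set.univ : Set B) := by
  have hT := hX.tensorData hNA hNB
  constructor
  · intro hm
    obtain ⟨M, N, hM, hN, h⟩ := forward hT hK hm
    exact ⟨M, N, hM, hN, by rw [h, coe_kz]⟩
  · rintro ⟨M, N, hM, hN, h⟩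
    exact backward hT hM hN K (by rw [h, coe_kz])

end
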